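/- Let n ≥ 1, s, m ∈ ℝ, 0 < p ≤ ∞ and 0 < q ≤ ∞. Let a ∈ S^m(ℝ^n) be such that a(x,ξ) = 0 for all x outside a fixed compact set K ⊂ ℝ^n, and let φ ∈ C^∞(ℝ^n × (ℝ^n ∖ {0})) be real-valued, positively homogeneous of degree 1 in ξ, and non-degenerate on K. Then there exists a constant C such that for every Schwartz function f on ℝ^n one has ‖T_a^φ f‖_{B^s_{p,q}} ≤ C ‖f‖_{B^{s+m−m_c(p)}_{p,q}}. -/

import Mathlib

noncomputable section

open MeasureTheory Complex
open scoped ENNReal NNReal InnerProductSpace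

/-- Euclidean space `ℝ^n`. -/
abbrev Rn (n : ℕ) := EuclideanSpace ℝ (Fin n)

/-- The Fourier transform `f̂(ξ) = ∫ e^{-i x·ξ} f(x) dx`. -/
def ftransform (n : ℕ) (f : Rn n → ℂ) (ξ : Rn n) : ℂ :=
  ∫ x : Rn n, Complex.exp (-(Complex.I * ((⟪x, ξ⟫_ℝ : ℝ) : ℂ))) * f x

/-- The Fourier integral operator `T_a^φ f(x) = (2π)^{-n} ∫ a(x,ξ) e^{iφ(x,ξ)} f̂(ξ) dξ`. -/
def fio (n : ℕ) (a : Rn n → Rn n → ℂ) (φ : Rn n → Rn n → ℝ) (f : Rn n → ℂ) (x : Rn n) : ℂ :=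
  ((((2 * Real.pi) ^ n)⁻¹ : ℝ) : ℂ) *
    ∫ ξ : Rn n, a x ξ * Complex.exp (Complex.I * ((φ x ξ : ℝ) : ℂ)) * ftransform n f ξ

/-- The Littlewood–Paley pieces `ψ_j` built from `ψ_0`. -/
def lpPiece (n : ℕ) (ψ0 : Rn n → ℝ) (j : ℕ) (ξ : Rn n) : ℝ :=
  if j = 0 then ψ0 ξ
  else ψ0 ((2 : ℝ) ^ (-(j : ℤ)) • ξ) - ψ0 ((2 : ℝ) ^ (-(j : ℤ) + 1) • ξ)

/-- Hypotheses on the base function `ψ_0` of a Littlewood–Paley partition of unity. -/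
def IsLPBase (n : ℕ) (ψ0 : Rn n → ℝ) : Prop :=
  ContDiff ℝ (⊤ : ℕ∞) ψ0 ∧ (∀ ξ : Rn n, ‖ξ‖ ≤ 1 → ψ0 ξ = 1) ∧ (∀ ξ : Rn n, 2 < ‖ξ‖ → ψ0 ξ = 0)

/-- Inverse Fourier transform of a real-valued function. -/
def invFT (n : ℕ) (h : Rn n → ℝ) (x : Rn n) : ℂ :=
  ((((2 * Real.pi) ^ n)⁻¹ : ℝ) : ℂ) *
    ∫ ξ : Rn n, Complex.exp (Complex.I * ((⟪x, ξ⟫_ℝ : ℝ) : ℂ)) * ((h ξ : ℝ) : ℂ)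

/-- The operator `h(D) g`: convolution of `g` with the inverse Fourier transform of `h`. -/
def smoothOp (n : ℕ) (h : Rn n → ℝ) (g : Rn n → ℂ) (x : Rn n) : ℂ :=
  ∫ y : Rn n, invFT n h (x - y) * g y

/-- `ℓ^q`-norm of a sequence in `ℝ≥0∞`, for `0 < q ≤ ∞`. -/
def lqSum (q : ℝ≥0∞) (u : ℕ → ℝ≥0∞) : ℝ≥0∞ :=
  if q = ∞ then ⨆ j, u j else (∑' j, u j ^ q.toReal) ^ (1 / q.toReal)

/-- Besov–Lipschitz quasi-norm `‖g‖_{B^s_{p,q}}`. -/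
def besovNorm (n : ℕ) (ψ0 : Rn n → ℝ) (s : ℝ) (p q : ℝ≥0∞) (g : Rn n → ℂ) : ℝ≥0∞ :=
  lqSum q fun j =>
    ENNReal.ofReal ((2 : ℝ) ^ ((j : ℝ) * s)) * eLpNorm (smoothOp n (lpPiece n ψ0 j) g) p volume

/-- Triebel–Lizorkin quasi-norm `‖g‖_{F^s_{p,q}}`. -/
def tlNorm (n : ℕ) (ψ0 : Rn n → ℝ) (s : ℝ) (p q : ℝ≥0∞) (g : Rn n → ℂ) : ℝ≥0∞ :=
  if p = ∞ then
    essSup (fun x : Rn n => lqSum q fun j =>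
      ENNReal.ofReal ((2 : ℝ) ^ ((j : ℝ) * s)) *
        (‖smoothOp n (lpPiece n ψ0 j) g x‖₊ : ℝ≥0∞)) volume
  else
    (∫⁻ x : Rn n, (lqSum q fun j =>
      ENNReal.ofReal ((2 : ℝ) ^ ((j : ℝ) * s)) *
        (‖smoothOp n (lpPiece n ψ0 j) g x‖₊ : ℝ≥0∞)) ^ p.toReal ∂volume) ^ (1 / p.toReal)

/-- Critical order `m_c(p) = -(n-1)|1/p - 1/2|`. -/
def criticalOrder (n : ℕ) (p : ℝ≥0∞) : ℝ := -((n : ℝ) - 1) * |p⁻¹.toReal - 1 / 2|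

/-- The symbol class `S^m(ℝ^n)`. -/
def SymbolClass (n : ℕ) (m : ℝ) (a : Rn n → Rn n → ℂ) : Prop :=
  ContDiff ℝ (⊤ : ℕ∞) (fun p : Rn n × Rn n => a p.1 p.2) ∧
  ∀ k l : ℕ, ∃ C : ℝ, ∀ x ξ : Rn n,
    ‖iteratedFDeriv ℝ k (fun ξ' => iteratedFDeriv ℝ l (fun x' => a x' ξ') x) ξ‖ ≤
      C * (1 + ‖ξ‖ ^ 2) ^ ((m - (k : ℝ)) / 2)

/-- Smoothness away from `ξ = 0` and positive homogeneity of degree 1 in `ξ` of a phase. -/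
def PhaseSmoothHomog (n : ℕ) (φ : Rn n → Rn n → ℝ) : Prop :=
  ContDiffOn ℝ (⊤ : ℕ∞) (fun p : Rn n × Rn n => φ p.1 p.2) {p : Rn n × Rn n | p.2 ≠ 0} ∧
  ∀ (x ξ : Rn n) (t : ℝ), 0 < t → φ x (t • ξ) = t * φ x ξ

/-- The phase class `Φ^k`. -/
def PhaseClass (n : ℕ) (k : ℕ) (φ : Rn n → Rn n → ℝ) : Prop :=
  PhaseSmoothHomog n φ ∧
  ∀ a b : ℕ, k ≤ a + b → ∃ C : ℝ, ∀ x ξ : Rn n, ξ ≠ 0 →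
    ‖ξ‖ ^ ((a : ℝ) - 1) *
      ‖iteratedFDerivWithin ℝ a
        (fun ξ' => iteratedFDeriv ℝ b (fun x' => φ x' ξ') x) {ξ' : Rn n | ξ' ≠ 0} ξ‖ ≤ C

/-- Determinant of the mixed Hessian `(∂²φ/∂x_i∂ξ_k)`. -/
def mixedHessianDet (n : ℕ) (φ : Rn n → Rn n → ℝ) (x ξ : Rn n) : ℝ :=
  Matrix.det (Matrix.of fun i k : Fin n =>
    fderiv ℝ (fun x' => fderiv ℝ (fun ξ' => φ x' ξ') ξ (EuclideanSpace.single k 1)) x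
      (EuclideanSpace.single i 1))

/-- The strong non-degeneracy (SND) condition. -/
def SNDCondition (n : ℕ) (φ : Rn n → Rn n → ℝ) : Prop :=
  ∃ δ : ℝ, 0 < δ ∧ ∀ x ξ : Rn n, ξ ≠ 0 → δ ≤ |mixedHessianDet n φ x ξ|

/-- Non-degeneracy of the phase on a compact set `K`. -/
def NonDegenerateOn (n : ℕ) (φ : Rn n → Rn n → ℝ) (K : Set (Rn n)) : Prop :=
  ∀ x ∈ K, ∀ ξ : Rn n, ξ ≠ 0 → mixedHessianDet n φ x ξ ≠ 0

open EuclideanSpace (single)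
open ENNReal renaming ofReal → ofR, ofReal_mul → ofR_mul, ofReal_one → ofR_one,
  ofReal_pow → ofR_pow, rpow_mul → erpow_mul, ofReal_le_ofReal → ofR_le_ofR,
  ofReal_ne_top → ofR_ne_top
open ENNReal (coe_toNNReal mul_ne_top coe_mul mul_rpow_of_nonneg rpow_le_rpow rpow_ne_top_of_nonneg
  coe_ne_top rpow_add_of_nonneg inv_ne_top ofReal_coe_nnreal ofReal_rpow_of_nonneg ofNNReal_toNNReal
  rpow_one toReal_mono coe_rpow_of_nonneg toReal_pos one_ne_top sum_le_tsum tsum_geometric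
  tsum_le_tsum mul_iSup)
open Real (pi norm_eq_abs rpow_neg norm_of_nonneg rpow_nonneg mul_rpow rpow_natCast rpow_mul
  rpow_add rpow_le_rpow_of_exponent_le)
open ContinuousLinearMap (lsmul inr inl smulRightL fst snd id_apply norm_id_le coe_coe
  opNorm_le_bound inr_apply opNorm_comp_le norm_inl_le_one apply_apply)
open Finset (range mem_range sum_congr sum_mul sum_eq_zero mul_sum sum_le_sum)
open Set (mem_univ indicator_of_mem mk_mem_prod Ioo Ici Ioi Icc)
open Metric (closedBall ball cthickening sphere ball_subset_ball)
open Function (uncurry)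
open ContinuousLinearMap renaming id → clmId
open MeasureTheory.Measure (integral_comp_smul restrict_univ restrict_le_self)
open LinearMap (transvection)

local notation "𝐞(" t ")" => cexp (I * ((t : ℝ) : ℂ))
local notation "𝐞⁻(" t ")" => cexp (-(I * ((t : ℝ) : ℂ)))
local notation "C∞" => (⊤ : ℕ∞)
local notation "𝒮" n:max => SchwartzMap (Rn n) ℂ
local notation "ℝ²ⁿ" n:max => Rn n × Rn n

section

/-- The amplitude `a` vanishes outside `K`. -/
abbrev VanishOff {n : ℕ} (K : Set (Rn n)) (a : Rn n → Rn n → ℂ) : Prop :=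
  ∀ x ξ : Rn n, x ∉ K → a x ξ = 0

variable {E F G H P : Type*} [NormedAddCommGroup E] [NormedSpace ℝ E] [NormedAddCommGroup F]
  [NormedSpace ℝ F] [NormedAddCommGroup G] [NormedSpace ℝ G] [NormedAddCommGroup H]
  [NormedSpace ℝ H] [NormedAddCommGroup P] [NormedSpace ℝ P]

variable {n : ℕ} {ι : Type*} {φ : Rn n → Rn n → ℝ} {b : ι → ℝ²ⁿ n → ℂ} {Q K : Set (Rn n)}
  {a : Rn n → Rn n → ℂ} {m : ℝ} {ψ0 : Rn n → ℝ} (hn : 1 ≤ n) (h : IsLPBase n ψ0)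
  (ha : SymbolClass n m a) (hK : IsCompact K) (haK : VanishOff K a) (hφ : PhaseSmoothHomog n φ)
  (hQ : IsCompact Q)

/-- A family of functions whose iterated derivatives are bounded, uniformly in the index `i`,
at the points of the sets `S i`. -/
structure UBdd (S : ι → Set E) (u : ι → E → F) : Prop where
  smooth : ∀ i, ∀ x ∈ S i, ContDiffAt ℝ C∞ (u i) x
  bound : ∀ k : ℕ, ∃ C : ℝ, ∀ i, ∀ x ∈ S i, ‖iteratedFDeriv ℝ k (u i) x‖ ≤ C

section PointwiseBounds

theorem ContDiffAt.exists_open_contDiffOn {f : E → F} {x : E} (hf : ContDiffAt ℝ C∞ f x) (n : ℕ) :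
    ∃ s : Set E, IsOpen s ∧ x ∈ s ∧ ContDiffOn ℝ n f s := by
  obtain ⟨u, hu, h⟩ := hf.contDiffOn (m := n) (by exact_mod_cast le_top) (by simp)
  obtain ⟨s, hs, hso, hxs⟩ := mem_nhds_iff.1 hu
  exact ⟨s, hso, hxs, h.mono hs⟩

theorem ContDiffAt.norm_iteratedFDeriv_bilinear_le (B : E →L[ℝ] F →L[ℝ] G) {f : H → E} {g : H → F}
    {x : H} (hf : ContDiffAt ℝ C∞ f x) (hg : ContDiffAt ℝ C∞ g x) (n : ℕ) : ‖iteratedFDeriv ℝ n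
    (fun y => B (f y) (g y)) x‖ ≤ ‖B‖ * ∑ i ∈ range (n + 1), (n.choose i : ℝ) * ‖iteratedFDeriv ℝ i
    f x‖ * ‖iteratedFDeriv ℝ (n - i) g x‖ := by
  obtain ⟨s, hs, hxs, hfs⟩ := hf.exists_open_contDiffOn n
  obtain ⟨t, ht, hxt, hgt⟩ := hg.exists_open_contDiffOn n
  have ho : IsOpen (s ∩ t) := hs.inter ht
  have hx : x ∈ s ∩ t := ⟨hxs, hxt⟩
  have := B.norm_iteratedFDerivWithin_le_of_bilinear (hfs.mono Set.inter_subset_left)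
    (hgt.mono Set.inter_subset_right) ho.uniqueDiffOn hx (n := n) le_rfl
  simpa only [iteratedFDerivWithin_of_isOpen _ ho hx] using this

theorem ContDiffAt.norm_iteratedFDeriv_comp_le_of_bounds {g : F → G} {f : E → F} {x : E}
    (hg : ContDiffAt ℝ C∞ g (f x)) (hf : ContDiffAt ℝ C∞ f x) {C D : ℝ}
    (hC : ∀ i, i ≤ n → ‖iteratedFDeriv ℝ i g (f x)‖ ≤ C)
    (hD : ∀ i, 1 ≤ i → i ≤ n → ‖iteratedFDeriv ℝ i f x‖ ≤ D ^ i) :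
    ‖iteratedFDeriv ℝ n (g ∘ f) x‖ ≤ n.factorial * C * D ^ n := by
  obtain ⟨t, ht, hxt, hgt⟩ := hg.exists_open_contDiffOn n
  obtain ⟨s, hs, hxs, hfs⟩ := hf.exists_open_contDiffOn n
  obtain ⟨s', hs', hso', hxs'⟩ := mem_nhds_iff.1 (hf.continuousAt.preimage_mem_nhds (ht.mem_nhds hxt))
  have ho : IsOpen (s ∩ s') := hs.inter hso'
  have hx : x ∈ s ∩ s' := ⟨hxs, hxs'⟩
  have := norm_iteratedFDerivWithin_comp_le hgt (hfs.mono Set.inter_subset_left) (n := n) le_rfl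
    ht.uniqueDiffOn ho.uniqueDiffOn (fun y hy => hs' hy.2) hx (C := C) (D := D)
    (fun i hi => by rw [iteratedFDerivWithin_of_isOpen _ ht hxt]; exact hC i hi)
    (fun i h1 hi => by rw [iteratedFDerivWithin_of_isOpen _ ho hx]; exact hD i h1 hi)
  simpa only [iteratedFDerivWithin_of_isOpen _ ho hx] using this

end PointwiseBounds

namespace UBdd

variable {κ : Type*} {S T : ι → Set E} {u v : ι → E → F}

theorem exists_pos_bound (hu : UBdd S u) (k : ℕ) :
    ∃ C : ℝ, 0 < C ∧ ∀ i, ∀ x ∈ S i, ‖iteratedFDeriv ℝ k (u i) x‖ ≤ C := by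
  obtain ⟨C, hC⟩ := hu.bound k
  exact ⟨max C 1, by positivity, fun i x hx => (hC i x hx).trans (le_max_left _ _)⟩

theorem exists_bound_le (hu : UBdd S u) (n : ℕ) :
    ∃ C : ℝ, 1 ≤ C ∧ ∀ k ≤ n, ∀ i, ∀ x ∈ S i, ‖iteratedFDeriv ℝ k (u i) x‖ ≤ C := by
  choose C hC using hu.bound
  refine ⟨1 + ∑ k ∈ range (n + 1), |C k|, ?_, fun k hk i x hx => ?_⟩
  · have : 0 ≤ ∑ k ∈ range (n + 1), |C k| := Finset.sum_nonneg fun _ _ => abs_nonneg _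
    linarith
  · have h1 : |C k| ≤ ∑ k ∈ range (n + 1), |C k| :=
      Finset.single_le_sum (f := fun k => |C k|) (fun _ _ => abs_nonneg _) (mem_range.2 (by omega))
    have := hC k i x hx
    have := le_abs_self (C k)
    linarith

theorem norm_le (hu : UBdd S u) : ∃ C : ℝ, 0 < C ∧ ∀ i, ∀ x ∈ S i, ‖u i x‖ ≤ C := by
  obtain ⟨C, h0, hC⟩ := hu.exists_pos_bound 0
  exact ⟨C, h0, fun i x hx => by simpa using hC i x hx⟩

theorem mono (hu : UBdd S u) (h : ∀ i, T i ⊆ S i) : UBdd T u :=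
  ⟨fun i x hx => hu.smooth i x (h i hx), fun k => by
    obtain ⟨C, hC⟩ := hu.bound k
    exact ⟨C, fun i x hx => hC i x (h i hx)⟩⟩

theorem reindex (hu : UBdd S u) (r : κ → ι) : UBdd (fun j => S (r j)) (fun j => u (r j)) :=
  ⟨fun j x hx => hu.smooth _ x hx, fun k => by
    obtain ⟨C, hC⟩ := hu.bound k
    exact ⟨C, fun j x hx => hC _ x hx⟩⟩

theorem congr (hu : UBdd S u) (h : ∀ i, ∀ x ∈ S i, v i =ᶠ[nhds x] u i) : UBdd S v :=
  ⟨fun i x hx => (hu.smooth i x hx).congr_of_eventuallyEq (h i x hx), fun k => by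
    obtain ⟨C, hC⟩ := hu.bound k
    refine ⟨C, fun i x hx => ?_⟩
    rw [((h i x hx).iteratedFDeriv ℝ k).eq_of_nhds]
    exact hC i x hx⟩

theorem bilinear {v : ι → E → G} (B : F →L[ℝ] G →L[ℝ] H) (hu : UBdd S u) (hv : UBdd S v) :
    UBdd S (fun i x => B (u i x) (v i x)) := by
  refine ⟨fun i x hx => ?_, fun k => ?_⟩
  · exact (B.isBoundedBilinearMap.contDiff.contDiffAt (x := (u i x, v i x))).comp x
      ((hu.smooth i x hx).prodMk (hv.smooth i x hx))
  · obtain ⟨C, hC1, hC⟩ := hu.exists_bound_le k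
    obtain ⟨D, hD1, hD⟩ := hv.exists_bound_le k
    refine ⟨‖B‖ * ∑ i ∈ range (k + 1), (k.choose i : ℝ) * C * D, fun i x hx => ?_⟩
    refine ((hu.smooth i x hx).norm_iteratedFDeriv_bilinear_le B (hv.smooth i x hx) k).trans ?_
    gcongr with j hj
    · exact hC j (by have := mem_range.1 hj; omega) i x hx
    · exact hD (k - j) (by omega) i x hx

theorem comp {T : ι → Set F} {g : ι → F → G} (hg : UBdd T g)
    (hs : ∀ i, ∀ x ∈ S i, ContDiffAt ℝ C∞ (u i) x)
    (hb : ∀ k : ℕ, 1 ≤ k → ∃ C : ℝ, ∀ i, ∀ x ∈ S i, ‖iteratedFDeriv ℝ k (u i) x‖ ≤ C)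
    (hST : ∀ i, ∀ x ∈ S i, u i x ∈ T i) : UBdd S (fun i x => g i (u i x)) := by
  refine ⟨fun i x hx => (hg.smooth i _ (hST i x hx)).comp x (hs i x hx), fun k => ?_⟩
  obtain ⟨C, hC1, hC⟩ := hg.exists_bound_le k
  have : ∃ D : ℝ, 1 ≤ D ∧ ∀ l, 1 ≤ l → l ≤ k → ∀ i, ∀ x ∈ S i,
      ‖iteratedFDeriv ℝ l (u i) x‖ ≤ D := by
    choose! D hD using hb
    refine ⟨1 + ∑ k ∈ range (k + 1), |D k|, ?_, fun l hl hk i x hx => ?_⟩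
    · have : 0 ≤ ∑ k ∈ range (k + 1), |D k| := Finset.sum_nonneg fun _ _ => abs_nonneg _
      linarith
    · have h1 : |D l| ≤ ∑ k ∈ range (k + 1), |D k| :=
        Finset.single_le_sum (f := fun k => |D k|) (fun _ _ => abs_nonneg _)
          (mem_range.2 (by omega))
      have := hD l hl i x hx
      have := le_abs_self (D l)
      linarith
  obtain ⟨D, hD1, hD⟩ := this
  refine ⟨k.factorial * C * D ^ k, fun i x hx => ?_⟩
  refine ContDiffAt.norm_iteratedFDeriv_comp_le_of_bounds (hg.smooth i _ (hST i x hx))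
    (hs i x hx) (fun l hl => hC l hl i _ (hST i x hx)) (fun l h1 hl => ?_)
  exact (hD l h1 hl i x hx).trans (le_self_pow₀ hD1 (by omega))

theorem comp' {T : ι → Set F} {g : ι → F → G} (hg : UBdd T g) (hu : UBdd S u)
    (hST : ∀ i, ∀ x ∈ S i, u i x ∈ T i) : UBdd S (fun i x => g i (u i x)) :=
  hg.comp hu.smooth (fun k _ => hu.bound k) hST

theorem clm_comp (L : F →L[ℝ] G) (hu : UBdd S u) : UBdd S (fun i x => L (u i x)) := by
  refine ⟨fun i x hx => L.contDiff.contDiffAt.comp x (hu.smooth i x hx), fun k => ?_⟩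
  obtain ⟨C, hC0, hC⟩ := hu.exists_pos_bound k
  refine ⟨‖L‖ * C, fun i x hx => ?_⟩
  have h := L.iteratedFDeriv_comp_left (hu.smooth i x hx) (i := k) (by exact_mod_cast le_top)
  rw [show (fun x => L (u i x)) = L ∘ u i from rfl, h]
  refine (L.norm_compContinuousMultilinearMap_le _).trans ?_
  gcongr
  exact hC i x hx

theorem add (hu : UBdd S u) (hv : UBdd S v) : UBdd S (fun i x => u i x + v i x) := by
  refine ⟨fun i x hx => (hu.smooth i x hx).add (hv.smooth i x hx), fun k => ?_⟩
  obtain ⟨C, hC⟩ := hu.bound k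
  obtain ⟨D, hD⟩ := hv.bound k
  refine ⟨C + D, fun i x hx => ?_⟩
  rw [show (fun x => u i x + v i x) = u i + v i from rfl, iteratedFDeriv_add_apply
    ((hu.smooth i x hx).of_le (by exact_mod_cast le_top))
    ((hv.smooth i x hx).of_le (by exact_mod_cast le_top))]
  exact (norm_add_le _ _).trans (add_le_add (hC i x hx) (hD i x hx))

theorem neg (hu : UBdd S u) : UBdd S (fun i x => -u i x) := by
  simpa using hu.clm_comp (-(clmId ℝ F))

theorem sub (hu : UBdd S u) (hv : UBdd S v) : UBdd S (fun i x => u i x - v i x) := by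
  simpa [sub_eq_add_neg] using hu.add hv.neg

theorem const {c : ι → F} {C : ℝ} (hc : ∀ i, ‖c i‖ ≤ C) : UBdd S (fun i _ => c i) := by
  refine ⟨fun i x _ => contDiffAt_const, fun k => ⟨|C|, fun i x _ => ?_⟩⟩
  rcases k with _ | k
  · simpa using (hc i).trans (le_abs_self C)
  · rw [iteratedFDeriv_const_of_ne (by omega)]
    simp

theorem finset_sum {α : Type*} (s : Finset α) {w : α → ι → E → F} (hw : ∀ a ∈ s, UBdd S (w a)) :
    UBdd S (fun i x => ∑ a ∈ s, w a i x) := by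
  classical
  induction s using Finset.induction_on with
  | empty => simpa using UBdd.const (S := S) (c := fun _ => (0 : F)) (C := 0) (by simp)
  | insert a s ha ih =>
    simp only [Finset.sum_insert ha]
    exact (hw a (by simp)).add (ih fun b hb => hw b (by simp [hb]))

theorem smul {c : ι → E → ℝ} (hc : UBdd S c) (hu : UBdd S u) : UBdd S (fun i x => c i x • u i x) :=
  hc.bilinear (lsmul ℝ ℝ) hu

theorem mul {𝔸 : Type*} [NormedRing 𝔸] [NormedAlgebra ℝ 𝔸] {f g : ι → E → 𝔸} (hf : UBdd S f)
    (hg : UBdd S g) : UBdd S (fun i x => f i x * g i x) :=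
  hf.bilinear (ContinuousLinearMap.mul ℝ 𝔸) hg

protected theorem fderiv (hu : UBdd S u) : UBdd S (fun i x => fderiv ℝ (u i) x) := by
  refine ⟨fun i x hx => (hu.smooth i x hx).fderiv_right (by simp), fun k => ?_⟩
  obtain ⟨C, hC⟩ := hu.bound (k + 1)
  exact ⟨C, fun i x hx => by rw [norm_iteratedFDeriv_fderiv]; exact hC i x hx⟩

theorem fderiv_apply (hu : UBdd S u) (e : E) : UBdd S (fun i x => fderiv ℝ (u i) x e) :=
  hu.fderiv.clm_comp (ContinuousLinearMap.apply ℝ F e)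

theorem of_fderiv (h0 : ∃ C : ℝ, ∀ i, ∀ x ∈ S i, ‖u i x‖ ≤ C)
    (hs : ∀ i, ∀ x ∈ S i, ContDiffAt ℝ C∞ (u i) x)
    (hu : UBdd S (fun i x => fderiv ℝ (u i) x)) : UBdd S u := by
  refine ⟨hs, fun k => ?_⟩
  rcases k with _ | k
  · simpa using h0
  · obtain ⟨C, hC⟩ := hu.bound k
    exact ⟨C, fun i x hx => by rw [← norm_iteratedFDeriv_fderiv]; exact hC i x hx⟩

/-- A bounded family on `S` vanishing near every point outside `S` is bounded everywhere. -/
theorem extend_zero (hu : UBdd S u) (h0 : ∀ i, ∀ x ∉ S i, u i =ᶠ[nhds x] fun _ => 0) :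
    UBdd (fun _ => Set.univ) u := by
  refine ⟨fun i x _ => ?_, fun k => ?_⟩
  · by_cases hx : x ∈ S i
    · exact hu.smooth i x hx
    · exact contDiffAt_const.congr_of_eventuallyEq (h0 i x hx)
  · obtain ⟨C, hC0, hC⟩ := hu.exists_pos_bound k
    refine ⟨C, fun i x _ => ?_⟩
    by_cases hx : x ∈ S i
    · exact hC i x hx
    · rw [((h0 i x hx).iteratedFDeriv ℝ k).eq_of_nhds, iteratedFDeriv_fun_zero]
      simpa using hC0.le

theorem contDiff (hu : UBdd (fun _ => Set.univ) u) (i : ι) : ContDiff ℝ C∞ (u i) :=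
  contDiff_iff_contDiffAt.2 fun x => hu.smooth i x (mem_univ _)

/-- Iterated derivatives of positive order of affine maps. -/
theorem affine_bounds {c : ι → F} {L : ι → E →L[ℝ] F} {C : ℝ} (hL : ∀ i, ‖L i‖ ≤ C) (k : ℕ)
    (hk : 1 ≤ k) : ∃ D : ℝ, ∀ i (x : E), ‖iteratedFDeriv ℝ k (fun x => c i + L i x) x‖ ≤ D := by
  refine ⟨max C 0, fun i x => ?_⟩
  obtain ⟨l, rfl⟩ : ∃ l, k = l + 1 := ⟨k - 1, by omega⟩
  rw [← norm_iteratedFDeriv_fderiv]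
  have : fderiv ℝ (fun x => c i + L i x) = fun _ => L i := by
    ext1 y
    rw [fderiv_const_add]
    exact (L i).fderiv
  rw [this]
  rcases l with _ | l
  · simpa using Or.inl (hL i)
  · rw [iteratedFDeriv_const_of_ne (by omega)]
    simp

theorem comp_affine {T : ι → Set F} {g : ι → F → G} (hg : UBdd T g) (c : ι → F) (L : ι → E →L[ℝ] F)
    {C : ℝ} (hL : ∀ i, ‖L i‖ ≤ C) (hST : ∀ i, ∀ x ∈ S i, c i + L i x ∈ T i) :
    UBdd S (fun i x => g i (c i + L i x)) :=
  hg.comp (u := fun i x => c i + L i x)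
    (fun i x _ => (contDiff_const.add (L i).contDiff).contDiffAt)
    (fun k hk => by
      obtain ⟨D, hD⟩ := affine_bounds (c := c) hL k hk
      exact ⟨D, fun i x _ => hD i x⟩) hST

theorem comp_clm {T : ι → Set F} {g : ι → F → G} (hg : UBdd T g) (L : ι → E →L[ℝ] F) {C : ℝ}
    (hL : ∀ i, ‖L i‖ ≤ C) (hST : ∀ i, ∀ x ∈ S i, L i x ∈ T i) :
    UBdd S (fun i x => g i (L i x)) := by
  simpa using hg.comp_affine (fun _ => 0) L hL (by simpa using hST)

/-- A function which is smooth near a compact set. -/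
theorem of_isCompact {f : E → F} {Q : Set E} (hQ : IsCompact Q) (hf : ∀ z ∈ Q, ContDiffAt ℝ C∞ f z)
    : UBdd (fun _ : ι => Q) (fun _ => f) := by
  refine ⟨fun _ z hz => hf z hz, fun k => ?_⟩
  have hc : ContinuousOn (fun z => ‖iteratedFDeriv ℝ k f z‖) Q := fun z hz =>
    (((hf z hz).iteratedFDeriv_right (m := 0) (i := k)
      (by simpa using (by exact_mod_cast le_top : ((k : ℕ∞) : WithTop ℕ∞) ≤ (C∞ :
        WithTop ℕ∞)))).continuousAt.norm).continuousWithinAt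
  obtain ⟨C, hC⟩ := (hQ.image_of_continuousOn hc).bddAbove
  exact ⟨C, fun _ z hz => hC (Set.mem_image_of_mem _ hz)⟩

/-- Functions of `x` obtained by freezing the parameter of a jointly smooth function on a compact
set form a bounded family. -/
theorem of_joint {f : P × E → F}
    {Q : Set (P × E)} (hQ : IsCompact Q) (hf : ∀ z ∈ Q, ContDiffAt ℝ C∞ f z) (r : ι → P)
    (hS : ∀ i, ∀ x ∈ S i, (r i, x) ∈ Q) : UBdd S (fun i x => f (r i, x)) := by
  simpa using (of_isCompact hQ hf (ι := ι)).comp_affine (S := S) (fun i => (r i, (0 : E)))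
    (fun _ => inr ℝ P E) (C := ‖inr ℝ P E‖)
    (fun _ => le_rfl) (by simpa using hS)

/-- Freezing the first variable in a bounded family of functions of two variables. -/
theorem freeze_left {T : ι → Set (P × E)}
    {g : ι → P × E → G} (hg : UBdd T g) (r : κ → ι) (q : κ → P) {S : κ → Set E}
    (hS : ∀ j, ∀ x ∈ S j, (q j, x) ∈ T (r j)) : UBdd S (fun j x => g (r j) (q j, x)) := by
  simpa using (hg.reindex r).comp_affine (S := S) (fun i => (q i, (0 : E)))
    (fun _ => inr ℝ P E) (C := ‖inr ℝ P E‖)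
    (fun _ => le_rfl) (by simpa using hS)

/-- Freezing the second variable in a bounded family of functions of two variables. -/
theorem freeze_right {T : ι → Set (E × P)}
    {g : ι → E × P → G} (hg : UBdd T g) (r : κ → ι) (q : κ → P) {S : κ → Set E}
    (hS : ∀ j, ∀ x ∈ S j, (x, q j) ∈ T (r j)) : UBdd S (fun j x => g (r j) (x, q j)) := by
  simpa using (hg.reindex r).comp_affine (S := S) (fun i => ((0 : E), q i))
    (fun _ => inl ℝ E P) (C := ‖inl ℝ E P‖)
    (fun _ => le_rfl) (by simpa using hS)

theorem inv {c : ι → E → ℝ} (hc : UBdd S c) {δ : ℝ} (hδ : 0 < δ) (hcδ : ∀ i, ∀ x ∈ S i, δ ≤ |c i x|)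
    : UBdd S (fun i x => (c i x)⁻¹) := by
  obtain ⟨R, hR0, hR⟩ := hc.norm_le
  have hQ : IsCompact {t : ℝ | δ ≤ |t| ∧ |t| ≤ R} := by
    apply IsCompact.of_isClosed_subset (isCompact_closedBall (0 : ℝ) R)
    · exact (isClosed_le continuous_const continuous_abs).inter
        (isClosed_le continuous_abs continuous_const)
    · intro t ht
      simpa using ht.2
  have h1 : UBdd (fun _ : ι => {t : ℝ | δ ≤ |t| ∧ |t| ≤ R}) (fun _ t => t⁻¹) :=
    of_isCompact hQ fun t ht => contDiffAt_inv ℝ (by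
      rintro rfl
      simp only [abs_zero, Set.mem_ofPred_eq] at ht
      linarith [ht.1])
  exact h1.comp' hc fun i x hx => ⟨hcδ i x hx, hR i x hx⟩

theorem ofReal {c : ι → E → ℝ} (hc : UBdd S c) : UBdd S (fun i x => (c i x : ℂ)) :=
  hc.clm_comp ofRealCLM

theorem exp_I {c : ι → E → ℝ} (hc : UBdd S c) : UBdd S (fun i x => cexp (I * (c i x : ℂ))) := by
  obtain ⟨R, hR0, hR⟩ := hc.norm_le
  have h1 : UBdd (fun _ : ι => closedBall (0 : ℝ) R) (fun _ t => cexp (I * (t : ℂ))) :=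
    of_isCompact (isCompact_closedBall _ _) fun t _ => by
      have : ContDiff ℝ C∞ (fun t : ℝ => cexp (I * (t : ℂ))) := by
        have := ofRealCLM.contDiff (n := (C∞ : WithTop ℕ∞))
        exact (contDiff_const.mul this).cexp
      exact this.contDiffAt
  exact h1.comp' hc fun i x hx => by simpa using hR i x hx

end UBdd

theorem integral_fderiv_apply_eq_zero {g : Rn n → ℂ} (hg : ContDiff ℝ 1 g)
    (hs : HasCompactSupport g) (v : Rn n) : ∫ x, fderiv ℝ g x v = 0 := by
  have hc : Continuous fun x => fderiv ℝ g x v :=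
    (hg.continuous_fderiv (by simp)).clm_apply continuous_const
  have hcs : HasCompactSupport fun x => fderiv ℝ g x v := hs.fderiv_apply ℝ v
  have := integral_mul_fderiv_eq_neg_fderiv_mul_of_integrable (μ := (volume : Measure (Rn n)))
    (f := fun _ => (1 : ℂ)) (g := g) (v := v) (by simp)
    (by simpa using hc.integrable_of_hasCompactSupport hcs)
    (by simpa using hg.continuous.integrable_of_hasCompactSupport hs)
    (by intro x _; fun_prop) (fun x _ => (hg.differentiable (by simp)).differentiableAt)
  simpa using this

theorem sq_norm_eq_sum_sq_apply (L : Rn n →L[ℝ] ℝ) : ‖L‖ ^ 2 = ∑ l, L (single l 1) ^ 2 := by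
  set g := (InnerProductSpace.toDual ℝ (Rn n)).symm L with hg
  have h1 : ‖L‖ = ‖g‖ := by simp [hg]
  have h2 : ∀ v, L v = ⟪g, v⟫_ℝ := fun v => by simp [hg]
  rw [h1, EuclideanSpace.norm_sq_eq]
  refine sum_congr rfl fun l _ => ?_
  rw [h2]
  simp [EuclideanSpace.inner_single_right]

theorem sum_mul_inv_sum_mul_self {α : Type*} [Fintype α] {d : α → ℝ} (h : ∑ l, d l * d l ≠ 0) :
    ∑ l, d l * (∑ l, d l * d l)⁻¹ * d l = 1 := by
  generalize hW : ∑ l, d l * d l = W at h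
  calc ∑ l, d l * W⁻¹ * d l = ∑ l, (d l * d l) * W⁻¹ := sum_congr rfl fun l _ => by ring
    _ = 1 := by rw [← sum_mul, hW, mul_inv_cancel₀ h]

/-- The family of functions `u i`, supported in the closed sets `S i`. -/
structure SuppUBdd (S : ι → Set E) (u : ι → E → F) : Prop where
  ubdd : UBdd S u
  isClosed : ∀ i, IsClosed (S i)
  eq_zero : ∀ i, ∀ x ∉ S i, u i x = 0

namespace SuppUBdd

variable {S : ι → Set E} {u v : ι → E → F}

theorem eventually_eq_zero (hu : SuppUBdd S u) (i : ι) {x : E} (hx : x ∉ S i) :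
    u i =ᶠ[nhds x] fun _ => 0 := by
  filter_upwards [(hu.isClosed i).isOpen_compl.mem_nhds hx] with y hy using hu.eq_zero i y hy

theorem univ (hu : SuppUBdd S u) : UBdd (fun _ => Set.univ) u :=
  hu.ubdd.extend_zero fun i _ hx => hu.eventually_eq_zero i hx

theorem contDiff (hu : SuppUBdd S u) (i : ι) : ContDiff ℝ C∞ (u i) := hu.univ.contDiff i

theorem bilinear {v : ι → E → G} (B : F →L[ℝ] G →L[ℝ] H) (hu : SuppUBdd S u) (hv : UBdd S v) :
    SuppUBdd S (fun i x => B (u i x) (v i x)) :=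
  ⟨hu.ubdd.bilinear B hv, hu.isClosed, fun i x hx => by simp [hu.eq_zero i x hx]⟩

theorem mul {𝔸 : Type*} [NormedRing 𝔸] [NormedAlgebra ℝ 𝔸] {f g : ι → E → 𝔸} (hf : SuppUBdd S f)
    (hg : UBdd S g) : SuppUBdd S (fun i x => f i x * g i x) :=
  hf.bilinear (ContinuousLinearMap.mul ℝ 𝔸) hg

theorem fderiv_apply (hu : SuppUBdd S u) (e : E) : SuppUBdd S (fun i x => fderiv ℝ (u i) x e) :=
  ⟨hu.ubdd.fderiv_apply e, hu.isClosed, fun i x hx => by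
    rw [(hu.eventually_eq_zero i hx).fderiv_eq]; simp⟩

theorem finset_sum {α : Type*} (s : Finset α) {w : α → ι → E → F} (hS : ∀ i, IsClosed (S i))
    (hw : ∀ a ∈ s, SuppUBdd S (w a)) : SuppUBdd S (fun i x => ∑ a ∈ s, w a i x) :=
  ⟨UBdd.finset_sum s fun a ha => (hw a ha).ubdd, hS, fun i x hx =>
    sum_eq_zero fun a ha => (hw a ha).eq_zero i x hx⟩

theorem hasCompactSupport (hu : SuppUBdd S u) (i : ι) (hS : IsCompact (S i)) :
    HasCompactSupport (u i) :=
  HasCompactSupport.intro hS fun x hx => hu.eq_zero i x hx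

end SuppUBdd

theorem SuppUBdd.exists_integral_exp_eq {S : ι → Set (Rn n)} {u : ι → Rn n → ℂ} {Ψ : ι → Rn n → ℝ}
    {c : ℝ} (hc : 0 < c) (hu : SuppUBdd S u) (hS : ∀ i, IsCompact (S i)) (hΨ : UBdd S Ψ)
    (hΨc : ∀ i, ∀ x ∈ S i, c ≤ ‖fderiv ℝ (Ψ i) x‖) : ∃ u' : ι → Rn n → ℂ, SuppUBdd S u' ∧ ∀ i, ∀ μ :
    ℝ, μ * ∫ x, u i x * 𝐞(μ * Ψ i x) = ∫ x, u' i x * cexp (I * ((μ * Ψ i x : ℝ) : ℂ)) := by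
  have hd : ∀ l : Fin n, UBdd S (fun i x => fderiv ℝ (Ψ i) x (single l 1)) :=
    fun l => hΨ.fderiv_apply _
  have hW : UBdd S (fun i x => (∑ l : Fin n, fderiv ℝ (Ψ i) x (single l 1) *
      fderiv ℝ (Ψ i) x (single l 1))⁻¹) := by
    refine (UBdd.finset_sum _ fun l _ => (hd l).mul (hd l)).inv (δ := c ^ 2) (by positivity) ?_
    intro i x hx
    have := hΨc i x hx
    simp only [← pow_two]
    rw [← sq_norm_eq_sum_sq_apply, abs_of_nonneg (by positivity)]
    gcongr
  set V : Fin n → ι → Rn n → ℝ := fun l i x => fderiv ℝ (Ψ i) x (single l 1) *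
    (∑ l : Fin n, fderiv ℝ (Ψ i) x (single l 1) * fderiv ℝ (Ψ i) x (single l 1))⁻¹ with hV
  have hVb : ∀ l, UBdd S (V l) := fun l => (hd l).mul hW
  have huV : ∀ l, SuppUBdd S (fun i x => u i x * (V l i x : ℂ)) := fun l => hu.mul (hVb l).ofReal
  refine ⟨fun i x => ∑ l, I * fderiv ℝ (fun x => u i x * (V l i x : ℂ)) x
    (single l 1), ?_, fun i μ => ?_⟩
  · refine SuppUBdd.finset_sum _ hu.isClosed fun l _ => ?_
    have := ((huV l).fderiv_apply (single l 1)).mul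
      (UBdd.const (S := S) (c := fun _ => I) (C := 1) (by simp))
    simpa [mul_comm] using this
  have hE : UBdd S (fun i x => 𝐞(μ * Ψ i x)) :=
    ((UBdd.const (S := S) (c := fun _ => μ) (C := |μ|) (fun _ => le_rfl)).mul hΨ).exp_I
  have hg : ∀ l, SuppUBdd S (fun i x => (u i x * (V l i x : ℂ)) *
      𝐞(μ * Ψ i x)) := fun l => (huV l).mul hE
  have hu'E : ∀ l, SuppUBdd S (fun i x => fderiv ℝ (fun x => u i x * (V l i x : ℂ)) x
    (single l 1) * 𝐞(μ * Ψ i x)) := fun l =>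
    ((huV l).fderiv_apply _).mul hE
  have huE : SuppUBdd S (fun i x => u i x * 𝐞(μ * Ψ i x)) := hu.mul hE
  have int1 : ∀ l, Integrable (fun x => fderiv ℝ (fun x => u i x * (V l i x : ℂ)) x
    (single l 1) * 𝐞(μ * Ψ i x)) := fun l =>
    ((hu'E l).contDiff i).continuous.integrable_of_hasCompactSupport
      ((hu'E l).hasCompactSupport i (hS i))
  have int2 : Integrable (fun x => u i x * 𝐞(μ * Ψ i x)) :=
    (huE.contDiff i).continuous.integrable_of_hasCompactSupport (huE.hasCompactSupport i (hS i))
  have key : ∀ x, ∑ l, fderiv ℝ (fun x => (u i x * (V l i x : ℂ)) * 𝐞(μ * Ψ i x)) x (single l 1) =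
      (∑ l, fderiv ℝ (fun x => u i x * (V l i x : ℂ)) x (single l 1) *
        𝐞(μ * Ψ i x)) + I * μ * (u i x * 𝐞(μ * Ψ i x)) := by
    intro x
    by_cases hx : x ∈ S i
    · have hΨd : HasFDerivAt (Ψ i) (fderiv ℝ (Ψ i) x) x :=
        ((hΨ.smooth i x hx).differentiableAt (by simp)).hasFDerivAt
      have hEd : HasFDerivAt (fun x => 𝐞(μ * Ψ i x))
          (𝐞(μ * Ψ i x) • (I • (ofRealCLM.comp (μ • fderiv ℝ (Ψ i) x)))) x :=
        (((ofRealCLM.hasFDerivAt (x := μ * Ψ i x)).comp x (hΨd.const_mul μ)).const_mul I).cexp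
      have hterm : ∀ l, fderiv ℝ (fun x => (u i x * (V l i x : ℂ)) * 𝐞(μ * Ψ i x)) x (single l 1) =
          fderiv ℝ (fun x => u i x * (V l i x : ℂ)) x (single l 1) * 𝐞(μ * Ψ i x) + (V l i x : ℂ) *
            (fderiv ℝ (Ψ i) x (single l 1) : ℂ) *
            (I * μ * (u i x * 𝐞(μ * Ψ i x))) := by
        intro l
        have h1 : HasFDerivAt (fun x => u i x * (V l i x : ℂ))
            (fderiv ℝ (fun x => u i x * (V l i x : ℂ)) x) x :=
          (((huV l).contDiff i).contDiffAt.differentiableAt (by simp)).hasFDerivAt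
        have h2 := (h1.mul hEd).fderiv
        rw [show ((fun x => u i x * (V l i x : ℂ)) * fun x => 𝐞(μ * Ψ i x)) =
          fun x => (u i x * (V l i x : ℂ)) * 𝐞(μ * Ψ i x) from rfl] at h2
        rw [h2]
        simp
        ring
      rw [sum_congr rfl fun l _ => hterm l, Finset.sum_add_distrib]
      congr 1
      have hone : ∑ l, V l i x * fderiv ℝ (Ψ i) x (single l 1) = 1 := by
        refine sum_mul_inv_sum_mul_self ?_
        simp only [← pow_two]
        rw [← sq_norm_eq_sum_sq_apply]
        have := hc.trans_le (hΨc i x hx)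
        positivity
      have : (∑ l, (V l i x : ℂ) * (fderiv ℝ (Ψ i) x (single l 1) : ℂ)) = 1 := by
        exact_mod_cast congrArg (fun t : ℝ => (t : ℂ)) hone
      rw [← sum_mul, this, one_mul]
    · rw [hu.eq_zero i x hx]
      rw [sum_eq_zero, sum_eq_zero]
      · simp
      · exact fun l _ => (hu'E l).eq_zero i x hx
      · exact fun l _ => ((hg l).fderiv_apply _).eq_zero i x hx
  have hint := congrArg (fun f : Rn n → ℂ => ∫ x, f x) (funext key)
  rw [integral_finsetSum _ fun l _ => (((hg l).fderiv_apply _).contDiff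
      i).continuous.integrable_of_hasCompactSupport (((hg l).fderiv_apply _).hasCompactSupport i
      (hS i)), sum_eq_zero fun l _ => integral_fderiv_apply_eq_zero
      (((hg l).contDiff i).of_le (by exact_mod_cast le_top)) ((hg l).hasCompactSupport i (hS i)) _,
    integral_add (integrable_finsetSum _ fun l _ => int1 l) (int2.const_mul _),
    integral_const_mul] at hint
  simp only [sum_mul, mul_assoc]
  simp only [← mul_sum]
  rw [integral_const_mul]
  linear_combination I * hint + (μ : ℂ) * (∫ x, u i x * 𝐞(μ * Ψ i x)) * I_mul_I

theorem SuppUBdd.osc_decay {S : ι → Set (Rn n)} {Ψ : ι → Rn n → ℝ} {c R : ℝ} (hc : 0 < c)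
    (hSR : ∀ i, S i ⊆ closedBall 0 R) (hΨ : UBdd S Ψ) (hΨc : ∀ i, ∀ x ∈ S i, c ≤ ‖fderiv ℝ (Ψ i) x‖)
    (N : ℕ) : ∀ {u : ι → Rn n → ℂ},
    SuppUBdd S u → ∃ C : ℝ, 0 ≤ C ∧ ∀ i, ∀ μ : ℝ,
      |μ| ^ N * ‖∫ x, u i x * 𝐞(μ * Ψ i x)‖ ≤ C := by
  have hmul : ∀ t : ℝ, ‖cexp (I * (t : ℂ))‖ = 1 := fun t => by
    rw [mul_comm]; exact Complex.norm_exp_ofReal_mul_I t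
  induction N with
  | zero =>
    intro u hu
    obtain ⟨C, hC0, hC⟩ := hu.ubdd.norm_le
    refine ⟨C * (volume (closedBall (0 : Rn n) R)).toReal, by positivity, fun i μ => ?_⟩
    rw [pow_zero, one_mul]
    have h0 : ∫ x, u i x * 𝐞(μ * Ψ i x) = ∫ x in closedBall (0 : Rn n) R, u i x * 𝐞(μ * Ψ i x) := by
      rw [setIntegral_eq_integral_of_forall_compl_eq_zero]
      intro x hx
      rw [hu.eq_zero i x fun h => hx (hSR i h), zero_mul]
    rw [h0]
    refine norm_setIntegral_le_of_norm_le_const (measure_closedBall_lt_top) fun x _ => ?_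
    rw [norm_mul, hmul, mul_one]
    by_cases hx : x ∈ S i
    · exact hC i x hx
    · simp [hu.eq_zero i x hx, hC0.le]
  | succ N ih =>
    intro u hu
    have hS : ∀ i, IsCompact (S i) := fun i =>
      (isCompact_closedBall (0 : Rn n) R).of_isClosed_subset (hu.isClosed i) (hSR i)
    obtain ⟨u', hu', h⟩ := hu.exists_integral_exp_eq hc hS hΨ hΨc
    obtain ⟨C, hC0, hC⟩ := ih hu'
    refine ⟨C, hC0, fun i μ => ?_⟩
    have := hC i μ
    rw [← h] at this
    rw [norm_mul, norm_real, norm_eq_abs, ← mul_assoc, ← pow_succ] at this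
    exact this

theorem SuppUBdd.fourier_decay {S : ι → Set (Rn n)} {R : ℝ} {u : ι → Rn n → ℂ} (hu : SuppUBdd S u)
    (hSR : ∀ i, S i ⊆ closedBall 0 R) (N : ℕ) : ∃ C : ℝ, 0 ≤ C ∧ ∀ i (τ : Rn n), (1 + ‖τ‖) ^ N * ‖∫
    x, u i x * 𝐞(⟪τ, x⟫_ℝ)‖ ≤ C := by
  have hL : UBdd (fun j : ι × {v : Rn n // ‖v‖ = 1} => S j.1) (fun j x => ⟪(j.2 : Rn n), x⟫_ℝ) := by
    have h1 : UBdd (fun _ : ι × {v : Rn n // ‖v‖ = 1} => closedBall (0 : ℝ) |R|)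
        (fun _ t => t) := UBdd.of_isCompact (isCompact_closedBall _ _) fun _ _ => contDiffAt_id
    refine h1.comp_clm (fun j => innerSL ℝ (j.2 : Rn n)) (C := 1) (fun j => ?_) fun j x hx => ?_
    · rw [innerSL_apply_norm, j.2.2]
    · have h2 := hSR _ hx
      simp only [mem_closedBall_zero_iff] at h2 ⊢
      refine ((innerSL ℝ (j.2 : Rn n)).le_opNorm x).trans ?_
      rw [innerSL_apply_norm, j.2.2, one_mul]
      exact h2.trans (le_abs_self R)
  have hu2 : SuppUBdd (fun j : ι × {v : Rn n // ‖v‖ = 1} => S j.1) (fun j => u j.1) :=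
    ⟨hu.ubdd.reindex Prod.fst, fun j => hu.isClosed j.1, fun j => hu.eq_zero j.1⟩
  have hfd : ∀ j : ι × {v : Rn n // ‖v‖ = 1}, ∀ x ∈ S j.1,
      1 ≤ ‖fderiv ℝ (fun x => ⟪(j.2 : Rn n), x⟫_ℝ) x‖ := by
    intro j x _
    have : fderiv ℝ (fun x => ⟪(j.2 : Rn n), x⟫_ℝ) x = innerSL ℝ (j.2 : Rn n) :=
      (innerSL ℝ (j.2 : Rn n)).fderiv
    rw [this, innerSL_apply_norm, j.2.2]
  obtain ⟨C, hC0, hC⟩ := SuppUBdd.osc_decay one_pos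
    (fun j : ι × {v : Rn n // ‖v‖ = 1} => hSR j.1) hL hfd N hu2
  obtain ⟨D, hD0, hD⟩ := SuppUBdd.osc_decay one_pos
    (fun j : ι × {v : Rn n // ‖v‖ = 1} => hSR j.1) hL hfd 0 hu2
  by_cases hne : Nonempty {v : Rn n // ‖v‖ = 1}
  · obtain ⟨v0⟩ := hne
    refine ⟨2 ^ N * (C + D), by positivity, fun i τ => ?_⟩
    set J := ‖∫ x, u i x * 𝐞(⟪τ, x⟫_ℝ)‖ with hJ
    have hτ : ∃ v : {v : Rn n // ‖v‖ = 1}, τ = ‖τ‖ • (v : Rn n) := by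
      by_cases h0 : τ = 0
      · exact ⟨v0, by simp [h0]⟩
      · refine ⟨⟨‖τ‖⁻¹ • τ, by simp [norm_smul, h0]⟩, ?_⟩
        simp [smul_smul, h0]
    obtain ⟨v, hv⟩ := hτ
    have e1 : ∀ x, ‖τ‖ * ⟪(v : Rn n), x⟫_ℝ = ⟪τ, x⟫_ℝ := fun x => by
      conv_rhs => rw [hv]
      rw [real_inner_smul_left]
    have h1 := hC (i, v) ‖τ‖
    have h2 := hD (i, v) ‖τ‖
    simp only [e1, abs_norm, pow_zero, one_mul] at h1 h2
    rw [← hJ] at h1 h2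
    have hJ0 : 0 ≤ J := norm_nonneg _
    have h3 : (1 + ‖τ‖) ^ N ≤ 2 ^ N * (‖τ‖ ^ N + 1) := by
      rcases le_total ‖τ‖ 1 with h | h
      · calc (1 + ‖τ‖) ^ N ≤ 2 ^ N := by gcongr; linarith
          _ ≤ _ := le_mul_of_one_le_right (by positivity) (by have := pow_nonneg (norm_nonneg τ) N; linarith)
      · calc (1 + ‖τ‖) ^ N ≤ (2 * ‖τ‖) ^ N := by gcongr; linarith
          _ = 2 ^ N * ‖τ‖ ^ N := mul_pow _ _ _
          _ ≤ _ := by gcongr; linarith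
    calc (1 + ‖τ‖) ^ N * J ≤ (2 ^ N * (‖τ‖ ^ N + 1)) * J := by gcongr
      _ = 2 ^ N * (‖τ‖ ^ N * J + J) := by ring
      _ ≤ _ := by gcongr
  · obtain ⟨B, hB0, hB⟩ := hu.ubdd.norm_le
    have hτ : ∀ τ : Rn n, τ = 0 := by
      intro τ
      by_contra h0
      exact hne ⟨⟨‖τ‖⁻¹ • τ, by simp [norm_smul, h0]⟩⟩
    refine ⟨B * (volume (closedBall (0 : Rn n) R)).toReal, by positivity, fun i τ => ?_⟩
    have h0 : ∫ x, u i x * 𝐞(⟪τ, x⟫_ℝ) = ∫ x in closedBall (0 : Rn n) R, u i x * 𝐞(⟪τ, x⟫_ℝ) := by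
      rw [setIntegral_eq_integral_of_forall_compl_eq_zero]
      intro x hx
      rw [hu.eq_zero i x fun h => hx (hSR i h), zero_mul]
    have hn : ‖τ‖ = 0 := by rw [hτ τ, norm_zero]
    rw [hn, add_zero, one_pow, one_mul, h0]
    refine norm_setIntegral_le_of_norm_le_const (μ := (volume : Measure (Rn n)))
      measure_closedBall_lt_top fun x _ => ?_
    rw [norm_mul, mul_comm I, Complex.norm_exp_ofReal_mul_I, mul_one]
    by_cases hx : x ∈ S i
    · exact hB i x hx
    · simp [hu.eq_zero i x hx, hB0.le]

/-- Iterated directional derivatives. -/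
def dIter (l : List E) (u : E → F) : E → F := l.foldr (fun w g z => fderiv ℝ g z w) u

section DIter

@[simp] theorem dIter_nil (u : E → F) : dIter [] u = u := rfl

@[simp] theorem dIter_cons (w : E) (l : List E) (u : E → F) :
    dIter (w :: l) u = fun z => fderiv ℝ (dIter l u) z w := rfl

theorem dIter_append (l l' : List E) (u : E → F) : dIter (l ++ l') u = dIter l (dIter l' u) := by
  simp [dIter, List.foldr_append]

theorem ContDiff.dIter {u : E → F} (hu : ContDiff ℝ C∞ u) (l : List E) :
    ContDiff ℝ C∞ (dIter l u) := by
  induction l with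
  | nil => exact hu
  | cons w l ih => exact (ih.fderiv_right (by simp)).clm_apply contDiff_const

theorem dIter_perm {u : E → F} (hu : ContDiff ℝ C∞ u) {l l' : List E} (h : l.Perm l') :
    dIter l u = dIter l' u := by
  induction h with
  | nil => rfl
  | cons x _ ih => simp only [dIter_cons, ih]
  | swap x y l =>
    have hg := hu.dIter l
    simp only [dIter_cons]
    ext z
    have hd : DifferentiableAt ℝ (fderiv ℝ (dIter l u)) z :=
      ((hg.fderiv_right (m := C∞) (by simp)).differentiable (by simp)).differentiableAt
    have key : ∀ a b : E, fderiv ℝ (fun z => fderiv ℝ (dIter l u) z a) z b =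
        fderiv ℝ (fderiv ℝ (dIter l u)) z b a := fun a b => by
      rw [fderiv_clm_apply hd (differentiableAt_const a)]
      simp
    rw [key, key]
    exact (hg.contDiffAt.isSymmSndFDerivAt (by
      rw [minSmoothness_of_isRCLikeNormedField]; exact WithTop.coe_le_coe.2 (le_top : (2 : ℕ∞) ≤ ⊤))).eq _ _
  | trans _ _ ih1 ih2 => rw [ih1, ih2]

theorem dIter_eq_iteratedFDeriv {u : E → F} (hu : ContDiff ℝ C∞ u) (l : List E) (x : E) :
    dIter l u x = iteratedFDeriv ℝ l.length u x l.get := by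
  induction l generalizing x with
  | nil => simp
  | cons w l ih =>
    have h1 : DifferentiableAt ℝ (iteratedFDeriv ℝ l.length u) x :=
      (hu.differentiable_iteratedFDeriv (by exact_mod_cast WithTop.coe_lt_top _)).differentiableAt
    have h2 : dIter l u = fun x => ContinuousMultilinearMap.apply ℝ (fun _ : Fin l.length => E) F
        l.get (iteratedFDeriv ℝ l.length u x) := by
      ext x; simp [ih]
    rw [dIter_cons, h2]
    have h3 := ((ContinuousMultilinearMap.apply ℝ (fun _ : Fin l.length => E) F
        l.get).hasFDerivAt.comp x h1.hasFDerivAt).fderiv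
    rw [show (fun x => ContinuousMultilinearMap.apply ℝ (fun _ : Fin l.length => E) F
        l.get (iteratedFDeriv ℝ l.length u x)) = (ContinuousMultilinearMap.apply ℝ (fun _ : Fin l.length => E) F
        l.get) ∘ (iteratedFDeriv ℝ l.length u) from rfl]
    simp only [h3]
    simp only [List.length_cons]
    rw [iteratedFDeriv_succ_apply_left]
    rfl

theorem dIter_clm {u : E → F} (hu : ContDiff ℝ C∞ u) (L : F →L[ℝ] G) (l : List E) :
    dIter l (fun x => L (u x)) = fun x => L (dIter l u x) := by
  induction l with
  | nil => rfl
  | cons w l ih =>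
    rw [dIter_cons, ih]
    ext x
    have := (L.hasFDerivAt.comp x (((hu.dIter l).differentiable (by simp)).differentiableAt
      (x := x)).hasFDerivAt).fderiv
    rw [show (fun x => L (dIter l u x)) = L ∘ dIter l u from rfl, this]
    rfl

theorem dIter_comp_clm {u : F → G} (hu : ContDiff ℝ C∞ u) (L : E →L[ℝ] F) (c : F) (l : List E) :
    dIter l (fun x => u (c + L x)) = fun x => dIter (l.map L) u (c + L x) := by
  induction l with
  | nil => rfl
  | cons w l ih =>
    rw [dIter_cons, ih]
    ext x
    have := ((((hu.dIter (l.map L)).differentiable (by simp)).differentiableAt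
      (x := c + L x)).hasFDerivAt.comp x (L.hasFDerivAt.const_add c)).fderiv
    rw [show (fun x => dIter (l.map L) u (c + L x)) = dIter (l.map L) u ∘ (fun x => c + L x)
      from rfl, this]
    rfl

theorem UBdd.of_dIter {β : Type*} [Fintype β] {S : ι → Set E} (e : β → E) (c : β → E →L[ℝ] ℝ)
    (hec : ∀ v, v = ∑ b, c b v • e b) {u : ι → E → F} (hu : ∀ i, ContDiff ℝ C∞ (u i))
    (h : ∀ l : List β, ∃ C : ℝ, ∀ i, ∀ x ∈ S i, ‖dIter (l.map e) (u i) x‖ ≤ C) : UBdd S u := by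
  refine ⟨fun i x _ => (hu i).contDiffAt, fun k => ?_⟩
  induction k generalizing u with
  | zero => simpa using h []
  | succ k ih =>
    have h1 : ∀ b : β, ∃ C : ℝ, ∀ i, ∀ x ∈ S i, ‖iteratedFDeriv ℝ k (dIter [e b] (u i)) x‖ ≤ C := by
      intro b
      refine ih (fun i => (hu i).dIter _) fun l => ?_
      obtain ⟨C, hC⟩ := h (l ++ [b])
      refine ⟨C, fun i x hx => ?_⟩
      have := hC i x hx
      rwa [List.map_append, dIter_append] at this
    choose C hC using h1
    refine ⟨∑ b, ‖smulRightL ℝ E F (c b)‖ * C b, fun i x hx => ?_⟩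
    rw [← norm_iteratedFDeriv_fderiv]
    have h2 : fderiv ℝ (u i) = fun x => ∑ b, smulRightL ℝ E F (c b) (dIter [e b] (u i) x) := by
      ext x v
      conv_lhs => rw [hec v]
      simp
    rw [h2, iteratedFDeriv_fun_sum_apply]
    · refine (norm_sum_le _ _).trans (sum_le_sum fun b _ => ?_)
      have h3 := (smulRightL ℝ E F (c b)).iteratedFDeriv_comp_left
        (((hu i).dIter [e b]).contDiffAt (x := x)) (i := k) (by exact_mod_cast le_top)
      rw [show (fun x => smulRightL ℝ E F (c b) (dIter [e b] (u i) x)) = (smulRightL ℝ E F (c b)) ∘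
        (dIter [e b] (u i)) from rfl, h3]
      refine (ContinuousLinearMap.norm_compContinuousMultilinearMap_le _ _).trans ?_
      gcongr
      exact hC b i x hx
    · intro b _
      exact (((smulRightL ℝ E F (c b)).contDiff.comp
        ((hu i).dIter [e b])).of_le (by exact_mod_cast le_top)).contDiffAt

theorem ContDiff.iteratedFDeriv_param {f : P × E → F} (hf : ContDiff ℝ C∞ f) (l : ℕ) : ContDiff ℝ C∞
    (fun z : P × E => iteratedFDeriv ℝ l (fun x => f (z.1, x)) z.2) := by
  induction l with
  | zero =>
    have : (fun z : P × E => iteratedFDeriv ℝ 0 (fun x => f (z.1, x)) z.2) =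
        fun z => (continuousMultilinearCurryFin0 ℝ E F).symm (f z) := by
      ext z; simp
    rw [this]
    exact (continuousMultilinearCurryFin0 ℝ E F).symm.contDiff.comp hf
  | succ l ih =>
    simp only [iteratedFDeriv_succ_eq_comp_left, Function.comp_def]
    have hJ : ContDiff ℝ C∞ (fun L : E →L[ℝ] E [×l]→L[ℝ] F =>
        ((continuousMultilinearCurryLeftEquiv ℝ (fun _ : Fin (l + 1) => E) F).symm L :
          E [×(l + 1)]→L[ℝ] F)) := by
      exact LinearIsometryEquiv.contDiff (𝕜 := ℝ) (E := E →L[ℝ] E [×l]→L[ℝ] F)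
        (F := E [×(l + 1)]→L[ℝ] F) (continuousMultilinearCurryLeftEquiv ℝ
        (fun _ : Fin (l + 1) => E) F).symm
    refine hJ.comp ?_
    refine ContDiff.fderiv (m := (C∞ : WithTop ℕ∞)) (f := fun z : P × E => iteratedFDeriv ℝ l (fun x => f (z.1, x)))
      (g := fun z => z.2) ?_ contDiff_snd (by simp)
    have : uncurry (fun z : P × E => iteratedFDeriv ℝ l (fun x => f (z.1, x))) =
      (fun z : P × E => iteratedFDeriv ℝ l (fun x => f (z.1, x)) z.2) ∘
        fun q : (P × E) × E => (q.1.1, q.2) := rfl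
    rw [this]
    exact ih.comp (by fun_prop)

end DIter

include ha in
theorem SymbolClass.norm_dIter_le (k l : ℕ) : ∃ C : ℝ, 0 ≤ C ∧ ∀ (vs ws : List (Rn n)) (r : ℝ), 0 ≤
    r → vs.length = k → ws.length = l → (∀ v ∈ vs, ‖v‖ ≤ r) → (∀ w ∈ ws, ‖w‖ ≤ 1) → ∀ x ξ, ‖dIter
    (vs.map (fun v => ((0 : Rn n), v)) ++ ws.map (fun w => (w, (0 : Rn n))))
    (fun z : ℝ²ⁿ n => a z.1 z.2) (x, ξ)‖ ≤ C * r ^ k * (1 + ‖ξ‖ ^ 2) ^ ((m - (k : ℝ)) / 2) := by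
  obtain ⟨C, hC⟩ := ha.2 k l
  refine ⟨max C 0, le_max_right _ _, fun vs ws r hr hk hl hvs hws x ξ => ?_⟩
  subst hk hl
  set A : ℝ²ⁿ n → ℂ := fun z => a z.1 z.2 with hA
  have hAs : ContDiff ℝ C∞ A := ha.1
  have hAsw : ContDiff ℝ C∞ (fun z : ℝ²ⁿ n => A (z.2, z.1)) := hAs.comp (by fun_prop)
  have e1 : ∀ x ξ, dIter (ws.map (fun w => (w, (0 : Rn n)))) A (x, ξ) =
      ContinuousMultilinearMap.apply ℝ (fun _ : Fin ws.length => Rn n) ℂ ws.get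
        (iteratedFDeriv ℝ ws.length (fun x' => a x' ξ) x) := by
    intro x ξ
    have h1 := congrFun (dIter_comp_clm hAs (inl ℝ (Rn n) (Rn n)) (0, ξ) ws) x
    have h2 := dIter_eq_iteratedFDeriv (u := fun x' => a x' ξ)
      (hAs.comp (f := fun x' => (x', ξ)) (by fun_prop)) ws x
    simp only [ContinuousMultilinearMap.apply_apply]
    rw [← h2]
    have hw : ws.map (inl ℝ (Rn n) (Rn n)) = ws.map (fun w => (w, (0 : Rn n))) := rfl
    rw [hw] at h1
    simpa [hA] using h1.symm
  have hgs : ContDiff ℝ C∞ (fun ξ => iteratedFDeriv ℝ ws.length (fun x' => a x' ξ) x) :=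
    (hAsw.iteratedFDeriv_param ws.length).comp (f := fun ξ => (ξ, x)) (by fun_prop)
  have e2 : dIter (vs.map (fun v => ((0 : Rn n), v)) ++ ws.map (fun w => (w, (0 : Rn n)))) A (x, ξ) =
      (iteratedFDeriv ℝ vs.length (fun ξ => iteratedFDeriv ℝ ws.length (fun x' => a x' ξ) x) ξ
        vs.get) ws.get := by
    rw [dIter_append]
    have h1 := congrFun (dIter_comp_clm (hAs.dIter (ws.map (fun w => (w, (0 : Rn n)))))
      (inr ℝ (Rn n) (Rn n)) (x, 0) vs) ξ
    have h3 := congrFun (dIter_clm hgs (ContinuousMultilinearMap.apply ℝ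
      (fun _ : Fin ws.length => Rn n) ℂ ws.get) vs) ξ
    rw [dIter_eq_iteratedFDeriv hgs, ContinuousMultilinearMap.apply_apply] at h3
    rw [← h3]
    simp only [← e1]
    have hw : vs.map (inr ℝ (Rn n) (Rn n)) = vs.map (fun w => ((0 : Rn n), w)) := rfl
    rw [hw] at h1
    simpa using h1.symm
  rw [e2]
  have hprod : ∀ (us : List (Rn n)) (r : ℝ), (∀ u ∈ us, ‖u‖ ≤ r) →
      ∏ i, ‖us.get i‖ ≤ r ^ us.length := by
    intro us r h
    calc ∏ i, ‖us.get i‖ ≤ ∏ i : Fin us.length, r :=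
          Finset.prod_le_prod (fun _ _ => norm_nonneg _) fun i _ => h _ (us.get_mem i)
      _ = r ^ us.length := by simp
  refine (ContinuousMultilinearMap.le_opNorm _ _).trans ?_
  refine (mul_le_mul (ContinuousMultilinearMap.le_opNorm _ _) (hprod ws 1 hws)
    (Finset.prod_nonneg fun _ _ => norm_nonneg _) (by positivity)).trans ?_
  rw [one_pow, mul_one]
  refine (mul_le_mul (hC x ξ) (hprod vs r hvs) (Finset.prod_nonneg fun _ _ => norm_nonneg _)
    ((norm_nonneg _).trans (hC x ξ))).trans ?_
  have : C ≤ max C 0 := le_max_left _ _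
  calc C * (1 + ‖ξ‖ ^ 2) ^ ((m - (vs.length : ℝ)) / 2) * r ^ vs.length
      ≤ max C 0 * (1 + ‖ξ‖ ^ 2) ^ ((m - (vs.length : ℝ)) / 2) * r ^ vs.length := by gcongr
    _ = _ := by ring

theorem exists_perm_map_inr_append_map_inl {α β γ : Type*} (l : List (α ⊕ β)) : ∃ (vs : List β)
    (ws : List α), ∀ f : α ⊕ β → γ, (l.map f).Perm
    (vs.map (fun b => f (Sum.inr b)) ++ ws.map (fun a => f (Sum.inl a))) := by
  induction l with
  | nil => exact ⟨[], [], fun f => by simp⟩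
  | cons c l ih =>
    obtain ⟨vs, ws, h⟩ := ih
    rcases c with a | b
    · refine ⟨vs, a :: ws, fun f => ?_⟩
      simp only [List.map_cons]
      exact ((h f).cons _).trans List.perm_middle.symm
    · exact ⟨b :: vs, ws, fun f => by simpa using h f⟩

theorem Real.rpow_le_rpow_abs_of_mem_Icc {t B q : ℝ} (hB : 0 < B) (h1 : B⁻¹ ≤ t) (h2 : t ≤ B) :
    t ^ q ≤ B ^ |q| := by
  have ht : 0 < t := (inv_pos.2 hB).trans_le h1
  rcases le_total 0 q with h | h
  · rw [abs_of_nonneg h]; exact Real.rpow_le_rpow ht.le h2 h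
  · rw [abs_of_nonpos h, rpow_neg hB.le, ← Real.inv_rpow hB.le]
    exact Real.rpow_le_rpow_of_nonpos (inv_pos.2 hB) h1 h

include ha in
theorem SymbolClass.ubdd_scaled : UBdd
    (fun _ : {r : ℝ // 1 ≤ r} => {z : ℝ²ⁿ n | 1 / 8 ≤ ‖z.2‖ ∧ ‖z.2‖ ≤ 8})
    (fun r z => (r : ℝ) ^ (-m) • a z.1 ((r : ℝ) • z.2)) := by
  have hA : ContDiff ℝ C∞ (fun z : ℝ²ⁿ n => a z.1 z.2) := ha.1
  let Λ : ℝ → (ℝ²ⁿ n →L[ℝ] ℝ²ⁿ n) := fun r => (fst ℝ (Rn n) (Rn n)).prod (r • snd ℝ (Rn n) (Rn n))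
  have hu : ∀ r : {r : ℝ // 1 ≤ r}, ContDiff ℝ C∞
      (fun z : ℝ²ⁿ n => a z.1 ((r : ℝ) • z.2)) := fun r =>
    hA.comp (f := fun z : ℝ²ⁿ n => (z.1, (r : ℝ) • z.2)) (by fun_prop)
  let e : Fin n ⊕ Fin n → ℝ²ⁿ n := Sum.elim (fun i => (single i 1, 0)) (fun i => (0, single i 1))
  let c : Fin n ⊕ Fin n → ℝ²ⁿ n →L[ℝ] ℝ := Sum.elim
    (fun i => (EuclideanSpace.proj i).comp (fst ℝ (Rn n) (Rn n)))
    (fun i => (EuclideanSpace.proj i).comp (snd ℝ (Rn n) (Rn n)))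
  refine UBdd.of_dIter e c ?_ (fun r => (hu r).const_smul _) ?_
  · rintro ⟨v, w⟩
    have hb : ∀ v : Rn n, v = ∑ i, v i • single i (1 : ℝ) := fun v => by
      ext j; simp [Finset.sum_apply, Pi.single_apply]
    have e1 : ∀ v : Rn n, ∑ i, v i • ((single i (1 : ℝ), (0 : Rn n)) : ℝ²ⁿ n)
        = (v, 0) := fun v => by
      conv_rhs => rw [hb v]
      simp [Prod.ext_iff, Prod.fst_sum, Prod.snd_sum]
    have e2 : ∀ v : Rn n, ∑ i, v i • (((0 : Rn n), single i (1 : ℝ)) : ℝ²ⁿ n)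
        = (0, v) := fun v => by
      conv_rhs => rw [hb v]
      simp [Prod.ext_iff, Prod.fst_sum, Prod.snd_sum]
    rw [Fintype.sum_sum_type]
    exact ((congrArg₂ (· + ·) (e1 v) (e2 w)).trans (by simp)).symm
  · intro l
    obtain ⟨vs, ws, hl⟩ := exists_perm_map_inr_append_map_inl (γ := ℝ²ⁿ n) l
    obtain ⟨C, hC0, hC⟩ := ha.norm_dIter_le vs.length ws.length
    set q : ℝ := (m - (vs.length : ℝ)) / 2 with hq
    refine ⟨C * 65 ^ |q|, fun r z hz => ?_⟩
    obtain ⟨r, hr⟩ := r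
    have hr0 : 0 < r := by linarith
    have h1 := congrFun (dIter_clm (hu ⟨r, hr⟩) (r ^ (-m) • clmId ℝ ℂ) (l.map e)) z
    simp only [smul_apply, id_apply] at h1
    have h2 := congrFun (dIter_comp_clm hA (Λ r) 0 (l.map e)) z
    simp only [zero_add] at h2
    have h3 : dIter (l.map e) (fun z : ℝ²ⁿ n => a z.1 (r • z.2)) z =
        dIter ((vs.map fun i => r • single i (1 : ℝ)).map
          (fun v => ((0 : Rn n), v)) ++ (ws.map fun i => single i (1 : ℝ)).map
          (fun w => (w, (0 : Rn n)))) (fun z : ℝ²ⁿ n => a z.1 z.2) (z.1, r • z.2) := by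
      refine h2.trans ?_
      rw [List.map_map, dIter_perm hA (hl (Λ r ∘ e))]
      simp only [List.map_map]
      congr 1
      congr 1
      congr 1
      · ext i : 1
        simp [Λ, e]
    have h4 := hC (vs.map fun i => r • single i (1 : ℝ))
      (ws.map fun i => single i (1 : ℝ)) r hr0.le (by simp) (by simp)
      (by
        intro v hv
        obtain ⟨i, _, rfl⟩ := List.mem_map.1 hv
        rw [norm_smul]; simp [abs_of_pos hr0])
      (by
        intro v hv
        obtain ⟨i, _, rfl⟩ := List.mem_map.1 hv
        simp) z.1 (r • z.2)
    rw [← h3] at h4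
    change ‖dIter (l.map e) (fun z : ℝ²ⁿ n => r ^ (-m) • a z.1 (r • z.2)) z‖ ≤ _
    rw [h1, norm_smul, norm_of_nonneg (rpow_nonneg hr0.le _)]
    refine (mul_le_mul_of_nonneg_left h4 (rpow_nonneg hr0.le _)).trans ?_
    rw [norm_smul, norm_of_nonneg hr0.le]
    have hz1 : 1 / 8 ≤ ‖z.2‖ := hz.1
    have hz2 : ‖z.2‖ ≤ 8 := hz.2
    have hsplit : 1 + (r * ‖z.2‖) ^ 2 = r ^ 2 * ((1 + (r * ‖z.2‖) ^ 2) / r ^ 2) := by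
      field_simp
    have ht : ((1 + (r * ‖z.2‖) ^ 2) / r ^ 2) ^ q ≤ 65 ^ |q| := by
      apply Real.rpow_le_rpow_abs_of_mem_Icc (by norm_num)
      · rw [le_div_iff₀ (by positivity), mul_pow]
        nlinarith [mul_le_mul hz1 hz1 (by norm_num) (norm_nonneg z.2), sq_nonneg r]
      · rw [div_le_iff₀ (by positivity), mul_pow]
        nlinarith [mul_le_mul hz2 hz2 (norm_nonneg z.2) (by norm_num), sq_nonneg r]
    rw [hsplit, mul_rpow (by positivity) (by positivity)]
    have hr2 : (r ^ 2) ^ q = r ^ (m - (vs.length : ℝ)) := by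
      rw [← rpow_natCast, ← rpow_mul hr0.le]; congr 1; rw [hq]; push_cast; ring
    have hr3 : r ^ (-m) * r ^ vs.length * r ^ (m - (vs.length : ℝ)) = 1 := by
      rw [← rpow_natCast, ← rpow_add hr0, ← rpow_add hr0]
      simp
    rw [hr2]
    calc r ^ (-m) * (C * r ^ vs.length * (r ^ (m - (vs.length : ℝ)) *
          ((1 + (r * ‖z.2‖) ^ 2) / r ^ 2) ^ q))
        = (r ^ (-m) * r ^ vs.length * r ^ (m - (vs.length : ℝ))) *
          (C * ((1 + (r * ‖z.2‖) ^ 2) / r ^ 2) ^ q) := by ring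
      _ ≤ C * 65 ^ |q| := by rw [hr3, one_mul]; gcongr

section Taylor

theorem UBdd.of_fderiv_of_zero {R : ℝ} (hR : 0 < R) {u u' : ι → E → F} {f' : ι → E → E →L[ℝ] F}
    (h0 : ∀ i, u i 0 = 0) (hs : ∀ i, ∀ x ∈ ball (0 : E) R, ContDiffAt ℝ C∞ (u i) x)
    (hd : ∀ i, ∀ x ∈ ball (0 : E) R, HasFDerivAt (u i) (f' i x) x)
    (hf' : UBdd (fun _ => ball (0 : E) R) f') : UBdd (fun _ => ball (0 : E) R) u := by
  have hfd : ∀ i, ∀ x ∈ ball (0 : E) R, fderiv ℝ (u i) x = f' i x :=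
    fun i x hx => (hd i x hx).fderiv
  obtain ⟨C, hC0, hC⟩ := hf'.norm_le
  refine UBdd.of_fderiv ⟨C * R, fun i x hx => ?_⟩ hs (hf'.congr fun i x hx => ?_)
  · have h1 := (convex_ball (0 : E) R).norm_image_sub_le_of_norm_hasFDerivWithin_le
      (f := u i) (f' := f' i) (C := C) (x := 0) (y := x)
      (fun z hz => (hd i z hz).hasFDerivWithinAt) (fun z hz => hC i z hz)
      (Metric.mem_ball_self hR) hx
    rw [h0, sub_zero, sub_zero] at h1
    refine h1.trans ?_
    have : ‖x‖ < R := by simpa using hx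
    gcongr
  · filter_upwards [Metric.isOpen_ball.mem_nhds hx] with y hy using hfd i y hy

variable {S : ι → Set E} {f : ι → E → F}

theorem UBdd.taylor_one (hf : UBdd S f) {R : ℝ} (hR : 0 < R) (c : ι → E) (ε : ι → ℝ)
    (hε0 : ∀ i, 0 < ε i) (hε1 : ∀ i, ε i ≤ 1)
    (hS : ∀ i, ∀ v ∈ ball (0 : E) R, c i + ε i • v ∈ S i) : UBdd (fun _ => ball (0 : E) R)
    (fun i v => (ε i)⁻¹ • (f i (c i + ε i • v) - f i (c i))) := by
  have hL : ∀ i, ‖ε i • clmId ℝ E‖ ≤ 1 * 1 := fun i => by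
    rw [norm_smul, norm_of_nonneg (hε0 i).le]
    exact mul_le_mul (hε1 i) norm_id_le (norm_nonneg _) zero_le_one
  have haff : ∀ i x, HasFDerivAt (fun v : E => c i + ε i • v) (ε i • clmId ℝ E) x :=
    fun i x => ((hasFDerivAt_id x).const_smul (ε i)).const_add (c i)
  refine UBdd.of_fderiv_of_zero (u' := f) hR (f' := fun i v => fderiv ℝ (f i) (c i + ε i • v))
    (fun i => by simp) (fun i x hx => ?_) (fun i x hx => ?_) ?_
  · have h1 : ContDiffAt ℝ C∞ (fun v : E => f i (c i + ε i • v)) x :=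
      ContDiffAt.comp x (f := fun v : E => c i + ε i • v) (hf.smooth i _ (hS i x hx)) (by fun_prop)
    exact (h1.sub contDiffAt_const).const_smul _
  · have h1 := ((((hf.smooth i _ (hS i x hx)).differentiableAt (by simp)).hasFDerivAt.comp x
      (haff i x)).sub_const (f i (c i))).const_smul (ε i)⁻¹
    refine h1.congr_fderiv ?_
    ext w
    simp only [smul_apply, ContinuousLinearMap.comp_apply, id_apply,
      map_smul, smul_smul, inv_mul_cancel₀ (hε0 i).ne', one_smul]
  · exact hf.fderiv.comp_affine c (fun i => ε i • clmId ℝ E) hL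
      (fun i x hx => by simpa using hS i x hx)

theorem UBdd.taylor_two (hf : UBdd S f) {R : ℝ} (hR : 0 < R) (c : ι → E) (ε : ι → ℝ)
    (hε0 : ∀ i, 0 < ε i) (hε1 : ∀ i, ε i ≤ 1)
    (hS : ∀ i, ∀ v ∈ ball (0 : E) R, c i + ε i • v ∈ S i) : UBdd (fun _ => ball (0 : E) R) (fun i v
    => ((ε i) ^ 2)⁻¹ • (f i (c i + ε i • v) - f i (c i) - ε i • fderiv ℝ (f i) (c i) v)) :=
    by
  have haff : ∀ i x, HasFDerivAt (fun v : E => c i + ε i • v) (ε i • clmId ℝ E) x :=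
    fun i x => ((hasFDerivAt_id x).const_smul (ε i)).const_add (c i)
  refine UBdd.of_fderiv_of_zero (u' := f) hR (fun i => by simp) (fun i x hx => ?_)
    (fun i x hx => ?_) (hf.fderiv.taylor_one hR c ε hε0 hε1 hS)
  · have h1 : ContDiffAt ℝ C∞ (fun v : E => f i (c i + ε i • v)) x :=
      ContDiffAt.comp x (f := fun v : E => c i + ε i • v) (hf.smooth i _ (hS i x hx)) (by fun_prop)
    exact ((h1.sub contDiffAt_const).sub
      ((fderiv ℝ (f i) (c i)).contDiff.contDiffAt.const_smul _)).const_smul _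
  · have h1 := (((((hf.smooth i _ (hS i x hx)).differentiableAt (by simp)).hasFDerivAt.comp x
      (haff i x)).sub_const (f i (c i))).sub
      ((fderiv ℝ (f i) (c i)).hasFDerivAt.const_smul (ε i))).const_smul ((ε i) ^ 2)⁻¹
    refine h1.congr_fderiv ?_
    ext w
    have := (hε0 i).ne'
    simp only [smul_apply, sub_apply, ContinuousLinearMap.comp_apply, id_apply,
      map_smul, ← smul_sub, smul_smul]
    congr 1
    field_simp

end Taylor

include hφ in
theorem PhaseSmoothHomog.contDiffAt {z : ℝ²ⁿ n} (hz : z.2 ≠ 0) :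
    ContDiffAt ℝ C∞ (fun p : ℝ²ⁿ n => φ p.1 p.2) z :=
  hφ.1.contDiffAt ((isOpen_ne_fun continuous_snd continuous_const).mem_nhds hz)

include hφ in
theorem PhaseSmoothHomog.contDiffAt_right (x : Rn n) {w : Rn n} (hw : w ≠ 0) : ContDiffAt ℝ C∞ (φ x)
    w :=
  ContDiffAt.comp w (f := fun w => (x, w)) (hφ.contDiffAt (z := (x, w)) hw) (by fun_prop)

include hφ in
theorem PhaseSmoothHomog.contDiffAt_left (x : Rn n) {w : Rn n} (hw : w ≠ 0) : ContDiffAt ℝ C∞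
    (fun x => φ x w) x :=
  ContDiffAt.comp x (f := fun x => (x, w)) (hφ.contDiffAt (z := (x, w)) hw) (by fun_prop)

/-- The gradient of the phase in the frequency variable. -/
def gradPhase (φ : Rn n → Rn n → ℝ) (x w : Rn n) : Rn n :=
  (InnerProductSpace.toDual ℝ (Rn n)).symm (fderiv ℝ (φ x) w)

theorem inner_gradPhase (x w v : Rn n) : ⟪gradPhase φ x w, v⟫_ℝ = fderiv ℝ (φ x) w v := by
  simp [gradPhase]

include hφ in
theorem PhaseSmoothHomog.gradPhase_smul (x w : Rn n) {t : ℝ} (ht : 0 < t) : gradPhase φ x (t • w) =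
    gradPhase φ x w := by
  unfold gradPhase
  congr 1
  have h1 : (fun w => φ x (t • w)) = fun w => t • φ x w := by
    ext w; simp [hφ.2 x w t ht]
  have h2 : fderiv ℝ (fun w => φ x (t • w)) w = t • fderiv ℝ (φ x) (t • w) := fderiv_comp_smul t
  have h3 : fderiv ℝ (fun w => t • φ x w) w = t • fderiv ℝ (φ x) w :=
    congrFun (fderiv_const_smul_field (f := φ x) t) w
  rw [h1, h3] at h2
  exact (smul_right_injective _ ht.ne' h2).symm

include hφ in
theorem PhaseSmoothHomog.inner_gradPhase_self (x : Rn n) {w : Rn n} (hw : w ≠ 0) : ⟪gradPhase φ x w,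
    w⟫_ℝ = φ x w := by
  rw [inner_gradPhase]
  have h1 : HasDerivAt (fun t : ℝ => φ x (t • w)) (fderiv ℝ (φ x) w w) 1 := by
    have hd : DifferentiableAt ℝ (φ x) ((1 : ℝ) • w) := by
      rw [one_smul]; exact (hφ.contDiffAt_right x hw).differentiableAt (by simp)
    have h2 := hd.hasFDerivAt.comp_hasDerivAt (1 : ℝ) ((hasDerivAt_id (1 : ℝ)).smul_const w)
    rw [one_smul] at h2
    simpa using! h2
  have h2 : HasDerivAt (fun t : ℝ => φ x (t • w)) (φ x w) 1 := by
    have h3 := (hasDerivAt_id (1 : ℝ)).mul_const (φ x w)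
    rw [one_mul] at h3
    refine h3.congr_of_eventuallyEq ?_
    filter_upwards [lt_mem_nhds (zero_lt_one' ℝ)] with t ht using hφ.2 x w t ht
  exact h1.unique h2

include hφ in
theorem PhaseSmoothHomog.contDiffAt_gradPhase {z : ℝ²ⁿ n} (hz : z.2 ≠ 0) : ContDiffAt ℝ C∞
    (fun p : ℝ²ⁿ n => gradPhase φ p.1 p.2) z := by
  refine (InnerProductSpace.toDual ℝ (Rn n)).symm.contDiff.contDiffAt.comp z ?_
  refine ContDiffAt.fderiv (m := (C∞ : WithTop ℕ∞)) (n := (C∞ : WithTop ℕ∞))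
    (f := fun p : ℝ²ⁿ n => φ p.1) (g := fun p => p.2) ?_ contDiffAt_snd (by simp)
  exact ContDiffAt.comp (z, z.2) (f := fun q : (ℝ²ⁿ n) × Rn n => (q.1.1, q.2))
    (hφ.contDiffAt (z := (z.1, z.2)) hz) (by fun_prop)

/-- The self-adjoint map which is the identity on `ℝω` and multiplies `ω^⊥` by `ε`. -/
def squeeze (ω : Rn n) (ε : ℝ) : Rn n →L[ℝ] Rn n :=
  ε • clmId ℝ (Rn n) + (1 - ε) • (innerSL ℝ ω).smulRight ω

theorem squeeze_apply (ω : Rn n) (ε : ℝ) (ζ : Rn n) :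
    squeeze ω ε ζ = ε • ζ + ((1 - ε) * ⟪ω, ζ⟫_ℝ) • ω := by
  simp [squeeze, smul_smul]

theorem inner_squeeze (ω : Rn n) (ε : ℝ) (u v : Rn n) :
    ⟪squeeze ω ε u, v⟫_ℝ = ⟪u, squeeze ω ε v⟫_ℝ := by
  simp only [squeeze_apply, inner_add_left, inner_add_right, real_inner_smul_left,
    real_inner_smul_right, real_inner_comm ω u]
  ring

include hn in
theorem det_squeeze {ω : Rn n} (hω : ‖ω‖ = 1) {ε : ℝ} (hε : 0 < ε) :
    LinearMap.det (squeeze ω ε : Rn n →ₗ[ℝ] Rn n) = ε ^ (n - 1) := by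
  have h1 : (squeeze ω ε : Rn n →ₗ[ℝ] Rn n) = ε • transvection
      ((innerSL ℝ ω : Rn n →L[ℝ] ℝ) : Rn n →ₗ[ℝ] ℝ) (((1 - ε) / ε) • ω) := by
    ext1 ζ
    simp only [coe_coe, squeeze_apply, LinearMap.smul_apply,
      transvection.apply, innerSL_apply_apply, smul_add, smul_smul]
    congr 2
    field_simp
  rw [h1, LinearMap.det_smul, transvection.det]
  simp only [coe_coe, innerSL_apply_apply, real_inner_smul_right,
    real_inner_self_eq_norm_sq, hω, finrank_euclideanSpace, Fintype.card_fin]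
  obtain ⟨k, rfl⟩ : ∃ k, n = k + 1 := ⟨n - 1, by omega⟩
  rw [pow_succ, Nat.add_sub_cancel]
  field_simp
  ring

theorem norm_squeeze_le {ω : Rn n} (hω : ‖ω‖ = 1) {ε : ℝ} (hε : 0 < ε) (hε1 : ε ≤ 1) :
    ‖squeeze ω ε‖ ≤ 1 := by
  refine opNorm_le_bound _ zero_le_one fun ζ => ?_
  rw [squeeze_apply]
  have h1 : |⟪ω, ζ⟫_ℝ| ≤ ‖ζ‖ := by simpa [hω] using abs_real_inner_le_norm ω ζ
  calc _ ≤ ‖ε • ζ‖ + ‖((1 - ε) * ⟪ω, ζ⟫_ℝ) • ω‖ := norm_add_le _ _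
    _ = ε * ‖ζ‖ + (1 - ε) * |⟪ω, ζ⟫_ℝ| := by
      rw [norm_smul, norm_smul, hω, norm_of_nonneg hε.le, norm_eq_abs, abs_mul,
        abs_of_nonneg (by linarith : 0 ≤ 1 - ε), mul_one]
    _ ≤ ε * ‖ζ‖ + (1 - ε) * ‖ζ‖ := by
      have : 0 ≤ 1 - ε := by linarith
      gcongr
    _ = 1 * ‖ζ‖ := by ring

theorem norm_squeeze_apply_le {ω : Rn n} (hω : ‖ω‖ = 1) {ε : ℝ} (hε : 0 < ε) (hε1 : ε ≤ 1)
    (u : Rn n) : ‖squeeze ω ε u‖ ≤ |⟪u, ω⟫_ℝ| + ε * ‖u‖ := by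
  rw [squeeze_apply, real_inner_comm]
  calc _ ≤ ‖ε • u‖ + ‖((1 - ε) * ⟪u, ω⟫_ℝ) • ω‖ := norm_add_le _ _
    _ = ε * ‖u‖ + (1 - ε) * |⟪u, ω⟫_ℝ| := by
      rw [norm_smul, norm_smul, hω, norm_of_nonneg hε.le, norm_eq_abs, abs_mul,
        abs_of_nonneg (by linarith : 0 ≤ 1 - ε), mul_one]
    _ ≤ _ := by nlinarith [abs_nonneg ⟪u, ω⟫_ℝ]

theorem le_two_mul_norm_squeeze_apply {ω : Rn n} (hω : ‖ω‖ = 1) {ε : ℝ} (hε : 0 < ε) (hε1 : ε ≤ 1)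
    (u : Rn n) : |⟪u, ω⟫_ℝ| + ε * ‖u‖ ≤ 2 * ‖squeeze ω ε u‖ := by
  have h1 : |⟪u, ω⟫_ℝ| ≤ ‖squeeze ω ε u‖ := by
    have h2 : ⟪squeeze ω ε u, ω⟫_ℝ = ⟪u, ω⟫_ℝ := by
      rw [inner_squeeze, squeeze_apply, real_inner_self_eq_norm_sq, hω, ← add_smul]
      simp
    rw [← h2]
    simpa [hω] using abs_real_inner_le_norm (squeeze ω ε u) ω
  have h3 : ε * ‖u‖ ≤ ‖squeeze ω ε u‖ := by
    apply le_of_sq_le_sq _ (norm_nonneg _)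
    rw [← real_inner_self_eq_norm_sq (squeeze ω ε u), squeeze_apply]
    simp only [inner_add_left, inner_add_right, real_inner_smul_left, real_inner_smul_right,
      real_inner_self_eq_norm_sq, hω, real_inner_comm u ω, norm_smul, mul_pow, norm_eq_abs,
      sq_abs, one_pow]
    nlinarith [mul_nonneg (mul_nonneg hε.le (by linarith : 0 ≤ 1 - ε)) (sq_nonneg ⟪u, ω⟫_ℝ),
      sq_nonneg ((1 - ε) * ⟪u, ω⟫_ℝ)]
  linarith

/-- The squeezing map as a continuous linear equivalence. -/
def squeezeEquiv (hn : 1 ≤ n) {ω : Rn n} (hω : ‖ω‖ = 1) {ε : ℝ} (hε : 0 < ε) : Rn n ≃L[ℝ] Rn n :=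
  (LinearMap.equivOfDetNeZero (squeeze ω ε : Rn n →ₗ[ℝ] Rn n)
    (by rw [det_squeeze hn hω hε]; positivity)).toContinuousLinearEquiv

include hn in
theorem coe_squeezeEquiv {ω : Rn n} (hω : ‖ω‖ = 1) {ε : ℝ} (hε : 0 < ε) :
    ⇑(squeezeEquiv hn hω hε) = squeeze ω ε := rfl

include hn in
theorem map_squeeze {ω : Rn n} (hω : ‖ω‖ = 1) {ε : ℝ} (hε : 0 < ε) : Measure.map (squeeze ω ε)
    (volume : Measure (Rn n)) = ofR (ε ^ (n - 1))⁻¹ • volume := by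
  have hdet := det_squeeze hn hω hε
  have h := Measure.map_linearMap_addHaar_eq_smul_addHaar (μ := (volume : Measure (Rn n)))
    (f := (squeeze ω ε : Rn n →ₗ[ℝ] Rn n)) (by rw [hdet]; positivity)
  rw [hdet, abs_of_pos (by positivity)] at h
  exact h

theorem integral_eq_integral_comp_squeeze (hn : 1 ≤ n) {ω : Rn n} (hω : ‖ω‖ = 1) {ε : ℝ}
    (hε : 0 < ε) (g : Rn n → F) : ∫ η, g η = ε ^ (n - 1) • ∫ ζ, g (squeeze ω ε ζ) := by
  have h1 : MeasurableEmbedding (squeeze ω ε) := by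
    rw [← coe_squeezeEquiv hn hω hε]
    exact (squeezeEquiv hn hω hε).toHomeomorph.measurableEmbedding
  rw [← h1.integral_map, map_squeeze hn hω hε, integral_smul_measure,
    ENNReal.toReal_ofReal (by positivity), smul_smul, mul_inv_cancel₀ (by positivity), one_smul]

include hn in
theorem lintegral_eq_lintegral_comp_squeeze {ω : Rn n} (hω : ‖ω‖ = 1) {ε : ℝ} (hε : 0 < ε)
    (g : Rn n → ℝ≥0∞) : ∫⁻ ζ, g (squeeze ω ε ζ) = ofR (ε ^ (n - 1))⁻¹ * ∫⁻ η, g η := by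
  have h1 : MeasurableEmbedding (squeeze ω ε) := by
    rw [← coe_squeezeEquiv hn hω hε]
    exact (squeezeEquiv hn hω hε).toHomeomorph.measurableEmbedding
  rw [← h1.lintegral_map, map_squeeze hn hω hε, lintegral_smul_measure, smul_eq_mul]

section Wedge

/-- The region in squeezed coordinates which carries the localized amplitudes. -/
def wedge (ω : Rn n) : Set (Rn n) := {ζ | 1 / 8 ≤ ⟪ω, ζ⟫_ℝ ∧ ⟪ω, ζ⟫_ℝ ≤ 8 ∧ ‖ζ - ⟪ω, ζ⟫_ℝ • ω‖ ≤ 1}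

theorem isClosed_wedge (ω : Rn n) : IsClosed (wedge ω) := by
  have h1 : Continuous fun ζ : Rn n => ⟪ω, ζ⟫_ℝ := by fun_prop
  have h2 : Continuous fun ζ : Rn n => ‖ζ - ⟪ω, ζ⟫_ℝ • ω‖ := by fun_prop
  exact (isClosed_le continuous_const h1).inter
    ((isClosed_le h1 continuous_const).inter (isClosed_le h2 continuous_const))

theorem wedge_subset {ω : Rn n} (hω : ‖ω‖ = 1) : wedge ω ⊆ closedBall 0 9 := by
  rintro ζ ⟨h1, h2, h3⟩
  rw [mem_closedBall_zero_iff]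
  calc ‖ζ‖ = ‖(ζ - ⟪ω, ζ⟫_ℝ • ω) + ⟪ω, ζ⟫_ℝ • ω‖ := by rw [sub_add_cancel]
    _ ≤ 1 + ‖⟪ω, ζ⟫_ℝ • ω‖ := (norm_add_le _ _).trans (by gcongr)
    _ ≤ 9 := by
      rw [norm_smul, hω, norm_of_nonneg (by linarith)]; linarith

theorem squeeze_eq_inner_smul_add (ω : Rn n) (ε : ℝ) (ζ : Rn n) :
    squeeze ω ε ζ = ⟪ω, ζ⟫_ℝ • ω + ε • (ζ - ⟪ω, ζ⟫_ℝ • ω) := by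
  rw [squeeze_apply, smul_sub, smul_smul, sub_mul, sub_smul, one_mul]
  abel

variable {κ : Type*} {ω : κ → Rn n} {ε : κ → ℝ}

theorem ubdd_wedge_id (hω : ∀ k, ‖ω k‖ = 1) : UBdd (fun k => wedge (ω k)) (fun _ ζ => ζ) :=
  (UBdd.of_isCompact (isCompact_closedBall (0 : Rn n) 9) fun _ _ => contDiffAt_id).mono
    fun k => wedge_subset (hω k)

theorem ubdd_wedge_clm (hω : ∀ k, ‖ω k‖ = 1) (L : κ → Rn n →L[ℝ] F) {C : ℝ} (hL : ∀ k, ‖L k‖ ≤ C) :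
    UBdd (fun k => wedge (ω k)) (fun k ζ => L k ζ) :=
  (ubdd_wedge_id hω).bilinear (ContinuousLinearMap.apply ℝ F) (UBdd.const (c := L) hL)

theorem ubdd_wedge_inner (hω : ∀ k, ‖ω k‖ = 1) :
    UBdd (fun k => wedge (ω k)) (fun k ζ => ⟪ω k, ζ⟫_ℝ) :=
  ubdd_wedge_clm hω (fun k => innerSL ℝ (ω k)) (C := 1) fun k => by simp [hω]

theorem ubdd_wedge_perp (hω : ∀ k, ‖ω k‖ = 1) :
    UBdd (fun k => wedge (ω k)) (fun k ζ => ζ - ⟪ω k, ζ⟫_ℝ • ω k) :=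
  (ubdd_wedge_id hω).sub ((ubdd_wedge_inner hω).smul
    (UBdd.const (c := ω) (C := 1) fun k => (hω k).le))

include hφ in
theorem ubdd_wedge_phase (hK : IsCompact K) {x : κ → Rn n} (hx : ∀ k, x k ∈ K) (hω : ∀ k, ‖ω k‖ = 1)
    (hε : ∀ k, 0 < ε k) (hε1 : ∀ k, ε k ≤ 1 / 64) : UBdd (fun k => wedge (ω k)) (fun k ζ => ((ε k) ^
    2)⁻¹ * (φ (x k) (squeeze (ω k) (ε k) ζ) - ⟪gradPhase φ (x k) (ω k), squeeze (ω k) (ε k) ζ⟫_ℝ))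
    := by
  let T : Set (Rn n) := {η | 1 / 2 ≤ ‖η‖ ∧ ‖η‖ ≤ 2}
  have hT : IsCompact T := by
    refine IsCompact.of_isClosed_subset (isCompact_closedBall (0 : Rn n) 2)
      ((isClosed_le continuous_const continuous_norm).inter
        (isClosed_le continuous_norm continuous_const)) fun η h => by simpa using h.2
  have hT0 : ∀ η ∈ T, η ≠ 0 := by
    rintro η h rfl
    have := h.1
    norm_num at this
  have hf : UBdd (fun _ : κ => T) (fun k => φ (x k)) :=
    UBdd.of_joint (f := fun p : ℝ²ⁿ n => φ p.1 p.2) (hK.prod hT)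
      (fun z hz => hφ.contDiffAt (hT0 _ hz.2)) x fun k η h => ⟨hx k, h⟩
  have hh := hf.taylor_two (R := 9) (by norm_num) ω ε hε (fun k => (hε1 k).trans (by norm_num))
    (fun k v hv => by
      have hv' : ‖v‖ < 9 := by simpa using hv
      have h1 : ‖ε k • v‖ ≤ 9 / 64 := by
        rw [norm_smul, norm_of_nonneg (hε k).le]
        nlinarith [norm_nonneg v, hε k, hε1 k]
      have h2 := norm_add_le (ω k) (ε k • v)
      have h3 := norm_sub_norm_le (ω k) (-(ε k • v))
      rw [sub_neg_eq_add, norm_neg] at h3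
      rw [hω] at h2 h3
      exact ⟨by linarith, by linarith⟩)
  have hr := ubdd_wedge_inner hω
  have hv : UBdd (fun k => wedge (ω k)) (fun k ζ => (⟪ω k, ζ⟫_ℝ)⁻¹ • (ζ - ⟪ω k, ζ⟫_ℝ • ω k)) :=
    (hr.inv (δ := 1 / 8) (by norm_num) fun k ζ h => h.1.trans (le_abs_self _)).smul
      (ubdd_wedge_perp hω)
  have hmain := hr.mul (hh.comp' hv fun k ζ h => by
    obtain ⟨h1, h2, h3⟩ := h
    have h0 : 0 < ⟪ω k, ζ⟫_ℝ := by linarith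
    rw [mem_ball_zero_iff, norm_smul, norm_inv, norm_of_nonneg h0.le]
    have : (⟪ω k, ζ⟫_ℝ)⁻¹ ≤ 8 := by
      rw [inv_le_comm₀ h0 (by norm_num)]; norm_num at h1 ⊢; exact h1
    nlinarith [norm_nonneg (ζ - ⟪ω k, ζ⟫_ℝ • ω k)])
  refine hmain.congr fun k ζ hζ => ?_
  have hpos : ∀ᶠ ζ' in nhds ζ, 0 < ⟪ω k, ζ'⟫_ℝ :=
    (by fun_prop : Continuous fun ζ' => ⟪ω k, ζ'⟫_ℝ).continuousAt.eventually_mem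
      (Ioi_mem_nhds (by have := hζ.1; linarith))
  filter_upwards [hpos] with ζ' hr0
  have hw0 : ω k ≠ 0 := by
    intro h; have := hω k; rw [h] at this; simp at this
  set r := ⟪ω k, ζ'⟫_ℝ with hr_def
  have e1 : squeeze (ω k) (ε k) ζ' = r • (ω k + ε k • (r⁻¹ • (ζ' - r • ω k))) := by
    rw [squeeze_eq_inner_smul_add, ← hr_def, smul_add, smul_comm (ε k) r⁻¹, smul_smul r r⁻¹,
      mul_inv_cancel₀ hr0.ne', one_smul]
  rw [e1, hφ.2 _ _ _ hr0, real_inner_smul_right, inner_add_right, real_inner_smul_right,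
    hφ.inner_gradPhase_self _ hw0, inner_gradPhase]
  simp only [smul_eq_mul]
  ring

/-- The Euclidean norm as a phase. -/
theorem phaseSmoothHomog_norm : PhaseSmoothHomog n (fun _ ξ => ‖ξ‖) := by
  refine ⟨fun z hz => ?_, fun x ξ t ht => by
    change ‖t • ξ‖ = t * ‖ξ‖
    rw [norm_smul, norm_of_nonneg ht.le]⟩
  exact (contDiffAt_snd.norm ℝ hz).contDiffWithinAt

theorem inner_gradPhase_norm (x : Rn n) {w : Rn n} (hw : ‖w‖ = 1) (v : Rn n) :
    ⟪gradPhase (fun _ ξ => ‖ξ‖) x w, v⟫_ℝ = ⟪w, v⟫_ℝ := by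
  rw [inner_gradPhase]
  have hw0 : w ≠ 0 := by rintro rfl; simp at hw
  have h1 := ((contDiffAt_norm ℝ (n := 1) hw0).differentiableAt (by simp)).hasFDerivAt.pow 2
  have h2 := (hasStrictFDerivAt_norm_sq w).hasFDerivAt
  have h3 := DFunLike.congr_fun (h1.unique h2) v
  simp [hw] at h3
  linarith

theorem ubdd_wedge_norm (hω : ∀ k, ‖ω k‖ = 1) (hε : ∀ k, 0 < ε k) (hε1 : ∀ k, ε k ≤ 1 / 64) : UBdd
    (fun k => wedge (ω k))
    (fun k ζ => ((ε k) ^ 2)⁻¹ * (‖squeeze (ω k) (ε k) ζ‖ - ⟪ω k, squeeze (ω k) (ε k) ζ⟫_ℝ)) := by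
  have := ubdd_wedge_phase (κ := κ) phaseSmoothHomog_norm (isCompact_singleton (x := (0 : Rn n)))
    (x := fun _ => 0) (by simp) hω hε hε1
  simpa only [inner_gradPhase_norm _ (hω _)] using this

theorem le_norm_squeeze {ω : Rn n} (hω : ‖ω‖ = 1) (ε : ℝ) {ζ : Rn n} :
    |⟪ω, ζ⟫_ℝ| ≤ ‖squeeze ω ε ζ‖ := by
  have h2 : ⟪squeeze ω ε ζ, ω⟫_ℝ = ⟪ω, ζ⟫_ℝ := by
    rw [inner_squeeze, squeeze_apply, real_inner_self_eq_norm_sq, hω, ← add_smul, real_inner_comm]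
    simp
  rw [← h2]
  simpa [hω] using abs_real_inner_le_norm (squeeze ω ε ζ) ω

theorem ubdd_wedge_norm_squeeze (hω : ∀ k, ‖ω k‖ = 1) (hε : ∀ k, 0 < ε k) (hε1 : ∀ k, ε k ≤ 1 / 64)
    :
    UBdd (fun k => wedge (ω k)) (fun k ζ => ‖squeeze (ω k) (ε k) ζ‖) := by
  have hT : IsCompact {η : Rn n | 1 / 8 ≤ ‖η‖ ∧ ‖η‖ ≤ 9} := by
    refine IsCompact.of_isClosed_subset (isCompact_closedBall (0 : Rn n) 9)
      ((isClosed_le continuous_const continuous_norm).inter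
        (isClosed_le continuous_norm continuous_const)) fun η h => by simpa using h.2
  have h1 : UBdd (fun _ : κ => {η : Rn n | 1 / 8 ≤ ‖η‖ ∧ ‖η‖ ≤ 9}) (fun _ η => ‖η‖) :=
    UBdd.of_isCompact hT fun η hη => contDiffAt_norm ℝ (by
      rintro rfl; have := hη.1; norm_num at this)
  refine h1.comp_clm (fun k => squeeze (ω k) (ε k))
    (fun k => norm_squeeze_le (hω k) (hε k) ((hε1 k).trans (by norm_num))) fun k ζ hζ => ?_
  refine ⟨(hζ.1.trans (le_abs_self _)).trans (le_norm_squeeze (hω k) _), ?_⟩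
  have h2 : ‖ζ‖ ≤ 9 := by simpa using wedge_subset (hω k) hζ
  calc _ ≤ 1 * ‖ζ‖ := (squeeze (ω k) (ε k)).le_of_opNorm_le
        (norm_squeeze_le (hω k) (hε k) ((hε1 k).trans (by norm_num))) ζ
    _ ≤ 9 := by linarith

theorem ubdd_wedge_displacement (hω : ∀ k, ‖ω k‖ = 1) (hε : ∀ k, 0 < ε k) (hε1 : ∀ k, ε k ≤ 1 / 64)
    {t : κ → ℝ} (ht : ∀ k, |t k - 1| ≤ 4 * ε k) : UBdd (fun k => wedge (ω k))
    (fun k ζ => (ε k)⁻¹ • (‖squeeze (ω k) (ε k) ζ‖ • (t k • ω k) - squeeze (ω k) (ε k) ζ)) := by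
  have hωc : UBdd (fun k => wedge (ω k)) (fun k _ => ω k) :=
    UBdd.const (c := ω) (C := 1) fun k => (hω k).le
  have h1 : UBdd (fun k => wedge (ω k)) (fun k _ => (ε k)⁻¹ * (t k - 1)) :=
    UBdd.const (c := fun k => (ε k)⁻¹ * (t k - 1)) (C := 4) fun k => by
      rw [norm_mul, norm_inv, norm_of_nonneg (hε k).le, norm_eq_abs, inv_mul_le_iff₀ (hε k)]
      linarith [ht k]
  have h2 : UBdd (fun k => wedge (ω k)) (fun k _ => ε k) := UBdd.const (c := ε) (C := 1) fun k => by
      rw [norm_of_nonneg (hε k).le]; linarith [hε1 k]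
  have := (((h1.mul (ubdd_wedge_norm_squeeze hω hε hε1)).smul hωc).add
    ((h2.mul (ubdd_wedge_norm hω hε hε1)).smul hωc)).sub (ubdd_wedge_perp hω)
  convert this using 3 with k ζ
  have hi : ⟪ω k, squeeze (ω k) (ε k) ζ⟫_ℝ = ⟪ω k, ζ⟫_ℝ := by
    rw [← inner_squeeze, squeeze_apply, real_inner_self_eq_norm_sq, hω, ← add_smul]
    simp
  rw [hi]
  have e1 := squeeze_eq_inner_smul_add (ω k) (ε k) ζ
  have h0 := (hε k).ne'
  set N := ‖squeeze (ω k) (ε k) ζ‖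
  rw [e1, smul_sub, smul_add, smul_smul (ε k)⁻¹ (ε k), inv_mul_cancel₀ h0, one_smul,
    smul_smul, smul_smul, smul_smul, ← sub_sub]
  congr 1
  rw [← sub_smul, ← add_smul]
  congr 1
  field_simp
  ring

end Wedge

/-- The angular resolution at frequency `lam`. -/
def width (lam : ℝ) : ℝ := (64 * √lam)⁻¹

theorem width_pos {lam : ℝ} (h : 1 ≤ lam) : 0 < width lam := by
  unfold width; positivity

theorem width_le {lam : ℝ} (h : 1 ≤ lam) : width lam ≤ 1 / 64 := by
  have : 1 ≤ √lam := Real.one_le_sqrt.mpr h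
  rw [width, inv_le_comm₀ (by positivity) (by norm_num)]
  norm_num; linarith

theorem mul_width_sq {lam : ℝ} (h : 1 ≤ lam) : lam * width lam ^ 2 = 1 / 4096 := by
  rw [width, inv_pow, mul_pow, Real.sq_sqrt (by linarith)]
  field_simp
  norm_num

/-- The frequency annulus carrying the rescaled amplitudes. -/
def annulus (n : ℕ) : Set (Rn n) := {η | 1 / 4 ≤ ‖η‖ ∧ ‖η‖ ≤ 4}

/-- The determinant of the mixed Hessian, as the Jacobian of `x ↦ ∇_ξ φ(x, w)`. -/
def mixedDet (φ : Rn n → Rn n → ℝ) (x w : Rn n) : ℝ := (fderiv ℝ (fun x' => gradPhase φ x' w) x).det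

/-- The mixed Hessian of `φ` is invertible over `Q`, away from the zero frequency. -/
abbrev MixedNonDeg (φ : Rn n → Rn n → ℝ) (Q : Set (Rn n)) : Prop :=
  ∀ x ∈ Q, ∀ w : Rn n, w ≠ 0 → mixedDet φ x w ≠ 0

/-- Uniform boundedness of families supported in `Q` times the frequency annulus. -/
abbrev ShellUBdd (Q : Set (Rn n)) (b : ι → ℝ²ⁿ n → ℂ) : Prop := SuppUBdd (fun _ => Q ×ˢ annulus n) b

theorem isCompact_annulus : IsCompact (annulus n) := by
  refine IsCompact.of_isClosed_subset (isCompact_closedBall (0 : Rn n) 4)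
    ((isClosed_le continuous_const continuous_norm).inter
      (isClosed_le continuous_norm continuous_const)) fun η h => by simpa using h.2

theorem ne_zero_of_mem_annulus {η : Rn n} (h : η ∈ annulus n) : η ≠ 0 := by
  rintro rfl
  have := h.1
  norm_num at this

/-- The kernel of the oscillatory integral operator with amplitude `b` and phase `φ`. -/
def oscKernel (φ : Rn n → Rn n → ℝ) (b : ℝ²ⁿ n → ℂ) (lam : ℝ) (x y : Rn n) : ℂ :=
  ∫ η, b (x, η) * 𝐞(lam * (φ x η - ⟪y, η⟫_ℝ))

/-- The neighbourhood of the unit sphere carrying the wave-packet directions. -/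
def shell (n : ℕ) (ε : ℝ) : Set (Rn n) := {w | |‖w‖ - 1| ≤ 6 * ε}

theorem isClosed_shell (ε : ℝ) : IsClosed (shell n ε) := isClosed_le (by fun_prop) continuous_const

/-- The anisotropic size of `u` relative to the direction `w`. -/
def aniso (ε : ℝ) (w u : Rn n) : ℝ := |⟪w, u⟫_ℝ| + ε * ‖u‖

theorem aniso_nonneg {ε : ℝ} (hε : 0 ≤ ε) (w u : Rn n) : 0 ≤ aniso ε w u := by
  unfold aniso; positivity

/-- The size of a wave packet with direction `w`. -/
def packet (φ : Rn n → Rn n → ℝ) (lam r : ℝ) (x y w : Rn n) : ℝ :=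
  (1 + lam * aniso (width lam) w (gradPhase φ x w - y)) ^ (-r)

theorem packet_nonneg (φ : Rn n → Rn n → ℝ) {lam : ℝ} (hl : 1 ≤ lam) (r : ℝ) (x y w : Rn n) :
    0 ≤ packet φ lam r x y w := by
  have := aniso_nonneg (width_pos hl).le w (gradPhase φ x w - y)
  unfold packet; positivity

/-- A smooth approximate unit. -/
def mollifier (n : ℕ) : Rn n → ℝ :=
  (⟨1 / 2, 1, by norm_num, by norm_num⟩ : ContDiffBump (0 : Rn n)).normed volume

theorem contDiff_mollifier : ContDiff ℝ C∞ (mollifier n) := ContDiffBump.contDiff_normed _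

theorem mollifier_eq_zero {u : Rn n} (hu : 1 ≤ ‖u‖) : mollifier n u = 0 := by
  have h := (⟨1 / 2, 1, by norm_num, by norm_num⟩ : ContDiffBump (0 : Rn n)).support_normed_eq
    (μ := volume)
  by_contra h0
  have h1 : u ∈ ball (0 : Rn n) 1 := by rw [← h]; exact h0
  rw [mem_ball_zero_iff] at h1
  linarith

theorem integral_mollifier_dilate {ε : ℝ} (hε : 0 < ε) {η : Rn n} (hη : η ≠ 0) :
    ‖η‖ ^ n * ∫ w, mollifier n (ε⁻¹ • (‖η‖ • w - η)) = ε ^ n := by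
  have h1 : ∀ w, mollifier n (ε⁻¹ • (‖η‖ • w - η)) =
      (fun v => mollifier n (v - ε⁻¹ • η)) ((ε⁻¹ * ‖η‖) • w) := fun w => by
    simp only [smul_sub, smul_smul]
  have h0 : 0 < ‖η‖ := norm_pos_iff.mpr hη
  rw [integral_congr_ae (.of_forall h1),
    integral_comp_smul volume (fun v => mollifier n (v - ε⁻¹ • η)), integral_sub_right_eq_self, mollifier,
    ContDiffBump.integral_normed, finrank_euclideanSpace_fin, abs_of_nonneg (by positivity)]
  rw [mul_pow, inv_pow, smul_eq_mul]
  field_simp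

theorem mem_wedge_of_norm_lt {ω : Rn n} (hω : ‖ω‖ = 1) {ε t : ℝ} (hε : 0 < ε) (hε1 : ε ≤ 1 / 64)
    (ht : |t - 1| ≤ 4 * ε) {ζ : Rn n} (hA : squeeze ω ε ζ ∈ annulus n)
    (h : ‖ε⁻¹ • (‖squeeze ω ε ζ‖ • (t • ω) - squeeze ω ε ζ)‖ < 1) : ζ ∈ wedge ω := by
  obtain ⟨hA1, hA2⟩ := hA
  set N := ‖squeeze ω ε ζ‖ with hN
  set r := ⟪ω, ζ⟫_ℝ with hr
  rw [abs_le] at ht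
  have h1 : ‖N • (t • ω) - squeeze ω ε ζ‖ < ε := by
    rw [norm_smul, norm_inv, norm_of_nonneg hε.le, inv_mul_lt_iff₀ hε, mul_one] at h
    exact h
  have hωω : ⟪ω, ω⟫_ℝ = 1 := by rw [real_inner_self_eq_norm_sq, hω, one_pow]
  have hp : ⟪ω, ζ - r • ω⟫_ℝ = 0 := by
    rw [inner_sub_right, real_inner_smul_right, hωω, hr]; ring
  have e1 : N • (t • ω) - squeeze ω ε ζ = (N * t - r) • ω - ε • (ζ - r • ω) := by
    rw [squeeze_eq_inner_smul_add, sub_smul, smul_smul, ← hr, sub_sub]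
  have h2 : |N * t - r| < ε := by
    have : ⟪ω, N • (t • ω) - squeeze ω ε ζ⟫_ℝ = N * t - r := by
      rw [e1, inner_sub_right, real_inner_smul_right, real_inner_smul_right, hp, hωω]; ring
    rw [← this]
    refine lt_of_le_of_lt (abs_real_inner_le_norm _ _) ?_
    rwa [hω, one_mul]
  have h3 : ‖ε • (ζ - r • ω)‖ < ε := by
    refine lt_of_le_of_lt ?_ h1
    have : ‖N • (t • ω) - squeeze ω ε ζ‖ ^ 2 = (N * t - r) ^ 2 + ‖ε • (ζ - r • ω)‖ ^ 2 := by
      rw [e1, ← real_inner_self_eq_norm_sq, ← real_inner_self_eq_norm_sq]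
      have hp' : ⟪ζ - r • ω, ω⟫_ℝ = 0 := by rw [real_inner_comm]; exact hp
      simp only [inner_sub_left (_ • ω), inner_sub_right _ (_ • ω), real_inner_smul_left,
        real_inner_smul_right, hp, hp', hωω]
      ring
    refine (sq_le_sq₀ (norm_nonneg _) (norm_nonneg _)).mp ?_
    rw [this]
    nlinarith [sq_nonneg (N * t - r)]
  rw [norm_smul, norm_of_nonneg hε.le] at h3
  rw [abs_lt] at h2
  refine ⟨?_, ?_, ?_⟩
  · nlinarith
  · nlinarith
  · exact (lt_of_mul_lt_mul_left (h3.trans_eq (mul_one ε).symm) hε.le).le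

theorem mem_shell_of_mollifier_ne_zero {ε : ℝ} (hε : 0 < ε) {η w : Rn n} (hη : η ∈ annulus n)
    (h : mollifier n (ε⁻¹ • (‖η‖ • w - η)) ≠ 0) : |‖w‖ - 1| ≤ 4 * ε := by
  have h1 : ‖ε⁻¹ • (‖η‖ • w - η)‖ < 1 := by
    by_contra h'; exact h (mollifier_eq_zero (not_lt.mp h'))
  rw [norm_smul, norm_inv, norm_of_nonneg hε.le, inv_mul_lt_iff₀ hε, mul_one] at h1
  have h2 := abs_norm_sub_norm_le (‖η‖ • w) η
  rw [norm_smul, norm_norm] at h2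
  have h3 : ‖η‖ * ‖w‖ - ‖η‖ = ‖η‖ * (‖w‖ - 1) := by ring
  rw [h3, abs_mul, abs_norm] at h2
  have := hη.1
  nlinarith [abs_nonneg (‖w‖ - 1)]

variable {H : Rn n → ℂ} (hnd : MixedNonDeg φ Q) (hb : ShellUBdd Q b)

/-- The oscillating amplitude of the kernel. -/
def oscAmp (φ : Rn n → Rn n → ℝ) (b : ℝ²ⁿ n → ℂ) (lam : ℝ) (z : ℝ²ⁿ n) : ℂ :=
  b z * 𝐞(lam * φ z.1 z.2)

theorem oscKernel_eq (φ : Rn n → Rn n → ℝ) (b : ℝ²ⁿ n → ℂ) (lam : ℝ) (x y : Rn n) : oscKernel φ b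
    lam x y = ∫ η, oscAmp φ b lam (x, η) * 𝐞⁻(lam * ⟪y, η⟫_ℝ) := by
  unfold oscKernel oscAmp
  refine integral_congr_ae (.of_forall fun η => ?_)
  simp only
  rw [mul_assoc, ← exp_add]
  congr 2
  push_cast
  ring

include hφ hQ hb in
theorem SuppUBdd.amp (lam : ℝ) : ShellUBdd Q (fun i => oscAmp φ (b i) lam) :=
  hb.mul (UBdd.exp_I (UBdd.of_isCompact (f := fun z : ℝ²ⁿ n => lam * φ z.1 z.2)
    (hQ.prod isCompact_annulus) fun _ hz =>
      contDiffAt_const.mul (hφ.contDiffAt (ne_zero_of_mem_annulus hz.2))))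

theorem norm_cexp_I_mul (t : ℝ) : ‖cexp (I * (t : ℂ))‖ = 1 := by
  rw [mul_comm]; exact Complex.norm_exp_ofReal_mul_I t

theorem norm_cexp_neg_I_mul (t : ℝ) : ‖cexp (-(I * (t : ℂ)))‖ = 1 := by
  rw [← mul_neg, ← Complex.ofReal_neg]; exact norm_cexp_I_mul _

/-- The localized integrand. -/
def localized (φ : Rn n → Rn n → ℝ) (b : ℝ²ⁿ n → ℂ) (lam : ℝ) (x y w η : Rn n) : ℂ :=
  b (x, η) * ((‖η‖ ^ n * mollifier n ((width lam)⁻¹ • (‖η‖ • w - η)) : ℝ) : ℂ) *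
    𝐞(lam * (φ x η - ⟪y, η⟫_ℝ))

include hφ hQ hb in
theorem smul_oscKernel_eq (i : ι) {lam : ℝ} (hl : 1 ≤ lam) (x y : Rn n) :
    (width lam) ^ n • oscKernel φ (b i) lam x y = ∫ w, ∫ η, localized φ (b i) lam x y w η := by
  have hε := width_pos hl
  have hε1 := width_le hl
  set ε := width lam with hεdef
  have hamp := (hb.amp hφ hQ lam).contDiff i
  have hF : ∀ w η, localized φ (b i) lam x y w η = oscAmp φ (b i) lam (x, η) * 𝐞⁻(lam * ⟪y, η⟫_ℝ) *
      ((‖η‖ ^ n * mollifier n (ε⁻¹ • (‖η‖ • w - η)) : ℝ) : ℂ) := fun w η => by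
    unfold localized oscAmp
    rw [mul_right_comm, mul_assoc (b i (x, η)) (𝐞(lam * φ x η)), ← exp_add]
    congr 3
    push_cast
    ring
  have hcont : Continuous (uncurry fun η w => localized φ (b i) lam x y w η) := by
    have h1 := hamp.continuous
    have h2 := (contDiff_mollifier (n := n)).continuous
    simp only [hF]
    unfold uncurry
    fun_prop
  have hcs : HasCompactSupport (uncurry fun η w => localized φ (b i) lam x y w η) := by
    refine HasCompactSupport.intro
      (isCompact_annulus.prod (isCompact_closedBall (0 : Rn n) 2)) fun z hz => ?_
    rcases z with ⟨η, w⟩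
    by_contra h0
    have h0' : localized φ (b i) lam x y w η ≠ 0 := h0
    unfold localized at h0'
    have hη : η ∈ annulus n := by
      by_contra hη
      exact h0' (by rw [hb.eq_zero i (x, η) fun h => hη h.2]; simp)
    have hm : mollifier n (ε⁻¹ • (‖η‖ • w - η)) ≠ 0 := fun h => h0' (by rw [← hεdef, h]; simp)
    have h2 := mem_shell_of_mollifier_ne_zero hε hη hm
    refine hz ⟨hη, ?_⟩
    rw [abs_le] at h2
    rw [mem_closedBall_zero_iff]
    linarith
  rw [← integral_integral_swap_of_hasCompactSupport hcont hcs, oscKernel_eq, ← integral_smul]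
  refine integral_congr_ae (.of_forall fun η => ?_)
  simp only [hF]
  by_cases hη : η = 0
  · have : b i (x, η) = 0 := hb.eq_zero i _ fun h => ne_zero_of_mem_annulus h.2 hη
    simp [oscAmp, this]
  rw [integral_const_mul, integral_complex_ofReal, integral_const_mul,
    integral_mollifier_dilate hε hη, Complex.real_smul]
  ring

include hb in
theorem integral_localized_eq_zero (i : ι) {lam : ℝ} (hl : 1 ≤ lam) (x y : Rn n) {w : Rn n}
    (hw : ¬ (x ∈ Q ∧ |‖w‖ - 1| ≤ 4 * width lam)) : ∫ η, localized φ (b i) lam x y w η = 0 := by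
  have : ∀ η, localized φ (b i) lam x y w η = 0 := fun η => by
    by_contra h0
    unfold localized at h0
    have hη : (x, η) ∈ Q ×ˢ annulus n := by
      by_contra hη
      exact h0 (by rw [hb.eq_zero i (x, η) hη]; simp)
    have hm : mollifier n ((width lam)⁻¹ • (‖η‖ • w - η)) ≠ 0 := fun h => h0 (by rw [h]; simp)
    exact hw ⟨hη.1, mem_shell_of_mollifier_ne_zero (width_pos hl) hη.2 hm⟩
  simp [this]

theorem norm_inv_smul_self {w : Rn n} (h : w ≠ 0) : ‖‖w‖⁻¹ • w‖ = 1 := by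
  rw [norm_smul, norm_inv, norm_norm, inv_mul_cancel₀ (norm_ne_zero_iff.mpr h)]

theorem UBdd.pow {S : ι → Set E}
    {c : ι → E → ℝ} (hc : UBdd S c) (m : ℕ) : UBdd S (fun i x => c i x ^ m) := by
  induction m with
  | zero => simpa using UBdd.const (S := S) (c := fun _ : ι => (1 : ℝ)) (C := 1) (by simp)
  | succ m ih => simpa only [pow_succ] using ih.mul hc

include hφ hQ hb in
theorem SuppUBdd.squeezed {κ : Type*} (r : κ → ι) {x ω : κ → Rn n} {ε t : κ → ℝ} (hx : ∀ k, x k ∈ Q)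
    (hω : ∀ k, ‖ω k‖ = 1) (hε : ∀ k, 0 < ε k) (hε1 : ∀ k, ε k ≤ 1 / 64)
    (ht : ∀ k, |t k - 1| ≤ 4 * ε k) : SuppUBdd (fun k => wedge (ω k)) (fun k ζ => b (r k) (x k,
    squeeze (ω k) (ε k) ζ) * ((‖squeeze (ω k) (ε k) ζ‖ ^ n * mollifier n ((ε k)⁻¹ • (‖squeeze (ω k)
    (ε k) ζ‖ • (t k • ω k) - squeeze (ω k) (ε k) ζ)) : ℝ) : ℂ) * cexp (I * ((1 / 4096 * ((ε k ^ 2)⁻¹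
    * (φ (x k) (squeeze (ω k) (ε k) ζ) - ⟪gradPhase φ (x k) (ω k), squeeze (ω k) (ε k) ζ⟫_ℝ)) : ℝ) :
    ℂ))) := by
  have h1 : UBdd (fun k => wedge (ω k)) (fun k ζ => b (r k) (x k, squeeze (ω k) (ε k) ζ)) :=
    (hb.univ.freeze_left r x (S := fun _ => Set.univ) (by simp)).comp_clm
      (fun k => squeeze (ω k) (ε k))
      (fun k => norm_squeeze_le (hω k) (hε k) ((hε1 k).trans (by norm_num))) (by simp)
  have hdisp := ubdd_wedge_displacement hω hε hε1 ht
  have hmol : UBdd (fun _ : κ => Set.univ) (fun _ => mollifier n) :=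
    SuppUBdd.univ (S := fun _ => closedBall (0 : Rn n) 1)
      ⟨UBdd.of_isCompact (isCompact_closedBall _ _) fun _ _ => contDiff_mollifier.contDiffAt,
        fun _ => Metric.isClosed_closedBall, fun _ x hx => mollifier_eq_zero
          (by rw [mem_closedBall_zero_iff] at hx; linarith)⟩
  have h2 := (((ubdd_wedge_norm_squeeze hω hε hε1).pow n).mul (hmol.comp' hdisp (by simp))).ofReal
  have h3 := ((UBdd.const (S := fun k => wedge (ω k)) (c := fun _ => (1 / 4096 : ℝ))
    (C := 1) (by intro k; norm_num)).mul (ubdd_wedge_phase hφ hQ hx hω hε hε1)).exp_I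
  refine ⟨(h1.mul h2).mul h3, fun k => isClosed_wedge _, fun k ζ hζ => ?_⟩
  by_contra h0
  refine hζ (mem_wedge_of_norm_lt (hω k) (hε k) (hε1 k) (ht k) ?_ ?_)
  · by_contra hA
    have hz : b (r k) (x k, squeeze (ω k) (ε k) ζ) = 0 := hb.eq_zero (r k) _ fun h => hA h.2
    exact h0 (by simp only [hz, zero_mul])
  · by_contra hA
    have hz := mollifier_eq_zero (not_lt.mp hA)
    exact h0 (by simp only [hz, mul_zero, Complex.ofReal_zero, zero_mul])

include hn hφ hQ hb in
theorem SuppUBdd.norm_integral_localized_le {lam : ι → ℝ} (hl : ∀ i, 1 ≤ lam i) (N : ℕ) : ∃ C : ℝ, 0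
    ≤ C ∧ ∀ i x y w, x ∈ Q →
      |‖w‖ - 1| ≤ 4 * width (lam i) → ‖∫ η, localized φ (b i) (lam i) x y w η‖ ≤
        C * width (lam i) ^ (n - 1) * packet φ (lam i) N x y w := by
  let κ : Type _ := {k : ι × ℝ²ⁿ n // k.2.1 ∈ Q ∧ |‖k.2.2‖ - 1| ≤ 4 * width (lam k.1)}
  let ω : κ → Rn n := fun k => ‖k.1.2.2‖⁻¹ • k.1.2.2
  let ε : κ → ℝ := fun k => width (lam k.1.1)
  have hε : ∀ k, 0 < ε k := fun k => width_pos (hl _)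
  have hε1 : ∀ k, ε k ≤ 1 / 64 := fun k => width_le (hl _)
  have hw : ∀ k : κ, 15 / 16 ≤ ‖k.1.2.2‖ ∧ ‖k.1.2.2‖ ≤ 17 / 16 := fun k => by
    have h1 : |‖k.1.2.2‖ - 1| ≤ 4 * ε k := k.2.2
    have h2 := hε1 k
    rw [abs_le] at h1
    constructor <;> linarith
  have hw0 : ∀ k : κ, k.1.2.2 ≠ 0 := fun k h => by
    have h1 := (hw k).1
    rw [h, norm_zero] at h1
    norm_num at h1
  have hω : ∀ k, ‖ω k‖ = 1 := fun k => norm_inv_smul_self (hw0 k)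
  have htω : ∀ k, ‖k.1.2.2‖ • ω k = k.1.2.2 := fun k => by
    rw [smul_smul, mul_inv_cancel₀ (norm_ne_zero_iff.mpr (hw0 k)), one_smul]
  obtain ⟨C, hC0, hC⟩ := (hb.squeezed hφ hQ (fun k : κ => k.1.1) (x := fun k => k.1.2.1)
    (t := fun k => ‖k.1.2.2‖) (fun k => k.2.1) hω hε hε1 fun k => k.2.2).fourier_decay
    (fun k => wedge_subset (hω k)) N
  refine ⟨C * 4 ^ N, by positivity, fun i x y w hx hwS => ?_⟩
  let k : κ := ⟨(i, x, w), hx, hwS⟩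
  have hlam := hl i
  set u := gradPhase φ x w - y with hu
  set τ := lam i • squeeze (ω k) (ε k) u with hτ
  have hgrad : gradPhase φ x (ω k) = gradPhase φ x w :=
    hφ.gradPhase_smul x w (inv_pos.mpr (norm_pos_iff.mpr (hw0 k)))
  have hCk := hC k τ
  have hlε : lam i = 1 / 4096 * ((ε k) ^ 2)⁻¹ := by
    have := mul_width_sq hlam
    have h0 := (hε k).ne'
    change lam i * ε k ^ 2 = _ at this
    field_simp
    linarith
  have hloc : ∀ ζ, localized φ (b i) (lam i) x y w (squeeze (ω k) (ε k) ζ) =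
      b i (x, squeeze (ω k) (ε k) ζ) * ((‖squeeze (ω k) (ε k) ζ‖ ^ n * mollifier n ((ε k)⁻¹ •
          (‖squeeze (ω k) (ε k) ζ‖ • (‖w‖ • ω k) - squeeze (ω k) (ε k) ζ)) : ℝ) : ℂ) *
        𝐞(1 / 4096 * ((ε k ^ 2)⁻¹ * (φ x (squeeze (ω k) (ε k) ζ) -
          ⟪gradPhase φ x (ω k), squeeze (ω k) (ε k) ζ⟫_ℝ))) *
        𝐞(⟪τ, ζ⟫_ℝ) := fun ζ => by
    have htω' : ‖w‖ • ω k = w := htω k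
    rw [localized, mul_assoc _ (cexp _) (cexp _), ← exp_add, ← mul_add,
      ← Complex.ofReal_add, htω', hτ, real_inner_smul_left, inner_squeeze, hgrad, hu,
      inner_sub_left]
    congr 4
    rw [← mul_assoc, ← hlε]
    ring
  have hJ : ∫ η, localized φ (b i) (lam i) x y w η =
      ε k ^ (n - 1) • ∫ ζ, localized φ (b i) (lam i) x y w (squeeze (ω k) (ε k) ζ) :=
    integral_eq_integral_comp_squeeze hn (hω k) (hε k) _
  simp_rw [hJ, hloc]
  rw [norm_smul, norm_of_nonneg (pow_nonneg (hε k).le _)]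
  have hτpos : 0 < (1 + ‖τ‖) ^ N := by positivity
  have haniso := aniso_nonneg (hε k).le w u
  have hcomp : 1 + lam i * aniso (ε k) w u ≤ 4 * (1 + ‖τ‖) := by
    have h1 := le_two_mul_norm_squeeze_apply (hω k) (hε k) ((hε1 k).trans (by norm_num)) u
    have h2 : |⟪w, u⟫_ℝ| ≤ 2 * |⟪u, ω k⟫_ℝ| := by
      have : ⟪w, u⟫_ℝ = ‖w‖ * ⟪u, ω k⟫_ℝ := by
        rw [real_inner_comm, ← real_inner_smul_right]
        exact congrArg (fun v => ⟪u, v⟫_ℝ) (htω k).symm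
      rw [this, abs_mul, abs_norm]
      have := (hw k).2
      change ‖w‖ ≤ 17 / 16 at this
      gcongr
      linarith
    have h3 : ‖τ‖ = lam i * ‖squeeze (ω k) (ε k) u‖ := by
      rw [hτ, norm_smul, norm_of_nonneg (by linarith)]
    have h4 : 0 ≤ ε k * ‖u‖ := mul_nonneg (hε k).le (norm_nonneg u)
    have h5 : aniso (ε k) w u ≤ 4 * ‖squeeze (ω k) (ε k) u‖ := by
      unfold aniso; linarith
    have := mul_le_mul_of_nonneg_left h5 (by linarith : 0 ≤ lam i)
    rw [h3]; linarith
  have hb0 : 0 < 1 + lam i * aniso (ε k) w u := by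
    have := mul_nonneg (zero_le_one.trans hlam) haniso; linarith
  have hpk : packet φ (lam i) N x y w = ((1 + lam i * aniso (ε k) w u) ^ N)⁻¹ := by
    rw [packet, rpow_neg hb0.le, rpow_natCast]
  rw [hpk]
  have hfin : C * ((1 + ‖τ‖) ^ N)⁻¹ ≤ C * 4 ^ N * ((1 + lam i * aniso (ε k) w u) ^ N)⁻¹ := by
    rw [mul_assoc]
    refine mul_le_mul_of_nonneg_left ?_ hC0
    rw [inv_le_comm₀ hτpos (by positivity), mul_inv, inv_inv]
    rw [inv_mul_le_iff₀ (by positivity), ← mul_pow]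
    exact pow_le_pow_left₀ hb0.le hcomp N
  have hI := (le_div_iff₀' hτpos).mpr hCk
  rw [div_eq_mul_inv] at hI
  calc _ ≤ ε k ^ (n - 1) * (C * 4 ^ N * ((1 + lam i * aniso (ε k) w u) ^ N)⁻¹) :=
        mul_le_mul_of_nonneg_left (hI.trans hfin) (pow_nonneg (hε k).le _)
    _ = C * 4 ^ N * ε k ^ (n - 1) * ((1 + lam i * aniso (ε k) w u) ^ N)⁻¹ := by ring

include hn hφ hQ hb in
theorem SuppUBdd.exists_enorm_oscKernel_le {lam : ι → ℝ} (hl : ∀ i, 1 ≤ lam i) (N : ℕ) : ∃ C : ℝ,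
    0 ≤ C ∧ ∀ i x y, ‖oscKernel φ (b i) (lam i) x y‖ₑ ≤ ofR (C * √(lam i)) * ∫⁻ w in shell n
    (width (lam i)), ofR (packet φ (lam i) N x y w) := by
  obtain ⟨C, hC0, hC⟩ := hb.norm_integral_localized_le hn hφ hQ hl N
  refine ⟨64 * C, by positivity, fun i x y => ?_⟩
  have hε := width_pos (hl i)
  have h1 := smul_oscKernel_eq hφ hQ hb i (hl i) x y
  have h2 : oscKernel φ (b i) (lam i) x y =
      (width (lam i) ^ n)⁻¹ • ∫ w, ∫ η, localized φ (b i) (lam i) x y w η := by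
    rw [← h1, smul_smul, inv_mul_cancel₀ (by positivity), one_smul]
  have h3 : ∀ w, ‖∫ η, localized φ (b i) (lam i) x y w η‖ₑ ≤
      (shell n (width (lam i))).indicator (fun w => ofR (C * width (lam i) ^ (n - 1)) *
        ofR (packet φ (lam i) N x y w)) w := fun w => by
    by_cases hw : x ∈ Q ∧ |‖w‖ - 1| ≤ 4 * width (lam i)
    · have hws : w ∈ shell n (width (lam i)) := hw.2.trans (by linarith)
      rw [indicator_of_mem hws, ← ofR_mul (by positivity), ← ofReal_norm]
      exact ofR_le_ofR (hC i x y w hw.1 hw.2)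
    · rw [integral_localized_eq_zero hb i (hl i) x y hw]
      simp
  have h4 : 64 * C * √(lam i) = (width (lam i) ^ n)⁻¹ * (C * width (lam i) ^ (n - 1)) := by
    obtain ⟨m, rfl⟩ : ∃ m, n = m + 1 := ⟨n - 1, by omega⟩
    have : 64 * √(lam i) = (width (lam i))⁻¹ := by rw [width, inv_inv]
    rw [Nat.add_sub_cancel, pow_succ, mul_right_comm, this]
    field_simp
  rw [h2, enorm_smul, h4, ofR_mul (by positivity), mul_assoc]
  have h5 : ‖(width (lam i) ^ n)⁻¹‖ₑ = ofR (width (lam i) ^ n)⁻¹ := by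
    rw [← ofReal_norm, norm_of_nonneg (by positivity)]
  rw [h5]
  gcongr
  calc _ ≤ ∫⁻ w, ‖∫ η, localized φ (b i) (lam i) x y w η‖ₑ := enorm_integral_le_lintegral_enorm _
    _ ≤ _ := lintegral_mono h3
    _ = _ := by
      rw [lintegral_indicator (isClosed_shell _).measurableSet, lintegral_const_mul']
      exact ofR_ne_top

theorem lintegral_comp_smul_Rn (g : Rn n → ℝ≥0∞) {R : ℝ} (hR : R ≠ 0) :
    ∫⁻ v, g (R • v) = ofR |(R ^ n)⁻¹| * ∫⁻ v, g v := by
  have h1 : MeasurableEmbedding fun v : Rn n => R • v :=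
    (Homeomorph.smulOfNeZero R hR).measurableEmbedding
  rw [← h1.lintegral_map g, Measure.map_addHaar_smul volume hR, lintegral_smul_measure,
    finrank_euclideanSpace_fin, smul_eq_mul]

include hφ in
theorem PhaseSmoothHomog.contDiffAt_gradPhase_left (x : Rn n) {w : Rn n} (hw : w ≠ 0) : ContDiffAt ℝ
    C∞ (fun x' => gradPhase φ x' w) x :=
  ContDiffAt.comp x (f := fun x' => (x', w)) (hφ.contDiffAt_gradPhase (z := (x, w)) hw)
    (by fun_prop)

include hφ in
theorem PhaseSmoothHomog.fderiv_gradPhase_left {x w : Rn n} (hw : w ≠ 0) : fderiv ℝ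
    (fun x' => gradPhase φ x' w) x = (fderiv ℝ (fun p : ℝ²ⁿ n => gradPhase φ p.1 p.2) (x, w)).comp
    (inl ℝ (Rn n) (Rn n)) := by
  have h1 := ((hφ.contDiffAt_gradPhase (z := (x, w)) hw).differentiableAt (by simp)).hasFDerivAt
  exact (HasFDerivAt.comp (g := fun p : ℝ²ⁿ n => gradPhase φ p.1 p.2)
    (f := fun x' : Rn n => (x', w)) x h1 (hasFDerivAt_prodMk_left (𝕜 := ℝ) x w)).fderiv

include hφ in
theorem PhaseSmoothHomog.continuousAt_mixedDet {z : ℝ²ⁿ n} (hz : z.2 ≠ 0) : ContinuousAt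
    (fun p : ℝ²ⁿ n => mixedDet φ p.1 p.2) z := by
  have h1 : ContinuousAt (fderiv ℝ (fun p : ℝ²ⁿ n => gradPhase φ p.1 p.2)) z :=
    ((hφ.contDiffAt_gradPhase hz).fderiv_right (m := 0) (by simp)).continuousAt
  have h2 : ContinuousAt (fun p : ℝ²ⁿ n => ((fderiv ℝ (fun p : ℝ²ⁿ n => gradPhase φ p.1 p.2) p).comp
        (inl ℝ (Rn n) (Rn n))).det) z :=
    ContinuousLinearMap.continuous_det.continuousAt.comp (h1.clm_comp continuousAt_const)
  refine h2.congr ?_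
  filter_upwards [(continuous_snd.continuousAt (x := z)).eventually_ne hz] with p hp
  rw [mixedDet, hφ.fderiv_gradPhase_left hp]

include hφ in
theorem PhaseSmoothHomog.mixedDet_smul (x w : Rn n) {t : ℝ} (ht : 0 < t) : mixedDet φ x (t • w) =
    mixedDet φ x w := by
  unfold mixedDet
  congr 2
  funext x'
  exact hφ.gradPhase_smul x' w ht

include hφ in
theorem PhaseSmoothHomog.mixedDet_ne_zero {x w : Rn n} (hw : w ≠ 0)
    (h : mixedHessianDet n φ x w ≠ 0) : mixedDet φ x w ≠ 0 := by
  have hd := (hφ.contDiffAt_gradPhase_left x hw).differentiableAt (by simp)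
  set D := fderiv ℝ (fun x' => gradPhase φ x' w) x with hD
  intro h0
  have h1 : ∃ v, v ≠ 0 ∧ D v = 0 := by
    have h2 := LinearMap.bot_lt_ker_of_det_eq_zero (f := (D : Rn n →ₗ[ℝ] Rn n)) h0
    obtain ⟨v, hv, hv0⟩ := (Submodule.ne_bot_iff _).mp h2.ne'
    exact ⟨v, hv0, hv⟩
  obtain ⟨v, hv0, hv⟩ := h1
  have hM : ∀ i k : Fin n, fderiv ℝ (fun x' => fderiv ℝ (fun ξ' => φ x' ξ') w
      (single k 1)) x (single i 1) =
      ⟪single k (1 : ℝ), D (single i 1)⟫_ℝ := fun i k => by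
    have e1 : (fun x' => fderiv ℝ (fun ξ' => φ x' ξ') w (single k 1)) =
        fun x' => innerSL ℝ (single k (1 : ℝ)) (gradPhase φ x' w) := by
      funext x'
      rw [innerSL_apply_apply, real_inner_comm, inner_gradPhase]
    have e5 : fderiv ℝ (fun x' => innerSL ℝ (single k (1 : ℝ))
        (gradPhase φ x' w)) x = (innerSL ℝ (single k (1 : ℝ))).comp D :=
      ((innerSL ℝ (single k (1 : ℝ))).hasFDerivAt.comp x hd.hasFDerivAt).fderiv
    rw [e1, e5]
    rfl
  refine h (Matrix.exists_vecMul_eq_zero_iff.mp ⟨v.ofLp, ?_, ?_⟩)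
  · intro h'; exact hv0 (by ext i; simpa using congrFun h' i)
  · funext k
    simp only [Matrix.vecMul, dotProduct, Matrix.of_apply, hM, Pi.zero_apply]
    have e2 : v = ∑ i, v i • single i (1 : ℝ) := by
      ext k
      simp [Pi.single_apply]
    have e3 : D v = ∑ i, v i • D (single i 1) := by
      conv_lhs => rw [e2]
      simp
    have e4 : ⟪single k (1 : ℝ), D v⟫_ℝ = 0 := by rw [hv, inner_zero_right]
    rw [e3, inner_sum] at e4
    simpa [real_inner_smul_right] using e4

include hφ in
theorem PhaseSmoothHomog.exists_thickening (hK : IsCompact K) (hnd : NonDegenerateOn n φ K) : ∃ δ,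
    0 < δ ∧ MixedNonDeg φ (cthickening δ K) := by
  let U : Set (ℝ²ⁿ n) := {z | z.2 ≠ 0 ∧ mixedDet φ z.1 z.2 ≠ 0}
  have hU : IsOpen U := isOpen_iff_mem_nhds.mpr fun z hz =>
    Filter.inter_mem ((continuous_snd.continuousAt (x := z)).eventually_ne hz.1)
      ((hφ.continuousAt_mixedDet hz.1).eventually_ne hz.2)
  have hS0 : ∀ w ∈ sphere (0 : Rn n) 1, w ≠ 0 := by
    rintro w hw rfl
    simp at hw
  obtain ⟨V, W, hV, -, hKV, hSW, hVW⟩ := generalized_tube_lemma hK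
    (isCompact_sphere (0 : Rn n) 1) hU fun z hz => ⟨hS0 _ hz.2,
      hφ.mixedDet_ne_zero (hS0 _ hz.2) (hnd _ hz.1 _ (hS0 _ hz.2))⟩
  obtain ⟨δ, hδ, hδV⟩ := hK.exists_cthickening_subset_open hV hKV
  refine ⟨δ, hδ, fun x hx w hw => ?_⟩
  have h0 := norm_pos_iff.mpr hw
  rw [← hφ.mixedDet_smul x w (inv_pos.mpr h0)]
  exact (hVW (a := (x, ‖w‖⁻¹ • w)) ⟨hδV hx, hSW (by simpa using norm_inv_smul_self hw)⟩).2

theorem ContinuousLinearMap.exists_pos_le_norm [FiniteDimensional ℝ E]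
    (L : E →L[ℝ] F) (hL : ∀ v, L v = 0 → v = 0) : ∃ c, 0 < c ∧ ∀ v, c * ‖v‖ ≤ ‖L v‖ := by
  obtain ⟨K, hK, hKL⟩ := (L : E →ₗ[ℝ] F).exists_antilipschitzWith (LinearMap.ker_eq_bot'.mpr hL)
  refine ⟨(K : ℝ)⁻¹, by positivity, fun v => ?_⟩
  have := hKL.le_mul_dist v 0
  rw [inv_mul_le_iff₀ (by exact_mod_cast hK)]
  simpa using this

/-- A function with injective partial derivative is locally bi-Lipschitz from below, uniformly in
the parameter. -/
theorem HasStrictFDerivAt.eventually_le_norm_sub [FiniteDimensional ℝ E] {G : P × E → F} {L : P × E →L[ℝ] F} {z : P × E}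
    (hG : HasStrictFDerivAt G L z) (hL : ∀ v, L (0, v) = 0 → v = 0) : ∃ c, 0 < c ∧ ∃ U ∈ nhds z, ∀ p
    x x', (p, x) ∈ U → (p, x') ∈ U → c * ‖x - x'‖ ≤ ‖G (p, x) - G (p, x')‖ := by
  obtain ⟨c, hc, hcL⟩ := (L.comp (inr ℝ P E)).exists_pos_le_norm hL
  have h1 := hG.isLittleO.def (half_pos hc)
  obtain ⟨U, hU, hUU⟩ := Filter.mem_prod_self_iff.mp (by rwa [nhds_prod_eq] at h1)
  refine ⟨c / 2, half_pos hc, U, hU, fun p x x' hx hx' => ?_⟩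
  have h2 : ‖G (p, x) - G (p, x') - L ((p, x) - (p, x'))‖ ≤ c / 2 * ‖(p, x) - (p, x')‖ :=
    hUU (mk_mem_prod hx hx')
  have h3 : ((p, x) : P × E) - (p, x') = (0, x - x') := by simp
  rw [h3] at h2
  have h4 := hcL (x - x')
  have h5 : ‖((0 : P), x - x')‖ = ‖x - x'‖ := by simp [Prod.norm_def]
  rw [h5] at h2
  have h6 := norm_sub_norm_le (L (0, x - x')) (G (p, x) - G (p, x'))
  rw [norm_sub_rev (L (0, x - x'))] at h6
  simp only [ContinuousLinearMap.comp_apply, inr_apply] at h4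
  linarith

include hφ hQ hnd in
/-- Uniform change of variables `x ↦ ∇_ξ φ(x, w)`. -/
theorem PhaseSmoothHomog.lintegral_gradPhase_le : ∃ C : ℝ≥0, ∀ (F : Rn n → ℝ≥0∞) (w : Rn n), w ≠ 0 →
    ∫⁻ x in Q, F (gradPhase φ x w) ≤ C * ∫⁻ u, F u := by
  have hS0 : ∀ w ∈ sphere (0 : Rn n) 1, w ≠ 0 := by
    rintro w hw rfl
    simp at hw
  have key : ∃ C : ℝ≥0, ∀ (F : Rn n → ℝ≥0∞) (w : Rn n),
      ∫⁻ x in {x | (x, w) ∈ Q ×ˢ sphere (0 : Rn n) 1}, F (gradPhase φ x w) ≤ C * ∫⁻ u, F u := by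
    refine (hQ.prod (isCompact_sphere (0 : Rn n) 1)).induction_on
      (p := fun Z => ∃ C : ℝ≥0, ∀ (F : Rn n → ℝ≥0∞) (w : Rn n),
        ∫⁻ x in {x | (x, w) ∈ Z}, F (gradPhase φ x w) ≤ C * ∫⁻ u, F u) ?_ ?_ ?_ ?_
    · exact ⟨0, by simp⟩
    · rintro s t hst ⟨C, hC⟩
      exact ⟨C, fun F w => (lintegral_mono_set (show {x | (x, w) ∈ s} ⊆ {x | (x, w) ∈ t} from
        fun x hx => hst hx)).trans (hC F w)⟩
    · rintro s t ⟨C, hC⟩ ⟨C', hC'⟩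
      refine ⟨C + C', fun F w => ?_⟩
      have : {x | (x, w) ∈ s ∪ t} = {x | (x, w) ∈ s} ∪ {x | (x, w) ∈ t} := rfl
      rw [this]
      refine (lintegral_union_le _ _ _).trans ?_
      push_cast
      rw [add_mul]
      exact add_le_add (hC F w) (hC' F w)
    · rintro ⟨x0, w0⟩ ⟨hx0, hw0⟩
      have hw00 := hS0 _ hw0
      have hd0 : 0 < |mixedDet φ x0 w0| := abs_pos.mpr (hnd _ hx0 _ hw00)
      let G : ℝ²ⁿ n → Rn n := fun p => gradPhase φ p.2 p.1
      have hGc : ContDiffAt ℝ C∞ G (w0, x0) :=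
        ContDiffAt.comp (w0, x0) (f := fun p : ℝ²ⁿ n => (p.2, p.1)) (hφ.contDiffAt_gradPhase (z := (x0, w0)) hw00)
          (by fun_prop)
      have hG := hGc.hasStrictFDerivAt (by simp)
      have hL : ∀ v, fderiv ℝ G (w0, x0) (0, v) = fderiv ℝ (fun x' => gradPhase φ x' w0) x0 v := by
        intro v
        have := (hG.hasFDerivAt.comp x0 (hasFDerivAt_prodMk_right w0 x0)).fderiv
        have h2 : (G ∘ fun x' => (w0, x')) = fun x' => gradPhase φ x' w0 := rfl
        rw [h2] at this
        rw [this]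
        simp
      obtain ⟨c, hc, U, hU, hUc⟩ := hG.eventually_le_norm_sub fun v hv => by
        rw [hL] at hv
        by_contra hv0
        refine hnd _ hx0 _ hw00 ?_
        exact LinearMap.det_eq_zero_iff_ker_ne_bot.mpr ((Submodule.ne_bot_iff _).mpr ⟨v, hv, hv0⟩)
      have h1 : ∀ᶠ z : ℝ²ⁿ n in nhds (x0, w0), z.2 ≠ 0 ∧
          |mixedDet φ x0 w0| / 2 < |mixedDet φ z.1 z.2| ∧ (z.2, z.1) ∈ U :=
        ((continuous_snd.continuousAt (x := (x0, w0))).eventually_ne hw00).and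
          (((hφ.continuousAt_mixedDet (z := (x0, w0)) hw00).abs.eventually_const_lt
            (by simp only; linarith)).and
          ((continuous_swap.continuousAt (x := (x0, w0))).eventually_mem hU))
      obtain ⟨V, V', hVo, hV, hV'o, hV', hVV⟩ := mem_nhds_prod_iff'.mp h1
      set d := |mixedDet φ x0 w0| / 2 with hd
      have hdpos : 0 < d := by positivity
      refine ⟨V ×ˢ V', mem_nhdsWithin_of_mem_nhds ((hVo.prod hV'o).mem_nhds ⟨hV, hV'⟩),
        d.toNNReal⁻¹, fun F w => ?_⟩
      by_cases hw : w ∈ V'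
      swap
      · have : {x | (x, w) ∈ V ×ˢ V'} = ∅ := by ext x; simp [hw]
        rw [this]
        simp
      have hVw : {x | (x, w) ∈ V ×ˢ V'} = V := by ext x; simp [hw]
      rw [hVw]
      have hinj : Set.InjOn (fun x => gradPhase φ x w) V := fun x hx x' hx' he => by
        have h2 := hUc w x x' (hVV (mk_mem_prod hx hw)).2.2 (hVV (mk_mem_prod hx' hw)).2.2
        have h3 : ‖G (w, x) - G (w, x')‖ = 0 := by
          rw [norm_eq_zero, sub_eq_zero]; exact he
        rw [h3] at h2
        have h4 : ‖x - x'‖ = 0 := by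
          have := norm_nonneg (x - x')
          nlinarith
        exact sub_eq_zero.mp (norm_eq_zero.mp h4)
      have hcv := lintegral_image_eq_lintegral_abs_det_fderiv_mul volume hVo.measurableSet
        (fun x hx => ((hφ.contDiffAt_gradPhase_left x (hVV (mk_mem_prod hx hw)).1).differentiableAt
            (by simp)).hasFDerivAt.hasFDerivWithinAt) hinj F
      have h5 : ofR d * ∫⁻ x in V, F (gradPhase φ x w) ≤ ∫⁻ u, F u := by
        rw [← lintegral_const_mul' _ _ ofR_ne_top]
        refine le_trans ?_ (setLIntegral_le_lintegral ((fun x => gradPhase φ x w) '' V) F)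
        rw [hcv]
        refine setLIntegral_mono' hVo.measurableSet fun x hx => ?_
        gcongr
        exact (hVV (mk_mem_prod hx hw)).2.1.le
      have h6 : ((d.toNNReal⁻¹ : ℝ≥0) : ℝ≥0∞) = (ofR d)⁻¹ := by
        rw [ENNReal.coe_inv (by simpa using hdpos), ofR]
      rw [h6]
      calc _ = (ofR d)⁻¹ * (ofR d * ∫⁻ x in V, F (gradPhase φ x w)) := by
            rw [← mul_assoc, ENNReal.inv_mul_cancel (by simpa using hdpos) ofR_ne_top, one_mul]
        _ ≤ _ := by gcongr
  obtain ⟨C, hC⟩ := key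
  refine ⟨C, fun F w hw => ?_⟩
  have h0 := norm_pos_iff.mpr hw
  have := hC F (‖w‖⁻¹ • w)
  simp_rw [hφ.gradPhase_smul _ w (inv_pos.mpr h0)] at this
  have e : {x | (x, ‖w‖⁻¹ • w) ∈ Q ×ˢ sphere (0 : Rn n) 1} = Q := by
    ext x
    simp [norm_inv_smul_self hw, h0.ne']
  rwa [e] at this

include hn in
theorem lintegral_aniso_le {r : ℝ} (hr : n < r) : ∃ C : ℝ≥0, ∀ lam : ℝ, 1 ≤ lam → ∀ w : Rn n, 1 /
    2 ≤ ‖w‖ → ∫⁻ u, ofR ((1 + lam * aniso (width lam) w u) ^ (-r)) ≤ C * ofR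
    ((lam ^ n * width lam ^ (n - 1))⁻¹) := by
  have hfin : ∫⁻ v : Rn n, ofR ((1 + ‖v‖) ^ (-r)) < ∞ :=
    finite_integral_one_add_norm (by simpa using hr)
  have hr0 : 0 < r := lt_of_le_of_lt (Nat.cast_nonneg n) hr
  set A := ∫⁻ v : Rn n, ofR ((1 + ‖v‖) ^ (-r)) with hA
  refine ⟨(2 ^ n * A).toNNReal, fun lam hl w hw => ?_⟩
  rw [coe_toNNReal (mul_ne_top (by simp) hfin.ne)]
  have hl0 : 0 < lam := by linarith
  have hε := width_pos hl
  have hε1 : width lam ≤ 1 := (width_le hl).trans (by norm_num)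
  have hw0 : 0 < ‖w‖ := by linarith
  set ω := ‖w‖⁻¹ • w with hω
  have hω1 : ‖ω‖ = 1 := norm_inv_smul_self (norm_pos_iff.mp hw0)
  have hpt : ∀ u, ofR ((1 + lam * aniso (width lam) w u) ^ (-r)) ≤
      (fun v => (fun v' => ofR ((1 + ‖v'‖) ^ (-r))) ((lam / 2) • v)) (squeeze ω (width lam) u) := by
    intro u
    refine ofR_le_ofR (Real.rpow_le_rpow_of_nonpos (by positivity) ?_ (by linarith))
    have h1 := norm_squeeze_apply_le hω1 hε hε1 u
    have h2 : |⟪u, ω⟫_ℝ| * ‖w‖ = |⟪w, u⟫_ℝ| := by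
      rw [hω, real_inner_smul_right, abs_mul, abs_inv, abs_norm, real_inner_comm]
      field_simp
    have h3 : ‖squeeze ω (width lam) u‖ ≤ 2 * aniso (width lam) w u := by
      unfold aniso
      have := abs_nonneg ⟪u, ω⟫_ℝ
      have := norm_nonneg u
      nlinarith [mul_nonneg hε.le (norm_nonneg u)]
    rw [norm_smul, norm_of_nonneg (by positivity)]
    nlinarith
  refine (lintegral_mono hpt).trans ?_
  rw [lintegral_eq_lintegral_comp_squeeze hn hω1 hε
    (fun v => (fun v' => ofR ((1 + ‖v'‖) ^ (-r))) ((lam / 2) • v)),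
    lintegral_comp_smul_Rn (fun v' : Rn n => ofR ((1 + ‖v'‖) ^ (-r))) (by positivity),
    ← hA, abs_of_nonneg (by positivity)]
  have h4 : (2 : ℝ≥0∞) ^ n = ofR (2 ^ n) := by
    rw [ofR_pow (by norm_num)]; norm_num
  rw [h4, mul_assoc, mul_comm A, ← mul_assoc, ← mul_assoc, ← ofR_mul (by positivity),
    ← ofR_mul (by positivity)]
  refine mul_le_mul' (ofR_le_ofR (le_of_eq ?_)) le_rfl
  field_simp
  rw [← mul_pow]
  ring

include hn in
theorem volume_shell_le : ∃ C : ℝ≥0, ∀ ε : ℝ, 0 < ε → ε ≤ 1 / 32 →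
    volume (shell n ε) ≤ C * ofR ε := by
  have : Nonempty (Fin n) := ⟨⟨0, hn⟩⟩
  set B := volume (ball (0 : Rn n) 1) with hB
  have hBt : B ≠ ∞ := Metric.isBounded_ball.measure_lt_top.ne
  refine ⟨(12 * n * 2 ^ n : ℝ≥0) * B.toNNReal, fun ε h0 h1 => ?_⟩
  have hsub : shell n ε ⊆ closedBall 0 (1 + 6 * ε) \ ball 0 (1 - 6 * ε) := by
    intro w hw
    have := abs_le.mp (show |‖w‖ - 1| ≤ 6 * ε from hw)
    simp only [Set.mem_sdiff, Metric.mem_closedBall, dist_zero_right, Metric.mem_ball, not_lt]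
    constructor <;> linarith
  refine (measure_mono hsub).trans ?_
  rw [measure_sdiff (fun w hw => by simp at hw ⊢; linarith) measurableSet_ball.nullMeasurableSet
    Metric.isBounded_ball.measure_lt_top.ne, Measure.addHaar_closedBall volume _ (by positivity),
    Measure.addHaar_ball volume (r := 1 - 6 * ε) _ (by linarith), finrank_euclideanSpace_fin, ← hB,
    ← ENNReal.sub_mul (fun _ _ => hBt), ← ENNReal.ofReal_sub _ (by have : 0 ≤ 1 - 6 * ε := by linarith
                                                                   positivity)]
  rw [coe_mul, coe_toNNReal hBt, mul_right_comm]
  gcongr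
  have h2 : ((12 * n * 2 ^ n : ℝ≥0) : ℝ≥0∞) = ofR (12 * n * 2 ^ n) := by
    rw [ENNReal.ofReal_eq_coe_nnreal (by positivity)]; rfl
  rw [h2, ← ofR_mul (by positivity)]
  refine ofR_le_ofR ?_
  have h3 := abs_pow_sub_pow_le (1 + 6 * ε) (1 - 6 * ε) n
  have h4 : max |1 + 6 * ε| |1 - 6 * ε| ≤ 2 := by
    refine max_le ?_ ?_ <;> rw [abs_le] <;> constructor <;> linarith
  have h5 : max |1 + 6 * ε| |1 - 6 * ε| ^ (n - 1) ≤ 2 ^ n :=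
    (pow_le_pow_left₀ (by positivity) h4 _).trans (pow_le_pow_right₀ (by norm_num) (by omega))
  have h6 : |1 + 6 * ε - (1 - 6 * ε)| = 12 * ε := by
    rw [abs_of_nonneg (by linarith)]; ring
  rw [h6] at h3
  calc _ ≤ _ := le_abs_self _
    _ ≤ _ := h3
    _ ≤ 12 * ε * n * 2 ^ n := by gcongr
    _ = _ := by ring

include hφ in
theorem PhaseSmoothHomog.exists_lipschitz_left (R : ℝ) : ∃ C : ℝ, 0 ≤ C ∧ ∀ x ∈ closedBall
    (0 : Rn n) R, ∀ z ∈ closedBall (0 : Rn n) R, ∀ w ∈ annulus n, ‖gradPhase φ x w - gradPhase φ z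
    w‖ ≤ C * ‖x - z‖ := by
  have hu : UBdd (fun _ : Unit => closedBall (0 : Rn n) R ×ˢ annulus n)
      (fun _ p => gradPhase φ p.1 p.2) :=
    UBdd.of_isCompact ((isCompact_closedBall _ _).prod isCompact_annulus)
      fun z hz => hφ.contDiffAt_gradPhase (ne_zero_of_mem_annulus hz.2)
  obtain ⟨C, hC0, hC⟩ := hu.fderiv.norm_le
  refine ⟨C, hC0.le, fun x hx z hz w hw => ?_⟩
  refine (convex_closedBall (0 : Rn n) R).norm_image_sub_le_of_norm_hasFDerivWithin_le
    (f := fun x => gradPhase φ x w) (fun y hy => ((hφ.contDiffAt_gradPhase_left y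
      (ne_zero_of_mem_annulus hw)).differentiableAt (by simp)).hasFDerivAt.hasFDerivWithinAt)
    (fun y hy => ?_) hz hx
  rw [hφ.fderiv_gradPhase_left (ne_zero_of_mem_annulus hw)]
  refine (opNorm_comp_le _ _).trans ?_
  have h1 := hC () (y, w) ⟨hy, hw⟩
  have h2 := norm_inl_le_one ℝ (Rn n) (Rn n)
  nlinarith [norm_nonneg (inl ℝ (Rn n) (Rn n))]

include hφ hQ in
theorem PhaseSmoothHomog.exists_lipschitz_right : ∃ C : ℝ, 0 ≤ C ∧ ∀ x ∈ Q, ∀ w w' : Rn n, 3 / 4 ≤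
    ‖w‖ → ‖w‖ ≤ 3 → ‖w' - w‖ ≤ 1 / 2 → ‖gradPhase φ x w' - gradPhase φ x w‖ ≤ C * ‖w' - w‖ ∧
        |φ x w' - φ x w - ⟪gradPhase φ x w, w' - w⟫_ℝ| ≤ C * ‖w' - w‖ ^ 2 := by
  have hu : UBdd (fun _ : Unit => Q ×ˢ annulus n) (fun _ p => gradPhase φ p.1 p.2) :=
    UBdd.of_isCompact (hQ.prod isCompact_annulus)
      fun z hz => hφ.contDiffAt_gradPhase (ne_zero_of_mem_annulus hz.2)
  obtain ⟨C, hC0, hC⟩ := hu.fderiv.norm_le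
  have hann : ∀ w v : Rn n, 3 / 4 ≤ ‖w‖ → ‖w‖ ≤ 3 → ‖v - w‖ ≤ 1 / 2 → v ∈ annulus n := by
    intro w v h1 h2 h3
    have h4 := norm_sub_norm_le w v
    have h5 := norm_sub_norm_le v w
    rw [norm_sub_rev] at h4
    constructor <;> linarith
  have hgrad : ∀ x ∈ Q, ∀ w w' : Rn n, 3 / 4 ≤ ‖w‖ → ‖w‖ ≤ 3 →
      ‖w' - w‖ ≤ 1 / 2 → ‖gradPhase φ x w' - gradPhase φ x w‖ ≤ C * ‖w' - w‖ := by
    intro x hx w w' h1 h2 h3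
    refine (convex_closedBall w (1 / 2)).norm_image_sub_le_of_norm_hasFDerivWithin_le
      (f := fun v => gradPhase φ x v)
      (f' := fun v => (fderiv ℝ (fun p : ℝ²ⁿ n => gradPhase φ p.1 p.2) (x, v)).comp
        (inr ℝ (Rn n) (Rn n))) (fun v hv => ?_)
      (fun v hv => ?_) (Metric.mem_closedBall_self (by norm_num)) (by simpa [dist_eq_norm] using h3)
    · have hv' := hann w v h1 h2 (by simpa [dist_eq_norm] using hv)
      have h1 := ((hφ.contDiffAt_gradPhase (z := (x, v))
        (ne_zero_of_mem_annulus hv')).differentiableAt (by simp)).hasFDerivAt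
      exact (HasFDerivAt.comp (g := fun p : ℝ²ⁿ n => gradPhase φ p.1 p.2)
        (f := fun v' : Rn n => (x, v')) v h1
        (hasFDerivAt_prodMk_right (𝕜 := ℝ) x v)).hasFDerivWithinAt
    · have hv' := hann w v h1 h2 (by simpa [dist_eq_norm] using hv)
      refine (opNorm_comp_le _ _).trans ?_
      have h1 := hC () (x, v) ⟨hx, hv'⟩
      have h2 := ContinuousLinearMap.norm_inr_le_one ℝ (Rn n) (Rn n)
      nlinarith [norm_nonneg (inr ℝ (Rn n) (Rn n))]
  refine ⟨C, hC0.le, fun x hx w w' h1 h2 h3 => ⟨hgrad x hx w w' h1 h2 h3, ?_⟩⟩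
  have key := (convex_closedBall w ‖w' - w‖).norm_image_sub_le_of_norm_hasFDerivWithin_le
    (f := fun v => φ x v - innerSL ℝ (gradPhase φ x w) v)
    (f' := fun v => fderiv ℝ (φ x) v - innerSL ℝ (gradPhase φ x w)) (C := C * ‖w' - w‖)
    (x := w) (y := w') (fun v hv => ?_) (fun v hv => ?_)
    (Metric.mem_closedBall_self (by positivity)) (by simp [dist_eq_norm])
  · simp only [innerSL_apply_apply] at key
    rw [norm_eq_abs] at key
    rw [inner_sub_right, pow_two, ← mul_assoc]
    convert key using 2
    ring
  · have hv1 : ‖v - w‖ ≤ 1 / 2 := by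
      have : ‖v - w‖ ≤ ‖w' - w‖ := by simpa [dist_eq_norm] using hv
      linarith
    have hv' := hann w v h1 h2 hv1
    exact (((hφ.contDiffAt_right x (ne_zero_of_mem_annulus hv')).differentiableAt
      (by simp)).hasFDerivAt.sub (innerSL ℝ (gradPhase φ x w)).hasFDerivAt).hasFDerivWithinAt
  · have hv0 : ‖v - w‖ ≤ ‖w' - w‖ := by simpa [dist_eq_norm] using hv
    refine opNorm_le_bound _ (by positivity) fun u => ?_
    rw [sub_apply, ← inner_gradPhase, innerSL_apply_apply, ← inner_sub_left]
    refine (norm_inner_le_norm _ _).trans ?_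
    gcongr
    exact (hgrad x hx w v h1 h2 (by linarith)).trans (by gcongr)

theorem lintegral_rpow_le_of_slowly_varying {S S' : Set (Rn n)} {g : Rn n → ℝ≥0∞} {C : ℝ≥0}
    (hS : MeasurableSet S) {ε p : ℝ} (hε : 0 < ε) (hp : 0 < p) (hp1 : p ≤ 1)
    (hg : ∀ w ∈ S, ∀ w', ‖w' - w‖ < ε → w' ∈ S' ∧ g w ≤ C * g w') : (∫⁻ w in S, g w) ^ p ≤
    (C ^ p * (ofR (ε ^ n) * volume (ball (0 : Rn n) 1))⁻¹) ^ (1 - p) * ∫⁻ w in S', g w ^ p := by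
  set J := ∫⁻ w in S', g w ^ p with hJ
  set D := C ^ p * (ofR (ε ^ n) * volume (ball (0 : Rn n) 1))⁻¹ with hD
  have hSS : S ⊆ S' := fun w hw => (hg w hw w (by simpa using hε)).1
  have hb0 : 0 < volume (ball (0 : Rn n) 1) := Metric.measure_ball_pos _ _ one_pos
  have hbt : volume (ball (0 : Rn n) 1) ≠ ∞ := Metric.isBounded_ball.measure_lt_top.ne
  have hvol : ∀ w : Rn n, volume (ball w ε) =
      ofR (ε ^ n) * volume (ball (0 : Rn n) 1) := fun w => by
    rw [Measure.addHaar_ball_of_pos volume _ hε, finrank_euclideanSpace_fin]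
  have hsup : ∀ w ∈ S, g w ^ p ≤ D * J := by
    intro w hw
    have h1 : g w ^ p * volume (ball w ε) ≤ C ^ p * J := by
      rw [← setLIntegral_const]
      calc _ ≤ ∫⁻ w' in ball w ε, C ^ p * g w' ^ p := by
            refine setLIntegral_mono' measurableSet_ball fun w' hw' => ?_
            rw [← mul_rpow_of_nonneg _ _ hp.le]
            exact rpow_le_rpow (hg w hw w' (by simpa [dist_eq_norm] using hw')).2 hp.le
        _ ≤ C ^ p * ∫⁻ w' in ball w ε, g w' ^ p := by
            rw [lintegral_const_mul' _ _ (rpow_ne_top_of_nonneg hp.le coe_ne_top)]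
        _ ≤ _ := by
            refine mul_le_mul' le_rfl (lintegral_mono_set fun w' hw' => ?_)
            exact (hg w hw w' (by simpa [dist_eq_norm] using hw')).1
    rw [hvol] at h1
    rw [hD, mul_right_comm, ← div_eq_mul_inv]
    rw [ENNReal.le_div_iff_mul_le (Or.inl (mul_ne_zero (by simpa using pow_pos hε n) hb0.ne'))
      (Or.inl (mul_ne_top ofR_ne_top hbt))]
    exact h1
  have h2 : ∀ w ∈ S, g w ≤ (D * J) ^ ((1 - p) / p) * g w ^ p := by
    intro w hw
    have h3 : g w = (g w ^ p) ^ ((1 - p) / p) * g w ^ p := by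
      rw [← erpow_mul, ← rpow_add_of_nonneg _ _ (by
        exact mul_nonneg hp.le (div_nonneg (by linarith) hp.le)) hp.le]
      rw [mul_div_cancel₀ _ hp.ne']
      simp
    conv_lhs => rw [h3]
    have hq : 0 ≤ (1 - p) / p := div_nonneg (by linarith) hp.le
    exact mul_le_mul' (rpow_le_rpow (hsup w hw) hq) le_rfl
  have hDt : D ≠ ∞ := by
    rw [hD]
    refine mul_ne_top (rpow_ne_top_of_nonneg hp.le coe_ne_top)
      (inv_ne_top.mpr (mul_ne_zero (by simpa using pow_pos hε n) hb0.ne'))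
  have hq : 0 ≤ (1 - p) / p := div_nonneg (by linarith) hp.le
  by_cases hJt : J = ∞
  · by_cases hp1' : p = 1
    · subst hp1'
      rw [hJt]
      simp
    by_cases hC0 : C = 0
    · have : ∫⁻ w in S, g w = 0 := by
        rw [setLIntegral_congr_fun hS (g := fun _ => 0), lintegral_zero]
        intro w hw
        have := (hg w hw w (by simpa using hε)).2
        simpa [hC0] using this
      rw [this, ENNReal.zero_rpow_of_pos hp]
      exact zero_le
    · have hD0 : D ≠ 0 := by
        rw [hD]
        refine mul_ne_zero (by simp [ENNReal.rpow_eq_zero_iff, hC0])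
          (ENNReal.inv_ne_zero.mpr (mul_ne_top ofR_ne_top hbt))
      rw [hJt, ENNReal.mul_top]
      · exact le_top
      · simp [ENNReal.rpow_eq_zero_iff, hD0, hDt]
  have hMt : (D * J) ^ ((1 - p) / p) ≠ ∞ := rpow_ne_top_of_nonneg hq (mul_ne_top hDt hJt)
  calc (∫⁻ w in S, g w) ^ p ≤ ((D * J) ^ ((1 - p) / p) * J) ^ p := by
        refine rpow_le_rpow ?_ hp.le
        refine (setLIntegral_mono' hS h2).trans ?_
        rw [lintegral_const_mul' _ _ hMt]
        exact mul_le_mul' le_rfl (lintegral_mono_set hSS)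
    _ = D ^ (1 - p) * J := by
        rw [mul_rpow_of_nonneg _ _ hp.le, ← erpow_mul, div_mul_cancel₀ _ hp.ne',
          mul_rpow_of_nonneg _ _ (by linarith), mul_assoc,
          ← rpow_add_of_nonneg _ _ (by linarith) hp.le]
        simp

include hφ in
theorem PhaseSmoothHomog.continuousOn_packet {lam : ℝ} (hl : 1 ≤ lam) (r : ℝ) : ContinuousOn
    (fun t : (ℝ²ⁿ n) × Rn n => packet φ lam r t.1.1 t.1.2 t.2) {t | t.2 ≠ 0} := by
  intro t ht
  have h1 : ContinuousAt (fun t : (ℝ²ⁿ n) × Rn n => gradPhase φ t.1.1 t.2) t :=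
    ContinuousAt.comp (f := fun t : (ℝ²ⁿ n) × Rn n => (t.1.1, t.2))
      (g := fun p : ℝ²ⁿ n => gradPhase φ p.1 p.2)
      (hφ.contDiffAt_gradPhase (z := (t.1.1, t.2)) ht).continuousAt (by fun_prop)
  have h2 : ContinuousAt (fun t : (ℝ²ⁿ n) × Rn n =>
      aniso (width lam) t.2 (gradPhase φ t.1.1 t.2 - t.1.2)) t := by
    unfold aniso
    fun_prop
  refine ContinuousAt.continuousWithinAt ?_
  unfold packet
  refine ContinuousAt.rpow_const (by fun_prop) (Or.inl ?_)
  have := aniso_nonneg (width_pos hl).le t.2 (gradPhase φ t.1.1 t.2 - t.1.2)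
  positivity

theorem ne_zero_of_mem_shell {s : ℝ} (hs : s ≤ 1 / 32) {w : Rn n} (hw : w ∈ shell n s) :
    3 / 4 ≤ ‖w‖ ∧ ‖w‖ ≤ 3 ∧ w ≠ 0 := by
  have := abs_le.mp (show |‖w‖ - 1| ≤ 6 * s from hw)
  refine ⟨by linarith, by linarith, fun h => ?_⟩
  rw [h, norm_zero] at this
  linarith

include hφ in
theorem PhaseSmoothHomog.aemeasurable_packet {lam : ℝ} (hl : 1 ≤ lam) (r : ℝ) {s : ℝ}
    (hs : s ≤ 1 / 32) (hQ : MeasurableSet Q) {c : Rn n → ℝ²ⁿ n} (hc : Continuous c) : AEMeasurable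
    (fun t : ℝ²ⁿ n => ofR (packet φ lam r (c t.1).1 (c t.1).2 t.2))
    ((volume.restrict Q).prod (volume.restrict (shell n s))) := by
  rw [Measure.prod_restrict]
  refine AEMeasurable.ennreal_ofReal (ContinuousOn.aemeasurable ?_
    (hQ.prod (isClosed_shell s).measurableSet))
  refine (hφ.continuousOn_packet hl r).comp (f := fun t : ℝ²ⁿ n => (c t.1, t.2))
    (by fun_prop) fun t ht => (ne_zero_of_mem_shell hs ht.2).2.2

include hφ in
theorem PhaseSmoothHomog.lintegral_packet_right (hn : 1 ≤ n) {r : ℝ} (hr : n < r) : ∃ C : ℝ≥0, ∀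
    lam : ℝ, 1 ≤ lam → ∀ s : ℝ, 0 < s → s ≤ 1 / 32 → ∀ x : Rn n, ∫⁻ y, ∫⁻ w in shell n s, ofR
    (packet φ lam r x y w) ≤ C * ofR (s * (lam ^ n * width lam ^ (n - 1))⁻¹) := by
  obtain ⟨C, hC⟩ := lintegral_aniso_le hn hr
  obtain ⟨V, hV⟩ := volume_shell_le hn
  refine ⟨C * V, fun lam hl s hs0 hs x => ?_⟩
  have hm := hφ.aemeasurable_packet hl r hs MeasurableSet.univ (c := fun y => (x, y)) (by fun_prop)
  rw [restrict_univ] at hm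
  rw [lintegral_lintegral_swap hm]
  calc _ ≤ ∫⁻ w in shell n s, C * ofR ((lam ^ n * width lam ^ (n - 1))⁻¹) := by
        refine setLIntegral_mono' (isClosed_shell s).measurableSet fun w hw => ?_
        have h1 := lintegral_sub_left_eq_self (μ := (volume : Measure (Rn n)))
          (fun u => ofR ((1 + lam * aniso (width lam) w u) ^ (-r))) (gradPhase φ x w)
        simp only [packet]
        rw [h1]
        exact hC lam hl w (by linarith [(ne_zero_of_mem_shell hs hw).1])
    _ = C * ofR ((lam ^ n * width lam ^ (n - 1))⁻¹) * volume (shell n s) := setLIntegral_const _ _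
    _ ≤ C * ofR ((lam ^ n * width lam ^ (n - 1))⁻¹) * (V * ofR s) := by
        gcongr; exact hV s hs0 hs
    _ = _ := by
        rw [ofR_mul hs0.le]; push_cast; ring

include hφ in
theorem PhaseSmoothHomog.lintegral_packet_left (hn : 1 ≤ n) (hQ : IsCompact Q)
    (hnd : MixedNonDeg φ Q) {r : ℝ} (hr : n < r) : ∃ C : ℝ≥0, ∀ lam : ℝ, 1 ≤ lam → ∀ s : ℝ, 0 < s →
    s ≤ 1 / 32 → ∀ y : Rn n, ∫⁻ x in Q, ∫⁻ w in shell n s, ofR (packet φ lam r x y w) ≤ C * ofR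
    (s * (lam ^ n * width lam ^ (n - 1))⁻¹) := by
  obtain ⟨C, hC⟩ := lintegral_aniso_le hn hr
  obtain ⟨V, hV⟩ := volume_shell_le hn
  obtain ⟨D, hD⟩ := hφ.lintegral_gradPhase_le hQ hnd
  refine ⟨D * C * V, fun lam hl s hs0 hs y => ?_⟩
  have hm := hφ.aemeasurable_packet hl r hs hQ.measurableSet (c := fun x => (x, y)) (by fun_prop)
  rw [lintegral_lintegral_swap hm]
  calc _ ≤ ∫⁻ w in shell n s, D * (C * ofR ((lam ^ n * width lam ^ (n - 1))⁻¹)) := by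
        refine setLIntegral_mono' (isClosed_shell s).measurableSet fun w hw => ?_
        have h1 := lintegral_sub_right_eq_self (μ := (volume : Measure (Rn n)))
          (fun u => ofR ((1 + lam * aniso (width lam) w u) ^ (-r))) y
        have h2 := hD (fun u => ofR ((1 + lam * aniso (width lam) w (u - y)) ^ (-r))) w
          (ne_zero_of_mem_shell hs hw).2.2
        simp only [packet]
        refine h2.trans ?_
        rw [h1]
        gcongr
        exact hC lam hl w (by linarith [(ne_zero_of_mem_shell hs hw).1])
    _ = D * (C * ofR ((lam ^ n * width lam ^ (n - 1))⁻¹)) * volume (shell n s) :=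
        setLIntegral_const _ _
    _ ≤ D * (C * ofR ((lam ^ n * width lam ^ (n - 1))⁻¹)) * (V * ofR s) := by
        gcongr; exact hV s hs0 hs
    _ = _ := by
        rw [ofR_mul hs0.le]; push_cast; ring

theorem packet_le_packet {lam r A : ℝ} (hl : 1 ≤ lam) (hr : 0 ≤ r) (hA : 1 ≤ A)
    {x y w x' y' w' : Rn n} (h : aniso (width lam) w' (gradPhase φ x' w' - y') ≤ A * aniso (width
    lam) w (gradPhase φ x w - y) + (A - 1) / lam) : packet φ lam r x y w ≤ A ^ r * packet φ lam r x'
    y' w' := by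
  have h1 := aniso_nonneg (width_pos hl).le w (gradPhase φ x w - y)
  have h2 := aniso_nonneg (width_pos hl).le w' (gradPhase φ x' w' - y')
  have hl0 : 0 < lam := by linarith
  unfold packet
  rw [rpow_neg (by positivity), rpow_neg (by positivity), ← div_eq_mul_inv,
    inv_eq_one_div, div_le_div_iff₀ (by positivity) (by positivity), one_mul,
    ← mul_rpow (by positivity) (by positivity)]
  refine Real.rpow_le_rpow (by positivity) ?_ hr
  calc _ ≤ 1 + lam * (A * aniso (width lam) w (gradPhase φ x w - y) + (A - 1) / lam) := by gcongr
    _ = _ := by field_simp; ring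

include hφ hQ in
theorem PhaseSmoothHomog.packet_slowly_varying {r : ℝ} (hr : 0 ≤ r) : ∃ C : ℝ, 0 ≤ C ∧ ∀ lam : ℝ,
    1 ≤ lam → ∀ x ∈ Q, ∀ y w w' : Rn n, w ∈ shell n (width lam) → ‖w' - w‖ < width lam → packet φ
    lam r x y w ≤ C * packet φ lam r x y w' := by
  obtain ⟨B, hB0, hB⟩ := hφ.exists_lipschitz_right hQ
  refine ⟨(2 + 2 * B) ^ r, by positivity, fun lam hl x hx y w w' hw hww => ?_⟩
  have hε := width_pos hl
  have hε1 := width_le hl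
  have hl0 : 0 < lam := by linarith
  obtain ⟨a1, a2, a3⟩ := ne_zero_of_mem_shell (by linarith) hw
  obtain ⟨b1, b2⟩ := hB x hx w w' a1 a2 (by linarith)
  have hw' : w' ≠ 0 := by
    rintro rfl
    rw [zero_sub, norm_neg] at hww
    linarith
  refine packet_le_packet hl hr (by linarith) ?_
  set u := gradPhase φ x w - y with hu
  set u' := gradPhase φ x w' - y with hu'
  have e1 : ⟪w, u⟫_ℝ = φ x w - ⟪w, y⟫_ℝ := by
    rw [hu, inner_sub_right, real_inner_comm, hφ.inner_gradPhase_self x a3]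
  have e2 : ⟪w', u'⟫_ℝ = φ x w' - ⟪w', y⟫_ℝ := by
    rw [hu', inner_sub_right, real_inner_comm, hφ.inner_gradPhase_self x hw']
  have e3 : ⟪w', u'⟫_ℝ = ⟪w, u⟫_ℝ + ⟪u, w' - w⟫_ℝ +
      (φ x w' - φ x w - ⟪gradPhase φ x w, w' - w⟫_ℝ) := by
    rw [e1, e2, hu, inner_sub_left, inner_sub_right y, real_inner_comm w', real_inner_comm w]
    ring
  have e4 : |⟪u, w' - w⟫_ℝ| ≤ ‖u‖ * width lam := (abs_real_inner_le_norm _ _).trans (by gcongr)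
  have e5 : ‖u'‖ ≤ ‖u‖ + B * width lam := by
    have : u' = u + (gradPhase φ x w' - gradPhase φ x w) := by rw [hu, hu']; abel
    rw [this]
    refine (norm_add_le _ _).trans ?_
    gcongr
    exact b1.trans (by gcongr)
  have e6 : B * ‖w' - w‖ ^ 2 ≤ B * width lam ^ 2 := by gcongr
  have e7 : |⟪w', u'⟫_ℝ| ≤ |⟪w, u⟫_ℝ| + ‖u‖ * width lam + B * width lam ^ 2 := by
    rw [e3]
    refine (abs_add_le _ _).trans (add_le_add ((abs_add_le _ _).trans ?_) (b2.trans e6))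
    gcongr
  have e8 : width lam ^ 2 ≤ 1 / lam := by
    have := mul_width_sq hl
    rw [le_div_iff₀ hl0]
    linarith
  unfold aniso
  have e9 : width lam * ‖u'‖ ≤ width lam * ‖u‖ + B * width lam ^ 2 := by
    nlinarith
  have e10 : (2 + 2 * B - 1) / lam = (1 + 2 * B) * (1 / lam) := by ring
  have e11 : 2 * B * width lam ^ 2 ≤ (1 + 2 * B) * (1 / lam) := by
    have : 0 ≤ 1 / lam := by positivity
    nlinarith
  have e12 : 0 ≤ |⟪w, u⟫_ℝ| := abs_nonneg _
  have e13 : 0 ≤ ‖u‖ * width lam := by positivity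
  rw [e10]
  nlinarith

theorem width_eq_rpow {lam : ℝ} (hl : 1 ≤ lam) : width lam = 64⁻¹ * lam ^ (-(1 / 2) : ℝ) := by
  rw [width, Real.sqrt_eq_rpow, mul_inv, rpow_neg (by linarith)]

include hn in
theorem width_rpow_identity (p : ℝ) {lam : ℝ} (hl : 1 ≤ lam) : (((width lam) ^ n)⁻¹) ^ (1 - p) *
    (width lam * (lam ^ n * width lam ^ (n - 1))⁻¹) = (64⁻¹ : ℝ) ^ (2 - 2 * n + n * p : ℝ) * lam ^
    (-(n * p / 2) - 1 : ℝ) := by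
  have hl0 : 0 < lam := by linarith
  have hw := width_pos hl
  obtain ⟨k, rfl⟩ : ∃ k, n = k + 1 := ⟨n - 1, by omega⟩
  have e1 : width lam * (lam ^ (k + 1) * width lam ^ (k + 1 - 1))⁻¹ =
      width lam ^ (1 - k : ℝ) * lam ^ (-(k + 1) : ℝ) := by
    rw [Real.rpow_sub hw, Real.rpow_one, rpow_natCast, rpow_neg hl0.le]
    rw [show ((k : ℝ) + 1) = ((k + 1 : ℕ) : ℝ) by push_cast; ring, rpow_natCast]
    simp only [Nat.add_sub_cancel]
    field_simp
  have e2 : (((width lam) ^ (k + 1))⁻¹) ^ (1 - p) = width lam ^ (-((k + 1) * (1 - p)) : ℝ) := by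
    rw [← rpow_natCast, ← rpow_neg hw.le, ← rpow_mul hw.le]
    congr 1; push_cast; ring
  rw [e1, e2, ← mul_assoc, ← rpow_add hw, width_eq_rpow hl,
    mul_rpow (by norm_num) (by positivity), ← rpow_mul hl0.le, mul_assoc,
    ← rpow_add hl0]
  congr 2 <;> (push_cast; ring)

/-- The sum of the wave packets through all directions dominating the oscillatory kernel. -/
def majorant (φ : Rn n → Rn n → ℝ) (lam r : ℝ) (x y : Rn n) : ℝ≥0∞ :=
  ∫⁻ w in shell n (width lam), ofR (packet φ lam r x y w)

theorem packet_le_one {lam r : ℝ} (hl : 1 ≤ lam) (hr : 0 ≤ r) (x y w : Rn n) :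
    packet φ lam r x y w ≤ 1 := by
  have := aniso_nonneg (width_pos hl).le w (gradPhase φ x w - y)
  exact Real.rpow_le_one_of_one_le_of_nonpos (by nlinarith) (by linarith)

include hn in
theorem exists_majorant_le {r : ℝ} (hr : 0 ≤ r) : ∃ C : ℝ≥0, ∀ lam : ℝ, 1 ≤ lam →
    ∀ x y : Rn n, majorant φ lam r x y ≤ C := by
  obtain ⟨V, hV⟩ := volume_shell_le hn
  refine ⟨V, fun lam hl x y => ?_⟩
  have hw := width_le hl
  calc majorant φ lam r x y ≤ ∫⁻ w in shell n (width lam), 1 :=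
        lintegral_mono fun w => by
          rw [← ofR_one]; exact ofR_le_ofR (packet_le_one hl hr _ _ _)
    _ = volume (shell n (width lam)) := by simp
    _ ≤ V * ofR (width lam) := hV _ (width_pos hl) (by linarith)
    _ ≤ V * 1 := by
        refine mul_le_mul' le_rfl ?_
        rw [← ofR_one]; exact ofR_le_ofR (by linarith)
    _ = V := mul_one _

include hφ in
theorem PhaseSmoothHomog.aemeasurable_majorant {lam : ℝ} (hl : 1 ≤ lam) (r : ℝ) :
    AEMeasurable (fun t : ℝ²ⁿ n => majorant φ lam r t.1 t.2) volume := by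
  have h : AEMeasurable (fun t : (ℝ²ⁿ n) × Rn n => ofR (packet φ lam r t.1.1 t.1.2 t.2))
      (volume.prod (volume.restrict (shell n (width lam)))) := by
    rw [← restrict_univ (μ := (volume : Measure (ℝ²ⁿ n))), Measure.prod_restrict]
    refine AEMeasurable.ennreal_ofReal (ContinuousOn.aemeasurable ?_
      (MeasurableSet.univ.prod (isClosed_shell _).measurableSet))
    refine (hφ.continuousOn_packet hl r).mono fun t ht => ?_
    exact (ne_zero_of_mem_shell (by linarith [width_le hl]) ht.2).2.2
  exact h.lintegral_prod_right'

include hφ in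
theorem PhaseSmoothHomog.aemeasurable_majorant_left {lam : ℝ} (hl : 1 ≤ lam) (r : ℝ) (y : Rn n) :
    AEMeasurable (fun x => majorant φ lam r x y) volume := by
  have h := hφ.aemeasurable_packet hl r (s := width lam) (by linarith [width_le hl])
    MeasurableSet.univ (c := fun x => (x, y)) (by fun_prop)
  rw [restrict_univ] at h
  exact h.lintegral_prod_right'

include hφ in
theorem PhaseSmoothHomog.aemeasurable_majorant_right {lam : ℝ} (hl : 1 ≤ lam) (r : ℝ) (x : Rn n) :
    AEMeasurable (fun y => majorant φ lam r x y) volume := by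
  have h := hφ.aemeasurable_packet hl r (s := width lam) (by linarith [width_le hl])
    MeasurableSet.univ (c := fun y => (x, y)) (by fun_prop)
  rw [restrict_univ] at h
  exact h.lintegral_prod_right'

include hφ in
theorem PhaseSmoothHomog.lintegral_majorant_right (hn : 1 ≤ n) {r : ℝ} (hr : n < r) : ∃ C : ℝ≥0, ∀
    lam : ℝ, 1 ≤ lam → ∀ x : Rn n,
    ∫⁻ y, majorant φ lam r x y ≤ C * ofR (lam ^ (-(n / 2) - 1 : ℝ)) := by
  obtain ⟨C, hC⟩ := hφ.lintegral_packet_right hn hr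
  refine ⟨C * Real.toNNReal ((64⁻¹ : ℝ) ^ (2 - 2 * n + n * 1 : ℝ)), fun lam hl x => ?_⟩
  refine (hC lam hl (width lam) (width_pos hl) (by linarith [width_le hl]) x).trans ?_
  have := width_rpow_identity hn 1 hl
  simp only [sub_self, Real.rpow_zero, one_mul] at this
  rw [this, ofR_mul (by positivity), coe_mul, mul_assoc, mul_one (n : ℝ)]
  rfl

include hφ in
theorem PhaseSmoothHomog.lintegral_majorant_rpow_left (hn : 1 ≤ n) (hQ : IsCompact Q)
    (hnd : MixedNonDeg φ Q) {p r : ℝ} (hp : 0 < p) (hp1 : p ≤ 1) (hr : n < r * p) : ∃ C : ℝ≥0, ∀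
    lam : ℝ, 1 ≤ lam → ∀ y : Rn n, ∫⁻ x in Q, majorant φ lam r x y ^ p ≤ C * ofR
    (lam ^ (-(n * p / 2) - 1 : ℝ)) := by
  have hr0 : 0 ≤ r := by
    by_contra h
    have : (0 : ℝ) ≤ n := by positivity
    nlinarith
  obtain ⟨B, hB0, hB⟩ := hφ.packet_slowly_varying hQ hr0
  obtain ⟨C, hC⟩ := hφ.lintegral_packet_left hn hQ hnd hr
  lift B to ℝ≥0 using hB0
  set V := volume (ball (0 : Rn n) 1) with hV
  have hV0 : V ≠ 0 := (Metric.measure_ball_pos _ _ one_pos).ne'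
  have hVt : V ≠ ∞ := measure_ball_lt_top.ne
  set D : ℝ≥0 := (((B : ℝ≥0∞) ^ p * V⁻¹) ^ (1 - p)).toNNReal with hD
  have hDt : ((B : ℝ≥0∞) ^ p * V⁻¹) ^ (1 - p) ≠ ∞ := rpow_ne_top_of_nonneg (by linarith) (mul_ne_top
      (rpow_ne_top_of_nonneg hp.le coe_ne_top) (inv_ne_top.mpr hV0))
  refine ⟨D * C * Real.toNNReal (7 / 6) *
    Real.toNNReal ((64⁻¹ : ℝ) ^ (2 - 2 * n + n * p : ℝ)), fun lam hl y => ?_⟩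
  have hw := width_pos hl
  have hw1 := width_le hl
  have key : ∀ x ∈ Q, majorant φ lam r x y ^ p ≤ (D * ofR ((((width lam) ^ n)⁻¹) ^ (1 - p))) *
        ∫⁻ w in shell n (7 / 6 * width lam), ofR (packet φ lam (r * p) x y w) := by
    intro x hx
    refine (lintegral_rpow_le_of_slowly_varying (S' := shell n (7 / 6 * width lam)) (C := B)
      (isClosed_shell _).measurableSet hw hp hp1
      fun w hws w' hww => ⟨?_, ?_⟩).trans (le_of_eq ?_)
    · have h1 : |‖w‖ - 1| ≤ 6 * width lam := hws
      have h2 := abs_norm_sub_norm_le w' w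
      show |‖w'‖ - 1| ≤ 6 * (7 / 6 * width lam)
      rw [abs_le] at *
      constructor <;> linarith
    · rw [← ofReal_coe_nnreal, ← ofR_mul (NNReal.coe_nonneg B)]
      exact ofR_le_ofR (hB lam hl x hx y w w' hws hww)
    · congr 1
      · rw [hD, coe_toNNReal hDt, ← ofReal_rpow_of_nonneg (by positivity)
          (by linarith), ← mul_rpow_of_nonneg _ _ (by linarith),
          ENNReal.mul_inv (Or.inr hVt) (Or.inr hV0), ENNReal.ofReal_inv_of_pos (by positivity)]
        congr 1; ring
      · refine lintegral_congr fun w => ?_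
        rw [ofReal_rpow_of_nonneg (packet_nonneg φ hl r x y w) hp.le]
        congr 1
        rw [packet, packet, ← rpow_mul]
        · ring_nf
        · have := aniso_nonneg hw.le w (gradPhase φ x w - y)
          nlinarith
  calc ∫⁻ x in Q, majorant φ lam r x y ^ p
      ≤ ∫⁻ x in Q, (D * ofR ((((width lam) ^ n)⁻¹) ^ (1 - p))) *
        ∫⁻ w in shell n (7 / 6 * width lam), ofR (packet φ lam (r * p) x y w) :=
        setLIntegral_mono' hQ.measurableSet key
    _ = (D * ofR ((((width lam) ^ n)⁻¹) ^ (1 - p))) * ∫⁻ x in Q,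
        ∫⁻ w in shell n (7 / 6 * width lam), ofR (packet φ lam (r * p) x y w) :=
        lintegral_const_mul' _ _ (mul_ne_top coe_ne_top ofR_ne_top)
    _ ≤ (D * ofR ((((width lam) ^ n)⁻¹) ^ (1 - p))) * (C * ofR
          (7 / 6 * width lam * (lam ^ n * width lam ^ (n - 1))⁻¹)) :=
        mul_le_mul' le_rfl (hC lam hl _ (by positivity) (by linarith) y)
    _ = D * C * ofR (7 / 6) * ofR ((((width lam) ^ n)⁻¹) ^ (1 - p) *
          (width lam * (lam ^ n * width lam ^ (n - 1))⁻¹)) := by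
        rw [mul_assoc (7 / 6 : ℝ), ofR_mul (show (0 : ℝ) ≤ 7 / 6 by norm_num),
          ofR_mul (show (0 : ℝ) ≤ (((width lam) ^ n)⁻¹) ^ (1 - p) by positivity)]
        ring
    _ = _ := by
        rw [width_rpow_identity hn p hl, ofR_mul (by positivity)]
        simp only [coe_mul, mul_assoc]
        rfl

theorem majorant_le_of_packet_le {lam r : ℝ} {A : ℝ} (hA : 0 ≤ A) {x y x' y' : Rn n}
    (h : ∀ w ∈ shell n (width lam), packet φ lam r x y w ≤ A * packet φ lam r x' y' w) :
    majorant φ lam r x y ≤ ofR A * majorant φ lam r x' y' := by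
  rw [majorant, majorant, ← lintegral_const_mul' _ _ ofR_ne_top]
  refine setLIntegral_mono' (isClosed_shell _).measurableSet fun w hw => ?_
  rw [← ofR_mul hA]
  exact ofR_le_ofR (h w hw)

theorem aniso_le_add {ε : ℝ} (hε0 : 0 ≤ ε) (hε1 : ε ≤ 1) {w : Rn n} (hw : ‖w‖ ≤ 3) (u v : Rn n) :
    aniso ε w u ≤ aniso ε w v + 4 * ‖u - v‖ := by
  have h1 : |⟪w, u⟫_ℝ| ≤ |⟪w, v⟫_ℝ| + 3 * ‖u - v‖ := by
    have e : ⟪w, u⟫_ℝ = ⟪w, v⟫_ℝ + ⟪w, u - v⟫_ℝ := by rw [inner_sub_right]; ring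
    rw [e]
    refine (abs_add_le _ _).trans (add_le_add_right ?_ _)
    exact (abs_real_inner_le_norm _ _).trans (mul_le_mul_of_nonneg_right hw (norm_nonneg _))
  have h2 : ‖u‖ ≤ ‖v‖ + ‖u - v‖ := by simpa using norm_add_le v (u - v)
  have h3 := mul_le_mul_of_nonneg_left h2 hε0
  have h4 := mul_le_mul_of_nonneg_right hε1 (norm_nonneg (u - v))
  unfold aniso
  linarith

theorem majorant_le_right {lam r : ℝ} (hl : 1 ≤ lam) (hr : 0 ≤ r) (x y y' : Rn n) : majorant φ lam r
    x y ≤ ofR ((4 * (1 + lam * ‖y - y'‖)) ^ r) * majorant φ lam r x y' := by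
  have hl0 : 0 < lam := by linarith
  refine majorant_le_of_packet_le (by positivity) fun w hw => ?_
  have hw1 := width_le hl
  have hw3 := (ne_zero_of_mem_shell (by linarith) hw).2.1
  have hd : 0 ≤ lam * ‖y - y'‖ := by positivity
  refine packet_le_packet hl hr (by linarith) ?_
  have h := aniso_le_add (width_pos hl).le (by linarith) hw3 (gradPhase φ x w - y')
    (gradPhase φ x w - y)
  have e : gradPhase φ x w - y' - (gradPhase φ x w - y) = y - y' := by abel
  rw [e] at h
  have h1 := aniso_nonneg (width_pos hl).le w (gradPhase φ x w - y)
  have h2 : 4 * ‖y - y'‖ ≤ (4 * (1 + lam * ‖y - y'‖) - 1) / lam := by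
    rw [le_div_iff₀ hl0]; linarith
  nlinarith

include hφ in
theorem PhaseSmoothHomog.majorant_le_left {r : ℝ} (hr : 0 ≤ r) (R : ℝ) : ∃ C : ℝ, 0 ≤ C ∧ ∀ lam : ℝ,
    1 ≤ lam → ∀ x ∈ closedBall (0 : Rn n) R, ∀ z ∈ closedBall (0 : Rn n) R, ∀ y, majorant φ lam r z
    y ≤ ofR (C * (1 + lam * ‖x - z‖) ^ r) * majorant φ lam r x y := by
  obtain ⟨B, hB0, hB⟩ := hφ.exists_lipschitz_left R
  refine ⟨(1 + 4 * B) ^ r, by positivity, fun lam hl x hx z hz y => ?_⟩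
  have hl0 : 0 < lam := by linarith
  rw [← mul_rpow (by positivity) (by positivity)]
  refine majorant_le_of_packet_le (by positivity) fun w hw => ?_
  have hw1 := width_le hl
  have hw3 := ne_zero_of_mem_shell (by linarith) hw
  have hd : 0 ≤ lam * ‖x - z‖ := by positivity
  have hA : 1 ≤ (1 + 4 * B) * (1 + lam * ‖x - z‖) := by nlinarith
  refine packet_le_packet hl hr hA ?_
  have h := aniso_le_add (width_pos hl).le (by linarith) hw3.2.1 (gradPhase φ x w - y)
    (gradPhase φ z w - y)
  rw [sub_sub_sub_cancel_right] at h
  have h1 := aniso_nonneg (width_pos hl).le w (gradPhase φ z w - y)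
  have h3 := hB x hx z hz w ⟨by linarith [hw3.1], by linarith [hw3.2.1]⟩
  have h2 : 4 * (B * ‖x - z‖) ≤ ((1 + 4 * B) * (1 + lam * ‖x - z‖) - 1) / lam := by
    rw [le_div_iff₀ hl0]; nlinarith
  nlinarith

section Schur

variable {α β : Type*} [MeasurableSpace α] [MeasurableSpace β] {μ : Measure α} {ν : Measure β}
  [SFinite μ] [SFinite ν]

theorem lintegral_sq_le_of_kernel {w : α → ℝ} (hw0 : ∀ x, 0 ≤ w x) (hw : Integrable w μ)
    {B : α × β → ℂ} (hB : Measurable B) {M : ℝ} (hBM : ∀ z, ‖B z‖ ≤ M) {h : β → ℂ}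
    (hh : Integrable h ν) : ∫⁻ x, ofR (w x) * ‖∫ η, B (x, η) * h η ∂ν‖ₑ ^ 2 ∂μ ≤ ∫⁻ η, ∫⁻ η', ‖∫ x,
    (w x : ℂ) * (B (x, η) * starRingEnd ℂ (B (x, η'))) ∂μ‖ₑ * (‖h η‖ₑ * ‖h η'‖ₑ) ∂ν ∂ν := by
  set Sh : α → ℂ := fun x => ∫ η, B (x, η) * h η ∂ν with hSh
  set F : α × (β × β) → ℂ := fun z => (w z.1 : ℂ) *
    ((B (z.1, z.2.1) * h z.2.1) * starRingEnd ℂ (B (z.1, z.2.2) * h z.2.2)) with hF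
  have hhh : Integrable (fun z : β × β => h z.1 * starRingEnd ℂ (h z.2)) (ν.prod ν) :=
    hh.mul_prod ((conjCLE : ℂ →L[ℝ] ℂ).integrable_comp hh)
  have hwc : Integrable (fun x => (w x : ℂ)) μ := hw.ofReal
  have hFi : Integrable F (μ.prod (ν.prod ν)) := by
    have h0 : Integrable (fun z : α × (β × β) => ((w z.1 : ℂ)) *
      (h z.2.1 * starRingEnd ℂ (h z.2.2))) (μ.prod (ν.prod ν)) := hwc.mul_prod hhh
    have h1 : Integrable (fun z : α × (β × β) => (B (z.1, z.2.1) * starRingEnd ℂ (B (z.1, z.2.2))) *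
        (((w z.1 : ℂ)) * (h z.2.1 * starRingEnd ℂ (h z.2.2)))) (μ.prod (ν.prod ν)) := by
      refine h0.bdd_mul (c := M * M) ((hB.comp (by fun_prop)).mul
        (Complex.continuous_conj.measurable.comp (hB.comp (by fun_prop)))).aestronglyMeasurable (.of_forall fun z => ?_)
      have := hBM (z.1, z.2.1)
      rw [norm_mul, RCLike.norm_conj]
      exact mul_le_mul this (hBM _) (norm_nonneg _) ((norm_nonneg _).trans this)
    refine h1.congr (.of_forall fun z => ?_)
    simp only [hF, map_mul]
    ring
  have hin : ∀ x, ∫ z, F (x, z) ∂(ν.prod ν) = ((w x * ‖Sh x‖ ^ 2 : ℝ) : ℂ) := by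
    intro x
    simp only [hF]
    rw [integral_const_mul, integral_prod_mul (fun η => B (x, η) * h η)
      (fun η => starRingEnd ℂ (B (x, η) * h η)), integral_conj]
    change (w x : ℂ) * (Sh x * starRingEnd ℂ (Sh x)) = _
    push_cast
    rw [Complex.mul_conj, Complex.normSq_eq_norm_sq]
    push_cast; rfl
  have hint : Integrable (fun x => ∫ z, F (x, z) ∂(ν.prod ν)) μ := hFi.integral_prod_left
  have hreal : Integrable (fun x => w x * ‖Sh x‖ ^ 2) μ := by
    have := hint.re
    refine this.congr (.of_forall fun x => ?_)
    simp only [hin]; exact Complex.ofReal_re _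
  have e1 : ∫⁻ x, ofR (w x) * ‖Sh x‖ₑ ^ 2 ∂μ = ofR (∫ x, w x * ‖Sh x‖ ^ 2 ∂μ) := by
    rw [ofReal_integral_eq_lintegral_ofReal hreal
      (.of_forall fun x => mul_nonneg (hw0 x) (by positivity))]
    refine lintegral_congr fun x => ?_
    rw [ofR_mul (hw0 x), ofR_pow (norm_nonneg _), ofReal_norm]
  have e2 : ((∫ x, w x * ‖Sh x‖ ^ 2 ∂μ : ℝ) : ℂ) = ∫ z, ∫ x, F (x, z) ∂μ ∂(ν.prod ν) := by
    rw [← integral_integral_swap hFi, ← integral_complex_ofReal]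
    exact integral_congr_ae (.of_forall fun x => (hin x).symm)
  have hnn : 0 ≤ ∫ x, w x * ‖Sh x‖ ^ 2 ∂μ :=
    integral_nonneg fun x => mul_nonneg (hw0 x) (by positivity)
  have e3 : ofR (∫ x, w x * ‖Sh x‖ ^ 2 ∂μ) = ‖∫ z, ∫ x, F (x, z) ∂μ ∂(ν.prod ν)‖ₑ := by
    rw [← e2, ← ofReal_norm, norm_real, norm_of_nonneg hnn]
  have hms : AEMeasurable (fun z => ‖∫ x, F (x, z) ∂μ‖ₑ) (ν.prod ν) :=
    hFi.integral_prod_right.aestronglyMeasurable.enorm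
  rw [e1, e3]
  refine (enorm_integral_le_lintegral_enorm _).trans ?_
  rw [lintegral_prod _ hms]
  refine lintegral_mono fun η => lintegral_mono fun η' => ?_
  have : ∫ x, F (x, (η, η')) ∂μ = (∫ x, (w x : ℂ) * (B (x, η) * starRingEnd ℂ (B (x, η'))) ∂μ) *
      (h η * starRingEnd ℂ (h η')) := by
    rw [← integral_mul_const]
    refine integral_congr_ae (.of_forall fun x => ?_)
    simp only [hF, map_mul]
    ring
  rw [this, enorm_mul, enorm_mul, RCLike.enorm_conj]

theorem lintegral_lintegral_conv_mul_le {k f : Rn n → ℝ≥0∞} (hk : Measurable k)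
    (hf : AEMeasurable f volume) :
    ∫⁻ x, ∫⁻ y, k (x - y) * (f x * f y) ≤ 2 * (∫⁻ x, k x) * ∫⁻ x, f x ^ 2 := by
  have hf2 : AEMeasurable (fun x => f x ^ 2) volume := hf.pow_const 2
  have hfm : ∀ a b : ℝ≥0∞, a * b ≤ a ^ 2 + b ^ 2 := by
    intro a b
    rcases le_total a b with h | h
    · calc a * b ≤ b * b := mul_le_mul' h le_rfl
        _ = b ^ 2 := (sq b).symm
        _ ≤ _ := le_add_self
    · calc a * b ≤ a * a := mul_le_mul' le_rfl h
        _ = a ^ 2 := (sq a).symm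
        _ ≤ _ := le_self_add
  have i1 : ∀ x, ∫⁻ y, k (x - y) = ∫⁻ y, k y := fun x => lintegral_sub_left_eq_self k x
  have i2 : ∀ y, ∫⁻ x, k (x - y) = ∫⁻ x, k x := fun y => lintegral_sub_right_eq_self k y
  have m1 : AEMeasurable (fun z : ℝ²ⁿ n => k (z.1 - z.2) * f z.2 ^ 2) (volume.prod volume) :=
    (hk.comp (by fun_prop : Measurable fun z : ℝ²ⁿ n => z.1 - z.2)).aemeasurable.mul
      (hf2.comp_quasiMeasurePreserving Measure.quasiMeasurePreserving_snd)
  have hkx : ∀ x, Measurable (fun y => k (x - y)) := fun x => hk.comp (by fun_prop)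
  have hky : ∀ y, Measurable (fun x => k (x - y)) := fun y => hk.comp (by fun_prop)
  calc ∫⁻ x, ∫⁻ y, k (x - y) * (f x * f y)
      ≤ ∫⁻ x, (f x ^ 2 * (∫⁻ y, k y) + ∫⁻ y, k (x - y) * f y ^ 2) := by
        refine lintegral_mono fun x => ?_
        rw [← i1 x, mul_comm (f x ^ 2), ← lintegral_mul_const _ (hkx x),
          ← lintegral_add_left ((hkx x).mul_const _)]
        refine lintegral_mono fun y => ?_
        rw [← mul_add]
        exact mul_le_mul' le_rfl (hfm _ _)
    _ = (∫⁻ x, f x ^ 2 * (∫⁻ y, k y)) + ∫⁻ x, ∫⁻ y, k (x - y) * f y ^ 2 :=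
        lintegral_add_left' (hf2.mul_const _) _
    _ = 2 * (∫⁻ x, k x) * ∫⁻ x, f x ^ 2 := by
        rw [lintegral_lintegral_swap m1, lintegral_mul_const'' _ hf2]
        have : ∀ y, ∫⁻ x, k (x - y) * f y ^ 2 = (∫⁻ x, k x) * f y ^ 2 := fun y => by
          rw [lintegral_mul_const _ (hky y), i2]
        simp_rw [this]
        rw [lintegral_const_mul'' _ hf2]
        ring

end Schur

theorem UBdd.difference_quotient
    {f : P × E → F} (hf : ContDiff ℝ C∞ f) {B : Set P} (hB : IsCompact B) (hBc : Convex ℝ B)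
    {Q : Set E} (hQ : IsCompact Q) : UBdd (fun _ : {z : P × P // z.1 ∈ B ∧ z.2 ∈ B} => Q)
    (fun j x => ‖j.1.1 - j.1.2‖⁻¹ • (f (j.1.1, x) - f (j.1.2, x))) := by
  have hs : ∀ q : P, ContDiff ℝ C∞ (fun x => f (q, x)) := fun q => hf.comp (contDiff_prodMk_right q)
  refine ⟨fun j x _ => ((hs _).sub (hs _)).const_smul _ |>.contDiffAt, fun k => ?_⟩
  have hg := hf.iteratedFDeriv_param k
  obtain ⟨C, hC0, hC⟩ := (UBdd.of_isCompact (ι := Unit) (hB.prod hQ)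
    (fun z _ => hg.contDiffAt)).fderiv.norm_le
  refine ⟨C, fun j x hx => ?_⟩
  rw [iteratedFDeriv_const_smul_apply' (((hs _).sub (hs _)).contDiffAt.of_le (by exact_mod_cast le_top)),
    fun_iteratedFDeriv_sub_apply ((hs _).contDiffAt.of_le (by exact_mod_cast le_top))
      ((hs _).contDiffAt.of_le (by exact_mod_cast le_top)), norm_smul,
    norm_inv, norm_norm]
  have hd : ∀ q : P, HasFDerivAt (fun q => iteratedFDeriv ℝ k (fun x => f (q, x)) x)
      ((fderiv ℝ (fun z : P × E => iteratedFDeriv ℝ k (fun x => f (z.1, x)) z.2)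
        (q, x)).comp (inl ℝ P E)) q := fun q =>
    HasFDerivAt.comp (g := fun z : P × E => iteratedFDeriv ℝ k (fun x => f (z.1, x)) z.2)
      (f := fun q : P => (q, x)) q ((hg.differentiable (by simp)) (q, x)).hasFDerivAt
      (hasFDerivAt_prodMk_left (𝕜 := ℝ) q x)
  have h1 := hBc.norm_image_sub_le_of_norm_hasFDerivWithin_le (C := C)
    (fun q _ => (hd q).hasFDerivWithinAt)
    (fun q hq => by
      refine (opNorm_comp_le _ _).trans ?_
      have h1 := hC () (q, x) ⟨hq, hx⟩
      have h2 := norm_inl_le_one ℝ P E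
      exact (mul_le_mul h1 h2 (norm_nonneg _) hC0.le).trans_eq (mul_one C)) j.2.2 j.2.1
  by_cases h0 : ‖j.1.1 - j.1.2‖ = 0
  · rw [h0]; simp [hC0.le]
  · rw [inv_mul_le_iff₀ (lt_of_le_of_ne (norm_nonneg _) (Ne.symm h0)), mul_comm]
    exact h1

theorem norm_integral_le_of_support {E F : Type*} [MeasurableSpace E] {μ : Measure E}
    [NormedAddCommGroup F] [NormedSpace ℝ F] {f : E → F} {Q : Set E} (hQ : μ Q < ∞) {M : ℝ}
    (h0 : ∀ x ∉ Q, f x = 0) (hM : ∀ x, ‖f x‖ ≤ M) : ‖∫ x, f x ∂μ‖ ≤ M * μ.real Q := by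
  rw [← setIntegral_eq_integral_of_forall_compl_eq_zero h0]
  exact norm_setIntegral_le_of_norm_le_const hQ fun x _ => hM x

include hφ in
theorem PhaseSmoothHomog.fderiv_left {x w : Rn n} (hw : w ≠ 0) : fderiv ℝ (fun x' => φ x' w) x =
    (fderiv ℝ (fun p : ℝ²ⁿ n => φ p.1 p.2) (x, w)).comp (inl ℝ (Rn n) (Rn n)) := by
  have h1 := ((hφ.contDiffAt (z := (x, w)) hw).differentiableAt (by simp)).hasFDerivAt
  exact (HasFDerivAt.comp (g := fun p : ℝ²ⁿ n => φ p.1 p.2)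
    (f := fun x' : Rn n => (x', w)) x h1 (hasFDerivAt_prodMk_left (𝕜 := ℝ) x w)).fderiv

include hφ in
theorem PhaseSmoothHomog.fderiv_right {x w : Rn n} (hw : w ≠ 0) : fderiv ℝ (φ x) w =
    (fderiv ℝ (fun p : ℝ²ⁿ n => φ p.1 p.2) (x, w)).comp (inr ℝ (Rn n) (Rn n)) := by
  have h1 := ((hφ.contDiffAt (z := (x, w)) hw).differentiableAt (by simp)).hasFDerivAt
  exact (HasFDerivAt.comp (g := fun p : ℝ²ⁿ n => φ p.1 p.2)
    (f := fun w' : Rn n => (x, w')) w h1 (hasFDerivAt_prodMk_right (𝕜 := ℝ) x w)).fderiv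

include hφ in
theorem PhaseSmoothHomog.exists_le_norm_fderiv_left_sub_at {z : ℝ²ⁿ n} (hz : z.2 ≠ 0)
    (hd : mixedDet φ z.1 z.2 ≠ 0) : ∃ c, 0 < c ∧ ∃ U ∈ nhds z, ∀ x w w', (x, w) ∈ U → (x, w') ∈ U →
    c * ‖w - w'‖ ≤ ‖fderiv ℝ (fun x' => φ x' w) x - fderiv ℝ (fun x' => φ x' w') x‖ := by
  set Φ : ℝ²ⁿ n → ℝ := fun p => φ p.1 p.2 with hΦ
  have hs : ContDiffAt ℝ C∞ (fderiv ℝ Φ) z := (hφ.contDiffAt hz).fderiv_right (by simp)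
  set G : ℝ²ⁿ n → (Rn n →L[ℝ] ℝ) := fun p => (fderiv ℝ Φ p).comp (inl ℝ (Rn n) (Rn n)) with hG
  have hGs : ContDiffAt ℝ C∞ G z := hs.clm_comp contDiffAt_const
  have hG' := (hGs.hasStrictFDerivAt (by simp))
  have hGd : ∀ v u, fderiv ℝ G z v u = fderiv ℝ (fderiv ℝ Φ) z v (u, 0) := by
    intro v u
    have h1 := (hs.differentiableAt (by simp)).hasFDerivAt.clm_comp
      (hasFDerivAt_const (inl ℝ (Rn n) (Rn n)) z)
    rw [h1.fderiv]
    simp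
  have hsymm : IsSymmSndFDerivAt ℝ Φ z := (hφ.contDiffAt hz).isSymmSndFDerivAt
    (by simpa using! WithTop.coe_le_coe.mpr (le_top (a := (2 : ℕ∞))))
  have hgd : ∀ u v, ⟪fderiv ℝ (fun x' => gradPhase φ x' z.2) z.1 u, v⟫_ℝ =
      fderiv ℝ (fderiv ℝ Φ) z (u, 0) (0, v) := by
    intro u v
    have h1 := ((hφ.contDiffAt_gradPhase_left z.1 hz).differentiableAt (by simp)).hasFDerivAt
    have h2 : HasFDerivAt (fun x' => fderiv ℝ Φ (x', z.2))
        ((fderiv ℝ (fderiv ℝ Φ) z).comp (inl ℝ (Rn n) (Rn n))) z.1 :=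
      HasFDerivAt.comp (g := fderiv ℝ Φ) (f := fun x' : Rn n => (x', z.2)) z.1
        (hs.differentiableAt (by simp)).hasFDerivAt (hasFDerivAt_prodMk_left (𝕜 := ℝ) z.1 z.2)
    have h3 := (((innerSL ℝ v).hasFDerivAt.comp z.1 h1).unique (((ContinuousLinearMap.apply ℝ ℝ
      ((0, v) : ℝ²ⁿ n)).hasFDerivAt.comp z.1 h2).congr_of_eventuallyEq (.of_forall fun x' => ?_)))
    · have := DFunLike.congr_fun h3 u
      rw [real_inner_comm]
      simpa using this
    · simp only [Function.comp, innerSL_apply_apply, apply_apply]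
      rw [real_inner_comm, inner_gradPhase, hφ.fderiv_right hz]
      simp [hΦ]
  obtain ⟨c, hc, U, hU, h⟩ := hG'.eventually_le_norm_sub (fun v hv => by
    have hker : ∀ u, ⟪fderiv ℝ (fun x' => gradPhase φ x' z.2) z.1 u, v⟫_ℝ = 0 := fun u => by
      rw [hgd, hsymm.eq, ← hGd, hv]; rfl
    obtain ⟨u, hu⟩ : ∃ u, fderiv ℝ (fun x' => gradPhase φ x' z.2) z.1 u = v := by
      have hu : IsUnit (LinearMap.det
        (fderiv ℝ (fun x' => gradPhase φ x' z.2) z.1 : Rn n →ₗ[ℝ] Rn n)) :=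
        isUnit_iff_ne_zero.mpr hd
      exact ⟨(LinearEquiv.ofIsUnitDet (v := Module.finBasis ℝ (Rn n))
        (v' := Module.finBasis ℝ (Rn n)) (f := (fderiv ℝ (fun x' => gradPhase φ x' z.2) z.1 :
          Rn n →ₗ[ℝ] Rn n)) (by rwa [LinearMap.det_toMatrix])).symm v,
        (LinearEquiv.ofIsUnitDet (v := Module.finBasis ℝ (Rn n))
          (v' := Module.finBasis ℝ (Rn n)) _).apply_symm_apply v⟩
    have := hker u
    rw [hu] at this
    exact inner_self_eq_zero.mp this)
  refine ⟨c, hc, U ∩ {p | p.2 ≠ 0}, Filter.inter_mem hU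
    ((continuous_snd.continuousAt (x := z)).eventually_ne hz), fun x w w' hw hw' => ?_⟩
  rw [hφ.fderiv_left hw.2, hφ.fderiv_left hw'.2]
  exact h x w w' hw.1 hw'.1

include hφ hQ hnd in
theorem PhaseSmoothHomog.exists_le_norm_fderiv_left_sub {w0 : Rn n} (hw0 : w0 ≠ 0) : ∃ c, 0 < c ∧ ∃
    ρ, 0 < ρ ∧ ∀ x ∈ Q, ∀ w ∈ ball w0 ρ, ∀ w' ∈ ball w0 ρ, c * ‖w - w'‖ ≤ ‖fderiv ℝ
    (fun x' => φ x' w) x - fderiv ℝ (fun x' => φ x' w') x‖ := by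
  refine hQ.induction_on (p := fun Q => ∃ c, 0 < c ∧ ∃ ρ, 0 < ρ ∧ ∀ x ∈ Q,
    ∀ w ∈ ball w0 ρ, ∀ w' ∈ ball w0 ρ,
      c * ‖w - w'‖ ≤ ‖fderiv ℝ (fun x' => φ x' w) x - fderiv ℝ (fun x' => φ x' w') x‖)
    ⟨1, one_pos, 1, one_pos, by simp⟩ ?_ ?_ ?_
  · rintro s t hst ⟨c, hc, ρ, hρ, h⟩
    exact ⟨c, hc, ρ, hρ, fun x hx => h x (hst hx)⟩
  · rintro s t ⟨c, hc, ρ, hρ, h⟩ ⟨c', hc', ρ', hρ', h'⟩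
    refine ⟨min c c', lt_min hc hc', min ρ ρ', lt_min hρ hρ', fun x hx w hw w' hw' => ?_⟩
    have hwa := ball_subset_ball (min_le_left ρ ρ') hw
    have hwa' := ball_subset_ball (min_le_left ρ ρ') hw'
    have hwb := ball_subset_ball (min_le_right ρ ρ') hw
    have hwb' := ball_subset_ball (min_le_right ρ ρ') hw'
    rcases hx with hx | hx
    · exact (mul_le_mul_of_nonneg_right (min_le_left _ _) (norm_nonneg _)).trans
        (h x hx w hwa w' hwa')
    · exact (mul_le_mul_of_nonneg_right (min_le_right _ _) (norm_nonneg _)).trans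
        (h' x hx w hwb w' hwb')
  · intro x0 hx0
    obtain ⟨c, hc, U, hU, h⟩ := hφ.exists_le_norm_fderiv_left_sub_at (z := (x0, w0)) hw0
      (hnd x0 hx0 w0 hw0)
    obtain ⟨A, hA, W, hW, hAW⟩ := mem_nhds_prod_iff.mp hU
    obtain ⟨ρ, hρ, hρW⟩ := Metric.mem_nhds_iff.mp hW
    exact ⟨A, mem_nhdsWithin_of_mem_nhds hA, c, hc, ρ, hρ, fun x hx w hw w' hw' =>
      h x w w' (hAW ⟨hx, hρW hw⟩) (hAW ⟨hx, hρW hw'⟩)⟩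

include hφ hQ in
theorem PhaseSmoothHomog.ubdd_difference_quotient {w0 : Rn n} (hw0 : w0 ≠ 0) : UBdd
    (fun _ : {z : ℝ²ⁿ n // z.1 ∈ closedBall w0 (‖w0‖ / 4) ∧ z.2 ∈ closedBall w0 (‖w0‖ / 4)} => Q)
    (fun j x => ‖j.1.1 - j.1.2‖⁻¹ • (φ x j.1.1 - φ x j.1.2)) := by
  have h0 : 0 < ‖w0‖ := norm_pos_iff.mpr hw0
  let χ : ContDiffBump w0 := ⟨‖w0‖ / 4, ‖w0‖ / 2, by positivity, by linarith⟩
  have hf : ContDiff ℝ C∞ (fun z : ℝ²ⁿ n => χ z.1 * φ z.2 z.1) := by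
    rw [contDiff_iff_contDiffAt]
    intro z
    by_cases hz : z.1 = 0
    · have h1 : ∀ᶠ y : ℝ²ⁿ n in nhds z, ‖y.1‖ < ‖w0‖ / 4 :=
        (continuous_fst.norm.continuousAt).eventually_lt continuousAt_const
          (by simp only [hz, norm_zero]; positivity)
      refine (contDiffAt_const (c := (0 : ℝ))).congr_of_eventuallyEq ?_
      filter_upwards [h1] with y hy
      rw [χ.zero_of_le_dist, zero_mul]
      have h2 := norm_sub_norm_le w0 y.1
      rw [dist_comm, dist_eq_norm]
      change ‖w0‖ / 2 ≤ _
      linarith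
    · exact ((χ.contDiff.comp contDiff_fst).contDiffAt).mul
        (ContDiffAt.comp (g := fun p : ℝ²ⁿ n => φ p.1 p.2)
          (f := fun z : ℝ²ⁿ n => (z.2, z.1)) z (hφ.contDiffAt (z := (z.2, z.1)) hz)
          (contDiff_snd.prodMk contDiff_fst).contDiffAt)
  have h := UBdd.difference_quotient hf (isCompact_closedBall w0 (‖w0‖ / 4))
    (convex_closedBall _ _) hQ
  convert h using 5 with j x
  · rw [χ.one_of_mem_closedBall j.2.1, one_mul]
  · rw [χ.one_of_mem_closedBall j.2.2, one_mul]

include hQ hb in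
theorem SuppUBdd.gram_symbol {κ : Type*} (r : κ → ι) (η η' : κ → Rn n) : SuppUBdd (fun _ : κ => Q)
    (fun k x => b (r k) (x, η k) * starRingEnd ℂ (b (r k) (x, η' k))) := by
  refine ⟨?_, fun _ => hQ.isClosed, fun k x hx => ?_⟩
  · exact (hb.univ.freeze_right r η fun _ _ _ => mem_univ _).mul
      ((hb.univ.freeze_right r η' fun _ _ _ => mem_univ _).clm_comp (conjCLE : ℂ →L[ℝ] ℂ))
  · rw [hb.eq_zero (r k) (x, η k) fun h => hx h.1, zero_mul]

theorem oscAmp_mul_conj (φ : Rn n → Rn n → ℝ) (b : ℝ²ⁿ n → ℂ) (lam : ℝ) (x η η' : Rn n) : oscAmp φ b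
    lam (x, η) * starRingEnd ℂ (oscAmp φ b lam (x, η')) = b (x, η) * starRingEnd ℂ (b (x, η')) *
    𝐞(lam * (φ x η - φ x η')) := by
  simp only [oscAmp, map_mul, ← exp_conj, conj_I, conj_ofReal]
  rw [mul_mul_mul_comm, ← exp_add]
  congr 2
  push_cast
  ring

include hφ hQ hnd hb in
theorem SuppUBdd.gram_decay {w0 : Rn n} (hw0 : w0 ≠ 0) (N : ℕ) : ∃ ρ, 0 < ρ ∧ ∃ C : ℝ, 0 ≤ C ∧ ∀ i
    (lam : ℝ), ∀ η ∈ ball w0 ρ, ∀ η' ∈ ball w0 ρ, (1 + |lam| * ‖η - η'‖) ^ N * ‖∫ x, oscAmp φ (b i)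
    lam (x, η) * starRingEnd ℂ (oscAmp φ (b i) lam (x, η'))‖ ≤ C := by
  obtain ⟨c, hc, ρ, hρ, hcρ⟩ := hφ.exists_le_norm_fderiv_left_sub hQ hnd hw0
  have h0 : 0 < ‖w0‖ := norm_pos_iff.mpr hw0
  set ρ' := min ρ (‖w0‖ / 4) with hρ'
  have hball : ∀ w ∈ ball w0 ρ', w ∈ closedBall w0 (‖w0‖ / 4) := fun w hw =>
    Metric.ball_subset_closedBall (ball_subset_ball (min_le_right _ _) hw)
  let J := ι × {z : ℝ²ⁿ n // z.1 ∈ ball w0 ρ' ∧ z.2 ∈ ball w0 ρ' ∧ z.1 ≠ z.2}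
  have hu := SuppUBdd.gram_symbol hQ hb (fun j : J => j.1) (fun j => j.2.1.1) (fun j => j.2.1.2)
  have hΨ := (hφ.ubdd_difference_quotient hQ hw0).reindex
    (fun j : J => ⟨j.2.1, hball _ j.2.2.1, hball _ j.2.2.2.1⟩)
  obtain ⟨R, hR⟩ := hQ.isBounded.subset_closedBall 0
  have hΨc : ∀ j : J, ∀ x ∈ Q, c ≤ ‖fderiv ℝ
      (fun x => ‖j.2.1.1 - j.2.1.2‖⁻¹ • (φ x j.2.1.1 - φ x j.2.1.2)) x‖ := by
    rintro ⟨i, ⟨⟨η, η'⟩, h1, h2, h3⟩⟩ x hx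
    have hne : ∀ w ∈ ball w0 ρ', w ≠ 0 := by
      intro w hw hw0
      have := hball w hw
      rw [hw0, Metric.mem_closedBall, dist_comm, dist_zero_right] at this
      linarith
    have hd : ∀ w ∈ ball w0 ρ', DifferentiableAt ℝ (fun x' => φ x' w) x := fun w hw =>
      (hφ.contDiffAt_left x (hne w hw)).differentiableAt (by simp)
    dsimp only
    have hder : HasFDerivAt (fun x => ‖η - η'‖⁻¹ • (φ x η - φ x η')) _ x :=
      ((hd η h1).hasFDerivAt.sub (hd η' h2).hasFDerivAt).const_smul ‖η - η'‖⁻¹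
    rw [hder.fderiv, norm_smul, norm_inv, norm_norm]
    have hpos : 0 < ‖η - η'‖ := norm_pos_iff.mpr (sub_ne_zero.mpr h3)
    rw [le_inv_mul_iff₀ hpos, mul_comm]
    exact hcρ x hx η (ball_subset_ball (min_le_left _ _) h1) η'
      (ball_subset_ball (min_le_left _ _) h2)
  obtain ⟨C, hC0, hC⟩ := SuppUBdd.osc_decay hc (fun _ => hR) hΨ hΨc N hu
  obtain ⟨M, hM0, hM⟩ := hb.univ.norm_le
  set V := M * M * volume.real Q with hV
  have hV0 : 0 ≤ V := by positivity
  have htriv : ∀ i (lam : ℝ) η η', ‖∫ x, oscAmp φ (b i) lam (x, η) *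
        starRingEnd ℂ (oscAmp φ (b i) lam (x, η'))‖ ≤ V := by
    intro i lam η η'
    refine norm_integral_le_of_support hQ.measure_lt_top (fun x hx => ?_) fun x => ?_
    · rw [oscAmp_mul_conj]
      have hz := hb.eq_zero i (x, η) fun h => hx h.1
      rw [hz, zero_mul, zero_mul]
    · rw [oscAmp_mul_conj, norm_mul, norm_mul, norm_cexp_I_mul, mul_one, RCLike.norm_conj]
      exact mul_le_mul (hM i _ (mem_univ _)) (hM i _ (mem_univ _)) (norm_nonneg _) hM0.le
  refine ⟨ρ', lt_min hρ (by positivity), 2 ^ (N - 1) * (V + (V + C)), by positivity,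
    fun i lam η hη η' hη' => ?_⟩
  refine (mul_le_mul_of_nonneg_right (add_pow_le zero_le_one (by positivity) N)
    (norm_nonneg _)).trans ?_
  rw [mul_assoc]
  refine mul_le_mul_of_nonneg_left ?_ (by positivity)
  rw [one_pow, add_mul, one_mul]
  refine add_le_add (htriv i lam η η') ?_
  by_cases hne : η = η'
  · rcases Nat.eq_zero_or_pos N with rfl | hN
    · simp only [pow_zero, one_mul]
      exact (htriv i lam η η').trans (by linarith)
    · rw [hne, sub_self, norm_zero, mul_zero, zero_pow hN.ne', zero_mul]
      exact add_nonneg hV0 hC0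
  · have h1 := hC (i, ⟨(η, η'), hη, hη', hne⟩) (lam * ‖η - η'‖)
    rw [abs_mul, abs_norm] at h1
    refine le_trans (le_of_eq ?_) (h1.trans (le_add_of_nonneg_left hV0))
    congr 3 with x
    rw [oscAmp_mul_conj]
    congr 4
    have : ‖η - η'‖ ≠ 0 := norm_ne_zero_iff.mpr (sub_ne_zero.mpr hne)
    simp only [smul_eq_mul]
    field_simp

theorem exists_lintegral_decay_le (n : ℕ) : ∃ C : ℝ≥0, ∀ lam : ℝ, 0 < lam → ∫⁻ v : Rn n, ofR
    (((1 + lam * ‖v‖) ^ (n + 1))⁻¹) ≤ C * ofR ((lam ^ n)⁻¹) := by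
  have h1 : ∫⁻ v : Rn n, ofR (((1 + ‖v‖) ^ (n + 1))⁻¹) < ∞ := by
    have h2 := finite_integral_one_add_norm (μ := (volume : Measure (Rn n)))
      (r := ((n + 1 : ℕ) : ℝ)) (by simp)
    refine lt_of_eq_of_lt (lintegral_congr fun v => ?_) h2
    rw [rpow_neg (by positivity), rpow_natCast]
  refine ⟨(∫⁻ v : Rn n, ofR (((1 + ‖v‖) ^ (n + 1))⁻¹)).toNNReal, fun lam hl => ?_⟩
  rw [coe_toNNReal h1.ne]
  have h3 := lintegral_comp_smul_Rn (fun v : Rn n => ofR (((1 + ‖v‖) ^ (n + 1))⁻¹)) hl.ne'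
  rw [abs_of_pos (by positivity)] at h3
  rw [mul_comm, ← h3]
  refine (lintegral_congr fun v => ?_).le
  rw [norm_smul, norm_eq_abs, abs_of_pos hl]

theorem lintegral_lintegral_decay_mul_le (n : ℕ) : ∃ C : ℝ≥0, ∀ lam : ℝ, 0 < lam → ∀
    (k : Rn n → Rn n → ℝ≥0∞) (f : Rn n → ℝ≥0∞) (A : ℝ≥0∞), AEMeasurable f →
    (∀ x y, f x ≠ 0 → f y ≠ 0 → k x y ≤ A * ofR (((1 + lam * ‖x - y‖) ^ (n + 1))⁻¹)) → ∫⁻ x, ∫⁻ y, k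
    x y * (f x * f y) ≤ A * (C * ofR ((lam ^ n)⁻¹)) * ∫⁻ x, f x ^ 2 := by
  obtain ⟨C, hC⟩ := exists_lintegral_decay_le n
  refine ⟨2 * C, fun lam hl k f A hf hk => ?_⟩
  have hm : Measurable fun v : Rn n => ofR (((1 + lam * ‖v‖) ^ (n + 1))⁻¹) := by fun_prop
  calc _ ≤ ∫⁻ x, ∫⁻ y, (A * ofR (((1 + lam * ‖x - y‖) ^ (n + 1))⁻¹)) *
        (f x * f y) := by
        refine lintegral_mono fun x => lintegral_mono fun y => ?_
        by_cases hx : f x = 0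
        · simp [hx]
        by_cases hy : f y = 0
        · simp [hy]
        exact mul_le_mul' (hk x y hx hy) le_rfl
    _ ≤ _ := lintegral_lintegral_conv_mul_le (hm.const_mul A) hf
    _ ≤ _ := by
        rw [lintegral_const_mul _ hm]
        refine mul_le_mul' ?_ le_rfl
        rw [mul_left_comm]
        refine mul_le_mul' le_rfl ?_
        rw [coe_mul, mul_assoc]
        exact mul_le_mul' le_rfl (hC lam hl)

theorem ENNReal.ofReal_inv_pow_of_mul_le {t c C : ℝ} (ht : 0 < t) (hC : t * c ≤ C) :
    ofR c ≤ ofR C * ofR t⁻¹ := by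
  rw [← ENNReal.ofReal_mul' (by positivity)]
  refine ofR_le_ofR ?_
  rwa [le_mul_inv_iff₀ ht, mul_comm]

include hb in
theorem SuppUBdd.exists_norm_oscAmp_le :
    ∃ M : ℝ, 0 < M ∧ ∀ i lam z, ‖oscAmp φ (b i) lam z‖ ≤ M := by
  obtain ⟨M, hM0, hM⟩ := hb.univ.norm_le
  refine ⟨M, hM0, fun i lam z => ?_⟩
  rw [oscAmp, norm_mul, norm_cexp_I_mul, mul_one]
  exact hM i z (mem_univ _)

include hφ hQ hnd hb in
theorem SuppUBdd.lintegral_oscAmp_sq_le_at {w0 : Rn n} (hw0 : w0 ≠ 0) : ∃ ρ, 0 < ρ ∧ ∃ C : ℝ≥0, ∀ i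
    (lam : ℝ), 1 ≤ lam → ∀ h : Rn n → ℂ, Integrable h → ∫⁻ x, ‖∫ η, oscAmp φ (b i) lam (x, η) *
    (ball w0 ρ).indicator h η‖ₑ ^ 2 ≤ C * ofR ((lam ^ n)⁻¹) * ∫⁻ η, ‖h η‖ₑ ^ 2 := by
  obtain ⟨ρ, hρ, C, hC0, hC⟩ := hb.gram_decay hφ hQ hnd hw0 (n + 1)
  obtain ⟨D, hD⟩ := lintegral_lintegral_decay_mul_le n
  obtain ⟨M, hM0, hM⟩ := hb.exists_norm_oscAmp_le (φ := φ)
  refine ⟨ρ, hρ, C.toNNReal * D, fun i lam hl h hh => ?_⟩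
  have hl0 : 0 < lam := by linarith
  set B := oscAmp φ (b i) lam with hB
  have hBc : Continuous B := ((hb.amp hφ hQ lam).contDiff i).continuous
  have hBz : ∀ x ∉ Q, ∀ η, B (x, η) = 0 := fun x hx η =>
    (hb.amp hφ hQ lam).eq_zero i (x, η) fun h => hx h.1
  set g := (ball w0 ρ).indicator h with hg
  have hgi : Integrable g := hh.indicator measurableSet_ball
  have h1 := lintegral_sq_le_of_kernel (μ := (volume : Measure (Rn n))) (w := Q.indicator 1)
    (fun x => Set.indicator_nonneg (fun _ _ => zero_le_one) x)
    ((integrable_indicator_iff hQ.measurableSet).mpr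
      (integrableOn_const hQ.measure_lt_top.ne)) hBc.measurable (hM i lam) hgi
  calc _ = ∫⁻ x, ofR (Q.indicator 1 x) * ‖∫ η, B (x, η) * g η‖ₑ ^ 2 := by
        refine lintegral_congr fun x => ?_
        by_cases hx : x ∈ Q
        · simp [hx]
        · simp [hBz x hx]
    _ ≤ _ := h1
    _ ≤ ofR C * (D * ofR ((lam ^ n)⁻¹)) * ∫⁻ η, ‖g η‖ₑ ^ 2 := by
        refine hD lam hl0 _ _ _ hgi.aestronglyMeasurable.enorm fun η η' hη hη' => ?_
        have hmem : ∀ η, ‖g η‖ₑ ≠ 0 → η ∈ ball w0 ρ := fun η hη => by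
          by_contra hc
          exact hη (by simp [hg, hc])
        have h2 := hC i lam η (hmem η hη) η' (hmem η' hη')
        have h3 : ∫ x, ((Q.indicator 1 x : ℝ) : ℂ) * (B (x, η) * starRingEnd ℂ (B (x, η'))) =
            ∫ x, B (x, η) * starRingEnd ℂ (B (x, η')) := by
          refine integral_congr_ae (.of_forall fun x => ?_)
          by_cases hx : x ∈ Q
          · simp [hx]
          · simp [hBz x hx]
        rw [h3, ← ofReal_norm]
        rw [abs_of_pos hl0] at h2
        exact ENNReal.ofReal_inv_pow_of_mul_le (by positivity) h2
    _ ≤ _ := by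
        rw [coe_mul, mul_assoc (C.toNNReal : ℝ≥0∞)]
        refine mul_le_mul' le_rfl (lintegral_mono fun η => ?_)
        refine pow_le_pow_left' ?_ 2
        exact enorm_indicator_le_enorm_self _ _

theorem ENNReal.add_sq_le (a b : ℝ≥0∞) : (a + b) ^ 2 ≤ 2 * a ^ 2 + 2 * b ^ 2 := by
  have := ENNReal.rpow_add_le_mul_rpow_add_rpow a b (p := 2) (by norm_num)
  norm_num at this
  rw [← mul_add]
  exact_mod_cast this

include hφ hQ hnd hb in
theorem SuppUBdd.lintegral_oscAmp_sq_le : ∃ C : ℝ≥0, ∀ i (lam : ℝ), 1 ≤ lam → ∀ h : Rn n → ℂ,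
    IntegrableOn h (annulus n) → ∫⁻ x, ‖∫ η, oscAmp φ (b i) lam (x, η) * h η‖ₑ ^ 2 ≤ C * ofR
    ((lam ^ n)⁻¹) * ∫⁻ η in annulus n, ‖h η‖ₑ ^ 2 := by
  obtain ⟨M, hM0, hM⟩ := hb.exists_norm_oscAmp_le (φ := φ)
  obtain ⟨A, hA, hAm, C, hC⟩ := (isCompact_annulus (n := n)).induction_on
    (p := fun A => ∃ A', A ⊆ A' ∧ MeasurableSet A' ∧ ∃ C : ℝ≥0, ∀ i (lam : ℝ), 1 ≤ lam →
      ∀ h : Rn n → ℂ, Integrable h →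
        ∫⁻ x, ‖∫ η, oscAmp φ (b i) lam (x, η) * A'.indicator h η‖ₑ ^ 2 ≤
          C * ofR ((lam ^ n)⁻¹) * ∫⁻ η, ‖h η‖ₑ ^ 2)
    ⟨∅, le_rfl, MeasurableSet.empty, 0, by simp⟩
    (by
      rintro s t hst ⟨A, hA, h⟩
      exact ⟨A, hst.trans hA, h⟩)
    (by
      rintro s t ⟨A, hA, hAm, C, hC⟩ ⟨A', hA', hAm', C', hC'⟩
      refine ⟨A ∪ A', Set.union_subset_union hA hA', hAm.union hAm', 2 * C + 2 * C',
        fun i lam hl h hh => ?_⟩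
      have hBc : Continuous (oscAmp φ (b i) lam) := ((hb.amp hφ hQ lam).contDiff i).continuous
      have hint : ∀ (u : Rn n → ℂ), Integrable u → ∀ x,
          Integrable fun η => oscAmp φ (b i) lam (x, η) * u η := fun u hu x =>
        hu.bdd_mul (c := M) (hBc.comp (by fun_prop)).aestronglyMeasurable
          (.of_forall fun η => hM i lam _)
      have hkey : ∀ x, ‖∫ η, oscAmp φ (b i) lam (x, η) * (A ∪ A').indicator h η‖ₑ ^ 2 ≤
          2 * ‖∫ η, oscAmp φ (b i) lam (x, η) * A.indicator h η‖ₑ ^ 2 +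
          2 * ‖∫ η, oscAmp φ (b i) lam (x, η) * A'.indicator (Aᶜ.indicator h) η‖ₑ ^ 2 := fun x => by
        refine le_trans (pow_le_pow_left' ?_ 2) (ENNReal.add_sq_le _ _)
        refine le_trans (le_of_eq ?_) (enorm_add_le _ _)
        rw [← integral_add (hint _ (hh.indicator hAm) x)
          (hint _ ((hh.indicator hAm.compl).indicator hAm') x)]
        congr 2 with η
        by_cases h1 : η ∈ A <;> by_cases h2 : η ∈ A' <;> simp [h1, h2]
      calc _ ≤ ∫⁻ x, (2 * ‖∫ η, oscAmp φ (b i) lam (x, η) * A.indicator h η‖ₑ ^ 2 +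
          2 * ‖∫ η, oscAmp φ (b i) lam (x, η) *
            A'.indicator (Aᶜ.indicator h) η‖ₑ ^ 2) := lintegral_mono hkey
        _ ≤ 2 * (C * ofR ((lam ^ n)⁻¹) * ∫⁻ η, ‖h η‖ₑ ^ 2) +
            2 * (C' * ofR ((lam ^ n)⁻¹) * ∫⁻ η, ‖Aᶜ.indicator h η‖ₑ ^ 2) := by
          have hm : AEMeasurable fun x => ‖∫ η, oscAmp φ (b i) lam (x, η) *
              A.indicator h η‖ₑ ^ 2 := by
            refine AEMeasurable.pow_const (AEStronglyMeasurable.enorm ?_) 2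
            exact ((hBc.aestronglyMeasurable.mul (hh.indicator hAm).aestronglyMeasurable.comp_snd :
                AEStronglyMeasurable (fun z : ℝ²ⁿ n => oscAmp φ (b i) lam z *
                  A.indicator h z.2) (volume.prod volume))).integral_prod_right'
          rw [lintegral_add_left' (hm.const_mul 2), lintegral_const_mul' _ _ (by simp),
            lintegral_const_mul' _ _ (by simp)]
          exact add_le_add (mul_le_mul' le_rfl (hC i lam hl h hh))
            (mul_le_mul' le_rfl (hC' i lam hl _ (hh.indicator hAm.compl)))
        _ ≤ 2 * (C * ofR ((lam ^ n)⁻¹) * ∫⁻ η, ‖h η‖ₑ ^ 2) +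
            2 * (C' * ofR ((lam ^ n)⁻¹) * ∫⁻ η, ‖h η‖ₑ ^ 2) := by
          refine add_le_add le_rfl (mul_le_mul' le_rfl (mul_le_mul' le_rfl
            (lintegral_mono fun η => pow_le_pow_left' (enorm_indicator_le_enorm_self _ _) 2)))
        _ = _ := by
          push_cast
          ring)
    (by
      intro w hw
      obtain ⟨ρ, hρ, C, hC⟩ := hb.lintegral_oscAmp_sq_le_at hφ hQ hnd (ne_zero_of_mem_annulus hw)
      exact ⟨_, mem_nhdsWithin_of_mem_nhds (Metric.ball_mem_nhds w hρ), _, le_rfl,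
        measurableSet_ball, C, hC⟩)
  refine ⟨C, fun i lam hl h hh => ?_⟩
  have h1 := hC i lam hl ((annulus n).indicator h)
    ((integrable_indicator_iff isCompact_annulus.measurableSet).mpr hh)
  calc _ = ∫⁻ x, ‖∫ η, oscAmp φ (b i) lam (x, η) *
          A.indicator ((annulus n).indicator h) η‖ₑ ^ 2 := by
        refine lintegral_congr fun x => ?_
        congr 3 with η
        by_cases hη : η ∈ annulus n
        · simp [hη, hA hη]
        · have hz : oscAmp φ (b i) lam (x, η) = 0 :=
            (hb.amp hφ hQ lam).eq_zero i (x, η) fun h => hη h.2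
          simp [hz]
    _ ≤ _ := h1
    _ ≤ _ := by
        rw [← lintegral_indicator isCompact_annulus.measurableSet]
        refine mul_le_mul' le_rfl (lintegral_mono fun η => ?_)
        by_cases hη : η ∈ annulus n <;> simp [hη]

theorem lintegral_exp_mul_sq_le (n : ℕ) : ∃ C : ℝ≥0, ∀ lam : ℝ, 1 ≤ lam → ∀ g : Rn n → ℂ, Integrable
    g → ∫⁻ η in annulus n, ‖∫ y, 𝐞⁻(lam * ⟪y, η⟫_ℝ) * g y‖ₑ ^ 2 ≤ C * ofR
    ((lam ^ n)⁻¹) * ∫⁻ y, ‖g y‖ₑ ^ 2 := by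
  let χ : ContDiffBump (0 : Rn n) := ⟨4, 5, by norm_num, by norm_num⟩
  have hw : SuppUBdd (fun _ : Unit => closedBall (0 : Rn n) 5) (fun _ x => ((χ x : ℝ) : ℂ)) := by
    refine ⟨(UBdd.of_isCompact (isCompact_closedBall _ _)
      fun z _ => (ofRealCLM.contDiff.comp χ.contDiff).contDiffAt),
      fun _ => Metric.isClosed_closedBall, fun _ x hx => ?_⟩
    rw [χ.zero_of_le_dist (by
      rw [dist_zero_right]
      exact (show (5 : ℝ) < ‖x‖ by simpa using hx).le), ofReal_zero]
  obtain ⟨C, hC0, hC⟩ := hw.fourier_decay (fun _ => le_rfl) (n + 1)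
  obtain ⟨D, hD⟩ := lintegral_lintegral_decay_mul_le n
  refine ⟨C.toNNReal * D, fun lam hl g hg => ?_⟩
  have hl0 : 0 < lam := by linarith
  have hBc : Continuous fun z : ℝ²ⁿ n => 𝐞⁻(lam * ⟪z.2, z.1⟫_ℝ) := by
    fun_prop
  have h1 := lintegral_sq_le_of_kernel (μ := (volume : Measure (Rn n))) (w := χ)
    (fun x => χ.nonneg) (χ.continuous.integrable_of_hasCompactSupport χ.hasCompactSupport)
    hBc.measurable (M := 1) (fun z => (norm_cexp_neg_I_mul _).le) hg
  calc _ ≤ ∫⁻ η in annulus n, ofR (χ η) *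
          ‖∫ y, 𝐞⁻(lam * ⟪y, η⟫_ℝ) * g y‖ₑ ^ 2 := by
        refine setLIntegral_mono' isCompact_annulus.measurableSet fun η hη => ?_
        rw [χ.one_of_mem_closedBall (by simpa using hη.2), ofR_one, one_mul]
    _ ≤ _ := setLIntegral_le_lintegral _ _
    _ ≤ _ := h1
    _ ≤ ofR C * (D * ofR ((lam ^ n)⁻¹)) * ∫⁻ y, ‖g y‖ₑ ^ 2 := by
        refine hD lam hl0 _ _ _ hg.aestronglyMeasurable.enorm fun y y' _ _ => ?_
        have h2 := hC () (lam • (y' - y))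
        rw [norm_smul, norm_eq_abs, abs_of_pos hl0, norm_sub_rev] at h2
        rw [← ofReal_norm]
        refine ENNReal.ofReal_inv_pow_of_mul_le (by positivity) (le_trans (le_of_eq ?_) h2)
        congr 3 with x
        rw [← exp_conj, ← exp_add]
        congr 2
        simp only [map_neg, map_mul, conj_I, conj_ofReal, inner_smul_left, inner_sub_left]
        push_cast
        simp only [conj_trivial]
        ring
    _ ≤ _ := by
        rw [coe_mul, mul_assoc (C.toNNReal : ℝ≥0∞)]
        exact le_rfl

/-- The operator with kernel `lam ^ n * oscKernel φ b lam`. -/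
def oscOp (φ : Rn n → Rn n → ℝ) (b : ℝ²ⁿ n → ℂ) (lam : ℝ) (g : Rn n → ℂ) (x : Rn n) : ℂ :=
  ((lam ^ n : ℝ) : ℂ) * ∫ y, oscKernel φ b lam x y * g y

include hφ hQ hb in
theorem SuppUBdd.integral_oscKernel_mul (i : ι) (lam : ℝ) {g : Rn n → ℂ} (hg : Integrable g)
    (x : Rn n) : ∫ y, oscKernel φ (b i) lam x y * g y = ∫ η, oscAmp φ (b i) lam (x, η) * ∫ y, cexp
    (-(I * ((lam * ⟪y, η⟫_ℝ : ℝ) : ℂ))) * g y := by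
  have hs := hb.amp hφ hQ lam
  have hc : Continuous fun η => oscAmp φ (b i) lam (x, η) :=
    (hs.contDiff i).continuous.comp (by fun_prop)
  have hcs : HasCompactSupport fun η => oscAmp φ (b i) lam (x, η) :=
    HasCompactSupport.of_support_subset_isCompact isCompact_annulus fun η hη => by
      by_contra hc
      exact hη (hs.eq_zero i (x, η) fun h => hc h.2)
  have hi := (hc.integrable_of_hasCompactSupport (μ := volume) hcs).mul_prod hg
  have hi2 : Integrable (fun z : ℝ²ⁿ n => (oscAmp φ (b i) lam (x, z.1) * g z.2) *
      𝐞⁻(lam * ⟪z.2, z.1⟫_ℝ)) (volume.prod volume) :=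
    hi.mul_bdd (c := 1) (by fun_prop) (.of_forall fun z => (norm_cexp_neg_I_mul _).le)
  simp_rw [oscKernel_eq, ← integral_const_mul, ← integral_mul_const]
  rw [integral_integral_swap]
  · refine integral_congr_ae (.of_forall fun η => ?_)
    refine integral_congr_ae (.of_forall fun y => ?_)
    dsimp only
    ring
  · refine (hi2.swap).congr (.of_forall fun z => ?_)
    simp only [Function.comp, Prod.swap, uncurry]
    ring

include hφ hQ hnd hb in
theorem SuppUBdd.lintegral_oscOp_sq_le : ∃ C : ℝ≥0, ∀ i (lam : ℝ), 1 ≤ lam → ∀ g : Rn n → ℂ,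
    Integrable g → ∫⁻ x, ‖oscOp φ (b i) lam g x‖ₑ ^ 2 ≤ C * ∫⁻ y, ‖g y‖ₑ ^ 2 := by
  obtain ⟨C, hC⟩ := hb.lintegral_oscAmp_sq_le hφ hQ hnd
  obtain ⟨D, hD⟩ := lintegral_exp_mul_sq_le n
  refine ⟨C * D, fun i lam hl g hg => ?_⟩
  have hl0 : 0 < lam := by linarith
  have hcont : Continuous fun η : Rn n => ∫ y, 𝐞⁻(lam * ⟪y, η⟫_ℝ) * g y := by
    refine continuous_of_dominated (bound := fun y => ‖g y‖)
      (fun η => (Continuous.aestronglyMeasurable (by fun_prop)).mul hg.aestronglyMeasurable)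
      (fun η => .of_forall fun y => ?_) hg.norm
      (.of_forall fun y => by fun_prop)
    rw [norm_mul, norm_cexp_neg_I_mul, one_mul]
  have h1 := hC i lam hl _ (hcont.continuousOn.integrableOn_compact isCompact_annulus)
  calc _ = ofR (lam ^ n) ^ 2 * ∫⁻ x, ‖∫ η, oscAmp φ (b i) lam (x, η) *
        ∫ y, 𝐞⁻(lam * ⟪y, η⟫_ℝ) * g y‖ₑ ^ 2 := by
        rw [← lintegral_const_mul' _ _ (by finiteness)]
        refine lintegral_congr fun x => ?_
        rw [oscOp, hb.integral_oscKernel_mul hφ hQ i lam hg, enorm_mul, mul_pow, ← ofReal_norm,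
          norm_real, norm_eq_abs, abs_of_pos (by positivity)]
    _ ≤ ofR (lam ^ n) ^ 2 * (C * ofR ((lam ^ n)⁻¹) * (D * ofR ((lam ^ n)⁻¹) * ∫⁻ y, ‖g y‖ₑ ^ 2)) :=
        mul_le_mul' le_rfl (h1.trans (mul_le_mul' le_rfl (hD lam hl g hg)))
    _ = (ofR (lam ^ n) * ofR ((lam ^ n)⁻¹)) ^ 2 * (C * D * ∫⁻ y, ‖g y‖ₑ ^ 2) := by ring
    _ = _ := by
        rw [← ofR_mul (by positivity), mul_inv_cancel₀ (by positivity),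
          ofR_one, one_pow, one_mul, coe_mul]

section Interpolation

theorem lintegral_rpow_Ioo_zero {a s : ℝ} (ha : -1 < a) (hs : 0 ≤ s) :
    ∫⁻ t in Ioo 0 s, ofR (t ^ a) = ofR (s ^ (a + 1) / (a + 1)) := by
  have h1 : IntegrableOn (fun t : ℝ => t ^ a) (Set.Ioc 0 s) :=
    (intervalIntegrable_iff_integrableOn_Ioc_of_le hs).mp
      (intervalIntegral.intervalIntegrable_rpow' ha)
  rw [← ofReal_integral_eq_lintegral_ofReal (h1.mono_set Set.Ioo_subset_Ioc_self)
    ((ae_restrict_iff' measurableSet_Ioo).mpr (.of_forall fun t ht =>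
      rpow_nonneg ht.1.le a)), ← integral_Ioc_eq_integral_Ioo,
    ← intervalIntegral.integral_of_le hs, integral_rpow (Or.inl ha),
    Real.zero_rpow (by linarith), sub_zero]

theorem lintegral_rpow_Ici {a s : ℝ} (ha : a < -1) (hs : 0 < s) :
    ∫⁻ t in Ici s, ofR (t ^ a) = ofR (s ^ (a + 1) / -(a + 1)) := by
  rw [setLIntegral_congr Ioi_ae_eq_Ici.symm,
    ← ofReal_integral_eq_lintegral_ofReal (integrableOn_Ioi_rpow_of_lt ha hs)
    ((ae_restrict_iff' measurableSet_Ioi).mpr (.of_forall fun t ht =>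
      rpow_nonneg (hs.trans ht).le a)), integral_Ioi_rpow_of_lt ha hs, div_neg, neg_div]

variable {α β : Type*} [MeasurableSpace α] [MeasurableSpace β] {μ : Measure α} {ν : Measure β}
  [SFinite ν]

theorem lintegral_Ioi_lintegral_lt {v : β → ℝ} (hv : Measurable v) (hv0 : ∀ y, 0 ≤ v y) {c r p : ℝ}
    (hc : 0 < c) (hr : 0 < r) (hrp : r < p) : ∫⁻ t in Ioi (0 : ℝ), ∫⁻ y,
    (if c * t < v y then ofR (t ^ (p - 1 - r)) * ofR (v y ^ r) else 0) ∂ν ≤ ofR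
    (c ^ (r - p) / (p - r)) * ∫⁻ y, ofR (v y ^ p) ∂ν := by
  rw [lintegral_lintegral_swap, ← lintegral_const_mul' _ _ (by simp)]
  · refine lintegral_mono fun y => ?_
    calc _ = ∫⁻ t in Ioi (0 : ℝ), (Ioo 0 (v y / c)).indicator
          (fun t => ofR (t ^ (p - 1 - r)) * ofR (v y ^ r)) t := by
          refine setLIntegral_congr_fun measurableSet_Ioi fun t ht => ?_
          have hiff : t ∈ Ioo 0 (v y / c) ↔ c * t < v y := by
            rw [Set.mem_Ioo, lt_div_iff₀' hc]
            exact ⟨fun h => h.2, fun h => ⟨ht, h⟩⟩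
          by_cases h : c * t < v y
          · rw [if_pos h, indicator_of_mem (hiff.mpr h)]
          · rw [if_neg h, Set.indicator_of_notMem fun h' => h (hiff.mp h')]
      _ ≤ ∫⁻ t, (Ioo 0 (v y / c)).indicator (fun t => ofR (t ^ (p - 1 - r)) * ofR (v y ^ r)) t :=
          setLIntegral_le_lintegral _ _
      _ = ofR ((v y / c) ^ (p - r) / (p - r)) * ofR (v y ^ r) := by
          rw [lintegral_indicator measurableSet_Ioo, lintegral_mul_const' _ _ (by simp),
            lintegral_rpow_Ioo_zero (by linarith) (div_nonneg (hv0 y) hc.le)]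
          congr 3 <;> ring_nf
      _ = _ := by
          have hpr : 0 < p - r := by linarith
          rw [← ofR_mul (div_nonneg (rpow_nonneg (div_nonneg (hv0 y) hc.le) _)
              hpr.le), ← ofR_mul (div_nonneg (rpow_nonneg hc.le _) hpr.le)]
          congr 1
          rw [Real.div_rpow (hv0 y) hc.le, show r - p = -(p - r) by ring, rpow_neg hc.le,
            show v y ^ p = v y ^ (p - r) * v y ^ r by
              rw [← Real.rpow_add_of_nonneg (hv0 y) hpr.le hr.le]; ring_nf]
          field_simp
  · refine Measurable.aemeasurable (Measurable.ite ?_ (by fun_prop) measurable_const)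
    exact measurableSet_lt (by fun_prop) (by fun_prop)

theorem lintegral_Ioi_lintegral_ge {v : β → ℝ} (hv : Measurable v) (hv0 : ∀ y, 0 ≤ v y) {c r p : ℝ}
    (hc : 0 < c) (hp : 0 < p) (hrp : p < r) : ∫⁻ t in Ioi (0 : ℝ), ∫⁻ y,
    (if v y ≤ c * t then ofR (t ^ (p - 1 - r)) * ofR (v y ^ r) else 0) ∂ν ≤ ofR
    (c ^ (r - p) / (r - p)) * ∫⁻ y, ofR (v y ^ p) ∂ν := by
  rw [lintegral_lintegral_swap, ← lintegral_const_mul' _ _ (by simp)]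
  · refine lintegral_mono fun y => ?_
    rcases (hv0 y).eq_or_lt with h0 | h0
    · refine le_of_eq_of_le ?_ zero_le
      simp [← h0, Real.zero_rpow (hp.trans hrp).ne']
    calc _ = ∫⁻ t in Ioi (0 : ℝ), (Ici (v y / c)).indicator
          (fun t => ofR (t ^ (p - 1 - r)) * ofR (v y ^ r)) t := by
          refine lintegral_congr fun t => ?_
          have hiff : t ∈ Ici (v y / c) ↔ v y ≤ c * t := by
            rw [Set.mem_Ici, div_le_iff₀' hc]
          by_cases h : v y ≤ c * t
          · rw [if_pos h, indicator_of_mem (hiff.mpr h)]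
          · rw [if_neg h, Set.indicator_of_notMem fun h' => h (hiff.mp h')]
      _ ≤ ∫⁻ t, (Ici (v y / c)).indicator (fun t => ofR (t ^ (p - 1 - r)) * ofR (v y ^ r)) t :=
          setLIntegral_le_lintegral _ _
      _ = ofR ((v y / c) ^ (p - r) / (r - p)) * ofR (v y ^ r) := by
          rw [lintegral_indicator measurableSet_Ici, lintegral_mul_const' _ _ (by simp),
            lintegral_rpow_Ici (by linarith) (div_pos h0 hc)]
          congr 3 <;> ring_nf
      _ = _ := by
          have hpr : 0 < r - p := by linarith
          rw [← ofR_mul (div_nonneg (rpow_nonneg (div_nonneg (hv0 y) hc.le) _)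
              hpr.le), ← ofR_mul (div_nonneg (rpow_nonneg hc.le _) hpr.le)]
          congr 1
          rw [Real.div_rpow (hv0 y) hc.le, show r - p = -(p - r) by ring, rpow_neg hc.le,
            show v y ^ p = v y ^ (p - r) * v y ^ r by
              rw [← rpow_add h0]; ring_nf]
          field_simp
  · refine Measurable.aemeasurable (Measurable.ite ?_ (by fun_prop) measurable_const)
    exact measurableSet_le (by fun_prop) (by fun_prop)

theorem measure_lt_mul_rpow_le {F : α → ℝ} (hF : AEMeasurable F μ) (hF0 : ∀ x, 0 ≤ F x) {t r p : ℝ}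
    (ht : 0 < t) (hr : 0 < r) : μ {x | t < F x} * ofR (t ^ (p - 1)) ≤ ofR (t ^ (p - 1 - r)) * ∫⁻ x,
    ofR (F x ^ r) ∂μ := by
  have h1 : μ {x | t < F x} ≤ μ {x | ofR (t ^ r) ≤ ofR (F x ^ r)} :=
    measure_mono fun x hx => ofR_le_ofR (Real.rpow_le_rpow ht.le (le_of_lt hx) hr.le)
  have h2 := mul_meas_ge_le_lintegral₀ (μ := μ) (hF.pow_const r).ennreal_ofReal (ofR (t ^ r))
  rw [show p - 1 = (p - 1 - r) + r by ring, rpow_add ht,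
    ofR_mul (rpow_nonneg ht.le _), show p - 1 - r + r - r = p - 1 - r by ring,
    mul_comm, mul_assoc]
  exact mul_le_mul' le_rfl ((mul_le_mul' le_rfl h1).trans h2)

theorem lintegral_rpow_eq_lintegral_meas_two_mul {F : α → ℝ} (hF : AEMeasurable F μ)
    (hF0 : ∀ x, 0 ≤ F x) {p : ℝ} (hp : 0 < p) : ∫⁻ x, ofR (F x ^ p) ∂μ = ofR (2 ^ p * p) * ∫⁻ t in
    Ioi 0, μ {x | 2 * t < F x} * ofR (t ^ (p - 1)) := by
  have h := lintegral_rpow_eq_lintegral_meas_lt_mul μ (f := fun x => F x / 2)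
    (.of_forall fun x => div_nonneg (hF0 x) zero_le_two) (hF.div_const 2) hp
  rw [ofR_mul (by positivity), mul_assoc]
  simp_rw [lt_div_iff₀' (zero_lt_two' ℝ)] at h
  rw [← h, ← lintegral_const_mul' _ _ (by simp)]
  refine lintegral_congr fun x => ?_
  rw [← ofR_mul (by positivity), Real.div_rpow (hF0 x) zero_le_two]
  congr 1
  field_simp

variable {T : (β → ℂ) → α → ℂ}

theorem ofReal_mul_lintegral_rpow_indicator {S : Set β} [DecidablePred (· ∈ S)] (g : β → ℂ) {r : ℝ}
    (hr : 0 < r) (a : ℝ) : ofR a * ∫⁻ y, ofR (‖S.indicator g y‖ ^ r) ∂ν = ∫⁻ y,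
    (if y ∈ S then ofR a * ofR (‖g y‖ ^ r) else 0) ∂ν := by
  rw [← lintegral_const_mul' _ _ (by simp)]
  refine lintegral_congr fun y => ?_
  by_cases hy : y ∈ S
  · rw [if_pos hy, indicator_of_mem hy]
  · rw [if_neg hy, Set.indicator_of_notMem hy, norm_zero, Real.zero_rpow hr.ne',
      ENNReal.ofReal_zero, mul_zero]

/-- The assumption that `T` is subadditive and preserves measurability on integrable functions. -/
structure IsSubadditiveOp (μ : Measure α) (ν : Measure β) (T : (β → ℂ) → α → ℂ) : Prop where
  norm_add_le : ∀ g h, Measurable g → Integrable g ν → Measurable h → Integrable h ν →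
      ∀ x, ‖T (g + h) x‖ ≤ ‖T g x‖ + ‖T h x‖
  aestronglyMeasurable : ∀ g, Measurable g → Integrable g ν → AEStronglyMeasurable (T g) μ

theorem IsSubadditiveOp.measure_lt_le (hT : IsSubadditiveOp μ ν T) {g : β → ℂ} (hg : Measurable g)
    (hgi : Integrable g ν) {S : Set β} (hS : MeasurableSet S) (t : ℝ) : μ {x | 2 * t < ‖T g x‖} ≤ μ
    {x | t < ‖T (S.indicator g) x‖} + μ {x | t < ‖T (Sᶜ.indicator g) x‖} := by
  refine (measure_mono fun x hx => ?_).trans (measure_union_le _ _)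
  have h := hT.norm_add_le _ _ (hg.indicator hS) (hgi.indicator hS) (hg.indicator hS.compl)
    (hgi.indicator hS.compl) x
  rw [Set.indicator_self_add_compl] at h
  by_contra hc
  simp only [Set.mem_union, Set.mem_ofPred_eq, not_or, not_lt] at hc hx
  linarith

theorem IsSubadditiveOp.lintegral_rpow_le (hT : IsSubadditiveOp μ ν T) {r p q A B : ℝ} (hr : 0 < r)
    (hrp : r < p) (hpq : p < q) (h1 : ∀ g, Measurable g → Integrable g ν → ∫⁻ x, ofR (‖T g x‖ ^ r)
    ∂μ ≤ ofR A * ∫⁻ y, ofR (‖g y‖ ^ r) ∂ν) (h2 : ∀ g, Measurable g → Integrable g ν → ∫⁻ x, ofR (‖T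
    g x‖ ^ q) ∂μ ≤ ofR B * ∫⁻ y, ofR (‖g y‖ ^ q) ∂ν) {c : ℝ} (hc : 0 < c) {g : β → ℂ}
    (hg : Measurable g) (hgi : Integrable g ν) : ∫⁻ x, ofR (‖T g x‖ ^ p) ∂μ ≤ ofR (2 ^ p * p) *
    (ofR A * ofR (c ^ (r - p) / (p - r)) + ofR B * ofR (c ^ (q - p) / (q - p))) * ∫⁻ y, ofR
    (‖g y‖ ^ p) ∂ν := by
  have hp : 0 < p := hr.trans hrp
  rw [lintegral_rpow_eq_lintegral_meas_two_mul (hT.aestronglyMeasurable g hg hgi).norm.aemeasurable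
    (fun x => norm_nonneg _) hp, mul_assoc]
  refine mul_le_mul' le_rfl ?_
  have hm1 : Measurable fun t : ℝ => ∫⁻ y, (if c * t < ‖g y‖ then
      ofR (t ^ (p - 1 - r)) * ofR (‖g y‖ ^ r) else 0) ∂ν :=
    Measurable.lintegral_prod_right' (f := fun z : ℝ × β => if c * z.1 < ‖g z.2‖ then
      ofR (z.1 ^ (p - 1 - r)) * ofR (‖g z.2‖ ^ r) else 0)
      (Measurable.ite (measurableSet_lt (by fun_prop) (by fun_prop)) (by fun_prop) measurable_const)
  calc _ ≤ ∫⁻ t in Ioi (0 : ℝ), (ofR A * (∫⁻ y, (if c * t < ‖g y‖ then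
          ofR (t ^ (p - 1 - r)) * ofR (‖g y‖ ^ r) else 0) ∂ν) +
        ofR B * (∫⁻ y, (if ‖g y‖ ≤ c * t then
          ofR (t ^ (p - 1 - q)) * ofR (‖g y‖ ^ q) else 0) ∂ν)) := by
        refine setLIntegral_mono' measurableSet_Ioi fun t ht => ?_
        have hS : MeasurableSet {y | c * t < ‖g y‖} := measurableSet_lt (by fun_prop) (by fun_prop)
        have hm := fun (S : Set β) (hS : MeasurableSet S) => (hT.aestronglyMeasurable _
          (hg.indicator hS) (hgi.indicator hS)).norm.aemeasurable
        have e1 := ofReal_mul_lintegral_rpow_indicator (ν := ν) (S := {y | c * t < ‖g y‖}) g hr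
          (t ^ (p - 1 - r))
        have e2 := ofReal_mul_lintegral_rpow_indicator (ν := ν) (S := {y | c * t < ‖g y‖}ᶜ) g
          (hp.trans hpq) (t ^ (p - 1 - q))
        simp only [Set.mem_compl_iff, Set.mem_ofPred_eq, not_lt] at e1 e2
        rw [← e1, ← e2, mul_left_comm, mul_left_comm (ofR B)]
        refine (mul_le_mul' (hT.measure_lt_le hg hgi hS t) le_rfl).trans ?_
        rw [add_mul]
        exact add_le_add ((measure_lt_mul_rpow_le (hm _ hS) (fun x => norm_nonneg _) ht hr).trans
            (mul_le_mul' le_rfl (h1 _ (hg.indicator hS) (hgi.indicator hS))))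
          ((measure_lt_mul_rpow_le (hm _ hS.compl) (fun x => norm_nonneg _) ht (hp.trans hpq)).trans
            (mul_le_mul' le_rfl (h2 _ (hg.indicator hS.compl) (hgi.indicator hS.compl))))
    _ ≤ _ := by
        rw [lintegral_add_left (hm1.const_mul _), lintegral_const_mul' _ _ (by simp),
          lintegral_const_mul' _ _ (by simp), add_mul, mul_assoc, mul_assoc]
        exact add_le_add (mul_le_mul' le_rfl (lintegral_Ioi_lintegral_lt hg.norm
          (fun y => norm_nonneg _) hc hr hrp)) (mul_le_mul' le_rfl (lintegral_Ioi_lintegral_ge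
            hg.norm (fun y => norm_nonneg _) hc hp hpq))

theorem IsSubadditiveOp.lintegral_rpow_le_of_sup (hT : IsSubadditiveOp μ ν T) {r p A B : ℝ}
    (hr : 0 < r) (hrp : r < p) (hB : 0 < B) (h1 : ∀ g, Measurable g → Integrable g ν → ∫⁻ x, ofR (‖T
    g x‖ ^ r) ∂μ ≤ ofR A * ∫⁻ y, ofR (‖g y‖ ^ r) ∂ν)
    (h2 : ∀ g, Measurable g → Integrable g ν → ∀ M, (∀ y, ‖g y‖ ≤ M) → ∀ x, ‖T g x‖ ≤ B * M)
    {g : β → ℂ} (hg : Measurable g) (hgi : Integrable g ν) : ∫⁻ x, ofR (‖T g x‖ ^ p) ∂μ ≤ ofR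
    (2 ^ p * p) * (ofR A * ofR (B ^ (p - r) / (p - r))) * ∫⁻ y, ofR (‖g y‖ ^ p) ∂ν := by
  have hp : 0 < p := hr.trans hrp
  have hc : 0 < B⁻¹ := inv_pos.mpr hB
  rw [lintegral_rpow_eq_lintegral_meas_two_mul (hT.aestronglyMeasurable g hg hgi).norm.aemeasurable
    (fun x => norm_nonneg _) hp, mul_assoc]
  refine mul_le_mul' le_rfl ?_
  calc _ ≤ ∫⁻ t in Ioi (0 : ℝ), (ofR A * (∫⁻ y, (if B⁻¹ * t < ‖g y‖ then
          ofR (t ^ (p - 1 - r)) * ofR (‖g y‖ ^ r) else 0) ∂ν)) := by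
        refine setLIntegral_mono' measurableSet_Ioi fun t ht => ?_
        have hS : MeasurableSet {y | B⁻¹ * t < ‖g y‖} :=
          measurableSet_lt (by fun_prop) (by fun_prop)
        have hm := (hT.aestronglyMeasurable _
          (hg.indicator hS) (hgi.indicator hS)).norm.aemeasurable
        have e1 := ofReal_mul_lintegral_rpow_indicator (ν := ν) (S := {y | B⁻¹ * t < ‖g y‖}) g hr
          (t ^ (p - 1 - r))
        simp only [Set.mem_ofPred_eq] at e1
        have hz : μ {x | t < ‖T ({y | B⁻¹ * t < ‖g y‖}ᶜ.indicator g) x‖} = 0 := by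
          convert measure_empty (μ := μ)
          refine Set.eq_empty_of_forall_notMem fun x (hx : t < _) => hx.not_ge ?_
          refine (h2 _ (hg.indicator hS.compl) (hgi.indicator hS.compl) (B⁻¹ * t) (fun y => ?_)
            x).trans_eq (by field_simp)
          by_cases hy : B⁻¹ * t < ‖g y‖
          · simp [hy, hc.le, (show (0 : ℝ) < t from ht).le, mul_nonneg]
          · rw [indicator_of_mem (by simpa using hy)]
            exact not_lt.mp hy
        rw [← e1, mul_left_comm]
        refine (mul_le_mul' (hT.measure_lt_le hg hgi hS t) le_rfl).trans ?_
        rw [hz, add_zero]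
        exact (measure_lt_mul_rpow_le hm (fun x => norm_nonneg _) ht hr).trans
            (mul_le_mul' le_rfl (h1 _ (hg.indicator hS) (hgi.indicator hS)))
    _ ≤ _ := by
        rw [lintegral_const_mul' _ _ (by simp), mul_assoc]
        refine mul_le_mul' le_rfl ((lintegral_Ioi_lintegral_lt hg.norm
          (fun y => norm_nonneg _) hc hr hrp).trans_eq ?_)
        rw [Real.inv_rpow hB.le, ← rpow_neg hB.le, neg_sub]

end Interpolation

theorem SuppUBdd.reindex {κ : Type*} {S : ι → Set E} {u : ι → E → F} (hu : SuppUBdd S u)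
    (r : κ → ι) : SuppUBdd (fun k => S (r k)) (fun k => u (r k)) :=
  ⟨hu.ubdd.reindex r, fun k => hu.isClosed (r k), fun k => hu.eq_zero (r k)⟩

include hb in
theorem SuppUBdd.oscAmp_eq_zero (i : ι) (lam : ℝ) {x η : Rn n} (h : ¬ (x ∈ Q ∧ η ∈ annulus n)) :
    oscAmp φ (b i) lam (x, η) = 0 := by
  have hz := hb.eq_zero i (x, η) h
  simp [oscAmp, hz]

include hb in
theorem SuppUBdd.oscKernel_eq_zero (i : ι) (lam : ℝ) {x : Rn n} (hx : x ∉ Q) (y : Rn n) : oscKernel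
    φ (b i) lam x y = 0 := by
  rw [oscKernel_eq]
  refine integral_eq_zero_of_ae (.of_forall fun η => ?_)
  have hz : oscAmp φ (b i) lam (x, η) = 0 := hb.oscAmp_eq_zero i lam fun h => hx h.1
  simp [hz]

include hb in
theorem SuppUBdd.oscOp_eq_zero (i : ι) (lam : ℝ) (g : Rn n → ℂ) {x : Rn n} (hx : x ∉ Q) : oscOp φ
    (b i) lam g x = 0 := by
  simp [oscOp, hb.oscKernel_eq_zero i lam hx]

include hb in
theorem SuppUBdd.oscKernel_eq_setIntegral (i : ι) (lam : ℝ) (x y : Rn n) : oscKernel φ (b i) lam x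
    y = ∫ η in annulus n, oscAmp φ (b i) lam (x, η) * 𝐞⁻(lam * ⟪y, η⟫_ℝ) := by
  rw [oscKernel_eq]
  refine (setIntegral_eq_integral_of_forall_compl_eq_zero fun η hη => ?_).symm
  have hz : oscAmp φ (b i) lam (x, η) = 0 := hb.oscAmp_eq_zero i lam fun h => hη h.2
  simp [hz]

include hφ hQ hb in
theorem SuppUBdd.continuous_oscKernel (i : ι) (lam : ℝ) :
    Continuous fun z : ℝ²ⁿ n => oscKernel φ (b i) lam z.1 z.2 := by
  simp_rw [hb.oscKernel_eq_setIntegral]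
  have hc := ((hb.amp hφ hQ lam).contDiff i).continuous
  refine continuous_parametric_integral_of_continuous ?_ isCompact_annulus
  simp only [Function.uncurry_def]
  exact (hc.comp (by fun_prop : Continuous fun p : (ℝ²ⁿ n) × Rn n => (p.1.1, p.2))).mul
    (by fun_prop)

include hb in
theorem SuppUBdd.exists_norm_oscKernel_le :
    ∃ M : ℝ, 0 < M ∧ ∀ i lam x y, ‖oscKernel φ (b i) lam x y‖ ≤ M := by
  obtain ⟨M, hM, h⟩ := hb.exists_norm_oscAmp_le (φ := φ)
  refine ⟨M * volume.real (annulus n) + 1, by positivity, fun i lam x y => ?_⟩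
  rw [hb.oscKernel_eq_setIntegral]
  refine (norm_setIntegral_le_of_norm_le_const isCompact_annulus.measure_lt_top
    fun η _ => ?_).trans (le_add_of_nonneg_right zero_le_one)
  rw [norm_mul, norm_cexp_neg_I_mul, mul_one]
  exact h i lam _

include hφ hQ hb in
theorem SuppUBdd.integrable_oscKernel_mul (i : ι) (lam : ℝ) {g : Rn n → ℂ} (hg : Integrable g)
    (x : Rn n) : Integrable fun y => oscKernel φ (b i) lam x y * g y := by
  obtain ⟨M, -, h⟩ := hb.exists_norm_oscKernel_le (φ := φ)
  exact hg.bdd_mul (c := M) ((hb.continuous_oscKernel hφ hQ i lam).comp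
      (by fun_prop : Continuous fun y : Rn n => (x, y))).aestronglyMeasurable
    (.of_forall fun y => h i lam x y)

include hφ hQ hb in
theorem SuppUBdd.continuous_oscOp (i : ι) (lam : ℝ) {g : Rn n → ℂ} (hg : Integrable g) : Continuous
    (oscOp φ (b i) lam g) := by
  obtain ⟨M, -, h⟩ := hb.exists_norm_oscKernel_le (φ := φ)
  refine continuous_const.mul (continuous_of_dominated (bound := fun y => M * ‖g y‖)
    (fun x => (hb.integrable_oscKernel_mul hφ hQ i lam hg x).aestronglyMeasurable)
    (fun x => .of_forall fun y => ?_) (hg.norm.const_mul M)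
    (.of_forall fun y => ?_))
  · rw [norm_mul]
    exact mul_le_mul_of_nonneg_right (h i lam x y) (norm_nonneg _)
  · exact ((hb.continuous_oscKernel hφ hQ i lam).comp
      (by fun_prop : Continuous fun x : Rn n => (x, y))).mul continuous_const

include hQ hb in
theorem SuppUBdd.hasCompactSupport_oscOp (i : ι) (lam : ℝ) (g : Rn n → ℂ) :
    HasCompactSupport (oscOp φ (b i) lam g) :=
  HasCompactSupport.of_support_subset_isCompact hQ fun x hx => by
    by_contra hc
    exact hx (hb.oscOp_eq_zero i lam g hc)

include hφ hQ hb in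
theorem SuppUBdd.isSubadditiveOp_oscOp (i : ι) (lam : ℝ) :
    IsSubadditiveOp volume volume (oscOp φ (b i) lam) where
  norm_add_le g h _ hg _ hh x := by
    have e : oscOp φ (b i) lam (g + h) x = oscOp φ (b i) lam g x + oscOp φ (b i) lam h x := by
      simp only [oscOp, Pi.add_apply, mul_add]
      rw [integral_add (hb.integrable_oscKernel_mul hφ hQ i lam hg x)
        (hb.integrable_oscKernel_mul hφ hQ i lam hh x), mul_add]
    rw [e]
    exact norm_add_le _ _
  aestronglyMeasurable g _ hg := (hb.continuous_oscOp hφ hQ i lam hg).aestronglyMeasurable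

include hn hφ hQ hb in
theorem SuppUBdd.enorm_oscOp_le (N : ℕ) : ∃ C : ℝ≥0, ∀ i (lam : ℝ), 1 ≤ lam → ∀ g x, ‖oscOp φ (b i)
    lam g x‖ₑ ≤ C * ofR (lam ^ (n + 1 / 2 : ℝ)) * ∫⁻ y, majorant φ lam N x y * ‖g y‖ₑ := by
  obtain ⟨C, hC, h⟩ := (hb.reindex (fun k : ι × {r : ℝ // 1 ≤ r} => k.1)).exists_enorm_oscKernel_le
    hn hφ hQ (lam := fun k => k.2) (fun k => k.2.2) N
  refine ⟨C.toNNReal, fun i lam hl g x => ?_⟩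
  have hl0 : 0 < lam := by linarith
  rw [oscOp, enorm_mul]
  calc _ ≤ ofR (lam ^ n) * ∫⁻ y, ofR (C * √lam) *
        (majorant φ lam N x y * ‖g y‖ₑ) := by
        refine mul_le_mul' ?_ ((enorm_integral_le_lintegral_enorm _).trans
          (lintegral_mono fun y => ?_))
        · rw [← ofReal_norm, norm_real, norm_eq_abs, abs_of_pos (by positivity)]
        · rw [enorm_mul, ← mul_assoc]
          exact mul_le_mul' (h (i, ⟨lam, hl⟩) x y) le_rfl
    _ = _ := by
        rw [lintegral_const_mul' _ _ (by simp), ← mul_assoc, ← ofR_mul (by positivity),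
          ofNNReal_toNNReal, ← ofR_mul hC, rpow_add hl0,
          rpow_natCast, Real.sqrt_eq_rpow]
        congr 2
        ring

include hn hφ hQ hb in
theorem SuppUBdd.enorm_oscOp_le_of_bound : ∃ C : ℝ≥0, ∀ i (lam : ℝ), 1 ≤ lam → ∀ g M,
    (∀ᵐ y, ‖g y‖ₑ ≤ M) → ∀ x, ‖oscOp φ (b i) lam g x‖ₑ ≤ C * ofR (lam ^ ((n - 1) / 2 : ℝ)) * M := by
  obtain ⟨C, h⟩ := hb.enorm_oscOp_le hn hφ hQ (n + 1)
  obtain ⟨D, hD⟩ := hφ.lintegral_majorant_right hn (r := ((n + 1 : ℕ) : ℝ)) (by push_cast; linarith)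
  refine ⟨C * D, fun i lam hl g M hM x => ?_⟩
  have hl0 : 0 < lam := by linarith
  calc _ ≤ C * ofR (lam ^ (n + 1 / 2 : ℝ)) *
        ∫⁻ y, majorant φ lam ((n + 1 : ℕ) : ℝ) x y * M := by
        refine (h i lam hl g x).trans (mul_le_mul' le_rfl (lintegral_mono_ae ?_))
        filter_upwards [hM] with y hy
        exact mul_le_mul' le_rfl hy
    _ ≤ C * ofR (lam ^ (n + 1 / 2 : ℝ)) * (D * ofR (lam ^ (-(n / 2) - 1 : ℝ)) * M) := by
        refine mul_le_mul' le_rfl ?_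
        rw [lintegral_mul_const'' _ (hφ.aemeasurable_majorant_right hl _ x)]
        exact mul_le_mul' (hD lam hl x) le_rfl
    _ = C * D * (ofR (lam ^ (n + 1 / 2 : ℝ)) * ofR (lam ^ (-(n / 2) - 1 : ℝ))) * M := by ring
    _ = _ := by
        rw [← ofR_mul (by positivity), ← rpow_add hl0, coe_mul]
        congr 4
        ring

include hn hφ hQ hnd hb in
theorem SuppUBdd.lintegral_enorm_oscOp_le : ∃ C : ℝ≥0, ∀ i (lam : ℝ), 1 ≤ lam → ∀ g : Rn n → ℂ,
    Integrable g → ∫⁻ x, ‖oscOp φ (b i) lam g x‖ₑ ≤ C * ofR (lam ^ ((n - 1) / 2 : ℝ)) * ∫⁻ y, ‖g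
    y‖ₑ := by
  obtain ⟨C, h⟩ := hb.enorm_oscOp_le hn hφ hQ (n + 1)
  obtain ⟨D, hD⟩ := hφ.lintegral_majorant_rpow_left hn hQ hnd zero_lt_one le_rfl
    (r := ((n + 1 : ℕ) : ℝ)) (by push_cast; linarith)
  refine ⟨C * D, fun i lam hl g hg => ?_⟩
  have hl0 : 0 < lam := by linarith
  calc _ ≤ ∫⁻ x in Q, C * ofR (lam ^ (n + 1 / 2 : ℝ)) *
        ∫⁻ y, majorant φ lam ((n + 1 : ℕ) : ℝ) x y * ‖g y‖ₑ := by
        rw [← setLIntegral_eq_of_support_subset (s := Q)]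
        · exact lintegral_mono fun x => h i lam hl g x
        · intro x hx
          by_contra hc
          exact hx (by simp [hb.oscOp_eq_zero i lam g hc])
    _ = C * ofR (lam ^ (n + 1 / 2 : ℝ)) *
        ∫⁻ y, ∫⁻ x in Q, majorant φ lam ((n + 1 : ℕ) : ℝ) x y * ‖g y‖ₑ := by
        rw [lintegral_const_mul' _ _ (mul_ne_top (by simp) (by simp)), lintegral_lintegral_swap]
        refine AEMeasurable.mul ?_ ?_
        · refine (hφ.aemeasurable_majorant hl _).mono_measure ?_
          rw [Measure.volume_eq_prod]
          exact Measure.prod_mono restrict_le_self le_rfl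
        · exact hg.aestronglyMeasurable.enorm.comp_snd
    _ ≤ C * ofR (lam ^ (n + 1 / 2 : ℝ)) * ∫⁻ y, D * ofR (lam ^ (-(n / 2) - 1 : ℝ)) * ‖g y‖ₑ := by
        refine mul_le_mul' le_rfl (lintegral_mono fun y => ?_)
        rw [lintegral_mul_const'' _ ((hφ.aemeasurable_majorant_left hl _ y).mono_measure
          restrict_le_self)]
        refine mul_le_mul' ?_ le_rfl
        simpa using hD lam hl y
    _ = C * D * (ofR (lam ^ (n + 1 / 2 : ℝ)) * ofR (lam ^ (-(n / 2) - 1 : ℝ))) * ∫⁻ y, ‖g y‖ₑ := by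
        rw [lintegral_const_mul' _ _ (mul_ne_top (by simp) (by simp))]
        ring
    _ = _ := by
        rw [← ofR_mul (by positivity), ← rpow_add hl0, coe_mul]
        congr 4
        ring

theorem ofReal_norm_rpow (z : ℂ) {p : ℝ} (hp : 0 ≤ p) : ofR (‖z‖ ^ p) = ‖z‖ₑ ^ p := by
  rw [← ofReal_rpow_of_nonneg (norm_nonneg _) hp, ofReal_norm]

include hn hφ hQ hnd hb in
theorem SuppUBdd.lintegral_enorm_oscOp_rpow_le {p : ℝ} (hp : 1 ≤ p) : ∃ C : ℝ≥0, ∀ i (lam : ℝ), 1 ≤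
    lam → ∀ g : Rn n → ℂ, Measurable g → Integrable g → ∫⁻ x, ‖oscOp φ (b i) lam g x‖ₑ ^ p ≤ C * ofR
    (lam ^ ((n - 1) * |1 - p / 2| : ℝ)) * ∫⁻ y, ‖g y‖ₑ ^ p := by
  obtain ⟨C1, h1⟩ := hb.lintegral_enorm_oscOp_le hn hφ hQ hnd
  obtain ⟨C2, h2⟩ := hb.lintegral_oscOp_sq_le hφ hQ hnd
  obtain ⟨C3, h3⟩ := hb.enorm_oscOp_le_of_bound hn hφ hQ
  have hn' : (1 : ℝ) ≤ n := by exact_mod_cast hn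
  have h1' : ∀ i (lam : ℝ), 1 ≤ lam → ∀ g : Rn n → ℂ, Measurable g → Integrable g →
      ∫⁻ x, ofR (‖oscOp φ (b i) lam g x‖ ^ (1 : ℝ)) ≤ ofR (C1 * lam ^ ((n - 1) / 2 : ℝ)) *
          ∫⁻ y, ofR (‖g y‖ ^ (1 : ℝ)) := fun i lam hl g _ hg => by
    simp_rw [ofReal_norm_rpow _ zero_le_one, rpow_one]
    rw [ofR_mul C1.coe_nonneg, ofReal_coe_nnreal]
    exact h1 i lam hl g hg
  have h2' : ∀ i (lam : ℝ), 1 ≤ lam → ∀ g : Rn n → ℂ, Measurable g → Integrable g →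
      ∫⁻ x, ofR (‖oscOp φ (b i) lam g x‖ ^ (2 : ℝ)) ≤
        ofR C2 * ∫⁻ y, ofR (‖g y‖ ^ (2 : ℝ)) := fun i lam hl g _ hg => by
    simp_rw [ofReal_norm_rpow _ zero_le_two, ENNReal.rpow_two]
    rw [ofReal_coe_nnreal]
    exact h2 i lam hl g hg
  rcases hp.eq_or_lt with rfl | hp
  · refine ⟨C1, fun i lam hl g _ hg => ?_⟩
    simp_rw [rpow_one]
    convert h1 i lam hl g hg using 5
    rw [abs_of_nonneg (by norm_num)]
    ring
  rcases lt_trichotomy p 2 with hp2 | rfl | hp2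
  · refine ⟨(2 ^ p * p * (C1 * (1 / (p - 1)) + C2 * (1 / (2 - p)))).toNNReal,
      fun i lam hl g hgm hg => ?_⟩
    have hl0 : 0 < lam := by linarith
    have hp1 : 0 < p - 1 := by linarith
    have hp2' : 0 < 2 - p := by linarith
    have h := (hb.isSubadditiveOp_oscOp hφ hQ i lam).lintegral_rpow_le zero_lt_one hp hp2
      (h1' i lam hl) (h2' i lam hl) (c := lam ^ ((n - 1) / 2 : ℝ)) (by positivity) hgm hg
    simp_rw [ofReal_norm_rpow _ (by linarith : 0 ≤ p)] at h
    refine h.trans_eq ?_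
    congr 1
    rw [← ofR_mul (by positivity), ← ofR_mul (by positivity),
      ← ENNReal.ofReal_add (by positivity) (by positivity), ← ofR_mul (by positivity),
      ← ofReal_coe_nnreal, Real.coe_toNNReal _ (by positivity),
      ← ofR_mul (by positivity), ← rpow_mul hl0.le, ← rpow_mul hl0.le,
      abs_of_pos (by linarith)]
    congr 1
    have e1 : lam ^ ((n - 1) / 2 : ℝ) * lam ^ ((n - 1) / 2 * (1 - p) : ℝ) =
        lam ^ ((n - 1) * (1 - p / 2) : ℝ) := by
      rw [← rpow_add hl0]; congr 1; ring
    have e2 : lam ^ ((n - 1) / 2 * (2 - p) : ℝ) = lam ^ ((n - 1) * (1 - p / 2) : ℝ) := by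
      congr 1; ring
    rw [e2, ← e1]
    ring
  · refine ⟨C2, fun i lam hl g _ hg => ?_⟩
    simpa using h2 i lam hl g hg
  · refine ⟨(2 ^ p * p * (C2 * ((C3 + 1) ^ (p - 2) / (p - 2)))).toNNReal,
      fun i lam hl g hgm hg => ?_⟩
    have hl0 : 0 < lam := by linarith
    have hp2' : 0 < p - 2 := by linarith
    have hC3 : (0 : ℝ) < C3 + 1 := by positivity
    have h := (hb.isSubadditiveOp_oscOp hφ hQ i lam).lintegral_rpow_le_of_sup zero_lt_two hp2
      (B := (C3 + 1) * lam ^ ((n - 1) / 2 : ℝ)) (by positivity) (h2' i lam hl)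
      (fun g _ _ M hM x => ?_) hgm hg
    · simp_rw [ofReal_norm_rpow _ (by linarith : 0 ≤ p)] at h
      refine h.trans_eq ?_
      congr 1
      rw [← ofR_mul (by positivity), ← ofR_mul (by positivity),
        ← ofReal_coe_nnreal, Real.coe_toNNReal _ (by positivity),
        ← ofR_mul (by positivity), mul_rpow hC3.le (by positivity),
        ← rpow_mul hl0.le, abs_of_neg (by linarith)]
      congr 1
      have e2 : lam ^ ((n - 1) / 2 * (p - 2) : ℝ) = lam ^ ((n - 1) * -(1 - p / 2) : ℝ) := by
        congr 1; ring
      rw [e2]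
      ring
    · have hM0 : 0 ≤ M := (norm_nonneg _).trans (hM 0)
      have h := h3 i lam hl g (ofR M) (.of_forall fun y => by
        rw [← ofReal_norm]
        exact ofR_le_ofR (hM y)) x
      rw [← ofReal_coe_nnreal, ← ofR_mul C3.coe_nonneg, ← ofR_mul
        (by positivity), ← ofReal_norm, ENNReal.ofReal_le_ofReal_iff (by positivity)] at h
      refine h.trans ?_
      gcongr
      linarith

theorem eLpNorm_le_of_lintegral_rpow_le {α β : Type*} [MeasurableSpace α] [MeasurableSpace β]
    {μ : Measure α} {ν : Measure β} {f : α → ℂ} {g : β → ℂ} {p : ℝ≥0∞} (hp0 : p ≠ 0) (hp : p ≠ ∞)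
    {A : ℝ≥0∞} (h : ∫⁻ x, ‖f x‖ₑ ^ p.toReal ∂μ ≤ A * ∫⁻ y, ‖g y‖ₑ ^ p.toReal ∂ν) :
    eLpNorm f p μ ≤ A ^ (1 / p.toReal) * eLpNorm g p ν := by
  rw [eLpNorm_eq_lintegral_rpow_enorm_toReal hp0 hp, eLpNorm_eq_lintegral_rpow_enorm_toReal hp0 hp,
    ← mul_rpow_of_nonneg _ _ (by positivity)]
  exact rpow_le_rpow h (by positivity)

include hn hφ hQ hnd hb in
theorem SuppUBdd.eLpNorm_oscOp_le {p : ℝ≥0∞} (hp : 1 ≤ p) : ∃ C : ℝ≥0, ∀ i (lam : ℝ), 1 ≤ lam → ∀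
    g : Rn n → ℂ, Measurable g → Integrable g → eLpNorm (oscOp φ (b i) lam g) p volume ≤ C * ofR
    (lam ^ (-criticalOrder n p)) * eLpNorm g p volume := by
  rcases eq_or_ne p ∞ with rfl | hpt
  · obtain ⟨C, h⟩ := hb.enorm_oscOp_le_of_bound hn hφ hQ
    refine ⟨C, fun i lam hl g _ _ => ?_⟩
    have e : -criticalOrder n ∞ = ((n - 1) / 2 : ℝ) := by
      simp [criticalOrder, abs_of_pos]
      ring
    rw [e]
    simp only [eLpNorm_exponent_top]
    exact eLpNormEssSup_le_of_ae_enorm_bound (.of_forall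
      (h i lam hl g _ (enorm_ae_le_eLpNormEssSup g volume)))
  · have hp0 : p ≠ 0 := (zero_lt_one.trans_le hp).ne'
    have hp1 : 1 ≤ p.toReal := by
      simpa using toReal_mono hpt hp
    obtain ⟨C, h⟩ := hb.lintegral_enorm_oscOp_rpow_le hn hφ hQ hnd hp1
    refine ⟨C ^ (1 / p.toReal), fun i lam hl g hgm hg => ?_⟩
    have hl0 : 0 < lam := by linarith
    refine (eLpNorm_le_of_lintegral_rpow_le hp0 hpt (h i lam hl g hgm hg)).trans_eq ?_
    congr 1
    rw [mul_rpow_of_nonneg _ _ (by positivity),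
      ofReal_rpow_of_nonneg (by positivity) (by positivity), ← rpow_mul hl0.le,
      coe_rpow_of_nonneg _ (by positivity)]
    congr 3
    have hpp : (0 : ℝ) < p.toReal := by linarith
    rw [criticalOrder, ENNReal.toReal_inv]
    have e : |1 - p.toReal / 2| = p.toReal * |p.toReal⁻¹ - 1 / 2| := by
      rw [← abs_of_pos hpp, ← abs_mul, abs_of_pos hpp]
      congr 1
      field_simp
    rw [e]
    field_simp

/-- The `L¹`-normalized dilation `μ^n κ(μ ·)`. -/
def dil (κ : Rn n → ℂ) (μ : ℝ) (v : Rn n) : ℂ := ((μ ^ n : ℝ) : ℂ) * κ (μ • v)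

/-- Convolution with the dilation of `κ`. -/
def dilConv (κ : Rn n → ℂ) (μ : ℝ) (F : Rn n → ℂ) (x : Rn n) : ℂ := ∫ y, dil κ μ (x - y) * F y

theorem SchwartzMap.exists_norm_le_inv_pow (κ : 𝒮 n) (N : ℕ) :
    ∃ C : ℝ, 0 ≤ C ∧ ∀ v, ‖κ v‖ ≤ C * ((1 + ‖v‖) ^ N)⁻¹ := by
  obtain ⟨C, hC⟩ : ∃ C : ℝ, ∀ v, (1 + ‖v‖) ^ N * ‖κ v‖ ≤ C := by
    exact ⟨_, fun v => by simpa using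
      SchwartzMap.one_add_le_sup_seminorm_apply (𝕜 := ℝ) (m := (N, 0)) le_rfl le_rfl κ v⟩
  refine ⟨C, (by positivity : (0 : ℝ) ≤ _).trans (hC 0), fun v => ?_⟩
  have h1 : 0 < (1 + ‖v‖) ^ N := by positivity
  rw [← div_eq_mul_inv, le_div_iff₀ h1, mul_comm]
  exact hC v

theorem SchwartzMap.continuous_dil (κ : 𝒮 n) (μ : ℝ) : Continuous (dil κ μ) :=
  continuous_const.mul (κ.continuous.comp (by fun_prop))

theorem SchwartzMap.exists_norm_dil_le (κ : 𝒮 n) (N : ℕ) : ∃ C : ℝ, 0 ≤ C ∧ ∀ μ : ℝ, 0 < μ → ∀ v,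
    ‖dil κ μ v‖ ≤ C * μ ^ n * ((1 + μ * ‖v‖) ^ N)⁻¹ := by
  obtain ⟨C, hC, h⟩ := κ.exists_norm_le_inv_pow N
  refine ⟨C, hC, fun μ hμ v => ?_⟩
  rw [dil, norm_mul, norm_real, norm_eq_abs, abs_of_pos (by positivity)]
  have := h (μ • v)
  rw [norm_smul, norm_eq_abs, abs_of_pos hμ] at this
  calc _ ≤ μ ^ n * (C * ((1 + μ * ‖v‖) ^ N)⁻¹) := by gcongr
    _ = _ := by ring

theorem SchwartzMap.exists_lintegral_dil_mul_le (κ : 𝒮 n) (N : ℕ) : ∃ C : ℝ≥0, ∀ μ lam L : ℝ, 0 <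
    μ → 0 ≤ lam → 1 ≤ L → lam ≤ L * μ → ∫⁻ v, ‖dil κ μ v‖ₑ * ofR ((1 + lam * ‖v‖) ^ N) ≤ C * ofR
    (L ^ N) := by
  obtain ⟨C, hC, h⟩ := κ.exists_norm_dil_le (N + (n + 1))
  obtain ⟨D, hD⟩ := exists_lintegral_decay_le n
  refine ⟨C.toNNReal * D, fun μ lam L hμ hl hL hle => ?_⟩
  calc _ ≤ ∫⁻ v : Rn n, ofR (C * μ ^ n * L ^ N) *
        ofR (((1 + μ * ‖v‖) ^ (n + 1))⁻¹) := by
        refine lintegral_mono fun v => ?_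
        rw [← ofReal_norm, ← ofR_mul (norm_nonneg _), ← ofR_mul (by positivity)]
        refine ofR_le_ofR ?_
        have h0 : 0 ≤ μ * ‖v‖ := by positivity
        have h1 : 1 + lam * ‖v‖ ≤ L * (1 + μ * ‖v‖) := by
          nlinarith [mul_le_mul_of_nonneg_right hle (norm_nonneg v)]
        have h2 : (1 + lam * ‖v‖) ^ N ≤ L ^ N * (1 + μ * ‖v‖) ^ N := by
          rw [← mul_pow]
          gcongr
        calc _ ≤ C * μ ^ n * ((1 + μ * ‖v‖) ^ (N + (n + 1)))⁻¹ *
              (L ^ N * (1 + μ * ‖v‖) ^ N) := by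
              gcongr
              exact h μ hμ v
          _ = _ := by
              rw [pow_add]
              field_simp
    _ ≤ ofR (C * μ ^ n * L ^ N) * (D * ofR ((μ ^ n)⁻¹)) := by
        rw [lintegral_const_mul' _ _ (by simp)]
        exact mul_le_mul' le_rfl (hD μ hμ)
    _ = _ := by
        rw [mul_left_comm, ← ofR_mul (by positivity), coe_mul,
          ofNNReal_toNNReal, mul_comm (ofR C), mul_assoc (D : ℝ≥0∞),
          ← ofR_mul hC]
        congr 2
        field_simp

theorem lintegral_conv_rpow_le {k f : Rn n → ℝ≥0∞} (hk : Measurable k) (hf : AEMeasurable f volume)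
    {p : ℝ} (hp : 1 ≤ p) : ∫⁻ x, (∫⁻ y, k (x - y) * f y) ^ p ≤ (∫⁻ v, k v) ^ p * ∫⁻ y, f y ^ p := by
  have hp0 : 0 < p := by linarith
  have hp1 : 0 ≤ 1 - 1 / p := by
    rw [sub_nonneg, div_le_one hp0]
    exact hp
  have hp1' : 0 ≤ 1 / p := by positivity
  have hkx : ∀ x, AEMeasurable (fun y => k (x - y)) volume := fun x =>
    (hk.comp (by fun_prop)).aemeasurable
  have hmul : (1 - 1 / p) * p = p - 1 := by field_simp
  calc _ ≤ ∫⁻ x, (∫⁻ v, k v) ^ (p - 1) * ∫⁻ y, k (x - y) * f y ^ p := by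
        refine lintegral_mono fun x => ?_
        have e : ∀ y, k (x - y) * f y =
            k (x - y) ^ (1 - 1 / p) * (k (x - y) * f y ^ p) ^ (1 / p) := fun y => by
          rw [mul_rpow_of_nonneg _ _ hp1', ← mul_assoc,
            ← rpow_add_of_nonneg _ _ hp1 hp1', sub_add_cancel, rpow_one,
            ← erpow_mul, mul_one_div_cancel hp0.ne', rpow_one]
        simp_rw [e]
        refine (rpow_le_rpow (ENNReal.lintegral_mul_norm_pow_le (hkx x)
          ((hkx x).mul (hf.pow_const p)) hp1 hp1' (by ring)) hp0.le).trans_eq ?_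
        rw [mul_rpow_of_nonneg _ _ hp0.le, ← erpow_mul, ← erpow_mul,
          one_div_mul_cancel hp0.ne', rpow_one, hmul,
          lintegral_sub_left_eq_self (fun v => k v) x]
        rfl
    _ = (∫⁻ v, k v) ^ (p - 1) * ((∫⁻ v, k v) * ∫⁻ y, f y ^ p) := by
        have hm : AEMeasurable (fun z : ℝ²ⁿ n => k (z.1 - z.2) * f z.2 ^ p) (volume.prod volume) :=
          (hk.comp (by fun_prop)).aemeasurable.mul (hf.pow_const p).comp_snd
        rw [lintegral_const_mul'' _ hm.lintegral_prod_right', lintegral_lintegral_swap hm]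
        congr 1
        have e : ∀ y, ∫⁻ x, k (x - y) * f y ^ p = (∫⁻ v, k v) * f y ^ p := fun y => by
          rw [lintegral_mul_const (f := fun x => k (x - y)) _ (hk.comp (by fun_prop)),
            lintegral_sub_right_eq_self (fun v => k v) y]
        simp_rw [e]
        rw [lintegral_const_mul'' _ (hf.pow_const p)]
    _ = _ := by
        rw [← mul_assoc]
        congr 1
        nth_rewrite 2 [← rpow_one (∫⁻ v, k v)]
        rw [← rpow_add_of_nonneg _ _ (by linarith) zero_le_one, sub_add_cancel]

theorem enorm_dilConv_le (κ : Rn n → ℂ) (μ : ℝ) (F : Rn n → ℂ) (x : Rn n) :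
    ‖dilConv κ μ F x‖ₑ ≤ ∫⁻ y, ‖dil κ μ (x - y)‖ₑ * ‖F y‖ₑ :=
  (enorm_integral_le_lintegral_enorm _).trans_eq (lintegral_congr fun y => enorm_mul _ _)

theorem SchwartzMap.eLpNorm_dilConv_le (κ : 𝒮 n) {p : ℝ≥0∞} (hp : 1 ≤ p) : ∃ C : ℝ≥0, ∀ μ : ℝ, 0 <
    μ → ∀ F : Rn n → ℂ, AEStronglyMeasurable F volume → eLpNorm (dilConv κ μ F) p volume ≤ C *
    eLpNorm F p volume := by
  obtain ⟨C, h⟩ := κ.exists_lintegral_dil_mul_le 0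
  have h' : ∀ μ : ℝ, 0 < μ → ∫⁻ v, ‖dil κ μ v‖ₑ ≤ C := fun μ hμ => by
    simpa using h μ μ 1 hμ hμ.le le_rfl (by simp)
  refine ⟨C, fun μ hμ F hF => ?_⟩
  have hm : Measurable fun v => ‖dil κ μ v‖ₑ := (κ.continuous_dil μ).measurable.enorm
  rcases eq_or_ne p ∞ with rfl | hpt
  · simp only [eLpNorm_exponent_top]
    refine eLpNormEssSup_le_of_ae_enorm_bound (.of_forall fun x => ?_)
    refine (enorm_dilConv_le κ μ F x).trans ?_
    calc _ ≤ ∫⁻ y, ‖dil κ μ (x - y)‖ₑ * eLpNormEssSup F volume := by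
          refine lintegral_mono_ae ?_
          filter_upwards [enorm_ae_le_eLpNormEssSup F volume] with y hy
          exact mul_le_mul' le_rfl hy
      _ ≤ _ := by
          rw [lintegral_mul_const (f := fun y => ‖dil κ μ (x - y)‖ₑ) _ (hm.comp (by fun_prop)),
            lintegral_sub_left_eq_self (fun v => ‖dil κ μ v‖ₑ) x]
          exact mul_le_mul' (h' μ hμ) le_rfl
  · have hp0 : p ≠ 0 := (zero_lt_one.trans_le hp).ne'
    have hp1 : 1 ≤ p.toReal := by simpa using toReal_mono hpt hp
    have hpp : 0 < p.toReal := by linarith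
    refine (eLpNorm_le_of_lintegral_rpow_le (μ := volume) (ν := volume) (g := F) hp0 hpt
      (A := (C : ℝ≥0∞) ^ p.toReal) ?_).trans_eq ?_
    · refine (lintegral_mono fun x => rpow_le_rpow (enorm_dilConv_le κ μ F x)
        hpp.le).trans ((lintegral_conv_rpow_le hm hF.enorm hp1).trans ?_)
      exact mul_le_mul' (rpow_le_rpow (h' μ hμ) hpp.le) le_rfl
    · rw [← erpow_mul, mul_one_div_cancel hpp.ne', rpow_one]

/-- A bounded function dominated by its integral obeys a reverse Hölder inequality. -/
theorem rpow_le_of_le_lintegral {α : Type*} [MeasurableSpace α] {μ : Measure α} {h : α → ℝ≥0∞}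
    {A : ℝ≥0∞} {B : ℝ≥0} (hB : ∀ y, h y ≤ B) (hA : ∀ y, h y ≤ A * ∫⁻ z, h z ∂μ) {p : ℝ} (hp : 0 < p)
    (hp1 : p ≤ 1) : (∀ y, h y ^ p ≤ A * ∫⁻ z, h z ^ p ∂μ) ∧ (∫⁻ z, h z ∂μ) ^ p ≤ A ^ (1 - p) * ∫⁻ z,
    h z ^ p ∂μ := by
  set S : ℝ≥0∞ := ⨆ y, h y with hS
  have hSB : S ≤ B := iSup_le hB
  have hSt : S ≠ ∞ := (hSB.trans_lt ENNReal.coe_lt_top).ne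
  have hp' : 0 ≤ 1 - p := by linarith
  have h1 : ∫⁻ z, h z ∂μ ≤ S ^ (1 - p) * ∫⁻ z, h z ^ p ∂μ := by
    rw [← lintegral_const_mul' _ _ (rpow_ne_top_of_nonneg hp' hSt)]
    refine lintegral_mono fun z => ?_
    have e : h z = h z ^ (1 - p) * h z ^ p := by
      rw [← rpow_add_of_nonneg _ _ hp' hp.le, sub_add_cancel, rpow_one]
    nth_rewrite 1 [e]
    exact mul_le_mul' (rpow_le_rpow (le_iSup h z) hp') le_rfl
  have h2 : S ^ p ≤ A * ∫⁻ z, h z ^ p ∂μ := by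
    rcases eq_or_ne S 0 with h0 | h0
    · rw [h0, ENNReal.zero_rpow_of_pos hp]
      exact zero_le
    have h3 : S ≤ S ^ (1 - p) * (A * ∫⁻ z, h z ^ p ∂μ) := by
      refine iSup_le fun y => (hA y).trans ?_
      rw [mul_left_comm]
      exact mul_le_mul' le_rfl h1
    have e : S = S ^ (1 - p) * S ^ p := by
      rw [← rpow_add_of_nonneg _ _ hp' hp.le, sub_add_cancel, rpow_one]
    nth_rewrite 1 [e] at h3
    exact (ENNReal.mul_le_mul_iff_right (ENNReal.rpow_pos (pos_iff_ne_zero.mpr h0) hSt).ne'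
      (rpow_ne_top_of_nonneg hp' hSt)).mp h3
  refine ⟨fun y => (rpow_le_rpow (le_iSup h y) hp.le).trans h2, ?_⟩
  set I := ∫⁻ z, h z ^ p ∂μ
  calc (∫⁻ z, h z ∂μ) ^ p ≤ (S ^ (1 - p) * I) ^ p := rpow_le_rpow h1 hp.le
    _ = (S ^ p) ^ (1 - p) * I ^ p := by
        rw [mul_rpow_of_nonneg _ _ hp.le, ← erpow_mul, ← erpow_mul, mul_comm (1 - p)]
    _ ≤ (A * I) ^ (1 - p) * I ^ p := mul_le_mul' (rpow_le_rpow h2 hp') le_rfl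
    _ = _ := by
        rw [mul_rpow_of_nonneg _ _ hp', mul_assoc,
          ← rpow_add_of_nonneg _ _ hp' hp.le, sub_add_cancel, rpow_one]

/-- A bounded continuous integrable function reproduced by convolution with `ϑ_lam`. -/
structure IsReproduced (ϑ : 𝒮 n) (lam : ℝ) (g : Rn n → ℂ) : Prop where
  continuous : Continuous g
  integrable : Integrable g
  bounded : ∃ M : ℝ≥0, ∀ y, ‖g y‖ₑ ≤ M
  eq_dilConv : ∀ y, g y = dilConv ϑ lam g y

theorem IsReproduced.exists_weighted_le (ϑ : 𝒮 n) (N : ℕ) : ∃ D : ℝ≥0, ∀ (lam : ℝ), 0 < lam → ∀ g,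
    IsReproduced ϑ lam g → ∀ (W : Rn n → ℝ≥0∞) (B C : ℝ≥0), (∀ y, W y ≤ B) →
    (∀ y z, W y ≤ C * ofR ((1 + lam * ‖y - z‖) ^ N) * W z) → ∀ p : ℝ, 0 < p → p ≤ 1 →
    (∀ y, (W y * ‖g y‖ₑ) ^ p ≤ C * D * ofR (lam ^ n) * ∫⁻ z, (W z * ‖g z‖ₑ) ^ p) ∧
    (∫⁻ z, W z * ‖g z‖ₑ) ^ p ≤ (C * D * ofR (lam ^ n)) ^ (1 - p) * ∫⁻ z, (W z * ‖g z‖ₑ) ^ p := by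
  obtain ⟨D, hD, h⟩ := ϑ.exists_norm_dil_le N
  refine ⟨D.toNNReal, fun lam hl g hg W B C hB hW p hp hp1 => ?_⟩
  obtain ⟨M, hM⟩ := hg.bounded
  refine rpow_le_of_le_lintegral (B := B * M) (fun y => ?_) (fun y => ?_) hp hp1
  · rw [coe_mul]
    exact mul_le_mul' (hB y) (hM y)
  · nth_rewrite 1 [hg.eq_dilConv y]
    calc W y * ‖dilConv ϑ lam g y‖ₑ ≤ W y * ∫⁻ z, ‖dil ϑ lam (y - z)‖ₑ * ‖g z‖ₑ :=
          mul_le_mul' le_rfl (enorm_dilConv_le _ _ _ _)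
      _ = ∫⁻ z, W y * (‖dil ϑ lam (y - z)‖ₑ * ‖g z‖ₑ) :=
          (lintegral_const_mul' _ _ ((hB y).trans_lt ENNReal.coe_lt_top).ne).symm
      _ ≤ ∫⁻ z, C * D.toNNReal * ofR (lam ^ n) * (W z * ‖g z‖ₑ) := by
          refine lintegral_mono fun z => ?_
          have h0 : 0 ≤ lam * ‖y - z‖ := by positivity
          have e1 : ‖dil ϑ lam (y - z)‖ₑ ≤ ofR (D * lam ^ n * ((1 + lam * ‖y - z‖) ^ N)⁻¹) := by
            rw [← ofReal_norm]
            exact ofR_le_ofR (h lam hl _)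
          calc _ ≤ C * ofR ((1 + lam * ‖y - z‖) ^ N) * W z *
                (ofR (D * lam ^ n * ((1 + lam * ‖y - z‖) ^ N)⁻¹) * ‖g z‖ₑ) :=
                mul_le_mul' (hW y z) (mul_le_mul' e1 le_rfl)
            _ = C * (ofR ((1 + lam * ‖y - z‖) ^ N) *
                ofR (D * lam ^ n * ((1 + lam * ‖y - z‖) ^ N)⁻¹)) *
                (W z * ‖g z‖ₑ) := by ring
            _ = _ := by
                rw [ofNNReal_toNNReal, ← ofR_mul (by positivity), mul_assoc _ (ofR D), ← ofR_mul hD]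
                congr 3
                field_simp
      _ = _ := lintegral_const_mul' _ _ (mul_ne_top (mul_ne_top (by simp) (by simp)) (by simp))

theorem IsReproduced.exists_le (ϑ : 𝒮 n) : ∃ D : ℝ≥0, ∀ (lam : ℝ), 0 < lam → ∀ g, IsReproduced ϑ lam
    g → ∀ p : ℝ, 0 < p → p ≤ 1 → (∀ y, ‖g y‖ₑ ^ p ≤ D * ofR (lam ^ n) * ∫⁻ z, ‖g z‖ₑ ^ p) ∧
    (∫⁻ z, ‖g z‖ₑ) ^ p ≤ (D * ofR (lam ^ n)) ^ (1 - p) * ∫⁻ z, ‖g z‖ₑ ^ p := by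
  obtain ⟨D, h⟩ := exists_weighted_le ϑ 0
  refine ⟨D, fun lam hl g hg p hp hp1 => ?_⟩
  simpa using h lam hl g hg (fun _ => 1) 1 1 (by simp) (by simp) p hp hp1

section Base

variable {Q' : Set (Rn n)}

include hn hφ hQ in
theorem SuppUBdd.lintegral_near_le (hQ' : IsCompact Q') (hQQ : Q ⊆ Q') (hnd : MixedNonDeg φ Q')
    (hb : ShellUBdd Q b) (κ ϑ : 𝒮 n) {p : ℝ} (hp : 0 < p) (hp1 : p ≤ 1) {N : ℕ}
    (hN : (n : ℝ) < N * p) : ∃ C : ℝ≥0, ∀ i (lam μ L : ℝ), 1 ≤ lam → 0 < μ → 1 ≤ L → lam ≤ L * μ → ∀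
    g : Rn n → ℂ, IsReproduced ϑ lam g → ∫⁻ x in Q', ‖dilConv κ μ (oscOp φ (b i) lam g) x‖ₑ ^ p ≤
    C * ofR (L ^ ⌈N * p⌉₊) * ofR (lam ^ ((n - 1) * (1 - p / 2) : ℝ)) * ∫⁻ y, ‖g y‖ₑ ^ p := by
  obtain ⟨R, hR⟩ := hQ'.isBounded.subset_closedBall 0
  obtain ⟨C1, h1⟩ := hb.enorm_oscOp_le hn hφ hQ N
  obtain ⟨C2, hC2, h2⟩ := hφ.majorant_le_left (r := N) (by positivity) R
  obtain ⟨C3, h3⟩ := κ.exists_lintegral_dil_mul_le N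
  obtain ⟨C4, h4⟩ := IsReproduced.exists_weighted_le ϑ N
  obtain ⟨C5, h5⟩ := hφ.lintegral_majorant_rpow_left hn hQ' hnd hp hp1 hN
  obtain ⟨C6, h6⟩ := exists_majorant_le (φ := φ) hn (r := (N : ℝ)) (by positivity)
  have hp0 : 0 ≤ p := hp.le
  have hp' : 0 ≤ 1 - p := by linarith
  refine ⟨(C1 * C2.toNNReal * C3) ^ p * ((4 ^ N * C4) ^ (1 - p) * C5), fun i lam μ L hl hμ hL hle g hg => ?_⟩
  have hl0 : 0 < lam := by linarith
  have hpt : ∀ x ∈ Q', ‖dilConv κ μ (oscOp φ (b i) lam g) x‖ₑ ≤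
      C1 * C2.toNNReal * C3 * ofR (lam ^ (n + 1 / 2 : ℝ)) * ofR (L ^ N) *
        ∫⁻ y, majorant φ lam N x y * ‖g y‖ₑ := fun x hx => by
    refine (enorm_dilConv_le _ _ _ _).trans ?_
    calc _ ≤ ∫⁻ z, C1 * ofR (lam ^ (n + 1 / 2 : ℝ)) * C2.toNNReal *
          (∫⁻ y, majorant φ lam N x y * ‖g y‖ₑ) *
          (‖dil κ μ (x - z)‖ₑ * ofR ((1 + lam * ‖x - z‖) ^ N)) := by
          refine lintegral_mono fun z => ?_
          by_cases hz : z ∈ Q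
          · have e : ∫⁻ y, majorant φ lam N z y * ‖g y‖ₑ ≤
                C2.toNNReal * ofR ((1 + lam * ‖x - z‖) ^ N) *
                  ∫⁻ y, majorant φ lam N x y * ‖g y‖ₑ := by
              rw [← lintegral_const_mul' _ _ (mul_ne_top (by simp) (by simp))]
              refine lintegral_mono fun y => ?_
              rw [← mul_assoc]
              refine mul_le_mul' ((h2 lam hl x (hR hx) z (hR (hQQ hz)) y).trans_eq ?_) le_rfl
              rw [ofR_mul hC2, ofNNReal_toNNReal, rpow_natCast]
            calc _ ≤ ‖dil κ μ (x - z)‖ₑ * (C1 * ofR (lam ^ (n + 1 / 2 : ℝ)) *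
                  (C2.toNNReal * ofR ((1 + lam * ‖x - z‖) ^ N) *
                    ∫⁻ y, majorant φ lam N x y * ‖g y‖ₑ)) :=
                  mul_le_mul' le_rfl ((h1 i lam hl g z).trans (mul_le_mul' le_rfl e))
              _ = _ := by ring
          · simp [hb.oscOp_eq_zero i lam g hz]
      _ = C1 * ofR (lam ^ (n + 1 / 2 : ℝ)) * C2.toNNReal * (∫⁻ y, majorant φ lam N x y * ‖g y‖ₑ) *
          ∫⁻ v, ‖dil κ μ v‖ₑ * ofR ((1 + lam * ‖v‖) ^ N) := by
          rw [lintegral_const_mul, lintegral_sub_left_eq_self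
            (fun v => ‖dil κ μ v‖ₑ * ofR ((1 + lam * ‖v‖) ^ N)) x]
          exact ((κ.continuous_dil μ).comp (by fun_prop)).enorm.measurable.mul (by fun_prop)
      _ ≤ _ := by
          refine (mul_le_mul' le_rfl (h3 μ lam L hμ hl0.le hL hle)).trans_eq ?_
          ring
  have hH : ∀ x, (∫⁻ y, majorant φ lam N x y * ‖g y‖ₑ) ^ p ≤
      ((4 ^ N : ℝ≥0) * C4 * ofR (lam ^ n)) ^ (1 - p) *
        ∫⁻ y, majorant φ lam N x y ^ p * ‖g y‖ₑ ^ p := fun x => by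
    simp_rw [← mul_rpow_of_nonneg _ _ hp0]
    refine (h4 lam hl0 g hg (majorant φ lam N x) C6 (4 ^ N) (h6 lam hl x) (fun y z => ?_) p hp
      hp1).2
    refine (majorant_le_right hl (by positivity) x y z).trans_eq ?_
    rw [rpow_natCast, mul_pow, ofR_mul (by positivity)]
    simp
  have hmeas : AEMeasurable (fun z : ℝ²ⁿ n => majorant φ lam N z.1 z.2 ^ p * ‖g z.2‖ₑ ^ p)
      ((volume.restrict Q').prod volume) := by
    refine AEMeasurable.mul ?_ ?_
    · refine ((hφ.aemeasurable_majorant hl _).mono_measure ?_).pow_const p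
      rw [Measure.volume_eq_prod]
      exact Measure.prod_mono restrict_le_self le_rfl
    · exact (hg.integrable.aestronglyMeasurable.enorm.pow_const p).comp_snd
  have hconst : ((4 ^ N : ℝ≥0) * C4 * ofR (lam ^ n)) ^ (1 - p) ≠ ∞ :=
    rpow_ne_top_of_nonneg hp' (by finiteness)
  calc _ ≤ ∫⁻ x in Q', (C1 * C2.toNNReal * C3 * ofR (lam ^ (n + 1 / 2 : ℝ)) *
        ofR (L ^ N)) ^ p * (((4 ^ N : ℝ≥0) * C4 * ofR (lam ^ n)) ^ (1 - p) *
          ∫⁻ y, majorant φ lam N x y ^ p * ‖g y‖ₑ ^ p) := by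
        refine setLIntegral_mono' hQ'.measurableSet fun x hx => ?_
        refine (rpow_le_rpow (hpt x hx) hp0).trans ?_
        rw [mul_rpow_of_nonneg _ _ hp0]
        exact mul_le_mul' le_rfl (hH x)
    _ = (C1 * C2.toNNReal * C3 * ofR (lam ^ (n + 1 / 2 : ℝ)) *
        ofR (L ^ N)) ^ p * (((4 ^ N : ℝ≥0) * C4 * ofR (lam ^ n)) ^ (1 - p) *
          ∫⁻ y, ∫⁻ x in Q', majorant φ lam N x y ^ p * ‖g y‖ₑ ^ p) := by
        rw [lintegral_const_mul' _ _ (rpow_ne_top_of_nonneg hp0 (by finiteness)),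
          lintegral_const_mul' _ _ hconst, lintegral_lintegral_swap hmeas]
    _ ≤ (C1 * C2.toNNReal * C3 * ofR (lam ^ (n + 1 / 2 : ℝ)) *
        ofR (L ^ N)) ^ p * (((4 ^ N : ℝ≥0) * C4 * ofR (lam ^ n)) ^ (1 - p) *
          (C5 * ofR (lam ^ (-(n * p / 2) - 1 : ℝ)) * ∫⁻ y, ‖g y‖ₑ ^ p)) := by
        refine mul_le_mul' le_rfl (mul_le_mul' le_rfl ?_)
        rw [← lintegral_const_mul' _ _ (by finiteness)]
        refine lintegral_mono fun y => ?_
        rw [lintegral_mul_const'' _ (((hφ.aemeasurable_majorant_left hl _ y).mono_measure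
          restrict_le_self).pow_const p)]
        exact mul_le_mul' (h5 lam hl y) le_rfl
    _ = ((C1 * C2.toNNReal * C3 : ℝ≥0) : ℝ≥0∞) ^ p *
        ((((4 ^ N * C4 : ℝ≥0) : ℝ≥0∞) ^ (1 - p)) * C5) * ofR (L ^ N) ^ p *
        (ofR (lam ^ (n + 1 / 2 : ℝ)) ^ p * ofR (lam ^ n) ^ (1 - p) *
          ofR (lam ^ (-(n * p / 2) - 1 : ℝ))) * ∫⁻ y, ‖g y‖ₑ ^ p := by
        rw [mul_rpow_of_nonneg _ _ hp0, mul_rpow_of_nonneg _ _ hp0, mul_rpow_of_nonneg _ _ hp']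
        push_cast
        ring
    _ ≤ _ := by
        refine mul_le_mul' (mul_le_mul' (mul_le_mul' ?_ ?_) ?_) le_rfl
        · rw [coe_mul (_ ^ p), coe_mul (_ ^ (1 - p)),
            coe_rpow_of_nonneg _ hp0, coe_rpow_of_nonneg _ hp']
        · rw [ofReal_rpow_of_nonneg (by positivity) hp0]
          refine ofR_le_ofR ?_
          rw [← rpow_natCast, ← rpow_natCast, ← rpow_mul (by positivity)]
          exact rpow_le_rpow_of_exponent_le hL (Nat.le_ceil _)
        · rw [ofReal_rpow_of_nonneg (by positivity) hp0,
            ofReal_rpow_of_nonneg (by positivity) hp', ← rpow_natCast lam n,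
            ← rpow_mul hl0.le, ← rpow_mul hl0.le, ← ofR_mul (by positivity),
            ← ofR_mul (by positivity), ← rpow_add hl0, ← rpow_add hl0]
          refine (congrArg (fun t => ofR (lam ^ t)) ?_).le
          ring

end Base

section Base

variable {Q' : Set (Rn n)}

/-- Away from its support, a smooth average of a compactly supported function decays. -/
theorem SchwartzMap.exists_enorm_dilConv_far_le (κ : 𝒮 n) (hQ : IsCompact Q) {δ : ℝ} (hδ : 0 < δ)
    (N : ℕ) : ∃ C : ℝ≥0, ∀ (μ : ℝ), 0 < μ → ∀ F : Rn n → ℂ, (∀ z ∉ Q, F z = 0) → ∀ x ∉ cthickening δ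
    Q, ‖dilConv κ μ F x‖ₑ ≤ C * ofR (μ ^ n * (μ ^ N)⁻¹ * ((1 + ‖x‖) ^ N)⁻¹) * ∫⁻ z, ‖F z‖ₑ := by
  obtain ⟨D, hD, h⟩ := κ.exists_norm_dil_le N
  obtain ⟨R, hR0, hR⟩ := hQ.isBounded.subset_closedBall_lt 0 0
  set c := δ / (δ + R + 1) with hc
  have hc0 : 0 < c := by positivity
  refine ⟨(D * (c ^ N)⁻¹).toNNReal, fun μ hμ F hF x hx => ?_⟩
  refine (enorm_dilConv_le _ _ _ _).trans ?_
  rw [← lintegral_const_mul' _ _ (by finiteness)]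
  refine lintegral_mono fun z => ?_
  by_cases hz : z ∈ Q
  · refine mul_le_mul' ?_ le_rfl
    rw [ofNNReal_toNNReal, ← ofR_mul (by positivity), ← ofReal_norm]
    refine ofR_le_ofR ((h μ hμ _).trans ?_)
    have hd : δ < ‖x - z‖ := by
      by_contra! hle
      exact hx (Metric.mem_cthickening_of_dist_le x z δ Q hz (by rwa [dist_eq_norm]))
    have hz' : ‖z‖ ≤ R := by simpa using hR hz
    have hxz : ‖x‖ ≤ ‖x - z‖ + ‖z‖ := by simpa using norm_add_le (x - z) z
    have hkey : c * (1 + ‖x‖) ≤ ‖x - z‖ := by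
      rw [hc, div_mul_eq_mul_div, div_le_iff₀ (by positivity)]
      nlinarith
    have hlow : μ * (c * (1 + ‖x‖)) ≤ 1 + μ * ‖x - z‖ := by nlinarith
    calc _ ≤ D * μ ^ n * ((μ * (c * (1 + ‖x‖))) ^ N)⁻¹ := by gcongr
      _ = _ := by rw [mul_pow, mul_pow]; field_simp
  · simp [hF z hz]

include hn hφ hQ in
theorem SuppUBdd.lintegral_far_le {δ : ℝ} (hδ : 0 < δ) (hnd : MixedNonDeg φ Q) (hb : ShellUBdd Q b)
    (κ ϑ : 𝒮 n) {p : ℝ} (hp : 0 < p) (hp1 : p ≤ 1) : ∃ C : ℝ≥0, ∀ i (lam μ L : ℝ), 1 ≤ lam → 1 ≤ μ →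
    1 ≤ L → lam ≤ L * μ → ∀ g : Rn n → ℂ, IsReproduced ϑ lam g → ∫⁻ x in (cthickening δ Q)ᶜ,
    ‖dilConv κ μ (oscOp φ (b i) lam g) x‖ₑ ^ p ≤ C * ofR L * ofR
    (lam ^ ((n - 1) * (1 - p / 2) : ℝ)) * ∫⁻ y, ‖g y‖ₑ ^ p := by
  obtain ⟨N, hN⟩ := exists_nat_ge (n + (n + 1) / p)
  have hN' : n * p + (n + 1) ≤ N * p := by
    have := mul_le_mul_of_nonneg_right hN hp.le
    rwa [add_mul, div_mul_cancel₀ _ hp.ne'] at this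
  obtain ⟨C1, h1⟩ := κ.exists_enorm_dilConv_far_le hQ hδ N
  obtain ⟨C2, h2⟩ := hb.lintegral_enorm_oscOp_le hn hφ hQ hnd
  obtain ⟨C3, h3⟩ := IsReproduced.exists_le ϑ
  obtain ⟨C4, h4⟩ := exists_lintegral_decay_le n
  have hp0 : 0 ≤ p := hp.le
  have hp' : 0 ≤ 1 - p := by linarith
  refine ⟨(C1 * C2) ^ p * C3 ^ (1 - p) * C4, fun i lam μ L hl hμ hL hle g hg => ?_⟩
  have hl0 : 0 < lam := by linarith
  have hμ0 : 0 < μ := by linarith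
  have hn0 : (0 : ℝ) ≤ n := by positivity
  have hF : (∫⁻ z, ‖oscOp φ (b i) lam g z‖ₑ) ^ p ≤ (C2 * ofR (lam ^ ((n - 1) / 2 : ℝ))) ^ p *
        ((C3 * ofR (lam ^ n)) ^ (1 - p) * ∫⁻ z, ‖g z‖ₑ ^ p) := by
    refine (rpow_le_rpow (h2 i lam hl g hg.integrable) hp0).trans ?_
    rw [mul_rpow_of_nonneg _ _ hp0]
    exact mul_le_mul' le_rfl (h3 lam hl0 g hg p hp hp1).2
  have hdec : ∀ x : Rn n, (C1 * ofR (μ ^ n * (μ ^ N)⁻¹ * ((1 + ‖x‖) ^ N)⁻¹)) ^ p ≤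
      (C1 : ℝ≥0∞) ^ p * ofR μ⁻¹ * ofR (((1 + 1 * ‖x‖) ^ (n + 1))⁻¹) := fun x => by
    rw [mul_rpow_of_nonneg _ _ hp0, mul_assoc ((C1 : ℝ≥0∞) ^ p),
      ← ofR_mul (by positivity), ofReal_rpow_of_nonneg (by positivity) hp0]
    refine mul_le_mul' le_rfl (ofR_le_ofR ?_)
    have hx : 1 ≤ 1 + ‖x‖ := by simp
    have hx0 : 0 < 1 + ‖x‖ := by positivity
    rw [← rpow_natCast μ n, ← rpow_natCast, ← rpow_natCast,
      ← rpow_neg hμ0.le, ← rpow_neg hx0.le, ← rpow_add hμ0,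
      mul_rpow (by positivity) (by positivity), ← rpow_mul hμ0.le,
      ← rpow_mul hx0.le, one_mul, ← rpow_natCast, ← rpow_neg hx0.le,
      ← Real.rpow_neg_one μ]
    refine mul_le_mul (rpow_le_rpow_of_exponent_le hμ ?_)
      (rpow_le_rpow_of_exponent_le hx ?_) (by positivity) (by positivity)
    · nlinarith
    · push_cast
      nlinarith
  have hlam : lam ^ ((n - 1) / 2 * p + n * (1 - p) : ℝ) * μ⁻¹ ≤
      L * lam ^ ((n - 1) * (1 - p / 2) : ℝ) := by
    have : ((n - 1) / 2 * p + n * (1 - p) : ℝ) = (1 - p) + (n - 1) * (1 - p / 2) := by ring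
    rw [this, rpow_add hl0, ← div_eq_mul_inv, div_le_iff₀ hμ0]
    calc _ ≤ lam ^ (1 : ℝ) * lam ^ ((n - 1) * (1 - p / 2) : ℝ) :=
          mul_le_mul_of_nonneg_right (rpow_le_rpow_of_exponent_le hl (by linarith)) (by positivity)
      _ ≤ (L * μ) * lam ^ ((n - 1) * (1 - p / 2) : ℝ) := by
          rw [Real.rpow_one]
          gcongr
      _ = _ := by ring
  set X := (∫⁻ z, ‖oscOp φ (b i) lam g z‖ₑ) ^ p
  calc _ ≤ ∫⁻ x in (cthickening δ Q)ᶜ, (C1 : ℝ≥0∞) ^ p * ofR μ⁻¹ * X *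
        ofR (((1 + 1 * ‖x‖) ^ (n + 1))⁻¹) := by
        refine setLIntegral_mono' Metric.isClosed_cthickening.measurableSet.compl fun x hx => ?_
        refine (rpow_le_rpow (h1 μ hμ0 _ (fun z hz => hb.oscOp_eq_zero i lam g hz) x hx)
          hp0).trans ?_
        rw [mul_rpow_of_nonneg _ _ hp0]
        exact (mul_le_mul' (hdec x) le_rfl).trans_eq (by ring)
    _ ≤ ∫⁻ x, (C1 : ℝ≥0∞) ^ p * ofR μ⁻¹ * X *
        ofR (((1 + 1 * ‖x‖) ^ (n + 1))⁻¹) := setLIntegral_le_lintegral _ _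
    _ ≤ (C1 : ℝ≥0∞) ^ p * ofR μ⁻¹ * X * C4 := by
        rw [lintegral_const_mul _ (by fun_prop)]
        exact mul_le_mul' le_rfl ((h4 1 one_pos).trans_eq (by simp))
    _ ≤ (C1 : ℝ≥0∞) ^ p * ofR μ⁻¹ * ((C2 * ofR (lam ^ ((n - 1) / 2 : ℝ))) ^ p *
        ((C3 * ofR (lam ^ n)) ^ (1 - p) * ∫⁻ z, ‖g z‖ₑ ^ p)) * C4 := by gcongr
    _ = (C1 : ℝ≥0∞) ^ p * C2 ^ p * C3 ^ (1 - p) * C4 * (ofR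
        (lam ^ ((n - 1) / 2 : ℝ)) ^ p * ofR (lam ^ n) ^ (1 - p) * ofR μ⁻¹) * ∫⁻ z, ‖g z‖ₑ ^ p := by
        rw [mul_rpow_of_nonneg _ _ hp0, mul_rpow_of_nonneg _ _ hp']
        ring
    _ ≤ (C1 : ℝ≥0∞) ^ p * C2 ^ p * C3 ^ (1 - p) * C4 *
        (ofR L * ofR (lam ^ ((n - 1) * (1 - p / 2) : ℝ))) *
        ∫⁻ z, ‖g z‖ₑ ^ p := by
        refine mul_le_mul' (mul_le_mul' le_rfl ?_) le_rfl
        rw [ofReal_rpow_of_nonneg (by positivity) hp0,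
          ofReal_rpow_of_nonneg (by positivity) hp', ← rpow_natCast lam n,
          ← rpow_mul hl0.le, ← rpow_mul hl0.le, ← ofR_mul (by positivity),
          ← ofR_mul (by positivity), ← ofR_mul (by positivity),
          ← rpow_add hl0]
        exact ofR_le_ofR hlam
    _ = _ := by
        rw [coe_mul, coe_mul, coe_rpow_of_nonneg _ hp0,
          coe_rpow_of_nonneg _ hp', coe_mul, mul_rpow_of_nonneg _ _ hp0]
        ring

include hn hφ hQ in
theorem exists_eLpNorm_dilConv_oscOp_le {δ : ℝ} (hδ : 0 < δ) (hnd : MixedNonDeg φ (cthickening δ Q))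
    {p : ℝ≥0∞} (hp : 0 < p) : ∃ N : ℕ, ∀ (κ ϑ : 𝒮 n) {b : ι → ℝ²ⁿ n → ℂ}, ShellUBdd Q b → ∃ C : ℝ≥0,
    ∀ i (lam μ L : ℝ), 1 ≤ lam → 1 ≤ μ → 1 ≤ L → lam ≤ L * μ → ∀ g : Rn n → ℂ, IsReproduced ϑ lam
    g → eLpNorm (dilConv κ μ (oscOp φ (b i) lam g)) p volume ≤ C * ofR (L ^ N) * ofR
    (lam ^ (-criticalOrder n p)) * eLpNorm g p volume := by
  have hQQ := Metric.self_subset_cthickening (δ := δ) Q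
  have hndQ : MixedNonDeg φ Q := fun x hx => hnd x (hQQ hx)
  rcases le_or_gt 1 p with h | h
  · refine ⟨0, fun κ ϑ b hb => ?_⟩
    obtain ⟨C1, h1⟩ := hb.eLpNorm_oscOp_le hn hφ hQ hndQ h
    obtain ⟨C2, h2⟩ := κ.eLpNorm_dilConv_le h
    refine ⟨C2 * C1, fun i lam μ L hl hμ hL hle g hg => ?_⟩
    refine (h2 μ (by linarith) _
      (hb.continuous_oscOp hφ hQ i lam hg.integrable).aestronglyMeasurable).trans ?_
    refine (mul_le_mul' le_rfl (h1 i lam hl g hg.continuous.measurable hg.integrable)).trans_eq ?_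
    simp
    ring
  · have hpt : p ≠ ∞ := (h.trans ENNReal.one_lt_top).ne
    have hp0 : 0 < p.toReal := toReal_pos hp.ne' hpt
    have hp1 : p.toReal ≤ 1 := by
      simpa using toReal_mono one_ne_top h.le
    obtain ⟨N', hN'⟩ := exists_nat_gt (n / p.toReal)
    rw [div_lt_iff₀ hp0] at hN'
    set N := ⌈N' * p.toReal⌉₊
    refine ⟨⌈((N + 1 : ℕ) : ℝ) * (1 / p.toReal)⌉₊, fun κ ϑ b hb => ?_⟩
    obtain ⟨C1, h1⟩ := hb.lintegral_near_le hn hφ hQ hQ.cthickening hQQ hnd κ ϑ hp0 hp1 hN'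
    obtain ⟨C2, h2⟩ := hb.lintegral_far_le hn hφ hQ hδ hndQ κ ϑ hp0 hp1
    have hinv : 0 ≤ 1 / p.toReal := by positivity
    refine ⟨(C1 + C2) ^ (1 / p.toReal), fun i lam μ L hl hμ hL hle g hg => ?_⟩
    have hl0 : 0 < lam := by linarith
    have hL0 : 0 < L := by linarith
    have key : ∫⁻ x, ‖dilConv κ μ (oscOp φ (b i) lam g) x‖ₑ ^ p.toReal ≤
        ((C1 + C2 : ℝ≥0) * ofR (L ^ (N + 1)) * ofR (lam ^ ((n - 1) * (1 - p.toReal / 2) : ℝ))) *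
          ∫⁻ y, ‖g y‖ₑ ^ p.toReal := by
      rw [← lintegral_add_compl _ (hQ.cthickening (r := δ)).measurableSet]
      have e1 : L ^ N ≤ L ^ (N + 1) := pow_le_pow_right₀ hL (by simp)
      have e2 : L ≤ L ^ (N + 1) := le_self_pow₀ hL (by simp)
      refine (add_le_add ((h1 i lam μ L hl (by linarith) hL hle g hg).trans
        (mul_le_mul' (mul_le_mul' (mul_le_mul' le_rfl (ofR_le_ofR e1)) le_rfl)
          le_rfl)) ((h2 i lam μ L hl hμ hL hle g hg).trans
        (mul_le_mul' (mul_le_mul' (mul_le_mul' le_rfl (ofR_le_ofR e2)) le_rfl) le_rfl))).trans_eq ?_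
      push_cast
      ring
    refine (eLpNorm_le_of_lintegral_rpow_le hp.ne' hpt key).trans (mul_le_mul' ?_ le_rfl)
    rw [mul_rpow_of_nonneg _ _ hinv, mul_rpow_of_nonneg _ _ hinv,
      coe_rpow_of_nonneg _ hinv, ofReal_rpow_of_nonneg (by positivity) hinv,
      ofReal_rpow_of_nonneg (by positivity) hinv, ← rpow_natCast L,
      ← rpow_natCast L, ← rpow_mul hl0.le, ← rpow_mul hL0.le]
    refine mul_le_mul' (mul_le_mul' le_rfl (ofR_le_ofR
      (rpow_le_rpow_of_exponent_le hL (Nat.le_ceil _)))) (ofR_le_ofR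
      (rpow_le_rpow_of_exponent_le hl (le_of_eq ?_)))
    rw [criticalOrder, ENNReal.toReal_inv, abs_of_nonneg]
    · field_simp
    · have := (one_le_inv₀ hp0).2 hp1
      linarith

end Base

section DerivUnderIntegral

variable {A : ℝ²ⁿ n → ℂ} {G : Rn n → ℂ}

theorem HasCompactSupport.slice {E : Type*} [Zero E] {A : ℝ²ⁿ n → E} (hs : HasCompactSupport A)
    (x : Rn n) : HasCompactSupport fun η => A (x, η) :=
  HasCompactSupport.intro (hs.image continuous_snd) fun η hη => by
    by_contra h
    exact hη ⟨(x, η), subset_tsupport _ h, rfl⟩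

theorem hasFDerivAt_integral_mul (hA : ContDiff ℝ 1 A) (hs : HasCompactSupport A)
    (hG : Continuous G) (x : Rn n) : HasFDerivAt (fun x => ∫ η, A (x, η) * G η)
    (∫ η, G η • (fderiv ℝ A (x, η)).comp (inl ℝ (Rn n) (Rn n))) x := by
  have hd : Continuous (fderiv ℝ A) := hA.continuous_fderiv (by simp)
  obtain ⟨M, hM⟩ := (hs.fderiv ℝ).exists_bound_of_continuous hd
  set T := Prod.snd '' tsupport A
  have hT : IsCompact T := hs.image continuous_snd
  have hcs : ∀ x, Continuous fun η : Rn n => A (x, η) := fun x =>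
    hA.continuous.comp (by fun_prop : Continuous fun η : Rn n => (x, η))
  have hds : ∀ x, Continuous fun η : Rn n => fderiv ℝ A (x, η) := fun x =>
    hd.comp (by fun_prop : Continuous fun η : Rn n => (x, η))
  refine hasFDerivAt_integral_of_dominated_of_fderiv_le (𝕜 := ℝ) (s := Set.univ)
    (F := fun x η => A (x, η) * G η) (F' := fun x η => G η •
      (fderiv ℝ A (x, η)).comp (inl ℝ (Rn n) (Rn n)))
    (bound := T.indicator fun η => ‖G η‖ * (M * ‖inl ℝ (Rn n) (Rn n)‖))
    Filter.univ_mem (.of_forall fun x => ((hcs x).mul hG).aestronglyMeasurable)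
    (((hcs x).mul hG).integrable_of_hasCompactSupport (hs.slice x).mul_right)
    (hG.smul ((hds x).clm_comp_const _)).aestronglyMeasurable
    (.of_forall fun η x _ => ?_) ?_
    (.of_forall fun η x _ => ?_)
  · by_cases hη : η ∈ T
    · rw [indicator_of_mem hη, norm_smul]
      exact mul_le_mul_of_nonneg_left ((opNorm_comp_le _ _).trans
        (mul_le_mul_of_nonneg_right (hM _) (norm_nonneg _))) (norm_nonneg _)
    · have : fderiv ℝ A (x, η) = 0 := by
        by_contra h
        exact hη ⟨(x, η), support_fderiv_subset ℝ h, rfl⟩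
      simp [this, Set.indicator_of_notMem hη]
  · rw [integrable_indicator_iff hT.measurableSet]
    exact (hG.norm.mul continuous_const).continuousOn.integrableOn_compact hT
  · have h1 : HasFDerivAt A (fderiv ℝ A (x, η)) (x, η) :=
      (hA.differentiable (by simp) _).hasFDerivAt
    have h2 := HasFDerivAt.comp (g := A) (f := fun e => (e, η)) x h1 (hasFDerivAt_prodMk_left x η)
    have h3 := h2.mul_const (G η)
    exact h3

theorem fderiv_integral_mul (hA : ContDiff ℝ 1 A) (hs : HasCompactSupport A) (hG : Continuous G)
    (x v : Rn n) :
    fderiv ℝ (fun x => ∫ η, A (x, η) * G η) x v = ∫ η, fderiv ℝ A (x, η) (v, 0) * G η := by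
  have hd : Continuous fun η : Rn n => fderiv ℝ A (x, η) := (hA.continuous_fderiv (by simp)).comp
    (by fun_prop : Continuous fun η : Rn n => (x, η))
  rw [(hasFDerivAt_integral_mul hA hs hG x).fderiv, ContinuousLinearMap.integral_apply]
  · refine integral_congr_ae (.of_forall fun η => ?_)
    simp [mul_comm]
  · refine (hG.smul (hd.clm_comp_const _)).integrable_of_hasCompactSupport
      (HasCompactSupport.intro (hs.image continuous_snd) fun η hη => ?_)
    have : fderiv ℝ A (x, η) = 0 := by
      by_contra h
      exact hη ⟨(x, η), support_fderiv_subset ℝ h, rfl⟩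
    simp [this]

end DerivUnderIntegral

/-- The directional derivative of a Schwartz function. -/
def SchwartzMap.lderiv (κ : 𝒮 n) (v : Rn n) : 𝒮 n := LineDeriv.lineDerivOp v κ

theorem SchwartzMap.lderiv_apply (κ : 𝒮 n) (v x : Rn n) : κ.lderiv v x = fderiv ℝ κ x v :=
  SchwartzMap.lineDerivOp_apply_eq_fderiv v κ x

theorem SchwartzMap.exists_norm_dil_le_const (κ : 𝒮 n) (μ : ℝ) : ∃ M : ℝ, ∀ v, ‖dil κ μ v‖ ≤ M := by
  obtain ⟨C, hC, h⟩ := κ.exists_norm_le_inv_pow 0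
  refine ⟨|μ ^ n| * C, fun v => ?_⟩
  rw [dil, norm_mul, norm_real, norm_eq_abs]
  exact mul_le_mul_of_nonneg_left (by simpa using h (μ • v)) (abs_nonneg _)

theorem SchwartzMap.integrable_dil_mul (κ : 𝒮 n) (μ : ℝ) {F : Rn n → ℂ} (hF : Integrable F)
    (x : Rn n) : Integrable fun y => dil κ μ (x - y) * F y := by
  obtain ⟨M, hM⟩ := κ.exists_norm_dil_le_const μ
  exact hF.bdd_mul ((κ.continuous_dil μ).comp (by fun_prop)).aestronglyMeasurable
    (.of_forall fun y => hM (x - y))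

theorem SchwartzMap.continuous_dilConv (κ : 𝒮 n) (μ : ℝ) {F : Rn n → ℂ} (hF : Integrable F) :
    Continuous (dilConv κ μ F) := by
  obtain ⟨M, hM⟩ := κ.exists_norm_dil_le_const μ
  refine continuous_of_dominated (bound := fun y => M * ‖F y‖)
    (fun x => (κ.integrable_dil_mul μ hF x).aestronglyMeasurable)
    (fun x => .of_forall fun y => ?_) (hF.norm.const_mul M)
    (.of_forall fun y => ?_)
  · rw [norm_mul]
    exact mul_le_mul_of_nonneg_right (hM _) (norm_nonneg _)
  · exact ((κ.continuous_dil μ).comp (by fun_prop)).mul continuous_const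

theorem SchwartzMap.dilConv_finset_sum (κ : 𝒮 n) (μ : ℝ) {α : Type*} (s : Finset α)
    {F : α → Rn n → ℂ} (hF : ∀ a ∈ s, Integrable (F a)) (x : Rn n) :
    dilConv κ μ (fun y => ∑ a ∈ s, F a y) x = ∑ a ∈ s, dilConv κ μ (F a) x := by
  unfold dilConv
  simp_rw [mul_sum]
  exact integral_finsetSum _ fun a ha => κ.integrable_dil_mul μ (hF a ha) x

theorem SchwartzMap.dilConv_lineDeriv (κ : 𝒮 n) {μ : ℝ} (hμ : μ ≠ 0) {F : Rn n → ℂ}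
    (hF : Differentiable ℝ F) (hs : HasCompactSupport F) (v : Rn n)
    (hF' : Continuous fun x => fderiv ℝ F x v) (x : Rn n) :
    dilConv (κ.lderiv v) μ F x = ((μ⁻¹ : ℝ) : ℂ) * dilConv κ μ (fun y => fderiv ℝ F y v) x := by
  have hd : ∀ y, HasFDerivAt (fun y => dil κ μ (x - y))
      (((μ ^ n : ℝ) : ℂ) • (fderiv ℝ κ (μ • (x - y))).comp (-(μ • clmId ℝ (Rn n)))) y := fun y => by
    have h1 : HasFDerivAt (fun y : Rn n => μ • (x - y)) (-(μ • clmId ℝ (Rn n))) y := by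
      have := ((hasFDerivAt_id (𝕜 := ℝ) y).const_sub x).fun_const_smul μ
      rwa [smul_neg] at this
    exact ((κ.hasFDerivAt (μ • (x - y))).comp y h1).const_mul _
  have happ : ∀ y, fderiv ℝ (fun y => dil κ μ (x - y)) y v = -(μ * dil (κ.lderiv v) μ (x - y)) :=
      fun y => by
    rw [(hd y).fderiv]
    simp only [dil, SchwartzMap.lderiv_apply, _root_.smul_apply,
      ContinuousLinearMap.comp_apply, neg_apply,
      id_apply, map_neg, map_smul, smul_eq_mul, Complex.real_smul]
    ring
  have hs' : HasCompactSupport fun y => fderiv ℝ F y v := hs.fderiv_apply (𝕜 := ℝ) v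
  have i1 := (κ.lderiv v).integrable_dil_mul μ (hF.continuous.integrable_of_hasCompactSupport hs) x
  have i2 := κ.integrable_dil_mul μ (hF'.integrable_of_hasCompactSupport hs') x
  have i3 := κ.integrable_dil_mul μ (hF.continuous.integrable_of_hasCompactSupport hs) x
  have key := integral_mul_fderiv_eq_neg_fderiv_mul_of_integrable (μ := volume)
    (f := fun y => dil κ μ (x - y)) (g := F) (v := v)
    (by
      simp_rw [happ]
      refine (i1.const_mul (-(μ : ℂ))).congr (.of_forall fun y => ?_)
      simp only
      ring) i2 i3
    (fun y _ => (hd y).differentiableAt) (fun y _ => hF y)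
  simp_rw [happ] at key
  unfold dilConv
  rw [key, ← integral_neg, ← integral_const_mul]
  refine integral_congr_ae (.of_forall fun y => ?_)
  have : (μ : ℂ) ≠ 0 := by exact_mod_cast hμ
  simp only
  push_cast
  field_simp

/-- The quasi-norm `eLpNorm` of a finite sum. -/
theorem exists_eLpNorm_sum_le {α β : Type*} [MeasurableSpace β] {ν : Measure β} (p : ℝ≥0∞)
    (s : Finset α) : ∃ C : ℝ≥0, ∀ f : α → β → ℂ, (∀ a ∈ s, AEStronglyMeasurable (f a) ν) → eLpNorm
    (fun x => ∑ a ∈ s, f a x) p ν ≤ C * ∑ a ∈ s, eLpNorm (f a) p ν := by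
  classical
  induction s using Finset.induction_on with
  | empty => exact ⟨0, fun f _ => by simp⟩
  | insert a s ha ih =>
    obtain ⟨C, hC⟩ := ih
    refine ⟨(ENNReal.LpAddConst p).toNNReal * (1 + C), fun f hf => ?_⟩
    have hs : AEStronglyMeasurable (fun x => ∑ a ∈ s, f a x) ν :=
      Finset.aestronglyMeasurable_fun_sum _ fun b hb => hf b (Finset.mem_insert_of_mem hb)
    simp_rw [Finset.sum_insert ha]
    refine (eLpNorm_add_le' (hf a (Finset.mem_insert_self _ _)) hs p).trans ?_
    rw [coe_mul, coe_toNNReal (ENNReal.LpAddConst_lt_top p).ne, mul_assoc]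
    refine mul_le_mul' le_rfl ?_
    have h1 := hC f fun b hb => hf b (Finset.mem_insert_of_mem hb)
    push_cast
    calc _ ≤ 1 * eLpNorm (f a) p ν + C * ∑ a ∈ s, eLpNorm (f a) p ν := by
          rw [one_mul]
          exact add_le_add le_rfl h1
      _ ≤ _ := by
          rw [mul_add]
          exact add_le_add (mul_le_mul' le_self_add le_rfl) (mul_le_mul' le_add_self le_rfl)

/-- The partial derivative of the phase in the `l`-th position variable. -/
def dPhase (φ : Rn n → Rn n → ℝ) (l : Fin n) (z : ℝ²ⁿ n) : ℝ :=
  fderiv ℝ (fun p : ℝ²ⁿ n => φ p.1 p.2) z (single l 1, 0)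

/-- The amplitude produced when a position derivative falls on the phase. -/
def phaseMul (φ : Rn n → Rn n → ℝ) (l : Fin n) (b : ℝ²ⁿ n → ℂ) (z : ℝ²ⁿ n) : ℂ :=
  b z * (I * (dPhase φ l z : ℂ))

/-- The partial derivative of an amplitude in the `l`-th position variable. -/
def xDeriv (l : Fin n) (b : ℝ²ⁿ n → ℂ) (z : ℝ²ⁿ n) : ℂ := fderiv ℝ b z (single l 1, 0)

include hφ in
theorem PhaseSmoothHomog.contDiffAt_dPhase (l : Fin n) {z : ℝ²ⁿ n} (hz : z.2 ≠ 0) : ContDiffAt ℝ C∞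
    (dPhase φ l) z :=
  ((hφ.contDiffAt hz).fderiv_right (by simp)).clm_apply contDiffAt_const

include hφ hQ hnd in
theorem PhaseSmoothHomog.sum_dPhase_ne_zero {x w : Rn n} (hx : x ∈ Q) (hw : w ≠ 0) : ∑ l, dPhase φ l
    (x, w) * dPhase φ l (x, w) ≠ 0 := by
  set L := fderiv ℝ (fun x' => φ x' w) x with hL
  have hl : ∀ l, dPhase φ l (x, w) = L (single l 1) := fun l => by
    rw [hL, hφ.fderiv_left hw]
    simp [dPhase]
  simp_rw [hl, ← sq]
  rw [← sq_norm_eq_sum_sq_apply, pow_ne_zero_iff two_ne_zero, norm_ne_zero_iff]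
  intro h0
  obtain ⟨c, hc, ρ, hρ, h⟩ := hφ.exists_le_norm_fderiv_left_sub hQ hnd hw
  have hwn : 0 < ‖w‖ := norm_pos_iff.2 hw
  set t := ρ / (2 * ‖w‖)
  have ht : 0 < t := by positivity
  have hmem : (1 + t) • w ∈ ball w ρ := by
    rw [mem_ball_iff_norm, add_smul, one_smul, add_sub_cancel_left, norm_smul, norm_of_nonneg ht.le]
    have : t * ‖w‖ = ρ / 2 := by
      simp only [t]
      field_simp
    linarith
  have := h x hx _ hmem w (Metric.mem_ball_self hρ)
  have hf : (fun x' => φ x' ((1 + t) • w)) = fun x' => (1 + t) * φ x' w :=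
    funext fun x' => hφ.2 x' w _ (by positivity)
  rw [hf, fderiv_const_mul ((hφ.contDiffAt_left x hw).differentiableAt (by simp)), ← hL, h0,
    add_smul, one_smul, add_sub_cancel_left, norm_smul, norm_of_nonneg ht.le] at this
  simp only [smul_zero, sub_zero, norm_zero] at this
  have : 0 < c * (t * ‖w‖) := by positivity
  linarith

include hφ hQ in
theorem SuppUBdd.phase (l : Fin n) (hb : ShellUBdd Q b) :
    ShellUBdd Q (fun i => phaseMul φ l (b i)) :=
  hb.mul (UBdd.of_isCompact (hQ.prod isCompact_annulus) fun z hz => contDiffAt_const.mul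
    (ofRealCLM.contDiff.contDiffAt.comp z (hφ.contDiffAt_dPhase l (ne_zero_of_mem_annulus hz.2))))

theorem SuppUBdd.xder (l : Fin n) (hb : ShellUBdd Q b) : ShellUBdd Q (fun i => xDeriv l (b i)) :=
  hb.fderiv_apply _

theorem continuous_integral_cexp_mul {g : Rn n → ℂ} (hg : Integrable g) (lam : ℝ) :
    Continuous fun η : Rn n => ∫ y, 𝐞⁻(lam * ⟪y, η⟫_ℝ) * g y := by
  refine continuous_of_dominated (bound := fun y => ‖g y‖) (fun η => ?_)
    (fun η => .of_forall fun y => ?_) hg.norm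
    (.of_forall fun y => by fun_prop)
  · exact AEStronglyMeasurable.mul (Continuous.aestronglyMeasurable (by fun_prop))
      hg.aestronglyMeasurable
  · rw [norm_mul, norm_cexp_neg_I_mul, one_mul]

include hφ hQ hb in
theorem SuppUBdd.oscOp_eq (i : ι) (lam : ℝ) {g : Rn n → ℂ} (hg : Integrable g) : oscOp φ (b i) lam
    g = fun x => ((lam ^ n : ℝ) : ℂ) * ∫ η, oscAmp φ (b i) lam (x, η) * ∫ y, cexp
    (-(I * ((lam * ⟪y, η⟫_ℝ : ℝ) : ℂ))) * g y :=
  funext fun x => by rw [oscOp, hb.integral_oscKernel_mul hφ hQ i lam hg x]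

include hφ hQ hb in
theorem SuppUBdd.integrable_oscAmp_mul (i : ι) (lam : ℝ) {G : Rn n → ℂ} (hG : Continuous G)
    (x : Rn n) : Integrable fun η => oscAmp φ (b i) lam (x, η) * G η := by
  have hA := hb.amp hφ hQ lam
  refine (((hA.contDiff i).continuous.comp (by fun_prop : Continuous fun η : Rn n =>
    (x, η))).mul hG).integrable_of_hasCompactSupport ?_
  exact ((hA.hasCompactSupport i (hQ.prod isCompact_annulus)).slice x).mul_right

include hφ hb in
theorem SuppUBdd.fderiv_oscAmp (i : ι) (lam : ℝ) (l : Fin n) (z : ℝ²ⁿ n) : fderiv ℝ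
    (oscAmp φ (b i) lam) z (single l 1, 0) = lam * oscAmp φ (phaseMul φ l (b i)) lam z + oscAmp φ
    (xDeriv l (b i)) lam z := by
  by_cases hz : z ∈ Q ×ˢ annulus n
  · have h1 : HasFDerivAt (b i) (fderiv ℝ (b i) z) z :=
      ((hb.contDiff i).differentiable (by simp) z).hasFDerivAt
    have h2 : HasFDerivAt (fun p : ℝ²ⁿ n => φ p.1 p.2)
        (fderiv ℝ (fun p : ℝ²ⁿ n => φ p.1 p.2) z) z :=
      ((hφ.contDiffAt (ne_zero_of_mem_annulus hz.2)).differentiableAt (by simp)).hasFDerivAt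
    have h3 : HasFDerivAt (fun z : ℝ²ⁿ n => 𝐞(lam * φ z.1 z.2)) _ z :=
      ((HasFDerivAt.comp (g := fun t : ℝ => (t : ℂ)) z ofRealCLM.hasFDerivAt
        (h2.const_mul lam)).const_mul I).cexp
    have h4 : HasFDerivAt (oscAmp φ (b i) lam) _ z := h1.mul h3
    rw [h4.fderiv]
    simp only [_root_.add_apply, _root_.smul_apply, ContinuousLinearMap.comp_apply, smul_eq_mul,
      Function.comp_apply, ofRealCLM_apply, oscAmp, phaseMul, xDeriv, dPhase]
    push_cast
    ring
  · have h0 : oscAmp φ (b i) lam =ᶠ[nhds z] fun _ => 0 :=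
      (hb.eventually_eq_zero i hz).mono fun y hy => by simp [oscAmp, hy]
    have hz0 := hb.eq_zero i z hz
    rw [h0.fderiv_eq]
    simp [oscAmp, phaseMul, xDeriv, hz0, (hb.eventually_eq_zero i hz).fderiv_eq]

include hφ hQ hb in
theorem SuppUBdd.differentiable_oscOp (i : ι) (lam : ℝ) {g : Rn n → ℂ} (hg : Integrable g) :
    Differentiable ℝ (oscOp φ (b i) lam g) := by
  rw [hb.oscOp_eq hφ hQ i lam hg]
  have hA := hb.amp hφ hQ lam
  exact fun x => (hasFDerivAt_integral_mul ((hA.contDiff i).of_le (by simp))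
    (hA.hasCompactSupport i (hQ.prod isCompact_annulus))
    (continuous_integral_cexp_mul hg lam) x).differentiableAt.const_mul _

include hφ hQ hb in
theorem SuppUBdd.fderiv_oscOp (i : ι) (lam : ℝ) {g : Rn n → ℂ} (hg : Integrable g) (l : Fin n)
    (x : Rn n) : fderiv ℝ (oscOp φ (b i) lam g) x (single l 1) = lam * oscOp φ
    (phaseMul φ l (b i)) lam g x + oscOp φ (xDeriv l (b i)) lam g x := by
  have hA := hb.amp hφ hQ lam
  have hA1 : ContDiff ℝ 1 (oscAmp φ (b i) lam) := (hA.contDiff i).of_le (by simp)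
  have hAs := hA.hasCompactSupport i (hQ.prod isCompact_annulus)
  have hG := continuous_integral_cexp_mul hg lam
  rw [hb.oscOp_eq hφ hQ i lam hg, (hb.phase hφ hQ l).oscOp_eq hφ hQ i lam hg,
    (hb.xder l).oscOp_eq hφ hQ i lam hg,
    fderiv_const_mul (hasFDerivAt_integral_mul hA1 hAs hG x).differentiableAt, _root_.smul_apply,
    fderiv_integral_mul hA1 hAs hG, smul_eq_mul]
  simp_rw [hb.fderiv_oscAmp hφ i lam l, add_mul, mul_assoc]
  rw [integral_add (((hb.phase hφ hQ l).integrable_oscAmp_mul hφ hQ i lam hG x).const_mul _)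
    ((hb.xder l).integrable_oscAmp_mul hφ hQ i lam hG x), integral_const_mul]
  ring

include hφ hQ in
theorem oscOp_finset_sum {α : Type*} (s : Finset α) {b : α → ι → ℝ²ⁿ n → ℂ}
    (hb : ∀ a, ShellUBdd Q (b a)) (i : ι) (lam : ℝ) {g : Rn n → ℂ} (hg : Integrable g) :
    oscOp φ (fun z => ∑ a ∈ s, b a i z) lam g = fun x => ∑ a ∈ s, oscOp φ (b a i) lam g x := by
  have hS : IsClosed (Q ×ˢ annulus n) := (hQ.prod isCompact_annulus).isClosed
  rw [(SuppUBdd.finset_sum s (fun _ => hS) fun a _ => hb a).oscOp_eq hφ hQ i lam hg]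
  ext x
  simp_rw [fun a => (hb a).oscOp_eq hφ hQ i lam hg]
  rw [← mul_sum, ← integral_finsetSum _ fun a _ =>
    (hb a).integrable_oscAmp_mul hφ hQ i lam (continuous_integral_cexp_mul hg lam) x]
  simp_rw [← sum_mul, oscAmp, ← sum_mul]

include hφ hQ hb in
theorem SuppUBdd.integrable_oscOp (i : ι) (lam : ℝ) {g : Rn n → ℂ} (hg : Integrable g) : Integrable
    (oscOp φ (b i) lam g) :=
  (hb.continuous_oscOp hφ hQ i lam hg).integrable_of_hasCompactSupport
    (hb.hasCompactSupport_oscOp hQ i lam g)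

include hφ hQ hb in
theorem SuppUBdd.dilConv_lderiv_oscOp (κ : 𝒮 n) (i : ι) (lam : ℝ) {μ : ℝ} (hμ : μ ≠ 0)
    {g : Rn n → ℂ} (hg : Integrable g) (l : Fin n) (x : Rn n) : dilConv (κ.lderiv (single l 1)) μ
    (oscOp φ (b i) lam g) x = ((lam / μ : ℝ) : ℂ) * dilConv κ μ (oscOp φ (phaseMul φ l (b i)) lam g)
    x + ((μ⁻¹ : ℝ) : ℂ) * dilConv κ μ (oscOp φ (xDeriv l (b i)) lam g) x := by
  have h1 := (hb.phase hφ hQ l).integrable_oscOp hφ hQ i lam hg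
  have h2 := (hb.xder l).integrable_oscOp hφ hQ i lam hg
  rw [κ.dilConv_lineDeriv hμ (hb.differentiable_oscOp hφ hQ i lam hg)
    (hb.hasCompactSupport_oscOp hQ i lam g)]
  · simp_rw [hb.fderiv_oscOp hφ hQ i lam hg]
    unfold dilConv
    simp_rw [mul_add]
    have i1 := κ.integrable_dil_mul μ (h1.const_mul (lam : ℂ)) x
    rw [integral_add i1 (κ.integrable_dil_mul μ h2 x)]
    simp_rw [mul_left_comm _ (lam : ℂ)]
    rw [integral_const_mul]
    push_cast
    ring
  · simp_rw [hb.fderiv_oscOp hφ hQ i lam hg]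
    exact (continuous_const.mul ((hb.phase hφ hQ l).continuous_oscOp hφ hQ i lam hg)).add
      ((hb.xder l).continuous_oscOp hφ hQ i lam hg)

theorem dilConv_eq_sum {κ : 𝒮 n} {κ' : Fin n → 𝒮 n}
    (h : ∀ x, κ x = ∑ l, (κ' l).lderiv (single l 1) x) (μ : ℝ) {F : Rn n → ℂ} (hF : Integrable F)
    (x : Rn n) : dilConv κ μ F x = ∑ l, dilConv ((κ' l).lderiv (single l 1)) μ F x := by
  simp only [dilConv]
  rw [← integral_finsetSum _ fun l _ => SchwartzMap.integrable_dil_mul _ μ hF x]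
  simp only [dil, h, mul_sum, sum_mul]

/-- Uniform `L^p` bounds for `dilConv κ μ ∘ oscOp φ (b i) lam` with gain `w L`, where the relative
scale `L` is tied to the frequencies `lam` and `μ` by the relation `R`. -/
def OscBound (φ : Rn n → Rn n → ℝ) (p : ℝ≥0∞) (ϑ : 𝒮 n) (R : ℝ → ℝ → ℝ → Prop) (w : ℝ → ℝ) (κ : 𝒮 n)
    (b : ι → ℝ²ⁿ n → ℂ) : Prop :=
  ∃ C : ℝ≥0, ∀ i (lam μ L : ℝ), 1 ≤ lam → 1 ≤ μ → 1 ≤ L → R lam μ L →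
    ∀ g : Rn n → ℂ, IsReproduced ϑ lam g → eLpNorm (dilConv κ μ (oscOp φ (b i) lam g)) p volume ≤
        C * ofR (w L) * ofR (lam ^ (-criticalOrder n p)) * eLpNorm g p volume

include hφ hQ in
theorem OscBound.of_sum {p : ℝ≥0∞} {ϑ : 𝒮 n} {R : ℝ → ℝ → ℝ → Prop} {w : ℝ → ℝ} {α : Type*}
    [Fintype α] {κ : 𝒮 n} {k : α → 𝒮 n} {v : α → ι → ℝ²ⁿ n → ℂ} (hv : ∀ a, ShellUBdd Q (v a))
    (hk : ∀ a, OscBound φ p ϑ R w (k a) (v a)) (h : ∀ lam μ L, 1 ≤ lam → 1 ≤ μ → 1 ≤ L → R lam μ L →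
    ∃ c : α → ℂ, (∀ a, ‖c a‖ ≤ L⁻¹) ∧ ∀ i g, Integrable g → ∀ x, dilConv κ μ (oscOp φ (b i) lam g) x
    = ∑ a, c a * dilConv (k a) μ (oscOp φ (v a i) lam g) x) : OscBound φ p ϑ R (fun L => w L * L⁻¹)
    κ b := by
  choose D hD using hk
  obtain ⟨C, hC⟩ := exists_eLpNorm_sum_le (ν := (volume : Measure (Rn n))) p (Finset.univ : Finset α)
  refine ⟨C * ∑ a, D a, fun i lam μ L hlam hμ hL hR g hg => ?_⟩
  obtain ⟨c, hc, hx⟩ := h lam μ L hlam hμ hL hR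
  rw [show dilConv κ μ (oscOp φ (b i) lam g) = fun x => ∑ a,
    (c a • dilConv (k a) μ (oscOp φ (v a i) lam g)) x from funext fun x => hx i g hg.integrable x]
  refine (hC _ fun a _ => (((k a).continuous_dilConv μ
    ((hv a).integrable_oscOp hφ hQ i lam hg.integrable)).const_smul (c a)).aestronglyMeasurable).trans ?_
  rw [coe_mul, ENNReal.ofNNReal_finsetSum, mul_assoc (C : ℝ≥0∞), mul_assoc (C : ℝ≥0∞),
    mul_assoc (C : ℝ≥0∞), sum_mul, sum_mul, sum_mul]
  refine mul_le_mul' le_rfl (sum_le_sum fun a _ => ?_)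
  rw [eLpNorm_const_smul, ENNReal.ofReal_mul' (inv_nonneg.mpr (by linarith))]
  calc ‖c a‖ₑ * eLpNorm (dilConv (k a) μ (oscOp φ (v a i) lam g)) p volume
      ≤ ofR L⁻¹ * _ := mul_le_mul' (by rw [← ofReal_norm]; exact ofR_le_ofR (hc a))
        (hD a i lam μ L hlam hμ hL hR g hg)
    _ = _ := by ring

include hφ hQ hnd hb in
theorem SuppUBdd.exists_sum_phaseMul_eq : ∃ c : Fin n → ι → ℝ²ⁿ n → ℂ, (∀ l, ShellUBdd Q (c l)) ∧ ∀
    i, b i = fun z => ∑ l, phaseMul φ l (c l i) z := by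
  have hV : ∀ l, UBdd (fun _ : ι => Q ×ˢ annulus n) (fun _ z =>
      -I * ((dPhase φ l z * (∑ k, dPhase φ k z * dPhase φ k z)⁻¹ : ℝ) : ℂ)) := fun l =>
    UBdd.of_isCompact (hQ.prod isCompact_annulus) fun z hz => by
      have hd := fun k => hφ.contDiffAt_dPhase k (ne_zero_of_mem_annulus hz.2)
      have h1 := (hd l).mul ((ContDiffAt.sum fun k (_ : k ∈ Finset.univ) => (hd k).mul (hd k)).inv
        (hφ.sum_dPhase_ne_zero hQ hnd hz.1 (ne_zero_of_mem_annulus hz.2)))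
      exact contDiffAt_const.mul (ofRealCLM.contDiff.contDiffAt.comp z h1)
  refine ⟨fun l i z => b i z * (-I * ((dPhase φ l z * (∑ k, dPhase φ k z * dPhase φ k z)⁻¹ : ℝ) : ℂ)),
    fun l => hb.mul (hV l), fun i => funext fun z => ?_⟩
  by_cases hz : z ∈ Q ×ˢ annulus n
  · have h1 := sum_mul_inv_sum_mul_self (hφ.sum_dPhase_ne_zero hQ hnd hz.1
      (ne_zero_of_mem_annulus hz.2))
    have h2 : (∑ l, ((dPhase φ l z * (∑ k, dPhase φ k z * dPhase φ k z)⁻¹ : ℝ) : ℂ) *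
        (dPhase φ l z : ℂ)) = 1 := by exact_mod_cast h1
    calc b i z = b i z * ∑ l, ((dPhase φ l z * (∑ k, dPhase φ k z * dPhase φ k z)⁻¹ : ℝ) : ℂ) *
          (dPhase φ l z : ℂ) := by rw [h2, mul_one]
      _ = _ := by
        rw [mul_sum]
        refine sum_congr rfl fun l _ => ?_
        rw [phaseMul]
        linear_combination ((b i z * (((dPhase φ l z *
          (∑ k, dPhase φ k z * dPhase φ k z)⁻¹ : ℝ) : ℂ) * (dPhase φ l z : ℂ)))) * I_mul_I
  · have h0 := hb.eq_zero i z hz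
    simp [phaseMul, h0]

theorem norm_inv_le_of_eq_mul {lam μ L : ℝ} (hlam : 1 ≤ lam) (hL : 1 ≤ L) (h : μ = L * lam) :
    ‖((μ⁻¹ : ℝ) : ℂ)‖ ≤ L⁻¹ ∧ ‖((lam / μ : ℝ) : ℂ)‖ ≤ L⁻¹ := by
  subst h
  have h0 : 0 < lam := by linarith
  have hL0 : 0 < L := by linarith
  rw [norm_real, norm_real, norm_of_nonneg (by positivity), norm_of_nonneg (by positivity)]
  constructor
  · exact inv_anti₀ hL0 (by nlinarith)
  · exact (by field_simp : lam / (L * lam) = L⁻¹).le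

include hφ hQ hnd in
/-- Output frequency at most the input frequency. -/
theorem oscBound_of_le {p : ℝ≥0∞} {ϑ : 𝒮 n} {w : ℝ → ℝ} (h : ∀ (κ : 𝒮 n) (b : ι → ℝ²ⁿ n → ℂ),
    ShellUBdd Q b → OscBound φ p ϑ (fun lam μ L => lam = L * μ) w κ b) (M : ℕ) : ∀ (κ : 𝒮 n)
    (b : ι → ℝ²ⁿ n → ℂ), ShellUBdd Q b → OscBound φ p ϑ (fun lam μ L => lam = L * μ)
    (fun L => w L * L⁻¹ ^ M) κ b := by
  induction M with
  | zero => simpa using h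
  | succ M ih =>
    intro κ b hb
    obtain ⟨c, hc, hbc⟩ := hb.exists_sum_phaseMul_eq hφ hQ hnd
    have hx := fun l => (hc l).xder l
    have hv : ∀ a : Fin n ⊕ Fin n, SuppUBdd (fun _ => Q ×ˢ annulus n)
        (Sum.elim c (fun l i => xDeriv l (c l i)) a) := by
      rintro (l | l)
      exacts [hc l, hx l]
    simp_rw [pow_succ, ← mul_assoc]
    refine OscBound.of_sum hφ hQ (w := fun L => w L * L⁻¹ ^ M)
      (k := Sum.elim (fun l => κ.lderiv (single l 1)) fun _ => κ) hv
      (fun a => ih _ _ (hv a)) fun lam μ L hlam hμ hL hR => ?_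
    obtain ⟨e1, e2⟩ := norm_inv_le_of_eq_mul hμ hL hR
    refine ⟨Sum.elim (fun _ => ((μ / lam : ℝ) : ℂ)) fun _ => -((lam⁻¹ : ℝ) : ℂ), ?_,
      fun i g hg x => ?_⟩
    · rintro (l | l)
      exacts [e2, by simpa only [Sum.elim_inr, norm_neg] using e1]
    · have hμ0 : μ ≠ 0 := by positivity
      have hlam0 : lam ≠ 0 := by positivity
      have h1 : dilConv κ μ (oscOp φ (b i) lam g) x =
          ∑ l, dilConv κ μ (oscOp φ (phaseMul φ l (c l i)) lam g) x := by
        rw [hbc i, oscOp_finset_sum hφ hQ Finset.univ (fun l => (hc l).phase hφ hQ l) i lam hg,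
          κ.dilConv_finset_sum μ Finset.univ
            fun l _ => ((hc l).phase hφ hQ l).integrable_oscOp hφ hQ i lam hg]
      rw [h1, Fintype.sum_sum_type, ← Finset.sum_add_distrib]
      refine sum_congr rfl fun l _ => ?_
      simp only [Sum.elim_inl, Sum.elim_inr]
      rw [(hc l).dilConv_lderiv_oscOp hφ hQ κ i lam hμ0 hg l x]
      push_cast
      have : (μ : ℂ) ≠ 0 := by exact_mod_cast hμ0
      have : (lam : ℂ) ≠ 0 := by exact_mod_cast hlam0
      field_simp
      ring

include hφ hQ in
/-- Output frequency at least the input frequency. -/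
theorem oscBound_of_ge {p : ℝ≥0∞} {ϑ : 𝒮 n} {ν : Type*} {κ : ν → 𝒮 n}
    (hκ : ∀ v, ∃ v' : Fin n → ν, ∀ x, κ v x = ∑ l, (κ (v' l)).lderiv (single l 1) x) (h : ∀ v (b : ι
    → ℝ²ⁿ n → ℂ), ShellUBdd Q b → OscBound φ p ϑ (fun lam μ L => μ = L * lam) (fun _ => 1) (κ v) b)
    (M : ℕ) : ∀ v (b : ι → ℝ²ⁿ n → ℂ), ShellUBdd Q b → OscBound φ p ϑ (fun lam μ L => μ = L * lam)
    (fun L => L⁻¹ ^ M) (κ v) b := by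
  induction M with
  | zero => simpa using h
  | succ M ih =>
    intro v b hb
    obtain ⟨v', hv'⟩ := hκ v
    have hv : ∀ a : Fin n ⊕ Fin n, SuppUBdd (fun _ => Q ×ˢ annulus n)
        (Sum.elim (fun l i => phaseMul φ l (b i)) (fun l i => xDeriv l (b i)) a) := by
      rintro (l | l)
      exacts [hb.phase hφ hQ l, hb.xder l]
    simp_rw [pow_succ]
    refine OscBound.of_sum hφ hQ (w := fun L => L⁻¹ ^ M)
      (k := Sum.elim (fun l => κ (v' l)) fun l => κ (v' l)) hv
      (fun a => ?_) fun lam μ L hlam hμ hL hR => ?_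
    · rcases a with l | l <;> exact ih _ _ (hv _)
    obtain ⟨e1, e2⟩ := norm_inv_le_of_eq_mul hlam hL hR
    refine ⟨Sum.elim (fun _ => ((lam / μ : ℝ) : ℂ)) fun _ => ((μ⁻¹ : ℝ) : ℂ), ?_,
      fun i g hg x => ?_⟩
    · rintro (l | l)
      exacts [e2, e1]
    · have hμ0 : μ ≠ 0 := by positivity
      rw [dilConv_eq_sum hv' μ (hb.integrable_oscOp hφ hQ i lam hg), Fintype.sum_sum_type,
        ← Finset.sum_add_distrib]
      exact sum_congr rfl fun l _ => hb.dilConv_lderiv_oscOp hφ hQ _ i lam hμ0 hg l x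

include hn hφ hQ in
theorem exists_oscBound {δ : ℝ} (hδ : 0 < δ) (hnd : MixedNonDeg φ (cthickening δ Q)) {p : ℝ≥0∞}
    (hp : 0 < p) (M : ℕ) (ϑ : 𝒮 n) (hb : ShellUBdd Q b) :
    (∀ κ : 𝒮 n, OscBound φ p ϑ (fun lam μ L => lam = L * μ) (fun L => L⁻¹ ^ M) κ b) ∧ ∀ {ν : Type}
    {κ : ν → 𝒮 n}, (∀ v, ∃ v' : Fin n → ν, ∀ x, κ v x = ∑ l, (κ (v' l)).lderiv (single l 1) x) → ∀
    v, OscBound φ p ϑ (fun lam μ L => μ = L * lam) (fun L => L⁻¹ ^ M) (κ v) b := by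
  obtain ⟨N, hN⟩ := exists_eLpNorm_dilConv_oscOp_le (ι := ι) hn hφ hQ hδ hnd hp
  have hQQ := Metric.self_subset_cthickening (δ := δ) Q
  constructor
  · intro κ
    obtain ⟨C, hC⟩ := oscBound_of_le hφ hQ (fun x hx => hnd x (hQQ hx)) (w := fun L => L ^ N)
      (fun κ b hb => by
        obtain ⟨C, hC⟩ := hN κ ϑ hb
        exact ⟨C, fun i lam μ L h1 h2 h3 h4 => hC i lam μ L h1 h2 h3 h4.le⟩) (N + M) κ b hb
    refine ⟨C, fun i lam μ L h1 h2 h3 h4 => ?_⟩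
    have := hC i lam μ L h1 h2 h3 h4
    beta_reduce at this ⊢
    rwa [pow_add, ← mul_assoc, ← mul_pow, mul_inv_cancel₀ (by positivity), one_pow, one_mul] at this
  · intro ν κ hκ v
    refine oscBound_of_ge hφ hQ hκ (fun v b hb => ?_) M v b hb
    obtain ⟨C, hC⟩ := hN (κ v) ϑ hb
    refine ⟨C, fun i lam μ L h1 h2 h3 h4 g hg => ?_⟩
    have := hC i lam μ 1 h1 h2 le_rfl (by rw [one_mul, h4]; nlinarith) g hg
    simpa using this

/-- The inverse Fourier transform of a Schwartz function, with the normalization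
`(2π)^{-n} ∫ e^{i x·ξ} h(ξ) dξ`. -/
def SchwartzMap.invF (h : 𝒮 n) : 𝒮 n :=
  FourierTransformInv.fourierInv (SchwartzMap.compCLMOfContinuousLinearEquiv ℂ
    (ContinuousLinearEquiv.smulLeft (Units.mk0 (2 * pi) Real.two_pi_pos.ne')) h)

theorem SchwartzMap.invF_apply (h : 𝒮 n) (x : Rn n) : h.invF x = ((((2 * pi) ^ n)⁻¹ : ℝ) : ℂ) * ∫ ξ,
    𝐞(⟪x, ξ⟫_ℝ) * h ξ := by
  rw [SchwartzMap.invF, SchwartzMap.fourierInv_coe, Real.fourierInv_eq']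
  have h1 := integral_comp_smul (volume : Measure (Rn n)) (fun ξ => 𝐞(⟪x, ξ⟫_ℝ) * h ξ) (2 * pi)
  rw [finrank_euclideanSpace_fin, abs_of_nonneg (by positivity), ← coe_smul, smul_eq_mul] at h1
  rw [← h1]
  refine integral_congr_ae (.of_forall fun v => ?_)
  simp only [smul_eq_mul, SchwartzMap.compCLMOfContinuousLinearEquiv_apply, Function.comp_apply]
  rw [real_inner_smul_right, real_inner_comm]
  congr 2
  push_cast
  ring

theorem SchwartzMap.ftransform_eq (g : 𝒮 n) (ξ : Rn n) :
    ftransform n g ξ = FourierTransform.fourier g ((2 * pi)⁻¹ • ξ) := by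
  rw [SchwartzMap.fourier_coe, Real.fourier_eq', ftransform]
  refine integral_congr_ae (.of_forall fun v => ?_)
  simp only [smul_eq_mul]
  rw [real_inner_smul_right]
  congr 2
  have : (pi : ℂ) ≠ 0 := by exact_mod_cast Real.pi_ne_zero
  push_cast
  field_simp

theorem SchwartzMap.ftransform_invF (h : 𝒮 n) : ftransform n h.invF = h := by
  ext ξ
  rw [SchwartzMap.ftransform_eq, SchwartzMap.invF, FourierTransform.fourier_fourierInv_eq,
    SchwartzMap.compCLMOfContinuousLinearEquiv_apply, Function.comp_apply]
  congr 1
  exact smul_inv_smul₀ Real.two_pi_pos.ne' ξ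

theorem SchwartzMap.contDiff_ftransform (g : 𝒮 n) : ContDiff ℝ C∞ (ftransform n g) := by
  rw [show ftransform n g = _ from funext g.ftransform_eq]
  exact ((FourierTransform.fourier g).smooth ⊤).comp (contDiff_const_smul _)

theorem SchwartzMap.invF_lderiv (h h' : 𝒮 n) (v : Rn n)
    (hh : ∀ ξ, h' ξ = I * ((⟪ξ, v⟫_ℝ : ℝ) : ℂ) * h ξ) : h.invF.lderiv v = h'.invF := by
  rw [SchwartzMap.lderiv, SchwartzMap.invF, SchwartzMap.lineDerivOp_fourierInv_eq, SchwartzMap.invF]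
  congr 1
  ext ξ
  have ht : Function.HasTemperateGrowth (fun x : Rn n => (⟪x, v⟫_ℝ : ℝ)) := by fun_prop
  simp only [_root_.smul_apply, SchwartzMap.smulLeftCLM_apply_apply ht,
    SchwartzMap.compCLMOfContinuousLinearEquiv_apply, Function.comp_apply, hh, smul_eq_mul]
  rw [show (ContinuousLinearEquiv.smulLeft (M₁ := Rn n)
    (Units.mk0 (2 * pi) Real.two_pi_pos.ne')) ξ = (2 * pi) • ξ from rfl,
    real_inner_smul_left, real_smul]
  push_cast
  ring

/-- Convolution against an inverse Fourier transform is a Fourier multiplier. -/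
theorem smoothOp_eq {h : Rn n → ℝ} (hc : Continuous h) (hs : HasCompactSupport h) {g : Rn n → ℂ}
    (hg : Integrable g) (x : Rn n) : smoothOp n h g x = ((((2 * pi) ^ n)⁻¹ : ℝ) : ℂ) * ∫ ξ, cexp
    (I * ((⟪x, ξ⟫_ℝ : ℝ) : ℂ)) * ((h ξ : ℂ) * ftransform n g ξ) := by
  have hi : Integrable fun ξ => (h ξ : ℂ) :=
    (continuous_ofReal.comp hc).integrable_of_hasCompactSupport (hs.comp_left ofReal_zero)
  have h1 : Integrable (fun z : ℝ²ⁿ n => 𝐞(⟪x - z.1, z.2⟫_ℝ) * (g z.1 * h z.2)) := by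
    refine (hg.mul_prod hi).bdd_mul (c := 1) (by fun_prop) (.of_forall fun z => ?_)
    rw [norm_cexp_I_mul]
  calc smoothOp n h g x = ((((2 * pi) ^ n)⁻¹ : ℝ) : ℂ) * ∫ y, ∫ ξ,
        𝐞(⟪x - y, ξ⟫_ℝ) * (g y * h ξ) := by
        rw [smoothOp, ← integral_const_mul]
        refine integral_congr_ae (.of_forall fun y => ?_)
        simp only [invFT]
        rw [mul_assoc, ← integral_mul_const]
        congr 2
        ext ξ
        ring
    _ = _ := by
        rw [integral_integral_swap h1]
        congr 2
        ext ξ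
        rw [ftransform, ← integral_const_mul, ← integral_const_mul]
        refine integral_congr_ae (.of_forall fun y => ?_)
        simp only
        rw [inner_sub_left, ofReal_sub, mul_sub, sub_eq_add_neg, exp_add]
        ring

/-- Schwartz functions from smooth compactly supported ones. -/
def cSchwartz (h : Rn n → ℂ) (hs : HasCompactSupport h) (hc : ContDiff ℝ C∞ h) :
    𝒮 n := hs.toSchwartzMap hc

theorem cSchwartz_apply (h : Rn n → ℂ) (hs : HasCompactSupport h) (hc : ContDiff ℝ C∞ h) (ξ : Rn n)
    : cSchwartz h hs hc ξ = h ξ := rfl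

/-- Compactly supported functions vanishing near the origin. -/
def PuncturedTest (n : ℕ) : Type :=
  {h : 𝒮 n // HasCompactSupport h ∧ ∃ r : ℝ, 0 < r ∧ ∀ ξ, ‖ξ‖ < r → h ξ = 0}

theorem PuncturedTest.exists_eq_sum_lderiv (θ : PuncturedTest n) : ∃ θ' : Fin n → PuncturedTest n,
    ∀ x, θ.1.invF x = ∑ l, ((θ' l).1.invF).lderiv (single l 1) x := by
  obtain ⟨θ, hs, r, hr, h0⟩ := θ
  have h0' : ∀ ξ, ‖ξ‖ < r → θ =ᶠ[nhds ξ] fun _ => 0 := fun ξ hξ => by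
    filter_upwards [(isOpen_lt continuous_norm continuous_const).mem_nhds hξ] with y hy using h0 y hy
  have hsm : ∀ l : Fin n, ContDiff ℝ C∞
      fun ξ : Rn n => (-I * ((ξ l * (‖ξ‖ ^ 2)⁻¹ : ℝ) : ℂ)) * θ ξ := fun l => by
    rw [contDiff_iff_contDiffAt]
    intro ξ
    by_cases hξ : ξ = 0
    · refine (contDiffAt_const (c := (0 : ℂ))).congr_of_eventuallyEq ?_
      filter_upwards [h0' ξ (by simpa [hξ] using hr)] with y hy
      rw [hy, mul_zero]
    · have h1 : ContDiffAt ℝ C∞ (fun ξ : Rn n => ξ l * (‖ξ‖ ^ 2)⁻¹) ξ :=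
        ContDiffAt.mul (by fun_prop) ((contDiff_norm_sq ℝ).contDiffAt.inv (by simpa using hξ))
      exact (contDiffAt_const.mul (ofRealCLM.contDiff.contDiffAt.comp ξ h1)).mul
        (θ.smooth ⊤).contDiffAt
  have hcs : ∀ l : Fin n, HasCompactSupport
      fun ξ : Rn n => (-I * ((ξ l * (‖ξ‖ ^ 2)⁻¹ : ℝ) : ℂ)) * θ ξ := fun l => hs.mul_left
  refine ⟨fun l => ⟨cSchwartz _ (hcs l) (hsm l), hcs l, r, hr, fun ξ hξ => ?_⟩, fun x => ?_⟩
  · rw [cSchwartz_apply, h0 ξ hξ, mul_zero]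
  have hE : ∀ l : Fin n, HasCompactSupport fun ξ : Rn n =>
      I * ((⟪ξ, single l (1 : ℝ)⟫_ℝ : ℝ) : ℂ) * cSchwartz _ (hcs l) (hsm l) ξ :=
    fun l => HasCompactSupport.mul_left (hcs l)
  have hE' : ∀ l : Fin n, ContDiff ℝ C∞ fun ξ : Rn n =>
      I * ((⟪ξ, single l (1 : ℝ)⟫_ℝ : ℝ) : ℂ) * cSchwartz _ (hcs l) (hsm l) ξ :=
    fun l => (contDiff_const.mul (ofRealCLM.contDiff.comp
      (contDiff_id.inner ℝ contDiff_const))).mul (hsm l)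
  simp_rw [fun l => SchwartzMap.invF_lderiv (cSchwartz _ (hcs l) (hsm l))
    (cSchwartz _ (hE l) (hE' l)) (single l 1) fun ξ => rfl, SchwartzMap.invF_apply]
  rw [← mul_sum, ← integral_finsetSum]
  · congr 2
    ext ξ
    rw [← mul_sum]
    congr 1
    simp only [cSchwartz_apply, EuclideanSpace.inner_single_right, conj_trivial, one_mul]
    by_cases hξ : ξ = 0
    · simp [h0 ξ (by simpa [hξ] using hr)]
    · have h2 : (∑ l, ξ l * ξ l) * (‖ξ‖ ^ 2)⁻¹ = 1 := by
        rw [EuclideanSpace.real_norm_sq_eq]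
        simp_rw [← sq]
        refine mul_inv_cancel₀ ?_
        rw [← EuclideanSpace.real_norm_sq_eq]
        simpa using hξ
      calc θ ξ = (((∑ l, ξ l * ξ l) * (‖ξ‖ ^ 2)⁻¹ : ℝ) : ℂ) * θ ξ := by rw [h2]; simp
        _ = _ := by
          rw [sum_mul, ofReal_sum, sum_mul]
          refine sum_congr rfl fun l _ => ?_
          push_cast
          linear_combination ((ξ l : ℂ) * ξ l * ((‖ξ‖ : ℂ) ^ 2)⁻¹ * θ ξ) * I_mul_I
  · intro l _
    refine ((cSchwartz _ (hE l) (hE' l)).integrable).bdd_mul (c := 1) (by fun_prop)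
      (.of_forall fun z => ?_)
    rw [norm_cexp_I_mul]

theorem invFT_eq {h : Rn n → ℝ} {H : 𝒮 n} (hH : ∀ ξ, H ξ = h ξ) : invFT n h = H.invF := by
  ext x
  simp only [invFT, SchwartzMap.invF_apply, hH]

theorem invFT_comp_smul (h : Rn n → ℝ) {μ : ℝ} (hμ : 0 < μ) :
    invFT n (fun ξ => h (μ⁻¹ • ξ)) = dil (invFT n h) μ := by
  ext x
  have h1 := integral_comp_smul (volume : Measure (Rn n))
    (fun ξ => 𝐞(⟪x, ξ⟫_ℝ) * ((h (μ⁻¹ • ξ) : ℝ) : ℂ)) μ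
  rw [finrank_euclideanSpace_fin, abs_of_nonneg (by positivity), ← coe_smul, smul_eq_mul] at h1
  simp only [invFT, dil]
  have h2 : (∫ ξ, 𝐞(⟪μ • x, ξ⟫_ℝ) * ((h ξ : ℝ) : ℂ)) =
      ∫ ξ, 𝐞(⟪x, μ • ξ⟫_ℝ) * ((h (μ⁻¹ • μ • ξ) : ℝ) : ℂ) :=
    integral_congr_ae (.of_forall fun ξ => by
      simp only [real_inner_smul_left, real_inner_smul_right, inv_smul_smul₀ hμ.ne'])
  rw [h2, h1]
  have : (μ : ℂ) ≠ 0 := by exact_mod_cast hμ.ne'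
  push_cast
  field_simp

theorem smoothOp_comp_smul (h : Rn n → ℝ) {μ : ℝ} (hμ : 0 < μ) (g : Rn n → ℂ) :
    smoothOp n (fun ξ => h (μ⁻¹ • ξ)) g = dilConv (invFT n h) μ g := by
  ext x
  simp only [smoothOp, invFT_comp_smul h hμ, dilConv]

include h in
theorem IsLPBase.hasCompactSupport : HasCompactSupport ψ0 :=
  HasCompactSupport.intro (isCompact_closedBall 0 2) fun ξ hξ => h.2.2 ξ (by simpa using hξ)

theorem contDiff_hasCompactSupport_comp_smul {h : Rn n → ℝ}
    (hh : ContDiff ℝ C∞ h ∧ HasCompactSupport h) {c : ℝ} (hc : c ≠ 0) :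
    ContDiff ℝ C∞ (fun ξ => h (c • ξ)) ∧ HasCompactSupport fun ξ => h (c • ξ) :=
  ⟨hh.1.comp (contDiff_const_smul c), hh.2.comp_homeomorph (Homeomorph.smulOfNeZero c hc)⟩

include h in
theorem IsLPBase.comp_smul {c : ℝ} (hc : c ≠ 0) :
    ContDiff ℝ C∞ (fun ξ => ψ0 (c • ξ)) ∧ HasCompactSupport fun ξ => ψ0 (c • ξ) :=
  contDiff_hasCompactSupport_comp_smul ⟨h.1, h.hasCompactSupport⟩ hc

/-- The difference `ψ₀ - ψ₀(2·)` generating the Littlewood–Paley pieces of positive index. -/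
def lpGen (ψ0 : Rn n → ℝ) (k : ℕ) (ξ : Rn n) : ℝ := if k = 0 then ψ0 ξ else ψ0 ξ - ψ0 ((2 : ℝ) • ξ)

theorem lpPiece_eq (k : ℕ) : lpPiece n ψ0 k = fun ξ => lpGen ψ0 k (((2 : ℝ) ^ k)⁻¹ • ξ) := by
  ext ξ
  by_cases hk : k = 0
  · simp [lpPiece, lpGen, hk]
  · simp only [lpPiece, lpGen, hk, if_false, smul_smul]
    rw [zpow_add₀ two_ne_zero, zpow_neg, zpow_natCast, zpow_one, mul_comm (2 : ℝ)]

include h in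
theorem IsLPBase.gen (k : ℕ) : ContDiff ℝ C∞ (lpGen ψ0 k) ∧ HasCompactSupport (lpGen ψ0 k) := by
  by_cases hk : k = 0
  · rw [show lpGen ψ0 k = ψ0 from funext fun ξ => by simp [lpGen, hk]]
    exact ⟨h.1, h.hasCompactSupport⟩
  · obtain ⟨h1, h2⟩ := h.comp_smul (c := 2) two_ne_zero
    rw [show lpGen ψ0 k = ψ0 - fun ξ => ψ0 ((2 : ℝ) • ξ) from funext fun ξ => by simp [lpGen, hk]]
    exact ⟨h.1.sub h1, h.hasCompactSupport.sub h2⟩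

include h in
theorem IsLPBase.lpGen_eq_zero {k : ℕ} (hk : k ≠ 0) {ξ : Rn n} (hξ : ‖ξ‖ ≤ 1 / 2) : lpGen ψ0 k ξ = 0
    := by
  simp only [lpGen, hk, if_false]
  rw [h.2.1 ξ (by linarith), h.2.1, sub_self]
  rw [norm_smul, norm_of_nonneg two_pos.le]
  linarith

include h in
theorem IsLPBase.lpGen_eq_zero_of_lt {k : ℕ} {ξ : Rn n} (hξ : 2 < ‖ξ‖) : lpGen ψ0 k ξ = 0 := by
  have h2 : ψ0 ((2 : ℝ) • ξ) = 0 := h.2.2 _ (by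
    rw [norm_smul, norm_of_nonneg two_pos.le]
    linarith)
  simp [lpGen, h.2.2 ξ hξ, h2]

include h in
theorem IsLPBase.piece (k : ℕ) :
    ContDiff ℝ C∞ (lpPiece n ψ0 k) ∧ HasCompactSupport (lpPiece n ψ0 k) := by
  rw [lpPiece_eq]
  exact contDiff_hasCompactSupport_comp_smul (h.gen k) (inv_ne_zero (pow_ne_zero k two_ne_zero))

theorem sum_lpPiece (J : ℕ) (ξ : Rn n) :
    ∑ j ∈ range (J + 1), lpPiece n ψ0 j ξ = ψ0 (((2 : ℝ) ^ J)⁻¹ • ξ) := by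
  induction J with
  | zero => simp [lpPiece]
  | succ J ih =>
    rw [Finset.sum_range_succ, ih, lpPiece_eq]
    simp only [lpGen, Nat.add_eq_zero_iff, one_ne_zero, and_false, if_false, smul_smul]
    rw [show (2 : ℝ) * (2 ^ (J + 1))⁻¹ = (2 ^ J)⁻¹ by rw [pow_succ]; field_simp]
    ring

theorem contDiff_ofReal_comp {h : Rn n → ℝ} (hc : ContDiff ℝ C∞ h) :
    ContDiff ℝ C∞ fun ξ => (h ξ : ℂ) := ofRealCLM.contDiff.comp hc

theorem hasCompactSupport_ofReal_comp {h : Rn n → ℝ} (hs : HasCompactSupport h) :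
    HasCompactSupport fun ξ => (h ξ : ℂ) := hs.comp_left ofReal_zero

/-- Smooth compactly supported real functions as complex Schwartz functions. -/
def rSchwartz (h : Rn n → ℝ) (hh : ContDiff ℝ C∞ h ∧ HasCompactSupport h) : 𝒮 n :=
  cSchwartz (fun ξ => (h ξ : ℂ)) (hasCompactSupport_ofReal_comp hh.2) (contDiff_ofReal_comp hh.1)

theorem smoothOp_comp_smul_eq {h : Rn n → ℝ} (hh : ContDiff ℝ C∞ h ∧ HasCompactSupport h) {μ : ℝ}
    (hμ : 0 < μ) (g : Rn n → ℂ) :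
    smoothOp n (fun ξ => h (μ⁻¹ • ξ)) g = dilConv (rSchwartz h hh).invF μ g := by
  rw [smoothOp_comp_smul h hμ, invFT_eq (H := rSchwartz h hh) fun ξ => rfl]

include h in
theorem IsLPBase.smoothOp_lpPiece (k : ℕ) (g : Rn n → ℂ) :
    smoothOp n (lpPiece n ψ0 k) g = dilConv (rSchwartz _ (h.gen k)).invF (2 ^ k) g := by
  rw [lpPiece_eq, smoothOp_comp_smul_eq (h.gen k) (by positivity)]

theorem hasCompactSupport_ofReal_mul {h : Rn n → ℝ} (hs : HasCompactSupport h) (G : Rn n → ℂ) :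
    HasCompactSupport fun ξ => (h ξ : ℂ) * G ξ :=
  HasCompactSupport.mul_right (f := fun ξ => (h ξ : ℂ)) (f' := G) (hasCompactSupport_ofReal_comp hs)

/-- The Littlewood–Paley pieces of a Schwartz function, as Schwartz functions. -/
def IsLPBase.block (h : IsLPBase n ψ0) (f : 𝒮 n) (j : ℕ) : 𝒮 n :=
  (cSchwartz (fun ξ => (lpPiece n ψ0 j ξ : ℂ) * ftransform n f ξ)
    (hasCompactSupport_ofReal_mul (h.piece j).2 _)
    ((contDiff_ofReal_comp (h.piece j).1).mul f.contDiff_ftransform)).invF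

include h in
theorem IsLPBase.smoothOp_eq_block (f : 𝒮 n) (j : ℕ) :
    smoothOp n (lpPiece n ψ0 j) f = h.block f j := by
  ext x
  rw [smoothOp_eq (h.piece j).1.continuous (h.piece j).2 f.integrable, IsLPBase.block,
    SchwartzMap.invF_apply]
  rfl

include h in
theorem IsLPBase.ftransform_block (f : 𝒮 n) (j : ℕ) (ξ : Rn n) :
    ftransform n (h.block f j) ξ = (lpPiece n ψ0 j ξ : ℂ) * ftransform n f ξ := by
  rw [IsLPBase.block, SchwartzMap.ftransform_invF, cSchwartz_apply]

/-- The reproducing kernel of functions with frequencies in the ball of radius `2`. -/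
def IsLPBase.repr (h : IsLPBase n ψ0) : 𝒮 n :=
  (rSchwartz _ (h.comp_smul (c := 2⁻¹) (by norm_num))).invF

theorem isReproduced_invF {h : Rn n → ℝ} (hh : ContDiff ℝ C∞ h ∧ HasCompactSupport h) {lam : ℝ}
    (hl : 0 < lam) {H : 𝒮 n} (hH : ∀ ξ, h (lam⁻¹ • ξ) = 1 ∨ H ξ = 0) : IsReproduced
    (rSchwartz h hh).invF lam H.invF where
  continuous := H.invF.continuous
  integrable := H.invF.integrable
  bounded := by
    obtain ⟨C, hC, hb⟩ := H.invF.exists_norm_le_inv_pow 0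
    exact ⟨C.toNNReal, fun y => by
      rw [← ofReal_norm]
      exact ofR_le_ofR (by simpa using hb y)⟩
  eq_dilConv y := by
    have h2 := contDiff_hasCompactSupport_comp_smul hh (inv_ne_zero hl.ne')
    rw [← smoothOp_comp_smul_eq hh hl, smoothOp_eq h2.1.continuous h2.2 H.invF.integrable,
      SchwartzMap.invF_apply, SchwartzMap.ftransform_invF]
    congr 2
    ext ξ
    rcases hH ξ with h3 | h3
    · rw [h3, ofReal_one, one_mul]
    · simp [h3]

include h in
theorem IsLPBase.isReproduced_block (f : 𝒮 n) (j : ℕ) :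
    IsReproduced h.repr (2 ^ j) (h.block f j) := by
  refine isReproduced_invF _ (pow_pos two_pos j) fun ξ => ?_
  rw [cSchwartz_apply, lpPiece_eq]
  rcases le_or_gt ‖((2 : ℝ) ^ j)⁻¹ • ξ‖ 2 with h4 | h4
  · refine .inl (h.2.1 _ ?_)
    rw [norm_smul, norm_of_nonneg (by norm_num)]
    linarith
  · right
    simp [h.lpGen_eq_zero_of_lt h4]

/-- A cutoff to the annulus equal to one where the Littlewood–Paley generator is supported. -/
def annulusCutoff (ψ0 : Rn n → ℝ) (η : Rn n) : ℝ := ψ0 ((2⁻¹ : ℝ) • η) - ψ0 ((4 : ℝ) • η)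

include h in
theorem IsLPBase.annulusCutoff_eq_zero {η : Rn n} (hη : η ∉ annulus n) :
    annulusCutoff ψ0 η = 0 := by
  have h1 : ‖(2⁻¹ : ℝ) • η‖ = 2⁻¹ * ‖η‖ := by rw [norm_smul, norm_of_nonneg (by norm_num)]
  have h2 : ‖(4 : ℝ) • η‖ = 4 * ‖η‖ := by rw [norm_smul, norm_of_nonneg (by norm_num)]
  rw [annulusCutoff]
  rcases lt_or_ge ‖η‖ (1 / 4) with h3 | h3
  · rw [h.2.1 _ (by linarith), h.2.1 _ (by linarith), sub_self]
  · have h4 : 4 < ‖η‖ := lt_of_not_ge fun h5 => hη ⟨h3, h5⟩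
    rw [h.2.2 _ (by linarith), h.2.2 _ (by linarith), sub_self]

include h in
theorem IsLPBase.annulusCutoff_mul_lpGen {j : ℕ} (hj : j ≠ 0) (η : Rn n) :
    annulusCutoff ψ0 η * lpGen ψ0 j η = lpGen ψ0 j η := by
  have h1 : ‖(2⁻¹ : ℝ) • η‖ = 2⁻¹ * ‖η‖ := by rw [norm_smul, norm_of_nonneg (by norm_num)]
  have h2 : ‖(4 : ℝ) • η‖ = 4 * ‖η‖ := by rw [norm_smul, norm_of_nonneg (by norm_num)]
  rcases le_or_gt ‖η‖ (1 / 2) with h3 | h3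
  · rw [h.lpGen_eq_zero hj h3, mul_zero]
  rcases le_or_gt ‖η‖ 2 with h4 | h4
  · rw [annulusCutoff, h.2.1 _ (by linarith), h.2.2 _ (by linarith), sub_zero, one_mul]
  · rw [h.lpGen_eq_zero_of_lt h4, mul_zero]

/-- Rescaled amplitudes at frequency `r`. -/
def scaledAmp (a : Rn n → Rn n → ℂ) (m : ℝ) (ψ0 : Rn n → ℝ) (r : {r : ℝ // 1 ≤ r}) (z : ℝ²ⁿ n) : ℂ
    :=
  (r : ℝ) ^ (-m) • a z.1 ((r : ℝ) • z.2) * (annulusCutoff ψ0 z.2 : ℂ)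

include ha in
theorem SymbolClass.suppUBdd_scaledAmp (h : IsLPBase n ψ0) (hK : IsCompact K) (haK : VanishOff K a)
    :
    SuppUBdd (fun _ => K ×ˢ annulus n) (scaledAmp a m ψ0) where
  ubdd := by
    refine UBdd.mul (ha.ubdd_scaled.mono fun _ z hz => ?_)
      (UBdd.of_isCompact (f := fun z => (annulusCutoff ψ0 z.2 : ℂ)) (hK.prod isCompact_annulus)
        fun z _ => ?_)
    · obtain ⟨_, h1, h2⟩ := hz
      exact ⟨by linarith, by linarith⟩
    · have h1 : ContDiff ℝ C∞ (annulusCutoff ψ0) :=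
        (h.comp_smul (c := 2⁻¹) (by norm_num)).1.sub (h.comp_smul (c := 4) (by norm_num)).1
      exact (ofRealCLM.contDiff.comp (h1.comp contDiff_snd)).contDiffAt
  isClosed _ := (hK.prod isCompact_annulus).isClosed
  eq_zero r z hz := by
    by_cases h1 : z.1 ∈ K
    · simp [scaledAmp, h.annulusCutoff_eq_zero fun h2 => hz ⟨h1, h2⟩]
    · simp [scaledAmp, haK _ _ h1]

include h ha hK haK hφ in
theorem IsLPBase.fio_block (f : 𝒮 n) {j : ℕ} (hj : j ≠ 0) (r : {r : ℝ // 1 ≤ r})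
    (hr : (r : ℝ) = 2 ^ j) : fio n a φ (h.block f j) = (((((2 * pi) ^ n)⁻¹ * (r : ℝ) ^ m : ℝ)) : ℂ)
    • oscOp φ (scaledAmp a m ψ0 r) r (h.block f j) := by
  ext x
  have hr0 : (0 : ℝ) < r := by linarith [r.2]
  have h1 := integral_comp_smul (volume : Measure (Rn n))
    (fun ξ => a x ξ * 𝐞(φ x ξ) * ftransform n (h.block f j) ξ) r
  rw [finrank_euclideanSpace_fin, abs_of_nonneg (by positivity), ← coe_smul, smul_eq_mul] at h1
  rw [(ha.suppUBdd_scaledAmp h hK haK).oscOp_eq hφ hK r r (h.block f j).integrable, Pi.smul_apply,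
    smul_eq_mul, fio]
  have h2 : ∀ η, (((r : ℝ) ^ m : ℝ) : ℂ) * (oscAmp φ (scaledAmp a m ψ0 r) r (x, η) *
      ∫ y, 𝐞⁻(r * ⟪y, η⟫_ℝ) * h.block f j y) =
      a x ((r : ℝ) • η) * 𝐞(φ x ((r : ℝ) • η)) *
        ftransform n (h.block f j) ((r : ℝ) • η) := fun η => by
    have h3 : (∫ y, 𝐞⁻(r * ⟪y, η⟫_ℝ) * h.block f j y) =
        ftransform n (h.block f j) ((r : ℝ) • η) := by
      simp only [ftransform, real_inner_smul_right]
    have h4 : (((r : ℝ) ^ m : ℝ) : ℂ) * (((r : ℝ) ^ (-m) : ℝ) : ℂ) = 1 := by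
      rw [← ofReal_mul, ← rpow_add hr0, add_neg_cancel, Real.rpow_zero, ofReal_one]
    have h5 : (annulusCutoff ψ0 η : ℂ) * (lpPiece n ψ0 j ((r : ℝ) • η) : ℂ) =
        lpPiece n ψ0 j ((r : ℝ) • η) := by
      rw [lpPiece_eq, ← hr]
      simp only [inv_smul_smul₀ hr0.ne']
      exact_mod_cast h.annulusCutoff_mul_lpGen hj η
    rw [h3, h.ftransform_block, oscAmp, scaledAmp, hφ.2 x η r hr0, real_smul]
    linear_combination ((annulusCutoff ψ0 η : ℂ) * (lpPiece n ψ0 j ((r : ℝ) • η) : ℂ)) *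
      a x ((r : ℝ) • η) * 𝐞(r * φ x η) * ftransform n f ((r : ℝ) • η) * h4 +
      a x ((r : ℝ) • η) * 𝐞(r * φ x η) * ftransform n f ((r : ℝ) • η) * h5
  have h6 : (r : ℂ) ≠ 0 := by exact_mod_cast hr0.ne'
  rw [ofReal_mul, mul_assoc, mul_left_comm (((r : ℝ) ^ m : ℝ) : ℂ),
    ← integral_const_mul (((r : ℝ) ^ m : ℝ) : ℂ)]
  simp only [h2]
  rw [h1]
  push_cast
  field_simp

include hn h ha hK haK hφ in
theorem IsLPBase.exists_eLpNorm_smoothOp_fio_block_le (hnd : NonDegenerateOn n φ K) {p : ℝ≥0∞}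
    (hp : 0 < p) (M : ℕ) : ∃ C : ℝ≥0, ∀ (f : 𝒮 n) (j k : ℕ), j ≠ 0 → eLpNorm
    (smoothOp n (lpPiece n ψ0 k) (fio n a φ (h.block f j))) p volume ≤ C * (2⁻¹ : ℝ≥0∞) ^
    (M * ((j - k) + (k - j))) * ofR ((2 : ℝ) ^ ((j : ℝ) * (m - criticalOrder n p))) * eLpNorm
    (h.block f j) p volume := by
  obtain ⟨δ, hδ, hδ'⟩ := hφ.exists_thickening hK hnd
  obtain ⟨h1, h2⟩ := exists_oscBound hn hφ hK hδ hδ' hp M h.repr (ha.suppUBdd_scaledAmp h hK haK)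
  choose C1 hC1 using fun b : Bool => h1 (rSchwartz _ (h.gen (cond b 1 0))).invF
  have hpt : HasCompactSupport (rSchwartz _ (h.gen 1)) ∧ ∃ r : ℝ, 0 < r ∧ ∀ ξ, ‖ξ‖ < r →
      rSchwartz _ (h.gen 1) ξ = 0 :=
    ⟨hasCompactSupport_ofReal_comp (h.gen 1).2, 1 / 2, by norm_num, fun ξ hξ => by
      rw [rSchwartz, cSchwartz_apply, h.lpGen_eq_zero one_ne_zero hξ.le, ofReal_zero]⟩
  obtain ⟨C2, hC2⟩ := h2 (κ := fun θ : PuncturedTest n => θ.1.invF)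
    PuncturedTest.exists_eq_sum_lderiv ⟨rSchwartz _ (h.gen 1), hpt⟩
  have hgen : ∀ k, ∃ b : Bool, (rSchwartz _ (h.gen k)).invF =
      (rSchwartz _ (h.gen (cond b 1 0))).invF ∧ (k ≠ 0 → b = true) := fun k => by
    refine ⟨decide (k ≠ 0), ?_, by simp⟩
    congr 1
    ext ξ
    by_cases hk : k = 0 <;> simp [rSchwartz, cSchwartz_apply, lpGen, hk]
  have hpow : ∀ l : ℕ, ofR (((2 : ℝ) ^ l)⁻¹ ^ M) = (2⁻¹ : ℝ≥0∞) ^ (M * l) := fun l => by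
    rw [ofR_pow (by positivity), ENNReal.ofReal_inv_of_pos (by positivity),
      ofR_pow two_pos.le, mul_comm, pow_mul, ENNReal.inv_pow]
    simp
  refine ⟨(C1 true + C1 false + C2) * (((2 * pi) ^ n)⁻¹).toNNReal, fun f j k hj => ?_⟩
  have hj1 : (1 : ℝ) ≤ 2 ^ j := one_le_pow₀ one_le_two
  have hk1 : (1 : ℝ) ≤ 2 ^ k := one_le_pow₀ one_le_two
  have hosc : eLpNorm (dilConv (rSchwartz _ (h.gen k)).invF (2 ^ k)
      (oscOp φ (scaledAmp a m ψ0 ⟨2 ^ j, hj1⟩) (2 ^ j) (h.block f j))) p volume ≤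
      (C1 true + C1 false + C2 : ℝ≥0) * (2⁻¹ : ℝ≥0∞) ^ (M * ((j - k) + (k - j))) *
        ofR (((2 : ℝ) ^ j) ^ (-criticalOrder n p)) * eLpNorm (h.block f j) p volume := by
    obtain ⟨b, hb, hb'⟩ := hgen k
    rw [hb]
    rcases le_total k j with hkj | hkj
    · refine (hC1 b ⟨2 ^ j, hj1⟩ (2 ^ j) (2 ^ k) (2 ^ (j - k)) hj1 hk1 (one_le_pow₀ one_le_two)
        (by beta_reduce; rw [← pow_add, Nat.sub_add_cancel hkj]) _ (h.isReproduced_block f j)).trans ?_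
      beta_reduce
      rw [hpow, Nat.sub_eq_zero_of_le hkj, add_zero]
      gcongr
      cases b
      · exact le_add_right le_add_self
      · exact le_add_right le_self_add
    · have := hb' (by omega)
      subst this
      refine (hC2 ⟨2 ^ j, hj1⟩ (2 ^ j) (2 ^ k) (2 ^ (k - j)) hj1 hk1 (one_le_pow₀ one_le_two)
        (by beta_reduce; rw [← pow_add, Nat.sub_add_cancel hkj]) _ (h.isReproduced_block f j)).trans ?_
      beta_reduce
      rw [hpow, Nat.sub_eq_zero_of_le hkj, zero_add]
      gcongr
      exact le_add_self
  rw [h.smoothOp_lpPiece, h.fio_block ha hK haK hφ f hj ⟨2 ^ j, hj1⟩ rfl]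
  have hsm : ∀ (κ : Rn n → ℂ) μ (c : ℂ) F, dilConv κ μ (c • F) = c • dilConv κ μ F :=
    fun κ μ c F => by
      ext x
      simp only [dilConv, Pi.smul_apply, smul_eq_mul, ← integral_const_mul]
      congr 1
      ext y
      ring
  rw [hsm, eLpNorm_const_smul]
  refine (mul_le_mul' le_rfl hosc).trans (le_of_eq ?_)
  rw [← ofReal_norm, norm_real, norm_of_nonneg (by positivity), ofR_mul (by positivity),
    coe_mul, sub_eq_add_neg, mul_add (j : ℝ), rpow_add two_pos, ofR_mul (by positivity),
    rpow_mul two_pos.le, rpow_mul two_pos.le, rpow_natCast, ofR]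
  ring

/-- The Fourier integral operator in terms of the Fourier transform `H` of its argument. -/
def fioHat (a : Rn n → Rn n → ℂ) (φ : Rn n → Rn n → ℝ) (H : Rn n → ℂ) (x : Rn n) : ℂ :=
  ((((2 * pi) ^ n)⁻¹ : ℝ) : ℂ) * ∫ ξ, a x ξ * 𝐞(φ x ξ) * H ξ

/-- `H` is integrable against the amplitude `a`, uniformly. -/
def Adm (a : Rn n → Rn n → ℂ) (H : Rn n → ℂ) : Prop :=
  Continuous H ∧ ∃ W : Rn n → ℝ, Integrable W ∧ ∀ x ξ, ‖a x ξ‖ * ‖H ξ‖ ≤ W ξ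

theorem Adm.mul (hH : Adm a H) {c : Rn n → ℝ} (hc : Continuous c) {B : ℝ} (hB : ∀ ξ, |c ξ| ≤ B) :
    Adm a fun ξ => (c ξ : ℂ) * H ξ := by
  obtain ⟨h1, W, hW, h2⟩ := hH
  refine ⟨(continuous_ofReal.comp hc).mul h1, fun ξ => B * W ξ, hW.const_mul B, fun x ξ => ?_⟩
  rw [norm_mul, norm_real, norm_eq_abs, mul_left_comm]
  exact mul_le_mul (hB ξ) (h2 x ξ) (by positivity) ((abs_nonneg _).trans (hB ξ))

include hn hφ in
theorem PhaseSmoothHomog.aestronglyMeasurable (ha : Continuous fun z : ℝ²ⁿ n => a z.1 z.2)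
    (hH : Continuous H) (x : Rn n) :
    AEStronglyMeasurable (fun ξ => a x ξ * 𝐞(φ x ξ) * H ξ) volume := by
  have : Nonempty (Fin n) := ⟨⟨0, hn⟩⟩
  have hv : (volume : Measure (Rn n)).restrict {0}ᶜ = volume :=
    Measure.restrict_eq_self_of_ae_mem (ae_iff.2 (by simp))
  rw [← hv]
  refine ContinuousOn.aestronglyMeasurable (fun ξ hξ => ?_) (measurableSet_singleton _).compl
  have h1 : ContinuousAt (fun ξ => φ x ξ) ξ :=
    ((hφ.contDiffAt (z := (x, ξ)) hξ).continuousAt).comp (f := fun ξ => (x, ξ)) (by fun_prop)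
  have h2 : Continuous fun ξ => a x ξ := ha.comp (by fun_prop : Continuous fun ξ => (x, ξ))
  exact ((h2.continuousAt.mul (Complex.continuous_exp.continuousAt.comp (continuousAt_const.mul
    (continuous_ofReal.continuousAt.comp h1)))).mul hH.continuousAt).continuousWithinAt

include hn hφ in
theorem Adm.integrable (ha : Continuous fun z : ℝ²ⁿ n => a z.1 z.2) (hH : Adm a H) (x : Rn n) :
    Integrable fun ξ => a x ξ * 𝐞(φ x ξ) * H ξ := by
  obtain ⟨h1, W, hW, h2⟩ := hH
  refine hW.mono' (hφ.aestronglyMeasurable hn ha h1 x) (.of_forall fun ξ => ?_)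
  rw [norm_mul, norm_mul, norm_cexp_I_mul, mul_one]
  exact h2 x ξ

include hn hφ in
theorem Adm.continuous_fioHat (ha : Continuous fun z : ℝ²ⁿ n => a z.1 z.2) (hH : Adm a H) :
    Continuous (fioHat a φ H) := by
  have : Nonempty (Fin n) := ⟨⟨0, hn⟩⟩
  obtain ⟨h1, W, hW, h2⟩ := hH
  refine continuous_const.mul (continuous_of_dominated
    (fun x => hφ.aestronglyMeasurable hn ha h1 x) (fun x => .of_forall fun ξ => ?_) hW ?_)
  · rw [norm_mul, norm_mul, norm_cexp_I_mul, mul_one]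
    exact h2 x ξ
  · filter_upwards [measure_eq_zero_iff_ae_notMem.1 (measure_singleton (0 : Rn n))] with ξ hξ
    have h3 : Continuous fun x => φ x ξ := continuous_iff_continuousAt.2 fun x =>
      ((hφ.contDiffAt (z := (x, ξ)) hξ).continuousAt).comp (f := fun x => (x, ξ)) (by fun_prop)
    have h4 : Continuous fun x => a x ξ := ha.comp (by fun_prop : Continuous fun x => (x, ξ))
    fun_prop

include haK in
theorem fioHat_eq_zero {x : Rn n} (hx : x ∉ K) : fioHat a φ H x = 0 := by
  simp [fioHat, haK x _ hx]

include hn hφ in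
theorem Adm.integrable_fioHat (ha : Continuous fun z : ℝ²ⁿ n => a z.1 z.2) (hK : IsCompact K)
    (haK : VanishOff K a) (hH : Adm a H) : Integrable (fioHat a φ H) :=
  (hH.continuous_fioHat hn hφ ha).integrable_of_hasCompactSupport
    (.intro hK fun _ hx => fioHat_eq_zero haK hx)

include hn hφ in
theorem Adm.tendsto_sum_dilConv_fioHat (ha : Continuous fun z : ℝ²ⁿ n => a z.1 z.2)
    (hK : IsCompact K) (haK : VanishOff K a) (hH : Adm a H) {c : ℕ → Rn n → ℝ}
    (hc : ∀ j, Continuous (c j)) {B : ℝ} (hcB : ∀ j ξ, |c j ξ| ≤ B)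
    (hB : ∀ J ξ, |∑ j ∈ range (J + 1), c j ξ| ≤ B)
    (hlim : ∀ ξ, ξ ≠ 0 → ∀ᶠ J in Filter.atTop, (∑ j ∈ range (J + 1), c j ξ : ℝ) * H ξ = H ξ)
    (κ : 𝒮 n) (μ : ℝ) (x : Rn n) : Filter.Tendsto
    (fun J => ∑ j ∈ range (J + 1), dilConv κ μ (fioHat a φ fun ξ => (c j ξ : ℂ) * H ξ) x)
    Filter.atTop (nhds (dilConv κ μ (fioHat a φ H) x)) := by
  have : Nonempty (Fin n) := ⟨⟨0, hn⟩⟩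
  have hS : ∀ J, Continuous fun ξ => ∑ j ∈ range (J + 1), c j ξ :=
    fun J => continuous_finsetSum _ fun j _ => hc j
  have hadm : ∀ J, Adm a fun ξ => ((∑ j ∈ range (J + 1), c j ξ : ℝ) : ℂ) * H ξ :=
    fun J => hH.mul (hS J) (hB J)
  have h1 : ∀ J, ∑ j ∈ range (J + 1), dilConv κ μ (fioHat a φ fun ξ => (c j ξ : ℂ) * H ξ) x =
      dilConv κ μ (fioHat a φ fun ξ => ((∑ j ∈ range (J + 1), c j ξ : ℝ) : ℂ) * H ξ) x :=
    fun J => by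
      rw [← κ.dilConv_finset_sum _ _ fun j _ => (hH.mul (hc j) (hcB j)).integrable_fioHat hn hφ ha
        hK haK]
      congr 1
      ext y
      simp only [fioHat]
      rw [← mul_sum, ← integral_finsetSum _ fun j _ =>
        (hH.mul (hc j) (hcB j)).integrable hn hφ ha y]
      congr 2
      ext ξ
      rw [ofReal_sum, sum_mul, mul_sum]
  simp only [h1]
  obtain ⟨W, hW, h2⟩ := hH.2
  obtain ⟨D, hD⟩ := κ.exists_norm_dil_le_const μ
  have h3 : ∀ J y ξ, ‖a y ξ * 𝐞(φ y ξ) *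
      (((∑ j ∈ range (J + 1), c j ξ : ℝ) : ℂ) * H ξ)‖ ≤ B * W ξ := fun J y ξ => by
    rw [norm_mul, norm_mul, norm_cexp_I_mul, mul_one, norm_mul, norm_real, norm_eq_abs,
      mul_left_comm]
    exact mul_le_mul (hB J ξ) (h2 y ξ) (by positivity) ((abs_nonneg _).trans (hB J ξ))
  refine tendsto_integral_of_dominated_convergence
    (fun y => K.indicator (fun _ => D * (((2 * pi) ^ n)⁻¹ * ∫ ξ, B * W ξ)) y)
    (fun J => (((κ.continuous_dil μ).comp (continuous_const.sub continuous_id)).mul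
      ((hadm J).continuous_fioHat hn hφ ha)).aestronglyMeasurable)
    ((integrable_indicator_iff hK.measurableSet).2 (integrableOn_const hK.measure_lt_top.ne))
    (fun J => .of_forall fun y => ?_) (.of_forall fun y => Filter.Tendsto.const_mul _ ?_)
  · by_cases hy : y ∈ K
    · rw [indicator_of_mem hy, norm_mul, fioHat, norm_mul, norm_real,
        norm_of_nonneg (by positivity)]
      have h4 := norm_integral_le_of_norm_le (hW.const_mul B) (.of_forall (h3 J y))
      have h5 : 0 ≤ D := (norm_nonneg _).trans (hD 0)
      gcongr
      exact hD _
    · rw [Set.indicator_of_notMem hy, fioHat_eq_zero haK hy, mul_zero, norm_zero]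
  · refine Filter.Tendsto.const_mul _ (tendsto_integral_of_dominated_convergence (fun ξ => B * W ξ)
      (fun J => hφ.aestronglyMeasurable hn ha (hadm J).1 y) (hW.const_mul B)
      (fun J => .of_forall (h3 J y)) ?_)
    filter_upwards [measure_eq_zero_iff_ae_notMem.1 (measure_singleton (0 : Rn n))] with ξ hξ
    refine tendsto_const_nhds.congr' ?_
    filter_upwards [hlim ξ hξ] with J hJ
    rw [hJ]

include ha in
theorem SymbolClass.adm_ftransform (f : 𝒮 n) : Adm a (ftransform n f) := by
  refine ⟨f.contDiff_ftransform.continuous, ?_⟩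
  obtain ⟨C, hC⟩ := ha.2 0 0
  obtain ⟨N, hN⟩ := exists_nat_gt m
  obtain ⟨D, hD0, hD⟩ := (FourierTransform.fourier f).exists_norm_le_inv_pow (N + (n + 1))
  have hC0 : 0 ≤ C := by
    have h1 := (norm_nonneg _).trans (hC 0 0)
    simpa using h1
  have hint : Integrable fun ξ : Rn n => (1 + ‖ξ‖) ^ (-((n + 1 : ℕ) : ℝ)) :=
    integrable_one_add_norm (by rw [finrank_euclideanSpace_fin]; push_cast; linarith)
  refine ⟨fun ξ => C * (D * (2 * pi) ^ (N + (n + 1))) * (1 + ‖ξ‖) ^ (-((n + 1 : ℕ) : ℝ)),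
    hint.const_mul _, fun x ξ => ?_⟩
  have h1 : ‖a x ξ‖ ≤ C * (1 + ‖ξ‖) ^ N := by
    have h2 := hC x ξ
    rw [norm_iteratedFDeriv_zero, norm_iteratedFDeriv_zero] at h2
    refine h2.trans (mul_le_mul_of_nonneg_left ?_ hC0)
    have h3 : 1 + ‖ξ‖ ^ 2 ≤ (1 + ‖ξ‖) ^ 2 := by nlinarith [norm_nonneg ξ]
    rw [Nat.cast_zero, sub_zero]
    calc (1 + ‖ξ‖ ^ 2) ^ (m / 2) ≤ (1 + ‖ξ‖ ^ 2) ^ ((N : ℝ) / 2) :=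
          rpow_le_rpow_of_exponent_le (by nlinarith [norm_nonneg ξ]) (by linarith)
      _ ≤ ((1 + ‖ξ‖) ^ 2) ^ ((N : ℝ) / 2) := by gcongr
      _ = _ := by
          rw [← rpow_natCast, ← rpow_mul (by positivity), ← rpow_natCast]
          congr 1
          push_cast
          ring
  have h4 : ‖ftransform n f ξ‖ ≤ D * (2 * pi) ^ (N + (n + 1)) * ((1 + ‖ξ‖) ^ (N + (n + 1)))⁻¹ := by
    rw [f.ftransform_eq]
    refine (hD _).trans ?_
    rw [mul_assoc]
    gcongr
    rw [← div_eq_mul_inv, ← div_pow, ← inv_pow]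
    gcongr
    have hpi : 1 ≤ 2 * pi := by linarith [Real.pi_gt_three]
    rw [norm_smul, norm_inv, norm_of_nonneg (by positivity), inv_le_comm₀ (by positivity)
      (by positivity), inv_div, div_le_iff₀ (by positivity)]
    have : (1 + (2 * pi)⁻¹ * ‖ξ‖) * (2 * pi) = 2 * pi + ‖ξ‖ := by field_simp
    linarith
  refine (mul_le_mul h1 h4 (norm_nonneg _) (by positivity)).trans (le_of_eq ?_)
  beta_reduce
  rw [rpow_neg (by positivity), rpow_natCast, pow_add (1 + ‖ξ‖)]
  field_simp

theorem phaseSmoothHomog_zero : PhaseSmoothHomog n fun _ _ => 0 := ⟨contDiffOn_const, by simp⟩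

theorem phaseMul_zero (l : Fin n) (b : ℝ²ⁿ n → ℂ) : phaseMul (fun _ _ => 0) l b = fun _ => 0 := by
  ext z
  simp [phaseMul, dPhase]

include hb in
theorem SuppUBdd.exists_enorm_oscOp_zero_le : ∃ C : ℝ≥0, ∀ i (lam : ℝ), 0 < lam → ∀ (g : Rn n → ℂ)
    (A : ℝ≥0∞), (∀ y, ‖g y‖ₑ ≤ A) → ∀ x, ‖oscOp (fun _ _ => 0) (b i) lam g x‖ₑ ≤ C * A := by
  have hs : SuppUBdd (fun _ : ι × Rn n => annulus n) fun j η => b j.1 (j.2, η) :=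
    ⟨hb.univ.freeze_left _ _ (by simp), fun _ => isCompact_annulus.isClosed,
      fun j η hη => hb.eq_zero _ _ fun h => hη h.2⟩
  obtain ⟨C, hC0, hC⟩ := hs.fourier_decay (R := 4) (fun _ η hη => by simpa using hη.2) (n + 1)
  obtain ⟨D, hD⟩ := exists_lintegral_decay_le n
  refine ⟨C.toNNReal * D, fun i lam hlam g A hA x => ?_⟩
  have hk : ∀ y, ‖oscKernel (fun _ _ => 0) (b i) lam x y‖ₑ ≤
      ofR C * ofR (((1 + lam * ‖y‖) ^ (n + 1))⁻¹) := fun y => by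
    rw [← ofR_mul hC0, ← ofReal_norm]
    refine ofR_le_ofR ?_
    have h1 := hC (i, x) (-(lam • y))
    rw [norm_neg, norm_smul, norm_of_nonneg hlam.le] at h1
    rw [← div_eq_mul_inv, le_div_iff₀' (by positivity), oscKernel]
    have h2 : ∀ η : Rn n, lam * (0 - ⟪y, η⟫_ℝ) = ⟪-(lam • y), η⟫_ℝ := fun η => by
      rw [inner_neg_left, real_inner_smul_left, zero_sub, mul_neg]
    simpa only [h2] using h1
  rw [oscOp, enorm_mul]
  calc _ ≤ ofR (lam ^ n) * ∫⁻ y : Rn n, ofR C * A *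
        ofR (((1 + lam * ‖y‖) ^ (n + 1))⁻¹) := by
        refine mul_le_mul' ?_ ((enorm_integral_le_lintegral_enorm _).trans
          (lintegral_mono fun y => ?_))
        · rw [← ofReal_norm, norm_real, norm_of_nonneg (by positivity)]
        · rw [enorm_mul, mul_right_comm]
          exact mul_le_mul' (hk y) (hA y)
    _ ≤ ofR (lam ^ n) * (ofR C * A * (D * ofR ((lam ^ n)⁻¹))) := by
        rw [lintegral_const_mul _ (by fun_prop)]
        exact mul_le_mul' le_rfl (mul_le_mul' le_rfl (hD lam hlam))
    _ = ofR (lam ^ n * (lam ^ n)⁻¹) * (ofR C * D * A) := by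
        rw [ofR_mul (by positivity)]
        ring
    _ = _ := by
        rw [mul_inv_cancel₀ (by positivity), ofR_one, one_mul, coe_mul]
        rfl

/-- Rapidly decaying bounds, uniform in the frequency `lam`, for zero-phase operators applied to
bounded functions, with gain `μ⁻¹ ^ M` at output frequency `μ`. -/
def LowBound (N M : ℕ) (κ : 𝒮 n) (b : ι → ℝ²ⁿ n → ℂ) : Prop :=
  ∃ C : ℝ≥0, ∀ i (lam μ : ℝ), 0 < lam → 1 ≤ μ → ∀ (g : Rn n → ℂ) (A : ℝ≥0∞), Integrable g →
    (∀ y, ‖g y‖ₑ ≤ A) → ∀ x, ‖dilConv κ μ (oscOp (fun _ _ => 0) (b i) lam g) x‖ₑ ≤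
      C * A * ofR (μ⁻¹ ^ M) * ofR (((1 + ‖x‖) ^ N)⁻¹)

include hQ hb in
theorem SuppUBdd.lowBound_zero (N : ℕ) (κ : 𝒮 n) : LowBound N 0 κ b := by
  obtain ⟨C, hC⟩ := hb.exists_enorm_oscOp_zero_le
  obtain ⟨D, hD⟩ := κ.exists_lintegral_dil_mul_le N
  obtain ⟨R, hR0, hR⟩ := hQ.isBounded.subset_closedBall_lt 0 0
  refine ⟨C * (D * (((1 + R) ^ N).toNNReal)), fun i lam μ hlam hμ g A _ hA x => ?_⟩
  refine (enorm_dilConv_le κ μ _ x).trans ?_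
  calc _ ≤ ∫⁻ y, C * A * (ofR ((1 + R) ^ N) * ofR (((1 + ‖x‖) ^ N)⁻¹)) *
        (‖dil κ μ (x - y)‖ₑ * ofR ((1 + 1 * ‖x - y‖) ^ N)) := by
        refine lintegral_mono fun y => ?_
        by_cases hy : y ∈ Q
        · have hyR : ‖y‖ ≤ R := by simpa using hR hy
          have h1 : (1 : ℝ≥0∞) ≤ ofR ((1 + R) ^ N) *
              ofR (((1 + ‖x‖) ^ N)⁻¹) * ofR ((1 + 1 * ‖x - y‖) ^ N) := by
            rw [← ofR_mul (by positivity), ← ofR_mul (by positivity),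
              ENNReal.one_le_ofReal, mul_right_comm, ← mul_pow, ← inv_pow, ← mul_pow]
            refine one_le_pow₀ ?_
            rw [← div_eq_mul_inv, one_le_div (by positivity)]
            have h2 := norm_le_norm_add_norm_sub' x y
            nlinarith [norm_nonneg (x - y), norm_nonneg y]
          calc _ ≤ ‖dil κ μ (x - y)‖ₑ * (C * A) * 1 := by
                rw [mul_one]
                exact mul_le_mul' le_rfl (hC i lam hlam g A hA y)
            _ ≤ ‖dil κ μ (x - y)‖ₑ * (C * A) * _ := mul_le_mul' le_rfl h1
            _ = _ := by ring
        · rw [hb.oscOp_eq_zero i lam g hy]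
          simp
    _ ≤ C * A * (ofR ((1 + R) ^ N) * ofR (((1 + ‖x‖) ^ N)⁻¹)) * (D * ofR (1 ^ N)) := by
        have hm : Measurable fun y => ‖dil κ μ (x - y)‖ₑ * ofR ((1 + 1 * ‖x - y‖) ^ N) :=
          ((κ.continuous_dil μ).comp (by fun_prop : Continuous fun y => x - y)).enorm.measurable.mul
            (by fun_prop)
        rw [lintegral_const_mul _ hm,
          lintegral_sub_left_eq_self (fun v => ‖dil κ μ v‖ₑ * ofR ((1 + 1 * ‖v‖) ^ N)) x]
        exact mul_le_mul' le_rfl (hD μ 1 1 (by linarith) zero_le_one le_rfl (by linarith))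
    _ = _ := by
        rw [one_pow, pow_zero, ofR_one, coe_mul, coe_mul, ofR]
        ring

include hQ in
theorem SuppUBdd.lowBound (N : ℕ) {ν : Type*} {κ : ν → 𝒮 n}
    (hκ : ∀ v, ∃ v' : Fin n → ν, ∀ x, κ v x = ∑ l, (κ (v' l)).lderiv (single l 1) x) (M : ℕ) : ∀ v
    (b : ι → ℝ²ⁿ n → ℂ), ShellUBdd Q b → LowBound N M (κ v) b := by
  induction M with
  | zero => exact fun v b hb => hb.lowBound_zero hQ N _
  | succ M ih =>
    intro v b hb
    obtain ⟨v', hv'⟩ := hκ v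
    choose D hD using fun l => ih (v' l) _ (hb.xder l)
    refine ⟨∑ l, D l, fun i lam μ hlam hμ g A hg hA x => ?_⟩
    have hμ0 : μ ≠ 0 := by positivity
    rw [dilConv_eq_sum hv' μ (hb.integrable_oscOp phaseSmoothHomog_zero hQ i lam hg)]
    refine (enorm_sum_le _ _).trans ?_
    rw [ENNReal.ofNNReal_finsetSum, sum_mul, sum_mul, sum_mul]
    refine sum_le_sum fun l _ => ?_
    have h0 : dilConv (κ (v' l)) μ (oscOp (fun _ _ => 0) (phaseMul (fun _ _ => 0) l (b i)) lam g)
        x = 0 := by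
      rw [phaseMul_zero]
      simp [dilConv, oscOp, oscKernel]
    rw [hb.dilConv_lderiv_oscOp phaseSmoothHomog_zero hQ _ i lam hμ0 hg l x, h0, mul_zero, zero_add,
      enorm_mul, pow_succ, ofR_mul (by positivity), ← ofReal_norm, norm_real,
      norm_of_nonneg (by positivity)]
    refine (mul_le_mul' le_rfl (hD l i lam μ hlam hμ g A hg hA x)).trans (le_of_eq ?_)
    ring

/-- A dyadic cutoff used to decompose a neighbourhood of the origin. -/
def lowCutoff (ψ0 : Rn n → ℝ) (η : Rn n) : ℝ := ψ0 ((2⁻¹ : ℝ) • η) - ψ0 η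

theorem norm_two_inv_smul (η : Rn n) : ‖(2⁻¹ : ℝ) • η‖ = 2⁻¹ * ‖η‖ := by
  rw [norm_smul, norm_of_nonneg (by norm_num)]

include h in
theorem IsLPBase.lowCutoff_eq_zero {η : Rn n} (hη : η ∉ annulus n) : lowCutoff ψ0 η = 0 := by
  have h1 := norm_two_inv_smul η
  rw [lowCutoff]
  rcases lt_or_ge ‖η‖ (1 / 4) with h3 | h3
  · rw [h.2.1 _ (by linarith), h.2.1 _ (by linarith), sub_self]
  · have h4 : 4 < ‖η‖ := lt_of_not_ge fun h5 => hη ⟨h3, h5⟩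
    rw [h.2.2 _ (by linarith), h.2.2 _ (by linarith), sub_self]

theorem sum_lowCutoff (J : ℕ) (ξ : Rn n) : ∑ l ∈ range (J + 1), lowCutoff ψ0 ((2 : ℝ) ^ l • ξ) = ψ0
    ((2⁻¹ : ℝ) • ξ) - ψ0 ((2 : ℝ) ^ J • ξ) := by
  induction J with
  | zero => simp [lowCutoff]
  | succ J ih =>
    rw [Finset.sum_range_succ, ih, lowCutoff, smul_smul, pow_succ', inv_mul_cancel_left₀ two_ne_zero,
      ← pow_succ']
    ring

theorem contDiff_dslope_cexp : ContDiff ℝ C∞ (dslope cexp 0) := by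
  have h1 : Differentiable ℂ (dslope cexp 0) := differentiableOn_univ.1
    ((Complex.differentiableOn_dslope Filter.univ_mem).2 Complex.differentiable_exp.differentiableOn)
  exact h1.contDiff.restrict_scalars ℝ

/-- The amplitude comparing the phases `φ` and `0` at the low frequency `σ`. -/
def lowAmp (a : Rn n → Rn n → ℂ) (φ : Rn n → Rn n → ℝ) (ψ0 : Rn n → ℝ) (σ : ℝ) (z : ℝ²ⁿ n) : ℂ :=
  a z.1 (σ • z.2) * (I * (φ z.1 z.2 : ℂ)) * dslope cexp 0 (I * ((σ * φ z.1 z.2 : ℝ) : ℂ)) *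
    (lowCutoff ψ0 z.2 : ℂ)

include hφ in
theorem PhaseSmoothHomog.suppUBdd_lowAmp (h : IsLPBase n ψ0)
    (ha : ContDiff ℝ C∞ fun z : ℝ²ⁿ n => a z.1 z.2) (hK : IsCompact K) (haK : VanishOff K a) :
    SuppUBdd (fun _ => K ×ˢ annulus n) fun σ : Icc (0 : ℝ) 1 => lowAmp a φ ψ0 σ where
  ubdd := by
    refine UBdd.of_joint (f := fun w : ℝ × (ℝ²ⁿ n) => lowAmp a φ ψ0 w.1 w.2)
      ((isCompact_Icc (a := (0 : ℝ)) (b := 1)).prod (hK.prod isCompact_annulus)) (fun w hw => ?_)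
      (fun σ : Icc (0 : ℝ) 1 => (σ : ℝ)) fun σ x hx => ⟨σ.2, hx⟩
    have hφ1 : ContDiffAt ℝ C∞ (fun w : ℝ × (ℝ²ⁿ n) => φ w.2.1 w.2.2) w :=
      (hφ.contDiffAt (ne_zero_of_mem_annulus hw.2.2)).comp w contDiff_snd.contDiffAt
    have hc : ContDiff ℝ C∞ (lowCutoff ψ0) := (h.comp_smul (c := 2⁻¹) (by norm_num)).1.sub h.1
    have h1 : ContDiff ℝ C∞ fun w : ℝ × (ℝ²ⁿ n) => a w.2.1 (w.1 • w.2.2) :=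
      ha.comp (f := fun w : ℝ × (ℝ²ⁿ n) => (w.2.1, w.1 • w.2.2)) (by fun_prop)
    have h2 : ContDiffAt ℝ C∞ (fun w : ℝ × (ℝ²ⁿ n) => (φ w.2.1 w.2.2 : ℂ)) w :=
      ofRealCLM.contDiff.contDiffAt.comp w hφ1
    have h3 : ContDiffAt ℝ C∞ (fun w : ℝ × (ℝ²ⁿ n) => I * ((w.1 * φ w.2.1 w.2.2 : ℝ) : ℂ)) w :=
      contDiffAt_const.mul (ofRealCLM.contDiff.contDiffAt.comp w (contDiffAt_fst.mul hφ1))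
    have h4 : ContDiff ℝ C∞ fun w : ℝ × (ℝ²ⁿ n) => (lowCutoff ψ0 w.2.2 : ℂ) :=
      ofRealCLM.contDiff.comp (hc.comp (contDiff_snd.comp contDiff_snd))
    exact ((h1.contDiffAt.mul (contDiffAt_const.mul h2)).mul
      (contDiff_dslope_cexp.contDiffAt.comp w h3)).mul h4.contDiffAt
  isClosed _ := (hK.prod isCompact_annulus).isClosed
  eq_zero σ z hz := by
    by_cases h1 : z.1 ∈ K
    · simp [lowAmp, h.lowCutoff_eq_zero fun h2 => hz ⟨h1, h2⟩]
    · simp [lowAmp, haK _ _ h1]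

include hn hφ in
theorem PhaseSmoothHomog.fioHat_lowCutoff (h : IsLPBase n ψ0)
    (ha : ContDiff ℝ C∞ fun z : ℝ²ⁿ n => a z.1 z.2) (hK : IsCompact K) (haK : VanishOff K a)
    {g : Rn n → ℂ} (hg : Integrable g) (hH : Adm a (ftransform n g)) {B : ℝ}
    (hB : ∀ ξ, |lowCutoff ψ0 ξ| ≤ B) {r : ℝ} (hr : 1 ≤ r) (σ : Icc (0 : ℝ) 1) (hσ : (σ : ℝ) = r⁻¹)
    (x : Rn n) : fioHat a φ (fun ξ => (lowCutoff ψ0 (r • ξ) : ℂ) * ftransform n g ξ) x = fioHat a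
    (fun _ _ => 0) (fun ξ => (lowCutoff ψ0 (r • ξ) : ℂ) * ftransform n g ξ) x +
    (((((2 * pi) ^ n)⁻¹ * r⁻¹ : ℝ)) : ℂ) * oscOp (fun _ _ => 0) (lowAmp a φ ψ0 σ) σ g x := by
  have hr0 : 0 < r := by linarith
  have hσ0 : (0 : ℝ) < σ := hσ ▸ inv_pos.2 hr0
  have hc : Continuous fun ξ : Rn n => lowCutoff ψ0 (r • ξ) :=
    ((h.comp_smul (c := 2⁻¹) (by norm_num)).1.continuous.sub h.1.continuous).comp (by fun_prop)
  have hA : Adm a fun ξ => (lowCutoff ψ0 (r • ξ) : ℂ) * ftransform n g ξ := hH.mul hc fun ξ => hB _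
  rw [← sub_eq_iff_eq_add', fioHat, fioHat, ← mul_sub,
    ← integral_sub (hA.integrable hn hφ ha.continuous x)
      (hA.integrable hn phaseSmoothHomog_zero ha.continuous x),
    (hφ.suppUBdd_lowAmp h ha hK haK).oscOp_eq phaseSmoothHomog_zero hK σ σ hg]
  have h1 := integral_comp_smul (volume : Measure (Rn n))
    (fun ξ => a x ξ * 𝐞(φ x ξ) * ((lowCutoff ψ0 (r • ξ) : ℂ) * ftransform n g ξ) -
      a x ξ * 𝐞(0) * ((lowCutoff ψ0 (r • ξ) : ℂ) * ftransform n g ξ)) (σ : ℝ)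
  rw [finrank_euclideanSpace_fin, abs_of_nonneg (by positivity), ← coe_smul, smul_eq_mul] at h1
  have h2 : ∀ η, ((σ : ℝ) : ℂ) * (oscAmp (fun _ _ => 0) (lowAmp a φ ψ0 σ) σ (x, η) *
      ∫ y, 𝐞⁻(σ * ⟪y, η⟫_ℝ) * g y) =
      a x ((σ : ℝ) • η) * 𝐞(φ x ((σ : ℝ) • η)) *
        ((lowCutoff ψ0 (r • (σ : ℝ) • η) : ℂ) * ftransform n g ((σ : ℝ) • η)) -
      a x ((σ : ℝ) • η) * 𝐞(0) *
        ((lowCutoff ψ0 (r • (σ : ℝ) • η) : ℂ) * ftransform n g ((σ : ℝ) • η)) := fun η => by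
    have h3 : (∫ y, 𝐞⁻(σ * ⟪y, η⟫_ℝ) * g y) = ftransform n g ((σ : ℝ) • η) := by
      simp only [ftransform, real_inner_smul_right]
    have h4 := sub_smul_dslope cexp 0 (I * ((σ * φ x η : ℝ) : ℂ))
    rw [sub_zero, smul_eq_mul, exp_zero] at h4
    have h5 : r • (σ : ℝ) • η = η := by rw [hσ, smul_inv_smul₀ hr0.ne']
    rw [h3, oscAmp, lowAmp, hφ.2 x η σ hσ0, h5]
    simp only [mul_zero, ofReal_zero, exp_zero, mul_one]
    push_cast at h4 ⊢
    linear_combination a x ((σ : ℝ) • η) * (lowCutoff ψ0 η : ℂ) * ftransform n g ((σ : ℝ) • η) * h4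
  have h6 : (((σ : ℝ) : ℂ)) ≠ 0 := by exact_mod_cast hσ0.ne'
  rw [ofReal_mul, mul_assoc, mul_left_comm ((r⁻¹ : ℝ) : ℂ), ← hσ, ← integral_const_mul ((σ : ℝ) : ℂ)]
  simp only [h2]
  rw [h1]
  push_cast
  field_simp

/-- The zero-phase low-frequency amplitude, translated into the annulus. -/
def transAmp (a : Rn n → Rn n → ℂ) (ψ0 : Rn n → ℝ) (e : Rn n) (z : ℝ²ⁿ n) : ℂ :=
  a z.1 ((8 : ℝ) • (z.2 - e)) * (ψ0 ((4 : ℝ) • (z.2 - e)) : ℂ)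

include h in
theorem IsLPBase.suppUBdd_transAmp (ha : ContDiff ℝ C∞ fun z : ℝ²ⁿ n => a z.1 z.2)
    (hK : IsCompact K) (haK : VanishOff K a) {e : Rn n} (he : ‖e‖ = 1) :
    SuppUBdd (fun _ => K ×ˢ annulus n) fun _ : Unit => transAmp a ψ0 e where
  ubdd := by
    refine UBdd.of_isCompact (hK.prod isCompact_annulus) fun z _ => ContDiff.contDiffAt ?_
    exact (ha.comp (f := fun z : ℝ²ⁿ n => (z.1, (8 : ℝ) • (z.2 - e))) (by fun_prop)).mul
      (ofRealCLM.contDiff.comp (h.1.comp (f := fun z : ℝ²ⁿ n => (4 : ℝ) • (z.2 - e)) (by fun_prop)))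
  isClosed _ := (hK.prod isCompact_annulus).isClosed
  eq_zero _ z hz := by
    by_cases h1 : z.1 ∈ K
    · have h2 : 2 < ‖(4 : ℝ) • (z.2 - e)‖ := by
        by_contra! h3
        rw [norm_smul, norm_of_nonneg (by norm_num)] at h3
        have h4 := norm_le_norm_add_norm_sub' z.2 e
        have h5 := norm_le_norm_add_norm_sub z.2 e
        exact hz ⟨h1, by linarith, by linarith⟩
      simp [transAmp, h.2.2 _ h2]
    · simp [transAmp, haK _ _ h1]

include h in
theorem IsLPBase.fioHat_zero_eq (ha : ContDiff ℝ C∞ fun z : ℝ²ⁿ n => a z.1 z.2) (hK : IsCompact K)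
    (haK : VanishOff K a) {e : Rn n} (he : ‖e‖ = 1) {g g' : Rn n → ℂ}
    (hg' : ∀ y, g' y = 𝐞(8 * ⟪y, e⟫_ℝ) * g y) (hgi : Integrable g')
    (hH : ∀ ξ : Rn n, 2 < ‖ξ‖ → ftransform n g ξ = 0) (x : Rn n) : fioHat a (fun _ _ => 0)
    (ftransform n g) x = ((((2 * pi) ^ n)⁻¹ : ℝ) : ℂ) * oscOp (fun _ _ => 0) (transAmp a ψ0 e) 8 g'
    x := by
  rw [(h.suppUBdd_transAmp ha hK haK he).oscOp_eq phaseSmoothHomog_zero hK () 8 hgi, fioHat]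
  congr 1
  have h1 := integral_comp_smul (volume : Measure (Rn n)) (fun ξ => a x ξ * ftransform n g ξ) 8
  rw [finrank_euclideanSpace_fin, abs_of_nonneg (by positivity), ← coe_smul, smul_eq_mul] at h1
  have h2 : ∀ η, oscAmp (fun _ _ => 0) (transAmp a ψ0 e) 8 (x, η) * ∫ y, 𝐞⁻(8 * ⟪y, η⟫_ℝ) * g' y =
      a x ((8 : ℝ) • (η - e)) * ftransform n g ((8 : ℝ) • (η - e)) := fun η => by
    have h3 : (∫ y, 𝐞⁻(8 * ⟪y, η⟫_ℝ) * g' y) = ftransform n g ((8 : ℝ) • (η - e)) := by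
      simp only [ftransform, hg', ← mul_assoc, ← exp_add]
      congr 1
      ext y
      congr 2
      rw [real_inner_smul_right, inner_sub_right]
      push_cast
      ring
    have h4 : (ψ0 ((4 : ℝ) • (η - e)) : ℂ) * ftransform n g ((8 : ℝ) • (η - e)) =
        ftransform n g ((8 : ℝ) • (η - e)) := by
      have h5 : ‖(4 : ℝ) • (η - e)‖ = 4 * ‖η - e‖ := by
        rw [norm_smul, norm_of_nonneg (by norm_num)]
      have h6 : ‖(8 : ℝ) • (η - e)‖ = 8 * ‖η - e‖ := by
        rw [norm_smul, norm_of_nonneg (by norm_num)]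
      rcases le_or_gt ‖η - e‖ (1 / 4) with h7 | h7
      · rw [h.2.1 _ (by linarith), ofReal_one, one_mul]
      · rw [hH _ (by linarith), mul_zero]
    rw [h3, oscAmp, transAmp]
    simp only [mul_zero, ofReal_zero, exp_zero, mul_one]
    rw [mul_assoc, h4]
  simp only [h2, ofReal_zero, mul_zero, exp_zero, mul_one]
  rw [integral_sub_right_eq_self (fun η => a x ((8 : ℝ) • η) * ftransform n g ((8 : ℝ) • η)) e, h1]
  push_cast
  field_simp

include h in
theorem IsLPBase.exists_lowCutoff_le : ∃ B : ℝ, ∀ ξ η : Rn n, |ψ0 ξ| ≤ B ∧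
    |ψ0 ξ - ψ0 η| ≤ B := by
  obtain ⟨B, hB⟩ := h.hasCompactSupport.exists_bound_of_continuous h.1.continuous
  simp only [norm_eq_abs] at hB
  refine ⟨B + B, fun ξ η => ⟨?_, (abs_sub _ _).trans (add_le_add (hB _) (hB _))⟩⟩
  linarith [hB ξ, abs_nonneg (ψ0 ξ)]

theorem SchwartzMap.dilConv_add_const_mul (κ : 𝒮 n) (μ : ℝ) {F G : Rn n → ℂ} (hF : Integrable F)
    (hG : Integrable G) (c : ℂ) (x : Rn n) :
    dilConv κ μ (fun y => F y + c * G y) x = dilConv κ μ F x + c * dilConv κ μ G x := by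
  simp only [dilConv]
  rw [← integral_const_mul, ← integral_add (κ.integrable_dil_mul μ hF x)
    ((κ.integrable_dil_mul μ hG x).const_mul c)]
  congr 1
  ext y
  ring

theorem ofReal_two_pow_inv (l : ℕ) : ofR ((2 : ℝ) ^ l)⁻¹ = (2⁻¹ : ℝ≥0∞) ^ l := by
  rw [ENNReal.ofReal_inv_of_pos (by positivity), ofR_pow two_pos.le, ENNReal.inv_pow]
  simp

include hn h ha hK haK hφ in
theorem IsLPBase.exists_enorm_dilConv_fio_low_le {N M : ℕ} {κ : 𝒮 n} (hκ : ∀ {ι : Type} (b : ι → ℝ²ⁿ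
    n → ℂ), SuppUBdd (fun _ => K ×ˢ annulus n) b → LowBound N M κ b) : ∃ C : ℝ≥0, ∀ (f : 𝒮 n)
    (μ : ℝ) (A : ℝ≥0∞), 1 ≤ μ → (∀ y, ‖h.block f 0 y‖ₑ ≤ A) → ∀ x, ‖dilConv κ μ
    (fio n a φ (h.block f 0)) x‖ₑ ≤ C * (A * ofR (μ⁻¹ ^ M) * ofR (((1 + ‖x‖) ^ N)⁻¹)) := by
  have he : ‖single (⟨0, hn⟩ : Fin n) (1 : ℝ)‖ = 1 := by simp
  generalize single (⟨0, hn⟩ : Fin n) (1 : ℝ) = e at he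
  have hlow := hφ.suppUBdd_lowAmp h ha.1 hK haK
  have htr := h.suppUBdd_transAmp ha.1 hK haK he
  obtain ⟨C1, hC1⟩ := hκ _ hlow
  obtain ⟨C2, hC2⟩ := hκ _ htr
  obtain ⟨B, hB⟩ := h.exists_lowCutoff_le
  have hpi : ‖((((2 * pi) ^ n)⁻¹ : ℝ) : ℂ)‖ₑ ≤ 1 := by
    rw [← ofReal_norm, norm_real, norm_of_nonneg (by positivity), ENNReal.ofReal_le_one]
    exact inv_le_one_of_one_le₀ (one_le_pow₀ (by linarith [Real.pi_gt_three]))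
  refine ⟨2 * C1 + C2, fun f μ A hμ hA x => ?_⟩
  have hg := (h.block f 0).integrable (μ := volume)
  have hH := ha.adm_ftransform (h.block f 0)
  have hsupp : ∀ ξ : Rn n, 2 < ‖ξ‖ → ftransform n (h.block f 0) ξ = 0 := fun ξ hξ => by
    rw [h.ftransform_block, lpPiece, if_pos rfl, h.2.2 ξ hξ, ofReal_zero, zero_mul]
  have hc : ∀ l : ℕ, Continuous fun ξ : Rn n => lowCutoff ψ0 ((2 : ℝ) ^ l • ξ) := fun l =>
    ((h.comp_smul (c := 2⁻¹) (by norm_num)).1.continuous.sub h.1.continuous).comp (by fun_prop)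
  have hlim : ∀ ξ : Rn n, ξ ≠ 0 → ∀ᶠ J in Filter.atTop,
      ((∑ l ∈ range (J + 1), lowCutoff ψ0 ((2 : ℝ) ^ l • ξ) : ℝ) : ℂ) *
        ftransform n (h.block f 0) ξ = ftransform n (h.block f 0) ξ := fun ξ hξ => by
    have h1 : Filter.Tendsto (fun J : ℕ => (2 : ℝ) ^ J * ‖ξ‖) Filter.atTop Filter.atTop :=
      (tendsto_pow_atTop_atTop_of_one_lt one_lt_two).atTop_mul_const (norm_pos_iff.2 hξ)
    filter_upwards [h1.eventually_gt_atTop 2] with J hJ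
    rcases le_or_gt ‖ξ‖ 2 with h2 | h2
    · rw [sum_lowCutoff, h.2.1 _ (by rw [norm_two_inv_smul]; linarith), h.2.2 ((2 : ℝ) ^ J • ξ)
        (by rwa [norm_smul, norm_of_nonneg (by positivity)]), sub_zero, ofReal_one, one_mul]
    · rw [hsupp ξ h2, mul_zero]
  have ht := fun (φ' : Rn n → Rn n → ℝ) (hφ' : PhaseSmoothHomog n φ') =>
    hH.tendsto_sum_dilConv_fioHat hn hφ' ha.1.continuous hK haK hc (fun j ξ => (hB _ _).2)
      (fun J ξ => by rw [sum_lowCutoff]; exact (hB _ _).2) hlim κ μ x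
  have hd := ((ht φ hφ).sub (ht _ phaseSmoothHomog_zero)).enorm
  set E := A * ofR (μ⁻¹ ^ M) * ofR (((1 + ‖x‖) ^ N)⁻¹) with hE
  have hdiff : ‖dilConv κ μ (fioHat a φ (ftransform n (h.block f 0))) x -
      dilConv κ μ (fioHat a (fun _ _ => 0) (ftransform n (h.block f 0))) x‖ₑ ≤ 2 * C1 * E := by
    refine le_of_tendsto' hd fun J => ?_
    rw [← Finset.sum_sub_distrib]
    calc _ ≤ ∑ l ∈ range (J + 1), (2⁻¹ : ℝ≥0∞) ^ l * (C1 * E) := by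
          refine (enorm_sum_le _ _).trans (sum_le_sum fun l _ => ?_)
          have h2 : (1 : ℝ) ≤ 2 ^ l := one_le_pow₀ one_le_two
          have h2i : ((2 : ℝ) ^ l)⁻¹ ∈ Icc (0 : ℝ) 1 := ⟨by positivity, inv_le_one_of_one_le₀ h2⟩
          have h3 := hφ.fioHat_lowCutoff hn h ha.1 hK haK hg hH (fun ξ => (hB _ _).2) h2
            ⟨_, h2i⟩ rfl
          have hAl : Adm a fun ξ => (lowCutoff ψ0 ((2 : ℝ) ^ l • ξ) : ℂ) *
            ftransform n (h.block f 0) ξ := hH.mul (hc l) fun ξ => (hB _ _).2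
          rw [funext h3, κ.dilConv_add_const_mul μ
            (hAl.integrable_fioHat hn phaseSmoothHomog_zero ha.1.continuous hK haK)
            (hlow.integrable_oscOp phaseSmoothHomog_zero hK ⟨_, h2i⟩ _ hg), add_sub_cancel_left,
            enorm_mul, ofReal_mul, enorm_mul, ← ofReal_two_pow_inv]
          refine mul_le_mul' ?_ ((hC1 ⟨_, h2i⟩ _ μ (by positivity) hμ _ A hg hA x).trans_eq ?_)
          · refine (mul_le_mul' hpi le_rfl).trans_eq ?_
            rw [one_mul, ← ofReal_norm, norm_real, norm_of_nonneg h2i.1]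
          · simp only [hE, mul_assoc]
      _ = (∑ l ∈ range (J + 1), (2⁻¹ : ℝ≥0∞) ^ l) * (C1 * E) := by rw [sum_mul]
      _ ≤ 2 * (C1 * E) := by
          refine mul_le_mul' ((sum_le_tsum _).trans_eq ?_) le_rfl
          rw [tsum_geometric, ENNReal.one_sub_inv_two, inv_inv]
      _ = _ := by rw [mul_assoc]
  have hz : ‖dilConv κ μ (fioHat a (fun _ _ => 0) (ftransform n (h.block f 0))) x‖ₑ ≤ C2 * E := by
    have hgi : Integrable fun y => 𝐞(8 * ⟪y, e⟫_ℝ) * h.block f 0 y :=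
      hg.bdd_mul (c := 1) (by fun_prop) (.of_forall fun y => (norm_cexp_I_mul _).le)
    have h3 := h.fioHat_zero_eq ha.1 hK haK he (fun y => rfl) hgi hsupp
    have h4 := κ.dilConv_add_const_mul μ (F := fun _ => 0) (integrable_zero _ _ _)
      (htr.integrable_oscOp phaseSmoothHomog_zero hK () 8 hgi) ((((2 * pi) ^ n)⁻¹ : ℝ) : ℂ) x
    have h5 : dilConv κ μ (fun _ => 0) x = 0 := by simp [dilConv]
    beta_reduce at h4
    simp only [zero_add, h5] at h4
    rw [funext h3, h4, enorm_mul]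
    refine (mul_le_mul' hpi (hC2 () 8 μ (by norm_num) hμ _ A hgi (fun y => ?_) x)).trans_eq ?_
    · rw [enorm_mul, ← ofReal_norm, norm_cexp_I_mul, ofR_one, one_mul]
      exact hA y
    · simp only [hE, one_mul, mul_assoc]
  rw [ENNReal.coe_add, add_mul]
  refine le_trans ?_ (add_le_add hdiff hz)
  refine le_trans (le_of_eq ?_) (enorm_add_le _ _)
  rw [sub_add_cancel]
  rfl

theorem IsReproduced.exists_enorm_le (ϑ : 𝒮 n) {p : ℝ≥0∞} (hp : 0 < p) :
    ∃ D : ℝ≥0, ∀ g, IsReproduced ϑ 1 g → ∀ y, ‖g y‖ₑ ≤ D * eLpNorm g p volume := by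
  rcases le_total 1 p with hp1 | hp1
  · have : Fact (1 ≤ p) := ⟨hp1⟩
    have := ENNReal.HolderConjugate.conjExponent hp1
    obtain ⟨D, hD⟩ : ∃ D : ℝ≥0, (D : ℝ≥0∞) = eLpNorm ϑ p.conjExponent volume :=
      ⟨_, coe_toNNReal (ϑ.eLpNorm_lt_top p.conjExponent volume).ne⟩
    refine ⟨D, fun g hg y => ?_⟩
    have h1 := eLpNorm_smul_le_mul_eLpNorm (p := p.conjExponent) (q := p) (r := 1)
      hg.continuous.aestronglyMeasurable
      (ϑ.continuous.comp (continuous_const.sub continuous_id) :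
        Continuous fun z => ϑ (y - z)).aestronglyMeasurable (μ := (volume : Measure (Rn n)))
    have h2 : eLpNorm (fun z => ϑ (y - z)) p.conjExponent volume = D := by
      rw [hD]
      exact eLpNorm_comp_measurePreserving ϑ.continuous.aestronglyMeasurable
        (Measure.measurePreserving_sub_left volume y)
    change _ ≤ eLpNorm (fun z => ϑ (y - z)) _ _ * _ at h1
    rw [h2] at h1
    refine le_trans ?_ h1
    conv_lhs => rw [hg.eq_dilConv y]
    refine (enorm_dilConv_le ϑ 1 g y).trans_eq ?_
    rw [eLpNorm_one_eq_lintegral_enorm]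
    refine lintegral_congr fun z => ?_
    simp [dil, enorm_smul]
  · obtain ⟨D, hD⟩ := IsReproduced.exists_le ϑ
    have hpt : p ≠ ⊤ := ne_top_of_le_ne_top one_ne_top hp1
    have hp0 : 0 < p.toReal := toReal_pos hp.ne' hpt
    refine ⟨D ^ (1 / p.toReal), fun g hg y => ?_⟩
    have h1 := (hD 1 one_pos g hg p.toReal hp0 (by simpa using toReal_mono one_ne_top hp1)).1 y
    rw [one_pow, ofR_one, mul_one] at h1
    have h2 := rpow_le_rpow h1 (z := 1 / p.toReal) (by positivity)
    rw [mul_rpow_of_nonneg _ _ (by positivity), ← erpow_mul,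
      mul_one_div_cancel hp0.ne', rpow_one] at h2
    rwa [eLpNorm_eq_lintegral_rpow_enorm_toReal hp.ne' hpt, coe_rpow_of_nonneg _ (by positivity)]

theorem exists_eLpNorm_decay_lt_top (n : ℕ) (p : ℝ≥0∞) : ∃ N : ℕ,
    eLpNorm (fun x : Rn n => ((1 + ‖x‖) ^ N)⁻¹) p volume < ⊤ := by
  obtain ⟨N, hN⟩ := Measure.HasTemperateGrowth.exists_eLpNorm_lt_top p
    (inferInstance : (volume : Measure (Rn n)).HasTemperateGrowth)
  refine ⟨N, ?_⟩
  convert hN using 3 with x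
  rw [rpow_neg (by positivity), rpow_natCast]

include hn h ha hK haK hφ in
theorem IsLPBase.exists_eLpNorm_smoothOp_fio_block_zero_le {p : ℝ≥0∞} (hp : 0 < p) (M : ℕ) : ∃ C :
    ℝ≥0, ∀ (f : 𝒮 n) (k : ℕ), eLpNorm (smoothOp n (lpPiece n ψ0 k) (fio n a φ (h.block f 0))) p
    volume ≤ C * (2⁻¹ : ℝ≥0∞) ^ (M * k) * eLpNorm (h.block f 0) p volume := by
  obtain ⟨N, hN⟩ := exists_eLpNorm_decay_lt_top n p
  obtain ⟨E, hE⟩ : ∃ E : ℝ≥0, (E : ℝ≥0∞) = _ := ⟨_, coe_toNNReal hN.ne⟩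
  obtain ⟨D, hD⟩ := IsReproduced.exists_enorm_le h.repr hp
  have hpt : HasCompactSupport (rSchwartz _ (h.gen 1)) ∧ ∃ r : ℝ, 0 < r ∧ ∀ ξ, ‖ξ‖ < r →
      rSchwartz _ (h.gen 1) ξ = 0 :=
    ⟨hasCompactSupport_ofReal_comp (h.gen 1).2, 1 / 2, by norm_num, fun ξ hξ => by
      rw [rSchwartz, cSchwartz_apply, h.lpGen_eq_zero one_ne_zero hξ.le, ofReal_zero]⟩
  obtain ⟨C0, hC0⟩ := h.exists_enorm_dilConv_fio_low_le hn ha hK haK hφ (N := N) (M := 0)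
    (κ := (rSchwartz _ (h.gen 0)).invF) fun b hb => hb.lowBound_zero hK N _
  obtain ⟨C1, hC1⟩ := h.exists_enorm_dilConv_fio_low_le hn ha hK haK hφ (N := N) (M := M)
    (κ := (rSchwartz _ (h.gen 1)).invF) fun b hb =>
      SuppUBdd.lowBound (κ := fun θ : PuncturedTest n => θ.1.invF) hK N
        PuncturedTest.exists_eq_sum_lderiv M ⟨rSchwartz _ (h.gen 1), hpt⟩ b hb
  refine ⟨(C0 + C1) * D * E, fun f k => ?_⟩
  have hA : ∀ y, ‖h.block f 0 y‖ₑ ≤ D * eLpNorm (h.block f 0) p volume :=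
    hD _ (by simpa using h.isReproduced_block f 0)
  have hpow : ofR (((2 : ℝ) ^ k)⁻¹ ^ M) = (2⁻¹ : ℝ≥0∞) ^ (M * k) := by
    rw [ofR_pow (by positivity), ofReal_two_pow_inv, mul_comm, pow_mul]
  have hx : ∀ x, ‖smoothOp n (lpPiece n ψ0 k) (fio n a φ (h.block f 0)) x‖ₑ ≤
      (((C0 + C1 : ℝ≥0) : ℝ≥0∞) * (D * eLpNorm (h.block f 0) p volume) * (2⁻¹ : ℝ≥0∞) ^ (M * k)) *
        ‖((1 + ‖x‖) ^ N)⁻¹‖ₑ := fun x => by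
    rw [h.smoothOp_lpPiece, Real.enorm_of_nonneg (by positivity), ← hpow]
    rcases eq_or_ne k 0 with rfl | hk
    · refine (hC0 f (2 ^ 0) _ (by norm_num) hA x).trans ?_
      simp only [pow_zero, inv_one, one_pow, mul_assoc]
      exact mul_le_mul' (by exact_mod_cast le_self_add) le_rfl
    · have hgen : (rSchwartz _ (h.gen k)).invF = (rSchwartz _ (h.gen 1)).invF := by
        congr 1
        ext ξ
        simp [rSchwartz, cSchwartz_apply, lpGen, hk]
      rw [hgen]
      refine (hC1 f (2 ^ k) _ (one_le_pow₀ one_le_two) hA x).trans ?_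
      simp only [mul_assoc]
      exact mul_le_mul' (by exact_mod_cast le_add_self) le_rfl
  have hc : ((C0 + C1 : ℝ≥0) : ℝ≥0∞) * (D * eLpNorm (h.block f 0) p volume) *
      (2⁻¹ : ℝ≥0∞) ^ (M * k) ≠ ⊤ := by
    refine mul_ne_top (mul_ne_top coe_ne_top (mul_ne_top
      coe_ne_top ((h.block f 0).eLpNorm_lt_top p volume).ne)) (by simp)
  obtain ⟨c, hc⟩ : ∃ c : ℝ≥0, (c : ℝ≥0∞) = _ := ⟨_, coe_toNNReal hc⟩
  rw [← hc] at hx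
  have hce : ‖(c : ℝ)‖ₑ = c := by rw [Real.enorm_of_nonneg c.coe_nonneg, ofReal_coe_nnreal]
  have h1 : eLpNorm (smoothOp n (lpPiece n ψ0 k) (fio n a φ (h.block f 0))) p volume ≤
      c * eLpNorm (fun x : Rn n => ((1 + ‖x‖) ^ N)⁻¹) p volume := by
    refine (eLpNorm_mono_enorm (g := fun x : Rn n => (c : ℝ) • ((1 + ‖x‖) ^ N)⁻¹)
      fun x => (hx x).trans_eq ?_).trans_eq ?_
    · rw [enorm_smul, hce]
    · rw [show (fun x : Rn n => (c : ℝ) • ((1 + ‖x‖) ^ N)⁻¹) =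
        (c : ℝ) • fun x : Rn n => ((1 + ‖x‖) ^ N)⁻¹ from rfl, eLpNorm_const_smul,
        hce]
  refine h1.trans_eq ?_
  rw [hc, ← hE, coe_mul, coe_mul]
  ring

include hn ha hK haK hφ in
theorem SymbolClass.integrable_fio (f : 𝒮 n) : Integrable (fio n a φ f) :=
  (ha.adm_ftransform f).integrable_fioHat hn hφ ha.1.continuous hK haK

include hn h ha hK haK hφ in
theorem IsLPBase.enorm_smoothOp_fio_le (f : 𝒮 n) (k : ℕ) (x : Rn n) : ‖smoothOp n (lpPiece n ψ0 k)
    (fio n a φ f) x‖ₑ ≤ ∑' j, ‖smoothOp n (lpPiece n ψ0 k) (fio n a φ (h.block f j)) x‖ₑ := by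
  obtain ⟨B, hB⟩ := h.exists_lowCutoff_le
  have hlim : ∀ ξ : Rn n, ξ ≠ 0 → ∀ᶠ J in Filter.atTop,
      ((∑ j ∈ range (J + 1), lpPiece n ψ0 j ξ : ℝ) : ℂ) * ftransform n f ξ =
        ftransform n f ξ := fun ξ _ => by
    filter_upwards [(tendsto_pow_atTop_atTop_of_one_lt (one_lt_two (α := ℝ))).eventually_ge_atTop
      ‖ξ‖] with J hJ
    rw [sum_lpPiece, h.2.1, ofReal_one, one_mul]
    rw [norm_smul, norm_inv, norm_of_nonneg (by positivity)]
    exact inv_mul_le_one_of_le₀ hJ (by positivity)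
  have ht := (ha.adm_ftransform f).tendsto_sum_dilConv_fioHat hn hφ ha.1.continuous hK haK
    (fun j => (h.piece j).1.continuous) (B := B)
    (fun j ξ => by
      rw [lpPiece]
      split_ifs
      exacts [(hB ξ ξ).1, (hB _ _).2])
    (fun J ξ => by rw [sum_lpPiece]; exact (hB _ 0).1) hlim
    (rSchwartz _ (h.gen k)).invF (2 ^ k) x
  rw [h.smoothOp_lpPiece]
  refine le_of_tendsto' ht.enorm fun J => (enorm_sum_le _ _).trans ?_
  refine le_trans (le_of_eq (sum_congr rfl fun j _ => ?_)) (sum_le_tsum _)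
  rw [h.smoothOp_lpPiece]
  simp only [← h.ftransform_block]
  rfl

/-- Distance of natural numbers. -/
def idxDist (j k : ℕ) : ℕ := (j - k) + (k - j)

theorem idxDist_comm (j k : ℕ) : idxDist j k = idxDist k j := add_comm _ _

theorem tsum_pow_idxDist_le (θ : ℝ≥0∞) (k : ℕ) : ∑' j, θ ^ idxDist j k ≤ 2 * (1 + (1 - θ)⁻¹) := by
  have h1 : ∑ j ∈ range k, θ ^ idxDist j k ≤ 1 + (1 - θ)⁻¹ := by
    rw [← Finset.sum_range_reflect]
    calc _ = ∑ j ∈ range k, θ ^ (j + 1) := sum_congr rfl fun j hj => by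
          congr 1
          have := mem_range.1 hj
          rw [idxDist]
          omega
      _ ≤ ∑ j ∈ range (k + 1), θ ^ j := by
          rw [Finset.sum_range_succ' _ k]
          exact le_self_add
      _ ≤ (1 - θ)⁻¹ := (sum_le_tsum _).trans_eq (tsum_geometric _)
      _ ≤ _ := le_add_self
  rw [← (ENNReal.summable.sum_add_tsum_nat_add' (f := fun j => θ ^ idxDist j k) (k := k)), two_mul]
  refine add_le_add h1 ?_
  have h2 : ∀ j, idxDist (j + k) k = j := fun j => by rw [idxDist]; omega
  simp only [h2, tsum_geometric]
  exact le_add_self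

theorem two_mul_inv_pow (d : ℕ) : (2⁻¹ : ℝ≥0∞) ^ d * 2 ^ d = 1 := by
  rw [← mul_pow, ENNReal.inv_mul_cancel two_ne_zero ENNReal.ofNat_ne_top, one_pow]

theorem tsum_le_iSup_two_pow (t : ℕ → ℝ≥0∞) (k : ℕ) :
    ∑' j, t j ≤ 6 * ⨆ j, 2 ^ idxDist j k * t j := by
  calc ∑' j, t j ≤ ∑' j, (2⁻¹ : ℝ≥0∞) ^ idxDist j k * ⨆ j, 2 ^ idxDist j k * t j := by
        refine tsum_le_tsum fun j => ?_
        refine le_trans ?_ (mul_le_mul' le_rfl (le_iSup (fun j => 2 ^ idxDist j k * t j) j))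
        rw [← mul_assoc, two_mul_inv_pow, one_mul]
    _ ≤ _ := by
        rw [ENNReal.tsum_mul_right]
        refine mul_le_mul' ((tsum_pow_idxDist_le _ _).trans_eq ?_) le_rfl
        rw [ENNReal.one_sub_inv_two, inv_inv]
        norm_num

theorem exists_tsum_pow_idxDist_le {r : ℝ} (hr : 0 < r) : ∃ C : ℝ≥0, ∀ k,
    ∑' j, ((2⁻¹ : ℝ≥0∞) ^ idxDist j k) ^ r ≤ C := by
  have h1 : (2⁻¹ : ℝ≥0∞) ^ r < 1 := ENNReal.rpow_lt_one (by simp) hr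
  refine ⟨(2 * (1 + (1 - (2⁻¹ : ℝ≥0∞) ^ r)⁻¹)).toNNReal, fun k => ?_⟩
  rw [coe_toNNReal (mul_ne_top ENNReal.ofNat_ne_top (ENNReal.add_ne_top.2
    ⟨one_ne_top, inv_ne_top.2 (tsub_pos_of_lt h1).ne'⟩))]
  refine le_trans (le_of_eq (tsum_congr fun j => ?_)) (tsum_pow_idxDist_le _ k)
  rw [← ENNReal.rpow_natCast, ← erpow_mul, mul_comm, erpow_mul, ENNReal.rpow_natCast]

theorem iSup_rpow_le_tsum {r : ℝ} (hr : 0 < r) (u : ℕ → ℝ≥0∞) : (⨆ j, u j) ^ r ≤ ∑' j, u j ^ r :=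
  ((ENNReal.orderIsoRpow r hr).map_iSup u).trans_le
    (iSup_le fun j => ENNReal.le_tsum (f := fun j => u j ^ r) j)

theorem exists_lqSum_iSup_le {q : ℝ≥0∞} (hq : 0 < q) : ∃ C : ℝ≥0, ∀ (c : ℝ≥0∞) (u w : ℕ → ℝ≥0∞),
    (∀ k, w k ≤ c * ⨆ j, (2⁻¹ : ℝ≥0∞) ^ idxDist j k * u j) → lqSum q w ≤ C * c * lqSum q u := by
  rcases eq_or_ne q ⊤ with rfl | hqt
  · refine ⟨1, fun c u w hw => ?_⟩
    rw [lqSum, lqSum, if_pos rfl, if_pos rfl, ENNReal.coe_one, one_mul]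
    refine iSup_le fun k => (hw k).trans (mul_le_mul' le_rfl (iSup_mono fun j => ?_))
    exact mul_le_of_le_one_left (zero_le) (pow_le_one₀ (zero_le) (by simp))
  have hr : 0 < q.toReal := toReal_pos hq.ne' hqt
  obtain ⟨C, hC⟩ := exists_tsum_pow_idxDist_le hr
  refine ⟨C ^ (1 / q.toReal), fun c u w hw => ?_⟩
  rw [lqSum, lqSum, if_neg hqt, if_neg hqt]
  have h1 : ∑' k, w k ^ q.toReal ≤ C * c ^ q.toReal * ∑' j, u j ^ q.toReal := by
    calc ∑' k, w k ^ q.toReal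
        ≤ ∑' k, c ^ q.toReal * ∑' j, ((2⁻¹ : ℝ≥0∞) ^ idxDist j k) ^ q.toReal * u j ^ q.toReal := by
          refine tsum_le_tsum fun k => (rpow_le_rpow (hw k) hr.le).trans ?_
          rw [mul_rpow_of_nonneg _ _ hr.le]
          refine mul_le_mul' le_rfl ((iSup_rpow_le_tsum hr _).trans_eq (tsum_congr fun j => ?_))
          rw [mul_rpow_of_nonneg _ _ hr.le]
      _ = c ^ q.toReal * ∑' j, (∑' k, ((2⁻¹ : ℝ≥0∞) ^ idxDist k j) ^ q.toReal) * u j ^ q.toReal := by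
          rw [ENNReal.tsum_mul_left, ENNReal.tsum_comm]
          simp only [ENNReal.tsum_mul_right, idxDist_comm]
      _ ≤ c ^ q.toReal * ∑' j, C * u j ^ q.toReal :=
          mul_le_mul' le_rfl (tsum_le_tsum fun j => mul_le_mul' (hC j) le_rfl)
      _ = _ := by
          rw [ENNReal.tsum_mul_left]
          ring
  refine (rpow_le_rpow h1 (by positivity)).trans_eq ?_
  rw [mul_rpow_of_nonneg _ _ (by positivity), mul_rpow_of_nonneg _ _ (by positivity),
    ← erpow_mul, mul_one_div_cancel hr.ne', rpow_one,
    coe_rpow_of_nonneg _ (by positivity)]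

theorem exists_eLpNorm_le_iSup {α : Type*} [MeasurableSpace α] {μ : Measure α} {p : ℝ≥0∞}
    (hp : 0 < p) : ∃ C : ℝ≥0, ∀ (G : α → ℂ) (T : ℕ → α → ℂ) (k : ℕ),
    (∀ j, AEStronglyMeasurable (T j) μ) → (∀ x, ‖G x‖ₑ ≤ ∑' j, ‖T j x‖ₑ) → eLpNorm G p μ ≤ C * ⨆ j,
    4 ^ idxDist j k * eLpNorm (T j) p μ := by
  rcases eq_or_ne p ⊤ with rfl | hpt
  · refine ⟨6, fun G T k _ hG => ?_⟩
    have hT : ∀ᵐ x ∂μ, ∀ j, ‖T j x‖ₑ ≤ eLpNorm (T j) ⊤ μ := ae_all_iff.2 fun j => by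
        rw [eLpNorm_exponent_top]
        exact enorm_ae_le_eLpNormEssSup _ _
    rw [eLpNorm_exponent_top]
    refine essSup_le_of_ae_le _ ?_
    filter_upwards [hT] with x hx
    refine ((hG x).trans (tsum_le_iSup_two_pow _ k)).trans
      (mul_le_mul' le_rfl (iSup_mono fun j => mul_le_mul' ?_ (hx j)))
    exact pow_le_pow_left' (by norm_num) _
  have hr : 0 < p.toReal := toReal_pos hp.ne' hpt
  obtain ⟨C, hC⟩ := exists_tsum_pow_idxDist_le hr
  refine ⟨6 * C ^ (1 / p.toReal), fun G T k hT hG => ?_⟩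
  set S := ⨆ j, 4 ^ idxDist j k * eLpNorm (T j) p μ with hS
  have hTS : ∀ j, 2 ^ idxDist j k * eLpNorm (T j) p μ ≤ (2⁻¹ : ℝ≥0∞) ^ idxDist j k * S := fun j => by
    refine le_trans (le_of_eq ?_) (mul_le_mul' le_rfl
      (le_iSup (fun j => 4 ^ idxDist j k * eLpNorm (T j) p μ) j))
    rw [← mul_assoc, show (4 : ℝ≥0∞) = 2 * 2 by norm_num, mul_pow, ← mul_assoc ((2⁻¹ : ℝ≥0∞) ^ _),
      two_mul_inv_pow, one_mul]
  have h1 : ∫⁻ x, ‖G x‖ₑ ^ p.toReal ∂μ ≤ 6 ^ p.toReal * (C * S ^ p.toReal) := by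
    calc ∫⁻ x, ‖G x‖ₑ ^ p.toReal ∂μ
        ≤ ∫⁻ x, 6 ^ p.toReal * ∑' j, (2 ^ idxDist j k) ^ p.toReal * ‖T j x‖ₑ ^ p.toReal ∂μ := by
          refine lintegral_mono fun x => (rpow_le_rpow
            ((hG x).trans (tsum_le_iSup_two_pow _ k)) hr.le).trans ?_
          rw [mul_rpow_of_nonneg _ _ hr.le]
          refine mul_le_mul' le_rfl ((iSup_rpow_le_tsum hr _).trans_eq (tsum_congr fun j => ?_))
          rw [mul_rpow_of_nonneg _ _ hr.le]
      _ = 6 ^ p.toReal * ∑' j, (2 ^ idxDist j k * eLpNorm (T j) p μ) ^ p.toReal := by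
          rw [lintegral_const_mul' _ _ (by simp), lintegral_tsum fun j =>
            ((hT j).enorm.pow_const _).const_mul _]
          congr 1
          refine tsum_congr fun j => ?_
          rw [lintegral_const_mul' _ _ (by simp), mul_rpow_of_nonneg _ _ hr.le,
            eLpNorm_eq_lintegral_rpow_enorm_toReal hp.ne' hpt, ← erpow_mul,
            one_div_mul_cancel hr.ne', rpow_one]
      _ ≤ 6 ^ p.toReal * ∑' j, ((2⁻¹ : ℝ≥0∞) ^ idxDist j k) ^ p.toReal * S ^ p.toReal := by
          refine mul_le_mul' le_rfl (tsum_le_tsum fun j => ?_)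
          rw [← mul_rpow_of_nonneg _ _ hr.le]
          exact rpow_le_rpow (hTS j) hr.le
      _ ≤ _ := by
          rw [ENNReal.tsum_mul_right]
          exact mul_le_mul' le_rfl (mul_le_mul' (hC k) le_rfl)
  rw [eLpNorm_eq_lintegral_rpow_enorm_toReal hp.ne' hpt]
  refine (rpow_le_rpow h1 (by positivity)).trans_eq ?_
  have h2 : ∀ c : ℝ≥0∞, (c ^ p.toReal) ^ (1 / p.toReal) = c := fun c => by
    rw [← erpow_mul, mul_one_div_cancel hr.ne', rpow_one]
  rw [mul_rpow_of_nonneg _ _ (by positivity), mul_rpow_of_nonneg _ _ (by positivity),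
    h2, h2, coe_mul, coe_rpow_of_nonneg _ (by positivity), mul_assoc]
  rfl

theorem ofReal_two_rpow_le {s : ℝ} {S : ℕ} (hs : |s| ≤ S) (j k : ℕ) : ofR
    ((2 : ℝ) ^ ((k : ℝ) * s)) ≤ 2 ^ (S * idxDist j k) * ofR ((2 : ℝ) ^ ((j : ℝ) * s)) := by
  have h1 : (2 : ℝ≥0∞) ^ (S * idxDist j k) = ofR ((2 : ℝ) ^ ((S * idxDist j k : ℕ) : ℝ)) := by
    rw [rpow_natCast, ofR_pow two_pos.le]
    simp
  rw [h1, ← ofR_mul (by positivity), ← rpow_add two_pos]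
  refine ofR_le_ofR (rpow_le_rpow_of_exponent_le one_le_two ?_)
  have h2 : |((k : ℝ) - j) * s| ≤ idxDist j k * S := by
    rw [abs_mul]
    refine mul_le_mul ?_ hs (abs_nonneg _) (by positivity)
    rw [idxDist, abs_le]
    rcases le_total j k with h | h
    · rw [Nat.sub_eq_zero_of_le h, zero_add, Nat.cast_sub h]
      have : (j : ℝ) ≤ k := by exact_mod_cast h
      constructor <;> linarith
    · rw [Nat.sub_eq_zero_of_le h, add_zero, Nat.cast_sub h]
      have : (k : ℝ) ≤ j := by exact_mod_cast h
      constructor <;> linarith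
  push_cast
  nlinarith [le_abs_self (((k : ℝ) - j) * s)]

end

/-- Local Besov–Lipschitz boundedness of Fourier integral operators with
compactly supported amplitude in `S^m` and non-degenerate homogeneous phase:
`T_a^φ : B^{s+m-m_c(p)}_{p,q} → B^s_{p,q}` for all `0 < p, q ≤ ∞` and `s ∈ ℝ`. -/
theorem local_besov_boundedness_of_fio
    (n : ℕ) (hn : 1 ≤ n) (s m : ℝ) (p q : ℝ≥0∞) (hp : 0 < p) (hq : 0 < q)
    (ψ0 : Rn n → ℝ) (hψ0 : IsLPBase n ψ0)
    (a : Rn n → Rn n → ℂ) (ha : SymbolClass n m a)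
    (K : Set (Rn n)) (hK : IsCompact K) (haK : ∀ x ξ : Rn n, x ∉ K → a x ξ = 0)
    (φ : Rn n → Rn n → ℝ) (hφ : PhaseSmoothHomog n φ) (hφnd : NonDegenerateOn n φ K) :
    ∃ C : ℝ≥0, ∀ f : SchwartzMap (Rn n) ℂ,
      besovNorm n ψ0 s p q (fio n a φ ⇑f) ≤
        (C : ℝ≥0∞) * besovNorm n ψ0 (s + m - criticalOrder n p) p q ⇑f := by
  obtain ⟨S, hS⟩ := exists_nat_ge |s|
  obtain ⟨C1, hC1⟩ := hψ0.exists_eLpNorm_smoothOp_fio_block_le hn ha hK haK hφ hφnd hp (S + 3)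
  obtain ⟨C2, hC2⟩ := hψ0.exists_eLpNorm_smoothOp_fio_block_zero_le hn ha hK haK hφ hp (S + 3)
  obtain ⟨C3, hC3⟩ := exists_eLpNorm_le_iSup (μ := (volume : Measure (Rn n))) hp
  obtain ⟨C4, hC4⟩ := exists_lqSum_iSup_le hq
  refine ⟨C4 * (C3 * (C1 + C2)), fun f => ?_⟩
  rw [besovNorm, besovNorm, coe_mul]
  refine hC4 _ _ _ fun k => ?_
  beta_reduce
  have hT : ∀ j, eLpNorm (smoothOp n (lpPiece n ψ0 k) (fio n a φ (hψ0.block f j))) p volume ≤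
      ((C1 + C2 : ℝ≥0) : ℝ≥0∞) * (2⁻¹ : ℝ≥0∞) ^ ((S + 3) * idxDist j k) *
        ofR ((2 : ℝ) ^ ((j : ℝ) * (m - criticalOrder n p))) *
          eLpNorm (hψ0.block f j) p volume := fun j => by
    rcases eq_or_ne j 0 with rfl | hj
    · refine (hC2 f k).trans (mul_le_mul' ?_ le_rfl)
      have : idxDist 0 k = k := by rw [idxDist]; omega
      rw [this, Nat.cast_zero, zero_mul, Real.rpow_zero, ENNReal.ofReal_one, mul_one]
      exact mul_le_mul' (by exact_mod_cast le_add_self) le_rfl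
    · refine (hC1 f j k hj).trans (mul_le_mul' (mul_le_mul' (mul_le_mul' ?_ le_rfl) le_rfl) le_rfl)
      exact_mod_cast le_self_add
  have hG := hC3 _ _ k (fun j => by
    rw [hψ0.smoothOp_lpPiece k]
    exact (SchwartzMap.continuous_dilConv _ _
      (ha.integrable_fio hn hK haK hφ (hψ0.block f j))).aestronglyMeasurable)
    (hψ0.enorm_smoothOp_fio_le hn ha hK haK hφ f k)
  refine (mul_le_mul' le_rfl hG).trans ?_
  rw [coe_mul, mul_left_comm, mul_assoc]
  refine mul_le_mul' le_rfl ?_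
  rw [mul_iSup, mul_iSup]
  refine iSup_mono fun j => ?_
  rw [hψ0.smoothOp_eq_block]
  refine (mul_le_mul' (ofReal_two_rpow_le hS j k) (mul_le_mul' le_rfl (hT j))).trans_eq ?_
  have h1 : ofR ((2 : ℝ) ^ ((j : ℝ) * (s + m - criticalOrder n p))) =
      ofR ((2 : ℝ) ^ ((j : ℝ) * s)) * ofR ((2 : ℝ) ^ ((j : ℝ) * (m - criticalOrder n p))) := by
    rw [← ofR_mul (by positivity), ← rpow_add two_pos]
    congr 2
    ring
  have h2 : (2⁻¹ : ℝ≥0∞) ^ ((S + 3) * idxDist j k) * 2 ^ (S * idxDist j k) * 4 ^ idxDist j k =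
      2⁻¹ ^ idxDist j k := by
    rw [show (S + 3) * idxDist j k = idxDist j k + (S * idxDist j k + (idxDist j k + idxDist j k)) by
      ring, pow_add, pow_add, pow_add, show (4 : ℝ≥0∞) = 2 * 2 by norm_num, mul_pow]
    calc _ = (2⁻¹ : ℝ≥0∞) ^ idxDist j k * (2⁻¹ ^ (S * idxDist j k) * 2 ^ (S * idxDist j k)) *
          (2⁻¹ ^ idxDist j k * 2 ^ idxDist j k) * (2⁻¹ ^ idxDist j k * 2 ^ idxDist j k) := by ring
      _ = _ := by rw [two_mul_inv_pow, two_mul_inv_pow, mul_one, mul_one, mul_one]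
  rw [h1, ← h2]
  ring
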